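/- Let n ≥ 2, β ∈ (0,π), and let C_β be the open cone over the spherical cap of aperture β. Suppose γ > 0 and Φ ∈ C²(C_β) is positive on C_β, harmonic on C_β (ΔΦ = 0), extends continuously to the closure of C_β minus the origin with Φ = 0 on ∂C_β ∖ {0}, and is positively homogeneous of degree γ (Φ(r x) = r^γ Φ(x) for all r > 0 and x ∈ C_β). Set p* = (n+γ)/(n+γ−2). Then there exist a number p₀ > p* and a constant C₀ > 0 such that for every p ∈ (p*, p₀) there exist functions u₁, v ∈ C²(C_β), both positive on C_β and extending continuously by 0 to ∂C_β ∖ {0}, with the following properties: (i) Δu₁ + u₁^p = 0 and Δv + v^p = 0 on C_β; (ii) v is positively homogeneous of degree −2/(p−1); (iii) for every η > 0 there exists r₀ > 0 such that |u₁(x) − v(x)| ≤ η v(x) for all x ∈ C_β with 0 < |x| < r₀; (iv) there exists c > 0 such that for every η > 0 there exists R₀ > 0 with |u₁(x) − c |x|^{2−2γ−n} Φ(x)| ≤ η c |x|^{2−2γ−n} Φ(x) for all x ∈ C_β with |x| > R₀; (v) u₁(x) ≤ C₀ M |x|^{−2/(p−1)} for all x ∈ C_β, where M = sup{ v(x) +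 |∇v(x)| + ‖D²v(x)‖ : x ∈ C_β, |x| = 1 } and C₀ does not depend on p. -/

import Mathlib

open Real MeasureTheory Filter

/-- The Euclidean Laplacian of `u : ℝⁿ → ℝ` at `x`. -/
noncomputable def lap {n : ℕ} (u : EuclideanSpace ℝ (Fin n) → ℝ)
    (x : EuclideanSpace ℝ (Fin n)) : ℝ :=
  ∑ i : Fin n,
    fderiv ℝ (fun y => fderiv ℝ u y (EuclideanSpace.single i 1)) x (EuclideanSpace.single i 1)

/-- The open cone over the spherical cap of aperture `β`:
`C_β = {x ≠ 0 : x·e₁ > |x| cos β}`. -/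
def cone (n : ℕ) (hn : 2 ≤ n) (β : ℝ) : Set (EuclideanSpace ℝ (Fin n)) :=
  {x | x ≠ 0 ∧ ‖x‖ * Real.cos β < x ⟨0, by omega⟩}

/-- `u` extends continuously by `0` to `∂C ∖ {0}`. -/
def VanishesOnBoundary {n : ℕ} (C : Set (EuclideanSpace ℝ (Fin n)))
    (u : EuclideanSpace ℝ (Fin n) → ℝ) : Prop :=
  ∀ y ∈ closure C \ C, y ≠ 0 → Filter.Tendsto u (nhdsWithin y C) (nhds 0)

namespace ConeHet
open scoped Topology

/-- An abstract symmetric Markov generator on `C(S, ℝ)`, given by its graph `L`, together with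
a potential operator `R` and the regularity it provides. -/
structure Gen (S : Type) [MetricSpace S] [CompactSpace S] [MeasurableSpace S] [BorelSpace S]
    (μ : Measure S) where
  L : Submodule ℝ (C(S, ℝ) × C(S, ℝ))
  one : ((1 : C(S, ℝ)), (0 : C(S, ℝ))) ∈ L
  max : ∀ g f, (g, f) ∈ L → ∀ x, (∀ y, g y ≤ g x) → f x ≤ 0
  mean : ∀ g f, (g, f) ∈ L → ∫ x, f x ∂μ = 0
  R : C(S, ℝ) →L[ℝ] C(S, ℝ)
  R_spec : ∀ f, (R f, f - ContinuousMap.const S (∫ x, f x ∂μ)) ∈ L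
  R_mean : ∀ f, ∫ x, R f x ∂μ = 0
  sym : ∀ g f g' f', (g, f) ∈ L → (g', f') ∈ L → ∫ x, g x * f' x ∂μ = ∫ x, g' x * f x ∂μ
  lip : ∃ C, ∀ g f, (g, f) ∈ L → ∀ x y, |g x - g y| ≤ C * ‖f‖ * dist x y
  osc : ∀ ε > 0, ∃ δ > 0, ∀ g f, (g, f) ∈ L → ‖f‖ ≤ 1 → -∫ x, g x * f x ∂μ ≤ δ →
    ∀ x y, |g x - g y| ≤ ε

theorem exists_fixed {E : Type*} [NormedAddCommGroup E] [NormedSpace ℝ E] [CompleteSpace E]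
    (T : E →L[ℝ] E) (hT : ‖T‖ < 1) (b : E) : ∃ w, w = T w + b := by
  obtain ⟨u, hu⟩ := isUnit_one_sub_of_norm_lt_one hT
  refine ⟨(↑u⁻¹ : E →L[ℝ] E) b, ?_⟩
  have h : (↑u * ↑u⁻¹ : E →L[ℝ] E) b = b := by rw [Units.mul_inv]; rfl
  rw [hu] at h
  have h2 : (↑u⁻¹ : E →L[ℝ] E) b - T ((↑u⁻¹ : E →L[ℝ] E) b) = b := h
  rw [sub_eq_iff_eq_add] at h2
  rw [add_comm]; exact h2

theorem inverse_one_sub_apply {E : Type*} [NormedAddCommGroup E] [NormedSpace ℝ E]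
    [CompleteSpace E] (T : E →L[ℝ] E) (hT : ‖T‖ < 1) (h : E) :
    Ring.inverse (1 - T) (h - T h) = h :=
  congrArg (fun T : E →L[ℝ] E => T h)
    (Ring.inverse_mul_cancel _ (isUnit_one_sub_of_norm_lt_one hT))

namespace Gen
variable {S : Type} [MetricSpace S] [CompactSpace S] [Nonempty S] [MeasurableSpace S] [BorelSpace S]
  {μ : Measure S} [IsProbabilityMeasure μ] (A : Gen S μ)

theorem integrable (f : C(S, ℝ)) : Integrable (fun x => f x) μ :=
  f.continuous.integrable_of_hasCompactSupport (HasCompactSupport.of_compactSpace _)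

theorem min {g f : C(S, ℝ)} (h : (g, f) ∈ A.L) (x : S) (hx : ∀ y, g x ≤ g y) : 0 ≤ f x := by
  have := A.max (-g) (-f) (by simpa using A.L.neg_mem h) x (by simpa using hx)
  simpa using this

theorem exists_max (g : C(S, ℝ)) : ∃ x, ∀ y, g y ≤ g x := by
  obtain ⟨x, -, hx⟩ := isCompact_univ.exists_isMaxOn Set.univ_nonempty g.continuous.continuousOn
  exact ⟨x, fun y => hx (Set.mem_univ y)⟩

theorem exists_min (g : C(S, ℝ)) : ∃ x, ∀ y, g x ≤ g y := by
  obtain ⟨x, hx⟩ := exists_max (-g)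
  exact ⟨x, fun y => by simpa using hx y⟩

theorem const_mem (c : ℝ) : (ContinuousMap.const S c, (0 : C(S, ℝ))) ∈ A.L := by
  have := A.L.smul_mem c A.one
  have h2 : c • ((1 : C(S, ℝ)), (0 : C(S, ℝ))) = (ContinuousMap.const S c, 0) := by
    ext <;> simp
  rwa [h2] at this

theorem nonneg_of_mem {l : ℝ} (hl : 0 < l) {g h : C(S, ℝ)} (H : (g, l • g - h) ∈ A.L)
    (hh : 0 ≤ h) : 0 ≤ g := by
  obtain ⟨x, hx⟩ := exists_min g
  have h1 := A.min H x hx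
  have h2 := hh x
  simp at h1 h2
  have h3 : 0 ≤ g x := by
    by_contra hc
    nlinarith [mul_pos hl (neg_pos.2 (not_le.1 hc))]
  exact fun y => h3.trans (hx y)

theorem le_of_mem {l : ℝ} (hl : 0 < l) {g h : C(S, ℝ)} (H : (g, l • g - h) ∈ A.L)
    {M : ℝ} (hM : ∀ x, h x ≤ M) (x : S) : g x ≤ M / l := by
  obtain ⟨z, hz⟩ := exists_max g
  have h1 := A.max _ _ H z hz
  have h2 := hM z
  simp at h1
  refine (hz x).trans ?_
  rw [le_div_iff₀ hl]; nlinarith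

theorem norm_le_of_mem {l : ℝ} (hl : 0 < l) {g h : C(S, ℝ)} (H : (g, l • g - h) ∈ A.L) :
    ‖g‖ ≤ ‖h‖ / l := by
  rw [ContinuousMap.norm_le _ (by positivity)]
  intro x
  rw [Real.norm_eq_abs, abs_le]
  constructor
  · have H' : (-g, l • (-g) - (-h)) ∈ A.L := by
      have := A.L.neg_mem H
      convert this using 1
      ext <;> simp <;> ring
    have := A.le_of_mem hl H' (M := ‖h‖) (fun x => by
      have := h.norm_coe_le_norm x
      rw [Real.norm_eq_abs, abs_le] at this
      simp; linarith) x
    simp at this; linarith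
  · exact A.le_of_mem hl H (fun x => (le_abs_self _).trans (h.norm_coe_le_norm x)) x

/-- A resolvent of the generator at `l`. -/
structure Res (l : ℝ) where
  J : C(S, ℝ) →L[ℝ] C(S, ℝ)
  spec : ∀ h, (J h, l • J h - h) ∈ A.L

theorem eq_of_mem {l : ℝ} (hl : 0 < l) {g g' h : C(S, ℝ)} (H : (g, l • g - h) ∈ A.L)
    (H' : (g', l • g' - h) ∈ A.L) : g = g' := by
  have : (g - g', l • (g - g') - 0) ∈ A.L := by
    convert A.L.sub_mem H H' using 1
    ext <;> simp; ring
  have := A.norm_le_of_mem hl this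
  simp at this
  exact sub_eq_zero.1 this

theorem exists_res_of_forall {l : ℝ} (hl : 0 < l)
    (H : ∀ h, ∃ g, (g, l • g - h) ∈ A.L) : Nonempty (A.Res l) := by
  choose J hJ using H
  refine ⟨⟨LinearMap.mkContinuous ⟨⟨J, ?_⟩, ?_⟩ (1 / l) ?_, hJ⟩⟩
  · intro a b
    refine A.eq_of_mem hl (hJ _) ?_
    convert A.L.add_mem (hJ a) (hJ b) using 1
    ext <;> simp; ring
  · intro c a
    refine A.eq_of_mem hl (hJ _) ?_
    convert A.L.smul_mem c (hJ a) using 1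
    ext <;> simp; ring
  · intro h
    have := A.norm_le_of_mem hl (hJ h)
    simp only [LinearMap.coe_mk, AddHom.coe_mk]
    rw [one_div, inv_mul_eq_div]; exact this

theorem Res.norm_le {l : ℝ} (hl : 0 < l) (r : A.Res l) : ‖r.J‖ ≤ 1 / l := by
  refine ContinuousLinearMap.opNorm_le_bound _ (by positivity) fun h => ?_
  have := A.norm_le_of_mem hl (r.spec h)
  rw [one_div, inv_mul_eq_div]; exact this

theorem exists_res_small : ∃ l > 0, Nonempty (A.Res l) := by
  refine ⟨1 / (2 * (‖A.R‖ + 1)), by positivity, A.exists_res_of_forall (by positivity) fun h => ?_⟩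
  set l : ℝ := 1 / (2 * (‖A.R‖ + 1)) with hl
  have hl0 : 0 < l := by positivity
  obtain ⟨w, hw⟩ := exists_fixed (l • A.R) (by
    rw [norm_smul, Real.norm_of_nonneg hl0.le, hl, one_div, inv_mul_lt_iff₀ (by positivity)]
    nlinarith [norm_nonneg A.R]) (-A.R h)
  have hw' : w = A.R (l • w - h) := by
    rw [map_sub, map_smul, sub_eq_add_neg]; exact hw
  have h1 := A.R_spec (l • w - h)
  have h2 := A.R_mean (l • w - h)
  rw [← hw'] at h1 h2
  have h3 : ∫ x, (l • w - h) x ∂μ = -∫ x, h x ∂μ := by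
    simp only [ContinuousMap.sub_apply, ContinuousMap.smul_apply, smul_eq_mul]
    rw [integral_sub ((integrable w).const_mul _) (integrable h), integral_const_mul, h2]; simp
  rw [h3] at h1
  refine ⟨w + ContinuousMap.const S ((∫ x, h x ∂μ) / l), ?_⟩
  convert A.L.add_mem h1 (A.const_mem ((∫ x, h x ∂μ) / l)) using 1
  ext x
  · simp
  · simp; field_simp; ring

theorem exists_res_near {l l' : ℝ} (hl : 0 < l) (h : |l' - l| < l) (r : A.Res l) :
    Nonempty (A.Res l') := by
  have hl' : 0 < l' := by have := abs_lt.1 h; linarith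
  refine A.exists_res_of_forall hl' fun f => ?_
  obtain ⟨g, hg⟩ := exists_fixed (-(l' - l) • r.J) (by
    rw [norm_smul, norm_neg, Real.norm_eq_abs]
    have := Res.norm_le A hl r
    calc |l' - l| * ‖r.J‖ ≤ |l' - l| * (1 / l) := by gcongr
      _ < 1 := by rw [mul_one_div, div_lt_one hl]; exact h) (r.J f)
  have hg' : g = r.J (f - (l' - l) • g) := by
    rw [map_sub, map_smul, sub_eq_neg_add, ← neg_smul]; exact hg
  refine ⟨g, ?_⟩
  have := r.spec (f - (l' - l) • g)
  rw [← hg'] at this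
  convert this using 2
  ext; simp; ring

theorem exists_res {l : ℝ} (hl : 0 < l) : Nonempty (A.Res l) := by
  obtain ⟨l₀, h0, hr⟩ := A.exists_res_small
  have key : ∀ k : ℕ, Nonempty (A.Res (l₀ * (3 / 2) ^ k)) := by
    intro k
    induction k with
    | zero => simpa using hr
    | succ k ih =>
      obtain ⟨r⟩ := ih
      refine A.exists_res_near (by positivity) ?_ r
      have : 0 < l₀ * (3 / 2 : ℝ) ^ k := by positivity
      rw [abs_lt, pow_succ]; constructor <;> nlinarith
  obtain ⟨k, hk⟩ := pow_unbounded_of_one_lt (l / l₀) (by norm_num : (1 : ℝ) < 3 / 2)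
  obtain ⟨r⟩ := key k
  refine A.exists_res_near (by positivity) ?_ r
  rw [div_lt_iff₀ h0] at hk
  rw [abs_lt]; constructor <;> nlinarith

/-- The resolvent. -/
noncomputable def J (l : ℝ) (hl : 0 < l) : C(S, ℝ) →L[ℝ] C(S, ℝ) := (A.exists_res hl).some.J

theorem J_spec {l : ℝ} (hl : 0 < l) (h : C(S, ℝ)) : (A.J l hl h, l • A.J l hl h - h) ∈ A.L :=
  (A.exists_res hl).some.spec h

theorem J_norm {l : ℝ} (hl : 0 < l) : ‖A.J l hl‖ ≤ 1 / l := Res.norm_le A hl _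

theorem J_eq {l : ℝ} (hl : 0 < l) {g h : C(S, ℝ)} (H : (g, l • g - h) ∈ A.L) :
    g = A.J l hl h := A.eq_of_mem hl H (A.J_spec hl h)

theorem J_nonneg {l : ℝ} (hl : 0 < l) {h : C(S, ℝ)} (hh : 0 ≤ h) : 0 ≤ A.J l hl h :=
  A.nonneg_of_mem hl (A.J_spec hl h) hh

theorem J_mono {l : ℝ} (hl : 0 < l) {h h' : C(S, ℝ)} (hh : h ≤ h') :
    A.J l hl h ≤ A.J l hl h' := by
  have := A.J_nonneg hl (sub_nonneg.2 hh)
  rwa [map_sub, sub_nonneg] at this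

theorem isClosed_L : IsClosed (A.L : Set (C(S, ℝ) × C(S, ℝ))) := by
  have : (A.L : Set (C(S, ℝ) × C(S, ℝ))) =
      {q | q.1 = A.J 1 one_pos (q.1 - q.2)} := by
    ext ⟨g, f⟩
    constructor
    · intro h
      refine A.J_eq one_pos ?_
      convert h using 2
      simp
    · intro h
      have h2 := A.J_spec one_pos (g - f)
      change g = _ at h
      rw [← h] at h2
      simpa using h2
  rw [this]
  exact isClosed_eq continuous_fst (by fun_prop)

end Gen
end ConeHet

namespace ConeHet
open scoped Topology BoundedContinuousFunction

/-- Bounded continuous curves. -/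
abbrev Crv (X : Type*) [NormedAddCommGroup X] := ℝ →ᵇ X

section Curves
variable {X : Type*} [NormedAddCommGroup X] [NormedSpace ℝ X] [CompleteSpace X]

/-- Translation of bounded curves. -/
noncomputable def shift (s : ℝ) : (Crv X) →L[ℝ] (Crv X) :=
  LinearMap.mkContinuous
    ⟨⟨fun f => f.compContinuous ⟨fun t => t + s, by fun_prop⟩, fun _ _ => rfl⟩, fun _ _ => rfl⟩ 1
    (fun f => by
      rw [one_mul, BoundedContinuousFunction.norm_le (norm_nonneg _)]
      exact fun t => f.norm_coe_le_norm _)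

@[simp] theorem shift_apply (s : ℝ) (f : Crv X) (t : ℝ) : shift s f t = f (t + s) := rfl

theorem shift_norm_le (s : ℝ) (f : Crv X) : ‖shift s f‖ ≤ ‖f‖ := by
  rw [BoundedContinuousFunction.norm_le (norm_nonneg _)]
  exact fun t => f.norm_coe_le_norm _

/-- Box averages of bounded curves. -/
noncomputable def avg (s : ℝ) : (Crv X) →L[ℝ] (Crv X) :=
  LinearMap.mkContinuous
    ⟨⟨fun f => BoundedContinuousFunction.ofNormedAddCommGroup (fun t => ∫ u in (0:ℝ)..1, f (t + s * u))
        (intervalIntegral.continuous_parametric_intervalIntegral_of_continuous' (by fun_prop) 0 1)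
        ‖f‖ (fun t => by
          have := intervalIntegral.norm_integral_le_of_norm_le_const
            (a := (0:ℝ)) (b := 1) (f := fun u => f (t + s * u)) (C := ‖f‖)
            (fun u _ => f.norm_coe_le_norm _)
          simpa using this),
      fun f g => by
        ext t
        exact intervalIntegral.integral_add ((by fun_prop : Continuous _).intervalIntegrable _ _)
          ((by fun_prop : Continuous _).intervalIntegrable _ _)⟩,
      fun c f => by
        ext t
        exact intervalIntegral.integral_smul _ _⟩ 1
    (fun f => by
      rw [one_mul, BoundedContinuousFunction.norm_le (norm_nonneg _)]
      intro t
      have := intervalIntegral.norm_integral_le_of_norm_le_const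
        (a := (0:ℝ)) (b := 1) (f := fun u => f (t + s * u)) (C := ‖f‖)
        (fun u _ => f.norm_coe_le_norm _)
      simpa using this)

theorem avg_apply (s : ℝ) (f : Crv X) (t : ℝ) : avg s f t = ∫ u in (0:ℝ)..1, f (t + s * u) := rfl

theorem avg_norm_le (s : ℝ) (f : Crv X) : ‖avg s f‖ ≤ ‖f‖ := by
  have := LinearMap.mkContinuous_norm_le _ zero_le_one _ |> fun h => (avg (X := X) s).le_of_opNorm_le h f
  simpa using this

theorem avg_shift (s r : ℝ) (f : Crv X) : avg s (shift r f) = shift r (avg s f) := by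
  ext t
  simp only [avg_apply, shift_apply]
  congr 1; ext u; congr 1; ring

theorem shift_shift (s r : ℝ) (f : Crv X) : shift s (shift r f) = shift (s + r) f := by
  ext t; simp only [shift_apply]; congr 1; ring

theorem shift_comm (s r : ℝ) (f : Crv X) : shift s (shift r f) = shift r (shift s f) := by
  rw [shift_shift, shift_shift, add_comm]

/-- Uniform continuity of a bounded curve. -/
def UC (f : Crv X) : Prop := Tendsto (fun s => shift s f) (𝓝 0) (𝓝 f)

/-- `g` is the derivative of `f`. -/
def IsD (f g : Crv X) : Prop := ∀ t, HasDerivAt f (g t) t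

theorem IsD.shift_sub {f g : Crv X} (h : IsD f g) (s : ℝ) : shift s f - f = s • avg s g := by
  ext t
  have h1 : ∀ u ∈ Set.uIcc (0:ℝ) 1, HasDerivAt (fun u => f (t + s * u)) (s • g (t + s * u)) u := by
    intro u _
    have := (h (t + s * u)).scomp u (((hasDerivAt_id u).const_mul s).const_add t)
    simpa [Function.comp_def] using this
  have h2 := intervalIntegral.integral_eq_sub_of_hasDerivAt h1
    ((by fun_prop : Continuous _).intervalIntegrable _ _)
  rw [intervalIntegral.integral_smul] at h2
  simpa [avg_apply] using h2.symm

theorem isD_avg {s : ℝ} (hs : s ≠ 0) (f : Crv X) : IsD (avg s f) (s⁻¹ • (shift s f - f)) := by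
  intro t
  have h0 : ∀ t, avg s f t = s⁻¹ • ∫ u in t..(t + s), f u := by
    intro t
    rw [avg_apply, intervalIntegral.integral_comp_add_mul (fun u => f u) hs]
    simp
  have h1 : HasDerivAt (fun t => ∫ u in (0:ℝ)..t, f u) (f t) t :=
    intervalIntegral.integral_hasDerivAt_right (f.continuous.intervalIntegrable _ _)
      (f.continuous.stronglyMeasurableAtFilter _ _) f.continuous.continuousAt
  have h2 : HasDerivAt (fun t => ∫ u in (0:ℝ)..(t + s), f u) (f (t + s)) t := by
    have : HasDerivAt (fun t => ∫ u in (0:ℝ)..t, f u) (f (t + s)) (t + s) :=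
      intervalIntegral.integral_hasDerivAt_right (f.continuous.intervalIntegrable _ _)
      (f.continuous.stronglyMeasurableAtFilter _ _) f.continuous.continuousAt
    exact this.comp_add_const t s
  have h3 := (h2.sub h1).const_smul s⁻¹
  have h4 : (avg s f : ℝ → X) = fun t => s⁻¹ • ((∫ u in (0:ℝ)..(t + s), f u) - ∫ u in (0:ℝ)..t, f u) := by
    funext t
    rw [h0, intervalIntegral.integral_interval_sub_left (f.continuous.intervalIntegrable _ _)
      (f.continuous.intervalIntegrable _ _)]
  rw [h4]
  exact h3

theorem IsD.avg {f g : Crv X} (h : IsD f g) (s : ℝ) : IsD (avg s f) (avg s g) := by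
  rcases eq_or_ne s 0 with rfl | hs
  · have : ∀ f : Crv X, ConeHet.avg 0 f = f := by intro f; ext t; simp [avg_apply]
    rw [this, this]; exact h
  · have := isD_avg hs f
    rw [h.shift_sub, smul_smul, inv_mul_cancel₀ hs, one_smul] at this
    exact this

theorem IsD.shift {f g : Crv X} (h : IsD f g) (s : ℝ) : IsD (shift s f) (shift s g) :=
  fun t => (h (t + s)).comp_add_const t s

theorem IsD.uc {f g : Crv X} (h : IsD f g) : UC f := by
  rw [UC, tendsto_iff_norm_sub_tendsto_zero]
  have h1 : ∀ s, ‖ConeHet.shift s f - f‖ ≤ |s| * ‖g‖ := by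
    intro s
    rw [h.shift_sub, norm_smul, Real.norm_eq_abs]
    gcongr
    exact avg_norm_le _ _
  refine squeeze_zero (fun _ => norm_nonneg _) h1 ?_
  have : Tendsto (fun s : ℝ => |s| * ‖g‖) (𝓝 0) (𝓝 (|0| * ‖g‖)) :=
    Continuous.tendsto (by fun_prop) 0
  simpa using this

theorem UC.avg {f : Crv X} (h : UC f) : Tendsto (fun s => avg s f) (𝓝 0) (𝓝 f) := by
  rw [Metric.tendsto_nhds]
  intro ε hε
  obtain ⟨δ, hδ, H⟩ := Metric.eventually_nhds_iff.1 (Metric.tendsto_nhds.1 h (ε / 2) (half_pos hε))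
  refine Metric.eventually_nhds_iff.2 ⟨δ, hδ, fun s hs => ?_⟩
  refine lt_of_le_of_lt ?_ (half_lt_self hε)
  rw [BoundedContinuousFunction.dist_le (half_pos hε).le]
  intro t
  rw [dist_eq_norm, avg_apply]
  have h1 : (∫ u in (0:ℝ)..1, f (t + s * u)) - f t = ∫ u in (0:ℝ)..1, (f (t + s * u) - f t) := by
    rw [intervalIntegral.integral_sub ((by fun_prop : Continuous _).intervalIntegrable _ _)
      ((by fun_prop : Continuous _).intervalIntegrable _ _)]
    simp
  rw [h1]
  have h2 := intervalIntegral.norm_integral_le_of_norm_le_const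
    (a := (0:ℝ)) (b := 1) (f := fun u => f (t + s * u) - f t) (C := ε / 2) (fun u hu => by
      rw [Set.uIoc_of_le zero_le_one] at hu
      have h3 := H (y := s * u) (by
        rw [Real.dist_eq, sub_zero] at hs ⊢
        rw [abs_mul, abs_of_pos hu.1]
        nlinarith [abs_nonneg s, hu.1, hu.2])
      rw [← dist_eq_norm]
      exact (BoundedContinuousFunction.dist_coe_le_dist t).trans h3.le)
  simpa using h2

theorem UC.avg_avg {f : Crv X} (h : UC f) (r : ℝ) :
    Tendsto (fun s => ConeHet.avg (r * s) (ConeHet.avg s f)) (𝓝 0) (𝓝 f) := by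
  rw [tendsto_iff_norm_sub_tendsto_zero]
  have h1 := tendsto_iff_norm_sub_tendsto_zero.1 h.avg
  have h2 : Tendsto (fun s => ‖ConeHet.avg (r * s) f - f‖) (𝓝 0) (𝓝 0) :=
    h1.comp (by simpa using (Continuous.tendsto (by fun_prop : Continuous fun s : ℝ => r * s) 0))
  refine squeeze_zero (fun _ => norm_nonneg _) (fun s => ?_) (by simpa using h1.add h2)
  calc ‖ConeHet.avg (r * s) (ConeHet.avg s f) - f‖
      = ‖ConeHet.avg (r * s) (ConeHet.avg s f - f) + (ConeHet.avg (r * s) f - f)‖ := by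
        rw [map_sub]; congr 1; abel
    _ ≤ ‖ConeHet.avg s f - f‖ + ‖ConeHet.avg (r * s) f - f‖ :=
        (norm_add_le _ _).trans (by gcongr; exact avg_norm_le _ _)

theorem UC.add {f g : Crv X} (hf : UC f) (hg : UC g) : UC (f + g) := by
  have := Tendsto.add hf hg
  simpa only [UC, map_add] using this

theorem UC.smul {f : Crv X} (hf : UC f) (c : ℝ) : UC (c • f) := by
  have := Tendsto.const_smul hf c
  simpa only [UC, map_smul] using this

theorem UC.of_tendsto {ι : Type*} {l : Filter ι} [l.NeBot] {F : ι → Crv X} {f : Crv X}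
    (hF : ∀ i, UC (F i)) (h : Tendsto F l (𝓝 f)) : UC f := by
  rw [UC, Metric.tendsto_nhds]
  intro ε hε
  obtain ⟨i, hi⟩ := (Metric.tendsto_nhds.1 h (ε / 3) (by positivity)).exists
  filter_upwards [Metric.tendsto_nhds.1 (hF i) (ε / 3) (by positivity)] with s hs
  rw [dist_eq_norm] at *
  have : ConeHet.shift s f - f = ConeHet.shift s (f - F i) + (ConeHet.shift s (F i) - F i) + (F i - f) := by
    rw [map_sub]; abel
  rw [this]
  have h1 := shift_norm_le s (f - F i)
  rw [norm_sub_rev f] at h1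
  have h2 := norm_add₃_le (a := ConeHet.shift s (f - F i)) (b := ConeHet.shift s (F i) - F i)
    (c := F i - f)
  linarith

theorem UC.sub {f g : Crv X} (hf : UC f) (hg : UC g) : UC (f - g) := by
  have := Tendsto.sub hf hg
  simpa only [UC, map_sub] using this

theorem UC.shift {f : Crv X} (hf : UC f) (r : ℝ) : UC (shift r f) := by
  have : Tendsto (fun s => ConeHet.shift r (ConeHet.shift s f)) (𝓝 0) (𝓝 (ConeHet.shift r f)) :=
    ((ConeHet.shift r).continuous.tendsto f).comp hf
  simpa only [UC, shift_comm] using this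

/-- The derivative operator is closed. -/
theorem IsD.of_tendsto {F G : ℕ → Crv X} {f g : Crv X}
    (hD : ∀ i, IsD (F i) (G i)) (hF : Tendsto F atTop (𝓝 f)) (hG : Tendsto G atTop (𝓝 g)) :
    IsD f g := by
  intro t
  refine hasDerivAt_of_tendstoUniformly (f := fun i t => F i t) (f' := fun i t => G i t) (l := atTop)
    ?_ (Eventually.of_forall fun i x => hD i x) ?_ t
  · exact (BoundedContinuousFunction.tendsto_iff_tendstoUniformly.1 hG)
  · intro x
    exact ((BoundedContinuousFunction.tendsto_iff_tendstoUniformly.1 hF).tendsto_at x)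

/-- The finite difference approximation of `∂² - B ∂`. -/
noncomputable def fd (B ε : ℝ) : (Crv X) →L[ℝ] (Crv X) :=
  (ε ^ 2)⁻¹ • (shift ε - 1) + ((ε ^ 2)⁻¹ + B / ε) • (shift (-ε) - 1)

theorem fd_eq (B : ℝ) {ε : ℝ} (hε : ε ≠ 0) {f f' f'' : Crv X} (h : IsD f f') (h' : IsD f' f'') :
    fd B ε f = avg (-1 * ε) (avg ε f'') - B • avg (-ε) f' := by
  have e1 := h.shift_sub ε
  have e2 := h.shift_sub (-ε)
  have e3 := h'.shift_sub ε
  have e4 : (shift ε f - f) + (shift (-ε) f - f) = ε ^ 2 • avg (-ε) (avg ε f'') := by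
    have : (shift ε f - f) + (shift (-ε) f - f) =
        -(shift ε (shift (-ε) f - f) - (shift (-ε) f - f)) := by
      rw [map_sub, shift_shift]
      have : shift (ε + -ε) f = f := by ext t; simp
      rw [this]; abel
    rw [this, e2, map_smul, ← avg_shift, ← smul_sub, ← map_sub, e3, map_smul, smul_smul, ← neg_smul]
    congr 1; ring
  have : fd B ε f = (ε ^ 2)⁻¹ • ((shift ε f - f) + (shift (-ε) f - f)) +
      (B / ε) • (shift (-ε) f - f) := by
    simp only [fd, ContinuousLinearMap.add_apply, ContinuousLinearMap.smul_apply,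
      ContinuousLinearMap.sub_apply, ContinuousLinearMap.one_apply]
    rw [add_smul, smul_add]; abel
  rw [this, e4, e2, smul_smul, smul_smul, inv_mul_cancel₀ (by positivity), one_smul, neg_one_mul]
  rw [show B / ε * -ε = -B by field_simp, neg_smul, ← sub_eq_add_neg]

theorem fd_tendsto (B : ℝ) {f f' f'' : Crv X} (h : IsD f f') (h' : IsD f' f'') (hu : UC f'') :
    Tendsto (fun ε => fd B ε f) (𝓝[>] 0) (𝓝 (f'' - B • f')) := by
  have h1 : Tendsto (fun ε : ℝ => avg (-1 * ε) (avg ε f'') - B • avg (-ε) f') (𝓝[>] 0)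
      (𝓝 (f'' - B • f')) := by
    refine Tendsto.mono_left ?_ nhdsWithin_le_nhds
    refine (hu.avg_avg (-1)).sub (Tendsto.const_smul ?_ B)
    exact h'.uc.avg.comp (by simpa using (Continuous.tendsto (continuous_neg (G := ℝ)) 0))
  refine h1.congr' ?_
  filter_upwards [self_mem_nhdsWithin] with ε hε
  exact (fd_eq B (ne_of_gt hε) h h').symm

end Curves
end ConeHet

namespace ConeHet
open scoped Topology BoundedContinuousFunction

/-- The drift `B` and the mass `l` of the operator `l - ∂² + B ∂ - L`. -/
structure Par where
  B : ℝ
  l : ℝ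
  hB : 0 < B
  hl : 0 < l

namespace Gen
variable {S : Type} [MetricSpace S] [CompactSpace S] [Nonempty S] [MeasurableSpace S]
  [BorelSpace S] {μ : Measure S} [IsProbabilityMeasure μ] (A : Gen S μ) (P : Par)

/-- The total mass of the finite difference stencil. -/
noncomputable def _root_.ConeHet.Par.N (P : Par) (k : ℕ) : ℝ :=
  ((1 / ((k:ℝ) + 1)) ^ 2)⁻¹ + (((1 / ((k:ℝ) + 1)) ^ 2)⁻¹ + P.B / (1 / ((k:ℝ) + 1)))

theorem _root_.ConeHet.Par.N_pos (P : Par) (k : ℕ) : 0 < P.N k := by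
  have := P.hB
  unfold Par.N; positivity

theorem lN_pos (k : ℕ) : 0 < P.l + P.N k := add_pos P.hl (P.N_pos k)

/-- The off-diagonal part of the finite difference stencil. -/
noncomputable def Pk (k : ℕ) : (Crv C(S, ℝ)) →L[ℝ] (Crv C(S, ℝ)) :=
  ((1 / ((k:ℝ) + 1)) ^ 2)⁻¹ • shift (1 / ((k:ℝ) + 1)) +
    (((1 / ((k:ℝ) + 1)) ^ 2)⁻¹ + P.B / (1 / ((k:ℝ) + 1))) • shift (-(1 / ((k:ℝ) + 1)))

theorem fd_eq_Pk (k : ℕ) (h : Crv C(S, ℝ)) :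
    fd P.B (1 / ((k:ℝ) + 1)) h = Pk P k h - P.N k • h := by
  simp only [fd, Pk, Par.N, ContinuousLinearMap.add_apply, ContinuousLinearMap.smul_apply,
      ContinuousLinearMap.sub_apply, ContinuousLinearMap.one_apply, add_smul, smul_sub]
  abel

theorem Pk_norm (k : ℕ) (h : Crv C(S, ℝ)) : ‖Pk P k h‖ ≤ P.N k * ‖h‖ := by
  have hB := P.hB
  simp only [Pk, ContinuousLinearMap.add_apply, ContinuousLinearMap.smul_apply, Par.N]
  rw [add_mul]
  refine (norm_add_le _ _).trans (add_le_add ?_ ?_)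
  · rw [norm_smul, Real.norm_of_nonneg (by positivity)]
    gcongr; exact shift_norm_le _ _
  · rw [norm_smul, Real.norm_of_nonneg (by positivity)]
    gcongr; exact shift_norm_le _ _

/-- The resolvent applied pointwise along a curve. -/
noncomputable def Jb (k : ℕ) : (Crv C(S, ℝ)) →L[ℝ] (Crv C(S, ℝ)) :=
  (A.J (P.l + P.N k) (lN_pos P k)).compLeftContinuousBounded ℝ

theorem Jb_apply (k : ℕ) (f : Crv C(S, ℝ)) (t : ℝ) :
    A.Jb P k f t = A.J (P.l + P.N k) (lN_pos P k) (f t) := rfl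

theorem Jb_norm (k : ℕ) (f : Crv C(S, ℝ)) : ‖A.Jb P k f‖ ≤ ‖f‖ / (P.l + P.N k) := by
  have := lN_pos P k
  rw [BoundedContinuousFunction.norm_le (by positivity)]
  intro t
  rw [Jb_apply]
  refine ((A.J _ _).le_of_opNorm_le (A.J_norm _) _).trans ?_
  rw [one_div, inv_mul_eq_div]
  gcongr; exact f.norm_coe_le_norm _

theorem JbPk_norm (k : ℕ) : ‖A.Jb P k ∘L Pk P k‖ < 1 := by
  have h1 := lN_pos P k
  have h2 := P.N_pos k
  refine lt_of_le_of_lt (ContinuousLinearMap.opNorm_le_bound _ (M := P.N k / (P.l + P.N k))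
    (by positivity) fun h => ?_) ?_
  · refine (A.Jb_norm P k _).trans ?_
    rw [div_mul_eq_mul_div]
    gcongr
    exact Pk_norm P k h
  · rw [div_lt_one h1]; linarith [P.hl]

/-- The solution operator of the discretised equation. -/
noncomputable def Gk (k : ℕ) : (Crv C(S, ℝ)) →L[ℝ] (Crv C(S, ℝ)) :=
  Ring.inverse (1 - A.Jb P k ∘L Pk P k) ∘L A.Jb P k

theorem Gk_unique {k : ℕ} {f h : Crv C(S, ℝ)} (H : h = A.Jb P k (f + Pk P k h)) :
    h = A.Gk P k f := by
  have h1 : h - (A.Jb P k ∘L Pk P k) h = A.Jb P k f := by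
    rw [map_add] at H
    change h - A.Jb P k (Pk P k h) = _
    rw [sub_eq_iff_eq_add]; exact H
  have h2 := inverse_one_sub_apply _ (A.JbPk_norm P k) h
  rw [h1] at h2
  exact h2.symm

theorem Gk_eq (k : ℕ) (f : Crv C(S, ℝ)) :
    A.Gk P k f = A.Jb P k (f + Pk P k (A.Gk P k f)) := by
  obtain ⟨h, hh⟩ := exists_fixed _ (A.JbPk_norm P k) (A.Jb P k f)
  have h1 : h = A.Jb P k (f + Pk P k h) := by
    rw [map_add, add_comm]; exact hh
  have h2 := A.Gk_unique P h1
  rw [← h2]; exact h1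

theorem Gk_norm (k : ℕ) (f : Crv C(S, ℝ)) : ‖A.Gk P k f‖ ≤ ‖f‖ / P.l := by
  have h1 := A.Jb_norm P k (f + Pk P k (A.Gk P k f))
  rw [← Gk_eq] at h1
  have h2 := Pk_norm P k (A.Gk P k f)
  have h3 := norm_add_le f (Pk P k (A.Gk P k f))
  rw [le_div_iff₀ (lN_pos P k)] at h1
  rw [le_div_iff₀ P.hl]; nlinarith

theorem Gk_mem_L (k : ℕ) (f : Crv C(S, ℝ)) (t : ℝ) :
    (A.Gk P k f t, (P.l • A.Gk P k f - fd P.B (1 / ((k:ℝ) + 1)) (A.Gk P k f) - f) t) ∈ A.L := by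
  have h1 := A.J_spec (lN_pos P k) ((f + Pk P k (A.Gk P k f)) t)
  rw [← Jb_apply, ← Gk_eq] at h1
  convert h1 using 2
  rw [fd_eq_Pk]
  simp only [BoundedContinuousFunction.coe_sub, BoundedContinuousFunction.coe_smul, Pi.sub_apply,
    BoundedContinuousFunction.coe_add, Pi.add_apply, add_smul]
  abel

theorem eq_Gk_of_mem {k : ℕ} {f h : Crv C(S, ℝ)}
    (H : ∀ t, (h t, (P.l • h - fd P.B (1 / ((k:ℝ) + 1)) h - f) t) ∈ A.L) : h = A.Gk P k f := by
  refine A.Gk_unique P ?_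
  ext1 t
  rw [Jb_apply]
  refine A.J_eq (lN_pos P k) ?_
  convert H t using 2
  rw [fd_eq_Pk]
  simp only [BoundedContinuousFunction.coe_sub, BoundedContinuousFunction.coe_smul, Pi.sub_apply,
    BoundedContinuousFunction.coe_add, Pi.add_apply, add_smul]
  abel

theorem Gk_mem_of_invariant {k : ℕ} {f : Crv C(S, ℝ)} {K : Set (Crv C(S, ℝ))}
    (hK : IsClosed K) (h0 : 0 ∈ K) (hi : ∀ u ∈ K, A.Jb P k (f + Pk P k u) ∈ K) :
    A.Gk P k f ∈ K := by
  set T := A.Jb P k ∘L Pk P k with hT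
  have hT1 := A.JbPk_norm P k
  let F : (Crv C(S, ℝ)) → (Crv C(S, ℝ)) := fun u => A.Jb P k (f + Pk P k u)
  have hmem : ∀ j : ℕ, F^[j] 0 ∈ K := by
    intro j
    induction j with
    | zero => exact h0
    | succ j ih => rw [Function.iterate_succ_apply']; exact hi _ ih
  have hd : ∀ j : ℕ, ‖F^[j] 0 - A.Gk P k f‖ ≤ ‖T‖ ^ j * ‖A.Gk P k f‖ := by
    intro j
    induction j with
    | zero => simp
    | succ j ih =>
      rw [Function.iterate_succ_apply']
      have : F (F^[j] 0) - A.Gk P k f = T (F^[j] 0 - A.Gk P k f) := by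
        conv_lhs => rw [Gk_eq]
        rw [← map_sub, hT]
        change _ = A.Jb P k (Pk P k _)
        congr 1; rw [map_sub]; abel
      rw [this, pow_succ']
      refine (T.le_opNorm _).trans ?_
      rw [mul_assoc]; gcongr
  refine hK.mem_of_tendsto (b := atTop) (f := fun j => F^[j] 0) ?_ (Eventually.of_forall hmem)
  rw [tendsto_iff_norm_sub_tendsto_zero]
  refine squeeze_zero (fun _ => norm_nonneg _) hd ?_
  have h0 : 0 ≤ ‖T‖ := T.opNorm_nonneg
  simpa using (tendsto_pow_atTop_nhds_zero_of_lt_one h0 hT1).mul_const ‖A.Gk P k f‖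

theorem eps_tendsto : Tendsto (fun k : ℕ => 1 / ((k:ℝ) + 1)) atTop (𝓝[>] 0) := by
  rw [tendsto_nhdsWithin_iff]
  exact ⟨tendsto_one_div_add_atTop_nhds_zero_nat, Eventually.of_forall fun k => by
    simp only [Set.mem_Ioi]; positivity⟩

theorem Gk_shift (k : ℕ) (s : ℝ) (f : Crv C(S, ℝ)) :
    A.Gk P k (shift s f) = shift s (A.Gk P k f) := by
  symm
  refine A.Gk_unique P ?_
  conv_lhs => rw [Gk_eq]
  have : Pk P k (shift s (A.Gk P k f)) = shift s (Pk P k (A.Gk P k f)) := by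
    simp only [Pk, ContinuousLinearMap.add_apply, ContinuousLinearMap.smul_apply, map_add, map_smul,
      shift_comm s]
  rw [this]
  rfl

theorem Gk_fd (k : ℕ) (ε : ℝ) (f : Crv C(S, ℝ)) :
    A.Gk P k (fd P.B ε f) = fd P.B ε (A.Gk P k f) := by
  simp only [fd, ContinuousLinearMap.add_apply, ContinuousLinearMap.smul_apply, map_add, map_smul,
    Gk_shift, ContinuousLinearMap.sub_apply, map_sub, ContinuousLinearMap.one_apply]

theorem Gk_sub_Gk (j k : ℕ) (f : Crv C(S, ℝ)) :
    ‖A.Gk P j f - A.Gk P k f‖ ≤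
      ‖fd P.B (1 / ((j:ℝ) + 1)) f - fd P.B (1 / ((k:ℝ) + 1)) f‖ / P.l / P.l := by
  have h1 : A.Gk P j f - A.Gk P k f =
      A.Gk P j (A.Gk P k (fd P.B (1 / ((j:ℝ) + 1)) f - fd P.B (1 / ((k:ℝ) + 1)) f)) := by
    refine A.eq_Gk_of_mem P fun t => ?_
    convert A.L.sub_mem (A.Gk_mem_L P j f t) (A.Gk_mem_L P k f t) using 1
    ext1
    · rfl
    · simp only [map_sub, Gk_fd]
      simp only [BoundedContinuousFunction.coe_sub, BoundedContinuousFunction.coe_smul, Pi.sub_apply,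
        Prod.snd_sub, smul_sub]
      abel
  rw [h1]
  exact (A.Gk_norm P _ _).trans (div_le_div_of_nonneg_right (A.Gk_norm P _ _) P.hl.le)

theorem Gk_cauchy {f : Crv C(S, ℝ)} (hf : UC f) : CauchySeq fun k => A.Gk P k f := by
  have hl := P.hl
  have base : ∀ f f' f'' : Crv C(S, ℝ), IsD f f' → IsD f' f'' → UC f'' →
      CauchySeq fun k => A.Gk P k f := by
    intro f f' f'' h h' hu
    have h1 := ((fd_tendsto P.B h h' hu).comp eps_tendsto).cauchySeq
    rw [Metric.cauchySeq_iff] at h1 ⊢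
    intro ε hε
    obtain ⟨N, hN⟩ := h1 (ε * P.l * P.l) (by positivity)
    refine ⟨N, fun j hj k hk => ?_⟩
    have := hN j hj k hk
    rw [dist_eq_norm] at this ⊢
    refine (A.Gk_sub_Gk P j k f).trans_lt ?_
    rw [div_div, div_lt_iff₀ (by positivity), ← mul_assoc]; exact this
  rw [Metric.cauchySeq_iff]
  intro ε hε
  have h3 : Tendsto (fun k : ℕ => avg (1 * (1 / ((k:ℝ) + 1))) (avg (1 / ((k:ℝ) + 1)) f)) atTop (𝓝 f) :=
    (hf.avg_avg 1).comp (eps_tendsto.mono_right nhdsWithin_le_nhds)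
  obtain ⟨i, hi⟩ := (Metric.tendsto_nhds.1 h3 (ε / 3 * P.l) (by positivity)).exists
  set g := avg (1 * (1 / ((i:ℝ) + 1))) (avg (1 / ((i:ℝ) + 1)) f) with hg
  have hi0 : (1 / ((i:ℝ) + 1)) ≠ 0 := by positivity
  have hi1 : 1 * (1 / ((i:ℝ) + 1)) ≠ 0 := by positivity
  have d1 := isD_avg hi0 f
  have d2 := isD_avg hi1 (avg (1 / ((i:ℝ) + 1)) f)
  have d3 : IsD ((1 * (1 / ((i:ℝ) + 1)))⁻¹ • (shift (1 * (1 / ((i:ℝ) + 1))) (avg (1 / ((i:ℝ) + 1)) f) -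
      avg (1 / ((i:ℝ) + 1)) f)) ((1 * (1 / ((i:ℝ) + 1)))⁻¹ • (shift (1 * (1 / ((i:ℝ) + 1)))
      ((1 / ((i:ℝ) + 1))⁻¹ • (shift (1 / ((i:ℝ) + 1)) f - f)) -
      ((1 / ((i:ℝ) + 1))⁻¹ • (shift (1 / ((i:ℝ) + 1)) f - f)))) :=
    fun t => (((d1.shift _) t).sub (d1 t)).const_smul _
  have u1 : UC ((1 / ((i:ℝ) + 1))⁻¹ • (shift (1 / ((i:ℝ) + 1)) f - f)) :=
    ((hf.shift _).sub hf).smul _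
  have hc := base g _ _ d2 d3 (((u1.shift _).sub u1).smul _)
  obtain ⟨N, hN⟩ := Metric.cauchySeq_iff.1 hc (ε / 3) (by positivity)
  refine ⟨N, fun j hj k hk => ?_⟩
  have h4 := hN j hj k hk
  rw [dist_eq_norm] at h4 hi ⊢
  have h5 : ∀ j, ‖A.Gk P j (f - g)‖ ≤ ε / 3 := by
    intro j
    refine (A.Gk_norm P j _).trans ?_
    rw [div_le_iff₀ hl, norm_sub_rev]; exact hi.le
  have h6 : A.Gk P j f - A.Gk P k f =
      A.Gk P j (f - g) + (A.Gk P j g - A.Gk P k g) + (- A.Gk P k (f - g)) := by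
    rw [map_sub, map_sub]; abel
  rw [h6]
  refine (norm_add₃_le).trans_lt ?_
  rw [norm_neg]
  linarith [h5 j, h5 k]

/-- The solution operator of `l h - h'' + B h' - L h = f` for uniformly continuous `f`. -/
noncomputable def G (f : Crv C(S, ℝ)) : Crv C(S, ℝ) := limUnder atTop fun k => A.Gk P k f

theorem G_tendsto {f : Crv C(S, ℝ)} (hf : UC f) :
    Tendsto (fun k => A.Gk P k f) atTop (𝓝 (A.G P f)) :=
  (A.Gk_cauchy P hf).tendsto_limUnder

theorem G_sub {f g : Crv C(S, ℝ)} (hf : UC f) (hg : UC g) :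
    A.G P (f - g) = A.G P f - A.G P g := by
  refine tendsto_nhds_unique (A.G_tendsto P (hf.sub hg)) ?_
  simpa only [map_sub] using (A.G_tendsto P hf).sub (A.G_tendsto P hg)

theorem G_smul {f : Crv C(S, ℝ)} (hf : UC f) (c : ℝ) : A.G P (c • f) = c • A.G P f := by
  refine tendsto_nhds_unique (A.G_tendsto P (hf.smul c)) ?_
  simpa only [map_smul] using (A.G_tendsto P hf).const_smul c

theorem G_shift {f : Crv C(S, ℝ)} (hf : UC f) (s : ℝ) :
    A.G P (shift s f) = shift s (A.G P f) := by
  refine tendsto_nhds_unique (A.G_tendsto P (hf.shift s)) ?_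
  simpa only [Gk_shift, Function.comp_def] using ((shift s).continuous.tendsto _).comp (A.G_tendsto P hf)

theorem G_norm {f : Crv C(S, ℝ)} (hf : UC f) : ‖A.G P f‖ ≤ ‖f‖ / P.l :=
  le_of_tendsto (A.G_tendsto P hf).norm (Eventually.of_forall fun k => A.Gk_norm P k f)

theorem G_uc {f : Crv C(S, ℝ)} (hf : UC f) : UC (A.G P f) := by
  rw [UC, tendsto_iff_norm_sub_tendsto_zero]
  have h1 := (tendsto_iff_norm_sub_tendsto_zero.1 hf).div_const P.l
  refine squeeze_zero (fun _ => norm_nonneg _) (fun s => ?_) (by simpa using h1)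
  rw [← G_shift A P hf, ← G_sub A P (hf.shift s) hf]
  exact A.G_norm P ((hf.shift s).sub hf)

theorem G_tendsto_of_tendsto {ι : Type*} {l : Filter ι} {F : ι → Crv C(S, ℝ)} {f : Crv C(S, ℝ)}
    (hF : ∀ i, UC (F i)) (hf : UC f) (h : Tendsto F l (𝓝 f)) :
    Tendsto (fun i => A.G P (F i)) l (𝓝 (A.G P f)) := by
  rw [tendsto_iff_norm_sub_tendsto_zero] at h ⊢
  refine squeeze_zero (fun _ => norm_nonneg _) (fun s => ?_) (by simpa using h.div_const P.l)
  rw [← G_sub A P (hF s) hf]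
  exact A.G_norm P ((hF s).sub hf)

theorem G_isD {f f' : Crv C(S, ℝ)} (h : IsD f f') (hu : UC f') : IsD (A.G P f) (A.G P f') := by
  intro t
  rw [hasDerivAt_iff_tendsto_slope_zero]
  have hf := h.uc
  have h1 : Tendsto (fun s : ℝ => A.G P (avg s f')) (𝓝[≠] 0) (𝓝 (A.G P f')) := by
    have h2 : ∀ s : ℝ, UC (avg s f') := by
      intro s
      have := (((avg s).continuous.tendsto _).comp hu)
      simpa only [UC, ← avg_shift, Function.comp_def] using this
    exact A.G_tendsto_of_tendsto P h2 hu (hu.avg.mono_left nhdsWithin_le_nhds)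
  have h3 := (BoundedContinuousFunction.tendsto_iff_tendstoUniformly.1 h1).tendsto_at t
  refine h3.congr' ?_
  filter_upwards [self_mem_nhdsWithin] with s hs
  have hs' : s ≠ 0 := hs
  have h4 : avg s f' = s⁻¹ • (shift s f - f) := by
    rw [h.shift_sub, smul_smul, inv_mul_cancel₀ hs', one_smul]
  rw [h4, G_smul A P ((hf.shift s).sub hf), G_sub A P (hf.shift s) hf, G_shift A P hf]
  simp

theorem G_mem_L {f f' f'' : Crv C(S, ℝ)} (h : IsD f f') (h' : IsD f' f'') (hu : UC f'') (t : ℝ) :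
    (A.G P f t, (P.l • A.G P f - (A.G P f'' - P.B • A.G P f') - f) t) ∈ A.L := by
  have h1 : Tendsto (fun k : ℕ => fd P.B (1 / ((k:ℝ) + 1)) (A.Gk P k f)) atTop
      (𝓝 (A.G P f'' - P.B • A.G P f')) := by
    have h2 := (fd_tendsto P.B h h' hu).comp eps_tendsto
    rw [tendsto_iff_norm_sub_tendsto_zero] at h2
    have hu2 : UC (f'' - P.B • f') := hu.sub (h'.uc.smul _)
    have h3 := A.G_tendsto P hu2
    rw [G_sub A P hu (h'.uc.smul _), G_smul A P h'.uc] at h3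
    rw [tendsto_iff_norm_sub_tendsto_zero] at h3 ⊢
    have h5 := (h2.div_const P.l).add h3
    rw [zero_div, add_zero] at h5
    refine squeeze_zero (fun _ => norm_nonneg _) (fun k => ?_) h5
    rw [← Gk_fd]
    have : A.Gk P k (fd P.B (1 / ((k:ℝ) + 1)) f) - (A.G P f'' - P.B • A.G P f') =
      A.Gk P k (fd P.B (1 / ((k:ℝ) + 1)) f - (f'' - P.B • f')) +
      (A.Gk P k (f'' - P.B • f') - (A.G P f'' - P.B • A.G P f')) := by
      rw [map_sub _ (fd P.B (1 / ((k:ℝ) + 1)) f)]; abel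
    rw [this]
    refine (norm_add_le _ _).trans (add_le_add (A.Gk_norm P _ _) le_rfl)
  have h4 := ((A.G_tendsto P h.uc).const_smul P.l |>.sub h1).sub_const f
  have h5 := (BoundedContinuousFunction.tendsto_iff_tendstoUniformly.1 h4).tendsto_at t
  have h6 := (BoundedContinuousFunction.tendsto_iff_tendstoUniformly.1 (A.G_tendsto P h.uc)).tendsto_at t
  exact A.isClosed_L.mem_of_tendsto (h6.prodMk_nhds h5) (Eventually.of_forall fun k => A.Gk_mem_L P k f t)

theorem eq_G_of_mem {h h' h'' f : Crv C(S, ℝ)} (hd : IsD h h') (hd' : IsD h' h'') (hu : UC h'')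
    (hf : UC f) (H : ∀ t, (h t, (P.l • h - (h'' - P.B • h') - f) t) ∈ A.L) : h = A.G P f := by
  have h1 : ∀ k : ℕ, h - A.Gk P k f =
      A.Gk P k ((h'' - P.B • h') - fd P.B (1 / ((k:ℝ) + 1)) h) := by
    intro k
    refine A.eq_Gk_of_mem P fun t => ?_
    convert A.L.sub_mem (H t) (A.Gk_mem_L P k f t) using 1
    ext1
    · rfl
    · rw [map_sub]
      simp only [BoundedContinuousFunction.coe_sub, BoundedContinuousFunction.coe_smul, Pi.sub_apply,
        Prod.snd_sub, smul_sub]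
      abel
  have h2 : Tendsto (fun k => A.Gk P k f) atTop (𝓝 h) := by
    rw [tendsto_iff_norm_sub_tendsto_zero]
    have h3 := tendsto_iff_norm_sub_tendsto_zero.1 ((fd_tendsto P.B hd hd' hu).comp eps_tendsto)
    have h4 := h3.div_const P.l
    rw [zero_div] at h4
    refine squeeze_zero (fun _ => norm_nonneg _) (fun k => ?_) h4
    rw [norm_sub_rev, h1]
    refine (A.Gk_norm P _ _).trans ?_
    rw [norm_sub_rev]; rfl
  exact tendsto_nhds_unique h2 (A.G_tendsto P hf)

theorem G_mem_of_invariant {f : Crv C(S, ℝ)} (hf : UC f) {K : Set (Crv C(S, ℝ))}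
    (hK : IsClosed K) (h0 : 0 ∈ K)
    (hi : ∀ᶠ k in atTop, ∀ u ∈ K, A.Jb P k (f + Pk P k u) ∈ K) : A.G P f ∈ K :=
  hK.mem_of_tendsto (A.G_tendsto P hf) (hi.mono fun _ hk => A.Gk_mem_of_invariant P hK h0 hk)

theorem G_nonneg {f : Crv C(S, ℝ)} (hf : UC f) (h0 : ∀ t, 0 ≤ f t) (t : ℝ) : 0 ≤ A.G P f t := by
  have hB := P.hB
  have : A.G P f ∈ {u : Crv C(S, ℝ) | ∀ t x, 0 ≤ u t x} := by
    refine A.G_mem_of_invariant P hf ?_ (fun _ _ => le_rfl) (Eventually.of_forall fun k u hu t => ?_)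
    · simp only [Set.setOf_forall]
      refine isClosed_iInter fun t => isClosed_iInter fun x => isClosed_le continuous_const ?_
      exact (continuous_eval_const x).comp
        (BoundedContinuousFunction.lipschitz_eval_const t).continuous
    · intro x
      rw [Jb_apply]
      refine A.J_nonneg (lN_pos P k) (fun x => ?_) x
      have h1 := h0 t x
      simp only [Pk, BoundedContinuousFunction.coe_add, ContinuousLinearMap.add_apply,
        ContinuousLinearMap.smul_apply, BoundedContinuousFunction.coe_smul, Pi.add_apply,
        shift_apply, ContinuousMap.add_apply, ContinuousMap.smul_apply, smul_eq_mul]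
      simp at h1 ⊢
      have h2 := hu (t + ((k:ℝ) + 1)⁻¹) x
      have h3 := hu (t + -((k:ℝ) + 1)⁻¹) x
      positivity
  exact fun x => this t x

theorem G_mono {f g : Crv C(S, ℝ)} (hf : UC f) (hg : UC g) (h : ∀ t, f t ≤ g t) (t : ℝ) :
    A.G P f t ≤ A.G P g t := by
  have := A.G_nonneg P (hg.sub hf) (fun t => by simpa using h t) t
  rw [G_sub A P hg hf] at this
  simpa using this

end Gen
end ConeHet

namespace ConeHet
open scoped Topology BoundedContinuousFunction

theorem second_deriv_nonneg {u u' : ℝ → ℝ} {c t₀ : ℝ} (h : ∀ᶠ t in 𝓝 t₀, HasDerivAt u (u' t) t)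
    (h' : HasDerivAt u' c t₀) (hm : IsLocalMin u t₀) : 0 ≤ c := by
  by_contra hc
  have hc' : c < 0 := not_le.1 hc
  have e1 : deriv u =ᶠ[𝓝 t₀] u' := h.mono fun t ht => ht.deriv
  have h0 : u' t₀ = 0 := hm.hasDerivAt_eq_zero h.self_of_nhds
  have e2 : deriv (deriv u) t₀ = c := (e1.deriv_eq).trans h'.deriv
  have hM : IsLocalMax u t₀ := isLocalMax_of_deriv_deriv_neg (by rw [e2]; exact hc')
    (by rw [e1.self_of_nhds, h0]) h.self_of_nhds.continuousAt
  have e3 : u =ᶠ[𝓝 t₀] fun _ => u t₀ := by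
    filter_upwards [hm, hM] with t h1 h2 using le_antisymm h2 h1
  have e4 : deriv u =ᶠ[𝓝 t₀] fun _ => 0 := by
    have := e3.deriv
    simpa using this
  have e5 := e4.deriv_eq
  simp [e2] at e5
  linarith

theorem deriv_nonneg_of_right {u : ℝ → ℝ} {c : ℝ} (h : HasDerivAt u c 0) (h0 : u 0 = 0)
    (hu : ∀ t ∈ Set.Icc (0:ℝ) 1, 0 ≤ u t) : 0 ≤ c := by
  have h1 := (hasDerivAt_iff_tendsto_slope_zero.1 h).mono_left
    (nhdsWithin_mono (0:ℝ) (fun x (hx : 0 < x) => (ne_of_gt hx : x ≠ 0)) : 𝓝[>] (0:ℝ) ≤ 𝓝[≠] 0)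
  refine ge_of_tendsto h1 ?_
  filter_upwards [Ioo_mem_nhdsGT (zero_lt_one : (0:ℝ) < 1)] with t ht
  have := hu t ⟨ht.1.le, ht.2.le⟩
  rw [zero_add, h0, sub_zero, smul_eq_mul]
  exact mul_nonneg (inv_nonneg.2 ht.1.le) this

namespace Gen
variable {S : Type} [MetricSpace S] [CompactSpace S] [Nonempty S] [MeasurableSpace S]
  [BorelSpace S] {μ : Measure S} [IsProbabilityMeasure μ] (A : Gen S μ) (P : Par)

theorem _root_.ConeHet.hasDerivAt_eval {h : ℝ → C(S, ℝ)} {h' : C(S, ℝ)} {t : ℝ}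
    (H : HasDerivAt h h' t) (x : S) : HasDerivAt (fun t => h t x) (h' x) t := by
  have := (ContinuousMap.evalCLM ℝ x : C(S, ℝ) →L[ℝ] ℝ).hasFDerivAt.comp_hasDerivAt t H
  exact this

theorem max_principle {a b : ℝ} {h h' h'' g : ℝ → C(S, ℝ)}
    (hc : ContinuousOn h (Set.Icc a b))
    (hd : ∀ t ∈ Set.Ioo a b, HasDerivAt h (h' t) t)
    (hd' : ∀ t ∈ Set.Ioo a b, HasDerivAt h' (h'' t) t)
    (hL : ∀ t ∈ Set.Ioo a b, (h t, g t) ∈ A.L)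
    (ha : ∀ x, 0 ≤ h a x) (hb : ∀ x, 0 ≤ h b x)
    (hneg : ∀ t ∈ Set.Ioo a b, ∀ x, h t x < 0 → h' t x = 0 → h'' t x + g t x < 0) :
    ∀ t ∈ Set.Icc a b, ∀ x, 0 ≤ h t x := by
  intro t ht x
  have hK : IsCompact (Set.Icc a b ×ˢ (Set.univ : Set S)) := isCompact_Icc.prod isCompact_univ
  have hcont : ContinuousOn (fun q : ℝ × S => h q.1 q.2) (Set.Icc a b ×ˢ (Set.univ : Set S)) := by
    have h1 : ContinuousOn (fun q : ℝ × S => (h q.1, q.2)) (Set.Icc a b ×ˢ (Set.univ : Set S)) :=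
      (hc.comp continuousOn_fst (fun q hq => hq.1)).prodMk continuousOn_snd
    exact (continuous_eval (F := C(S, ℝ))).comp_continuousOn h1
  obtain ⟨⟨t₀, x₀⟩, hm, hmin⟩ := hK.exists_isMinOn ⟨(t, x), ht, Set.mem_univ _⟩ hcont
  have hmin' : ∀ s ∈ Set.Icc a b, ∀ y, h t₀ x₀ ≤ h s y := fun s hs y =>
    hmin (a := (s, y)) ⟨hs, Set.mem_univ _⟩
  refine le_trans ?_ (hmin' t ht x)
  by_contra hn
  rw [not_le] at hn
  have hta : t₀ ≠ a := by rintro rfl; linarith [ha x₀]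
  have htb : t₀ ≠ b := by rintro rfl; linarith [hb x₀]
  have hI : t₀ ∈ Set.Ioo a b := ⟨lt_of_le_of_ne hm.1.1 (Ne.symm hta), lt_of_le_of_ne hm.1.2 htb⟩
  have hlm : IsLocalMin (fun t => h t x₀) t₀ := by
    filter_upwards [Ioo_mem_nhds hI.1 hI.2] with s hs
    exact hmin' s ⟨hs.1.le, hs.2.le⟩ x₀
  have h0 := hlm.hasDerivAt_eq_zero (hasDerivAt_eval (hd t₀ hI) x₀)
  have h2 := second_deriv_nonneg (u := fun t => h t x₀) (u' := fun t => h' t x₀)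
    (by filter_upwards [Ioo_mem_nhds hI.1 hI.2] with s hs using hasDerivAt_eval (hd s hs) x₀)
    (hasDerivAt_eval (hd' t₀ hI) x₀) hlm
  have h3 := A.min (hL t₀ hI) x₀ (hmin' t₀ hm.1)
  linarith [hneg t₀ hI x₀ hn h0]

/-- Classical solutions `h` of `l h - h'' + B h' - L h = f`. -/
structure Cl (h h' h'' f : ℝ → C(S, ℝ)) : Prop where
  d1 : ∀ t, HasDerivAt h (h' t) t
  d2 : ∀ t, HasDerivAt h' (h'' t) t
  eqn : ∀ t, (h t, P.l • h t - h'' t + P.B • h' t - f t) ∈ A.L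

variable {A P}

theorem Cl.neg {h h' h'' f : ℝ → C(S, ℝ)} (H : A.Cl P h h' h'' f) :
    A.Cl P (fun t => -h t) (fun t => -h' t) (fun t => -h'' t) (fun t => -f t) where
  d1 t := (H.d1 t).neg
  d2 t := (H.d2 t).neg
  eqn t := by
    convert A.L.neg_mem (H.eqn t) using 1
    ext1
    · rfl
    · simp only [Prod.snd_neg, smul_neg]; abel

theorem Cl.shift {h h' h'' f : ℝ → C(S, ℝ)} (H : A.Cl P h h' h'' f) (s : ℝ) :
    A.Cl P (fun t => h (t + s)) (fun t => h' (t + s)) (fun t => h'' (t + s)) (fun t => f (t + s)) where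
  d1 t := (H.d1 (t + s)).comp_add_const t s
  d2 t := (H.d2 (t + s)).comp_add_const t s
  eqn t := H.eqn (t + s)

theorem Cl.add {h h' h'' f k k' k'' e : ℝ → C(S, ℝ)} (H : A.Cl P h h' h'' f)
    (H2 : A.Cl P k k' k'' e) :
    A.Cl P (fun t => h t + k t) (fun t => h' t + k' t) (fun t => h'' t + k'' t)
      (fun t => f t + e t) where
  d1 t := (H.d1 t).add (H2.d1 t)
  d2 t := (H.d2 t).add (H2.d2 t)
  eqn t := by
    convert A.L.add_mem (H.eqn t) (H2.eqn t) using 1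
    ext1
    · rfl
    · simp only [Prod.snd_add, smul_add]; abel

theorem Cl.smul {h h' h'' f : ℝ → C(S, ℝ)} (H : A.Cl P h h' h'' f) (c : ℝ) :
    A.Cl P (fun t => c • h t) (fun t => c • h' t) (fun t => c • h'' t) (fun t => c • f t) where
  d1 t := (H.d1 t).const_smul c
  d2 t := (H.d2 t).const_smul c
  eqn t := by
    convert A.L.smul_mem c (H.eqn t) using 1
    ext1
    · rfl
    · simp only [Prod.smul_snd, smul_add, smul_sub, smul_comm c]

theorem Cl.sub {h h' h'' f k k' k'' e : ℝ → C(S, ℝ)} (H : A.Cl P h h' h'' f)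
    (H2 : A.Cl P k k' k'' e) :
    A.Cl P (fun t => h t - k t) (fun t => h' t - k' t) (fun t => h'' t - k'' t)
      (fun t => f t - e t) := by
  simpa only [sub_eq_add_neg] using H.add H2.neg

/-- The constant of the interior gradient estimate. -/
noncomputable def _root_.ConeHet.Par.C (P : Par) : ℝ := P.B / 2 + Real.exp (P.B / 2)

theorem _root_.ConeHet.Par.C_pos (P : Par) : 0 < P.C := by
  have := P.hB; unfold Par.C; positivity

theorem Cl.gradient_aux {h h' h'' f : ℝ → C(S, ℝ)} (H : A.Cl P h h' h'' f) {M M' : ℝ}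
    (hM : ∀ t ∈ Set.Icc (-1:ℝ) 1, ‖h t‖ ≤ M) (hM' : ∀ t ∈ Set.Icc (-1:ℝ) 1, ‖f t‖ < M') (x : S) :
    h' 0 x ≤ P.C * (M + M') := by
  have hB := P.hB
  have hl := P.hl
  have hM0 : 0 ≤ M := (norm_nonneg _).trans (hM 0 (by norm_num))
  have hM0' : 0 < M' := (norm_nonneg _).trans_lt (hM' 0 (by norm_num))
  set E : ℝ := Real.exp (P.B / 2) with hE
  have hE0 : 0 < E := Real.exp_pos _
  let e : ℝ → ℝ := fun t => Real.exp (-(P.B / 2) * t)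
  have he : ∀ t, HasDerivAt e (-(P.B / 2) * e t) t := by
    intro t
    have := ((hasDerivAt_id t).const_mul (-(P.B / 2))).exp
    simp only [id, mul_one] at this
    rw [mul_comm] at this
    exact this
  have he0 : ∀ t, 0 < e t := fun t => Real.exp_pos _
  have heE : ∀ t ∈ Set.Icc (-1:ℝ) 1, e t ≤ E := fun t ht => Real.exp_le_exp.2 (by nlinarith [ht.1, ht.2])
  let k : ℝ → C(S, ℝ) := fun t => e t • h t
  let k' : ℝ → C(S, ℝ) := fun t => e t • h' t + (-(P.B / 2) * e t) • h t
  let k'' : ℝ → C(S, ℝ) := fun t => (e t • h'' t + (-(P.B / 2) * e t) • h' t) +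
    ((-(P.B / 2) * e t) • h' t + (-(P.B / 2) * (-(P.B / 2) * e t)) • h t)
  have dk : ∀ t, HasDerivAt k (k' t) t := fun t => (he t).smul (H.d1 t)
  have dk' : ∀ t, HasDerivAt k' (k'' t) t := fun t =>
    ((he t).smul (H.d2 t)).add (((he t).const_mul _).smul (H.d1 t))
  have dm : ∀ (q q' : ℝ → C(S, ℝ)), (∀ t, HasDerivAt q (q' t) t) →
      ∀ t, HasDerivAt (fun t => q (-t)) (-q' (-t)) t := by
    intro q q' hq t
    have := (hq (-t)).scomp t (hasDerivAt_neg t)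
    simpa [Function.comp_def] using this
  let b : ℝ → ℝ := fun t => 2 * E * M * t + E * M' * (t - t ^ 2)
  let b' : ℝ → ℝ := fun t => 2 * E * M + E * M' * (1 - 2 * t)
  have db : ∀ t, HasDerivAt b (b' t) t := by
    intro t
    have := ((hasDerivAt_id t).const_mul (2 * E * M)).add
      (((hasDerivAt_id t).sub ((hasDerivAt_id t).pow 2)).const_mul (E * M'))
    refine this.congr_deriv ?_
    simp [b']
  have db' : ∀ t, HasDerivAt b' (-2 * E * M') t := by
    intro t
    have := (((hasDerivAt_id t).const_mul 2).const_sub 1 |>.const_mul (E * M')).const_add (2 * E * M)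
    refine this.congr_deriv ?_
    ring
  let one : C(S, ℝ) := 1
  have key := A.max_principle (a := 0) (b := 1)
    (h := fun t => b t • one - (k t - k (-t))) (h' := fun t => b' t • one - (k' t + k' (-t)))
    (h'' := fun t => (-2 * E * M') • one - (k'' t - k'' (-t)))
    (g := fun t => -(e t • (P.l • h t - h'' t + P.B • h' t - f t) -
      e (-t) • (P.l • h (-t) - h'' (-t) + P.B • h' (-t) - f (-t)))) ?_ ?_ ?_ ?_ ?_ ?_ ?_
  · have h1 : HasDerivAt (fun t => b t - (k t x - k (-t) x)) (b' 0 - (k' 0 x + k' 0 x)) 0 := by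
      have h2 := hasDerivAt_eval (dk 0) x
      have h3 := hasDerivAt_eval (dm k k' dk 0) x
      refine ((db 0).sub (h2.sub h3)).congr_deriv ?_
      simp
    have h2 := deriv_nonneg_of_right h1 (by simp [b]) (fun t ht => by
      have := key t ht x
      simpa [one] using this)
    have h3 : k' 0 x = h' 0 x - P.B / 2 * h 0 x := by
      simp [k', e]; ring
    have h4 : b' 0 = 2 * E * M + E * M' := by simp [b']
    have h5 : h 0 x ≤ M := (le_abs_self _).trans (((h 0).norm_coe_le_norm x).trans (hM 0 (by norm_num)))
    rw [h3, h4] at h2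
    simp only [Par.C]
    nlinarith [mul_le_mul_of_nonneg_left h5 hB.le, mul_pos hE0 hM0', mul_pos hB hM0']
  · have c1 : Continuous k := continuous_iff_continuousAt.2 fun t => (dk t).continuousAt
    have c2 : Continuous b := continuous_iff_continuousAt.2 fun t => (db t).continuousAt
    fun_prop
  · intro t _
    have := ((db t).smul_const one).sub ((dk t).sub (dm k k' dk t))
    refine this.congr_deriv ?_
    simp
  · intro t _
    have := ((db' t).smul_const one).sub ((dk' t).add (dm k' k'' dk' t))
    refine this.congr_deriv ?_
    rw [sub_eq_add_neg (k'' t)]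
  · intro t _
    have h1 : (b t • one, (0 : C(S, ℝ))) ∈ A.L := by
      have := A.L.smul_mem (b t) A.one
      simpa using this
    have h2 := A.L.smul_mem (e t) (H.eqn t)
    have h3 := A.L.smul_mem (e (-t)) (H.eqn (-t))
    have := A.L.sub_mem h1 (A.L.sub_mem h2 h3)
    convert this using 1
    ext1
    · rfl
    · simp
  · intro x; simp [b]
  · intro y
    have h1 : ∀ t ∈ Set.Icc (-1:ℝ) 1, |k t y| ≤ E * M := by
      intro t ht
      simp only [k, ContinuousMap.smul_apply, smul_eq_mul, abs_mul, abs_of_pos (he0 t)]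
      have := ((h t).norm_coe_le_norm y).trans (hM t ht)
      rw [Real.norm_eq_abs] at this
      exact mul_le_mul (heE t ht) this (abs_nonneg _) hE0.le
    have h2 := abs_le.1 (h1 1 (by norm_num))
    have h3 := abs_le.1 (h1 (-1) (by norm_num))
    simp [b, one]; linarith
  · intro t ht y hneg _
    have h1 : ∀ t ∈ Set.Icc (-1:ℝ) 1, |e t * f t y| < E * M' := by
      intro t ht
      simp only [abs_mul, abs_of_pos (he0 t)]
      have := ((f t).norm_coe_le_norm y).trans_lt (hM' t ht)
      rw [Real.norm_eq_abs] at this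
      calc e t * |f t y| ≤ E * |f t y| := mul_le_mul_of_nonneg_right (heE t ht) (abs_nonneg _)
        _ < E * M' := mul_lt_mul_of_pos_left this hE0
    have h2 := abs_lt.1 (h1 t ⟨by linarith [ht.1], ht.2.le⟩)
    have h3 := abs_lt.1 (h1 (-t) ⟨by linarith [ht.2], by linarith [ht.1]⟩)
    have h4 : 0 ≤ b t := by
      simp only [b]
      have : 0 ≤ t - t ^ 2 := by nlinarith [ht.1, ht.2]
      have := ht.1.le
      positivity
    simp [one, k, k''] at hneg ⊢
    have h5 : 0 ≤ (P.l + P.B ^ 2 / 4) * (e t * h t y - e (-t) * h (-t) y) := by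
      apply mul_nonneg (by positivity); linarith
    linarith

theorem Cl.gradient {h h' h'' f : ℝ → C(S, ℝ)} (H : A.Cl P h h' h'' f) {M M' t₀ : ℝ}
    (hM : ∀ t, |t - t₀| ≤ 1 → ‖h t‖ ≤ M) (hM' : ∀ t, |t - t₀| ≤ 1 → ‖f t‖ ≤ M') :
    ‖h' t₀‖ ≤ P.C * (M + M') := by
  have hC := P.C_pos
  have hM0 : 0 ≤ M := (norm_nonneg _).trans (hM t₀ (by norm_num))
  have hM0' : 0 ≤ M' := (norm_nonneg _).trans (hM' t₀ (by norm_num))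
  rw [ContinuousMap.norm_le _ (by positivity)]
  intro x
  refine le_of_forall_pos_le_add fun ε hε => ?_
  have hb : ∀ t ∈ Set.Icc (-1:ℝ) 1, |t + t₀ - t₀| ≤ 1 := fun t ht => by
    rw [add_sub_cancel_right, abs_le]; exact ht
  have e1 : P.C * (M + M') + ε = P.C * (M + (M' + ε / P.C)) := by field_simp; ring
  have hε' : 0 < ε / P.C := by positivity
  have h1 := (H.shift t₀).gradient_aux (M := M) (M' := M' + ε / P.C) (fun t ht => hM _ (hb t ht))
    (fun t ht => (hM' _ (hb t ht)).trans_lt (by linarith)) x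
  have h2 := (H.shift t₀).neg.gradient_aux (M := M) (M' := M' + ε / P.C)
    (fun t ht => by rw [norm_neg]; exact hM _ (hb t ht))
    (fun t ht => by rw [norm_neg]; exact (hM' _ (hb t ht)).trans_lt (by linarith)) x
  rw [e1, Real.norm_eq_abs, abs_le]
  simp at h1 h2
  constructor <;> linarith

end Gen
end ConeHet

namespace ConeHet
open scoped Topology BoundedContinuousFunction

theorem exists_smooth_of_uc {X : Type*} [NormedAddCommGroup X] [NormedSpace ℝ X] [CompleteSpace X]
    {f : Crv X} (hf : UC f) :
    ∃ F F' F'' : ℕ → Crv X, (∀ i, IsD (F i) (F' i)) ∧ (∀ i, IsD (F' i) (F'' i)) ∧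
      (∀ i, UC (F'' i)) ∧ Tendsto F atTop (𝓝 f) := by
  let ε : ℕ → ℝ := fun i => 1 / ((i:ℝ) + 1)
  have hε : ∀ i, ε i ≠ 0 := fun i => by positivity
  have hε1 : ∀ i, 1 * ε i ≠ 0 := fun i => by rw [one_mul]; exact hε i
  refine ⟨fun i => avg (1 * ε i) (avg (ε i) f),
    fun i => (1 * ε i)⁻¹ • (shift (1 * ε i) (avg (ε i) f) - avg (ε i) f),
    fun i => (1 * ε i)⁻¹ • (shift (1 * ε i) ((ε i)⁻¹ • (shift (ε i) f - f)) -
      ((ε i)⁻¹ • (shift (ε i) f - f))), fun i => isD_avg (hε1 i) _, fun i => ?_, fun i => ?_, ?_⟩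
  · have d1 := isD_avg (hε i) f
    exact fun t => (((d1.shift _) t).sub (d1 t)).const_smul _
  · have u1 : UC ((ε i)⁻¹ • (shift (ε i) f - f)) := ((hf.shift _).sub hf).smul _
    exact ((u1.shift _).sub u1).smul _
  · exact (hf.avg_avg 1).comp (Gen.eps_tendsto.mono_right nhdsWithin_le_nhds)

theorem exists_smooth_of_isD {X : Type*} [NormedAddCommGroup X] [NormedSpace ℝ X] [CompleteSpace X]
    {f f' : Crv X} (h : IsD f f') (hf : UC f') :
    ∃ F F' F'' : ℕ → Crv X, (∀ i, IsD (F i) (F' i)) ∧ (∀ i, IsD (F' i) (F'' i)) ∧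
      (∀ i, UC (F'' i)) ∧ Tendsto F atTop (𝓝 f) ∧ Tendsto F' atTop (𝓝 f') := by
  let ε : ℕ → ℝ := fun i => 1 / ((i:ℝ) + 1)
  have hε : ∀ i, ε i ≠ 0 := fun i => by positivity
  have hl : Tendsto ε atTop (𝓝 0) := Gen.eps_tendsto.mono_right nhdsWithin_le_nhds
  exact ⟨fun i => avg (ε i) f, fun i => avg (ε i) f',
    fun i => (ε i)⁻¹ • (shift (ε i) f' - f'), fun i => h.avg _, fun i => isD_avg (hε i) _,
    fun i => ((hf.shift _).sub hf).smul _, h.uc.avg.comp hl, hf.avg.comp hl⟩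

namespace Gen
variable {S : Type} [MetricSpace S] [CompactSpace S] [Nonempty S] [MeasurableSpace S]
  [BorelSpace S] {μ : Measure S} [IsProbabilityMeasure μ] (A : Gen S μ) (P : Par)

theorem G_cl {f f' f'' : Crv C(S, ℝ)} (h : IsD f f') (h' : IsD f' f'') (hu : UC f'') :
    A.Cl P (A.G P f) (A.G P f') (A.G P f'') f where
  d1 := A.G_isD P h h'.uc
  d2 := A.G_isD P h' hu
  eqn t := by
    convert A.G_mem_L P h h' hu t using 2
    simp only [BoundedContinuousFunction.coe_sub, BoundedContinuousFunction.coe_smul, Pi.sub_apply]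
    abel

/-- The constant of the global gradient estimate. -/
noncomputable def _root_.ConeHet.Par.C1 (P : Par) : ℝ := P.C * (1 / P.l + 1)

theorem _root_.ConeHet.Par.C1_pos (P : Par) : 0 < P.C1 := by
  have := P.hl; have := P.C_pos; unfold Par.C1; positivity

theorem G_deriv_norm {f f' f'' : Crv C(S, ℝ)} (h : IsD f f') (h' : IsD f' f'') (hu : UC f'') :
    ‖A.G P f'‖ ≤ P.C1 * ‖f‖ := by
  have := P.C1_pos
  rw [BoundedContinuousFunction.norm_le (by positivity)]
  intro t
  have h1 : ‖A.G P f‖ ≤ ‖f‖ / P.l := A.G_norm P h.uc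
  refine ((A.G_cl P h h' hu).gradient (M := ‖f‖ / P.l) (M' := ‖f‖)
    (fun t _ => ((A.G P f).norm_coe_le_norm t).trans h1) (fun t _ => f.norm_coe_le_norm t)).trans ?_
  unfold Par.C1
  apply le_of_eq; ring

theorem G_smooth {f : Crv C(S, ℝ)} (hf : UC f) :
    ∃ g : Crv C(S, ℝ), IsD (A.G P f) g ∧ UC g ∧ ‖g‖ ≤ P.C1 * ‖f‖ := by
  obtain ⟨F, F', F'', d1, d2, u2, hF⟩ := exists_smooth_of_uc hf
  have hC := P.C1_pos
  have hu : ∀ i, UC (F i) := fun i => (d1 i).uc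
  have hu' : ∀ i, UC (F' i) := fun i => (d2 i).uc
  have key : ∀ i j, ‖A.G P (F' i) - A.G P (F' j)‖ ≤ P.C1 * ‖F i - F j‖ := by
    intro i j
    rw [← G_sub A P (hu' i) (hu' j)]
    exact A.G_deriv_norm P (f := F i - F j) (f'' := F'' i - F'' j)
      (fun t => ((d1 i) t).sub ((d1 j) t)) (fun t => ((d2 i) t).sub ((d2 j) t)) ((u2 i).sub (u2 j))
  have hc : CauchySeq fun i => A.G P (F' i) := by
    rw [Metric.cauchySeq_iff]
    intro ε hε
    obtain ⟨N, hN⟩ := Metric.cauchySeq_iff.1 hF.cauchySeq (ε / P.C1) (by positivity)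
    refine ⟨N, fun j hj k hk => ?_⟩
    have := hN j hj k hk
    rw [dist_eq_norm] at this ⊢
    refine (key j k).trans_lt ?_
    rw [lt_div_iff₀ hC] at this
    linarith
  obtain ⟨g, hg⟩ := cauchySeq_tendsto_of_complete hc
  refine ⟨g, IsD.of_tendsto (fun i => A.G_isD P (d1 i) (hu' i)) (A.G_tendsto_of_tendsto P hu hf hF) hg,
    UC.of_tendsto (fun i => A.G_uc P (hu' i)) hg, ?_⟩
  exact le_of_tendsto_of_tendsto hg.norm (hF.norm.const_mul _)
    (Eventually.of_forall fun i => A.G_deriv_norm P (d1 i) (d2 i) (u2 i))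

theorem G_classical {f f' : Crv C(S, ℝ)} (h : IsD f f') (hu : UC f') :
    ∃ g : Crv C(S, ℝ), UC g ∧ A.Cl P (A.G P f) (A.G P f') g f := by
  obtain ⟨F, F', F'', d1, d2, u2, hF, hF'⟩ := exists_smooth_of_isD h hu
  have hC := P.C1_pos
  have hu1 : ∀ i, UC (F i) := fun i => (d1 i).uc
  have hu' : ∀ i, UC (F' i) := fun i => (d2 i).uc
  have key : ∀ f' f'' : Crv C(S, ℝ), IsD f' f'' → UC f'' → ‖A.G P f''‖ ≤ P.C1 * ‖f'‖ := by
    intro f' f'' hd hu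
    obtain ⟨g, hg, _, hn⟩ := A.G_smooth P hd.uc
    have : g = A.G P f'' := by
      ext1 t
      exact (hg t).unique (A.G_isD P hd hu t)
    rwa [this] at hn
  have hc : CauchySeq fun i => A.G P (F'' i) := by
    rw [Metric.cauchySeq_iff]
    intro ε hε
    obtain ⟨N, hN⟩ := Metric.cauchySeq_iff.1 hF'.cauchySeq (ε / P.C1) (by positivity)
    refine ⟨N, fun j hj k hk => ?_⟩
    have := hN j hj k hk
    rw [dist_eq_norm] at this ⊢
    rw [← G_sub A P (u2 j) (u2 k)]
    refine (key (F' j - F' k) _ (fun t => ((d2 j) t).sub ((d2 k) t)) ((u2 j).sub (u2 k))).trans_lt ?_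
    rw [lt_div_iff₀ hC] at this
    linarith
  obtain ⟨g, hg⟩ := cauchySeq_tendsto_of_complete hc
  have h1 := A.G_tendsto_of_tendsto P hu1 h.uc hF
  have h2 := A.G_tendsto_of_tendsto P hu' hu hF'
  refine ⟨g, UC.of_tendsto (fun i => A.G_uc P (u2 i)) hg, A.G_isD P h hu,
    IsD.of_tendsto (fun i => A.G_isD P (d2 i) (u2 i)) h2 hg, fun t => ?_⟩
  have ev : ∀ {F : ℕ → Crv C(S, ℝ)} {f : Crv C(S, ℝ)}, Tendsto F atTop (𝓝 f) →
      Tendsto (fun i => F i t) atTop (𝓝 (f t)) := fun h =>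
    (BoundedContinuousFunction.tendsto_iff_tendstoUniformly.1 h).tendsto_at t
  exact A.isClosed_L.mem_of_tendsto ((ev h1).prodMk_nhds
    (((((ev h1).const_smul P.l).sub (ev hg)).add ((ev h2).const_smul P.B)).sub (ev hF)))
    (Eventually.of_forall fun i => (A.G_cl P (d1 i) (d2 i) (u2 i)).eqn t)

/-- Weighted comparison: bounds by `exp (κ t) g` are transported to `exp (κ t) χ`. -/
theorem G_weight {f : Crv C(S, ℝ)} (hf : UC f) {χ Lχ : C(S, ℝ)} (hχ : (χ, Lχ) ∈ A.L)
    (hχ0 : ∀ x, 0 ≤ χ x) {g : C(S, ℝ)} {κ η : ℝ} (hη : 0 < η)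
    (H : ∀ x, g x + η ≤ P.l * χ x - Lχ x - (κ ^ 2 - P.B * κ) * χ x)
    (hfg : ∀ t x, |f t x| ≤ Real.exp (κ * t) * g x) :
    ∀ t x, |A.G P f t x| ≤ Real.exp (κ * t) * χ x := by
  have hB := P.hB
  let e : ℕ → ℝ := fun k => 1 / ((k:ℝ) + 1)
  let s : ℕ → ℝ := fun k => (e k ^ 2)⁻¹ * (Real.exp (κ * e k) - 1) +
    ((e k ^ 2)⁻¹ + P.B / e k) * (Real.exp (-κ * e k) - 1)
  have he : ∀ k, 0 < e k := fun k => by positivity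
  have hs : Tendsto s atTop (𝓝 (κ ^ 2 - P.B * κ)) := by
    have d1 : HasDerivAt (fun t : ℝ => Real.exp (κ / 2 * t) - Real.exp (-(κ / 2) * t)) κ 0 := by
      have a1 := ((hasDerivAt_id (0:ℝ)).const_mul (κ / 2)).exp
      have a2 := ((hasDerivAt_id (0:ℝ)).const_mul (-(κ / 2))).exp
      refine (a1.sub a2).congr_deriv ?_
      simp
    have d2 : HasDerivAt (fun t : ℝ => Real.exp (-κ * t)) (-κ) 0 := by
      have a1 := ((hasDerivAt_id (0:ℝ)).const_mul (-κ)).exp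
      refine a1.congr_deriv ?_
      simp
    have hl : Tendsto e atTop (𝓝[≠] 0) :=
      eps_tendsto.mono_right (nhdsWithin_mono _ fun x (hx : 0 < x) => ne_of_gt hx)
    have l1 := (hasDerivAt_iff_tendsto_slope_zero.1 d1).comp hl
    have l2 := (hasDerivAt_iff_tendsto_slope_zero.1 d2).comp hl
    have l3 := (l1.pow 2).add (l2.const_mul P.B)
    have e0 : κ ^ 2 + P.B * -κ = κ ^ 2 - P.B * κ := by ring
    rw [e0] at l3
    refine l3.congr fun k => ?_
    have h1 : Real.exp (κ * e k) = Real.exp (κ / 2 * e k) ^ 2 := by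
      rw [← Real.exp_nat_mul]; congr 1; push_cast; ring
    have h2 : Real.exp (-κ * e k) = Real.exp (-(κ / 2) * e k) ^ 2 := by
      rw [← Real.exp_nat_mul]; congr 1; push_cast; ring
    have h3 : Real.exp (κ / 2 * e k) * Real.exp (-(κ / 2) * e k) = 1 := by
      rw [← Real.exp_add]; simp
    have h4 := (he k).ne'
    simp only [s, Function.comp, zero_add, mul_zero, Real.exp_zero, sub_self, sub_zero, smul_eq_mul]
    rw [h1, h2]
    generalize Real.exp (κ / 2 * e k) = a at *
    generalize Real.exp (-(κ / 2) * e k) = b at *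
    field_simp
    linear_combination (-2) * h3
  have hev : ∀ᶠ k in atTop, |s k - (κ ^ 2 - P.B * κ)| * ‖χ‖ < η := by
    have := ((hs.sub_const (κ ^ 2 - P.B * κ)).abs).mul_const ‖χ‖
    rw [sub_self, abs_zero, zero_mul] at this
    exact this.eventually_lt_const hη
  have : A.G P f ∈ {u : Crv C(S, ℝ) | ∀ t x, |u t x| ≤ Real.exp (κ * t) * χ x} := by
    refine A.G_mem_of_invariant P hf ?_ (fun t x => ?_) (hev.mono fun k hk u hu t => ?_)
    · simp only [Set.setOf_forall]
      refine isClosed_iInter fun t => isClosed_iInter fun x => isClosed_le ?_ continuous_const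
      exact ((continuous_eval_const x).comp
        (BoundedContinuousFunction.lipschitz_eval_const t).continuous).abs
    · have := hχ0 x
      simp; positivity
    · have b1 : ∀ x, |(f + Pk P k u) t x| ≤
          (Real.exp (κ * t) • ((P.l + P.N k) • χ - Lχ)) x := by
        intro x
        have h0 : (f + Pk P k u) t x = f t x + ((e k ^ 2)⁻¹ * u (t + e k) x +
            ((e k ^ 2)⁻¹ + P.B / e k) * u (t + -(e k)) x) := rfl
        have hN : P.N k = (e k ^ 2)⁻¹ + ((e k ^ 2)⁻¹ + P.B / e k) := rfl
        have hek := he k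
        have hE := Real.exp_pos (κ * t)
        have h1 := hu (t + e k) x
        have h2 := hu (t + -(e k)) x
        have h3 := hfg t x
        have h4 := H x
        have h5 : (s k - (κ ^ 2 - P.B * κ)) * χ x ≤ η := by
          refine le_trans ?_ hk.le
          refine mul_le_mul (le_abs_self _) ((le_abs_self _).trans (χ.norm_coe_le_norm x)) (hχ0 x)
            (abs_nonneg _)
        have e1 : Real.exp (κ * (t + e k)) = Real.exp (κ * t) * Real.exp (κ * e k) := by
          rw [← Real.exp_add]; ring_nf
        have e2 : Real.exp (κ * (t + -(e k))) = Real.exp (κ * t) * Real.exp (-κ * e k) := by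
          rw [← Real.exp_add]; ring_nf
        rw [e1] at h1
        rw [e2] at h2
        rw [h0]
        have c1 : 0 ≤ (e k ^ 2)⁻¹ := by positivity
        have c2 : 0 ≤ (e k ^ 2)⁻¹ + P.B / e k := by positivity
        have h6 : |f t x + ((e k ^ 2)⁻¹ * u (t + e k) x +
            ((e k ^ 2)⁻¹ + P.B / e k) * u (t + -(e k)) x)| ≤
            |f t x| + ((e k ^ 2)⁻¹ * |u (t + e k) x| +
            ((e k ^ 2)⁻¹ + P.B / e k) * |u (t + -(e k)) x|) := by
          refine (abs_add_le _ _).trans (add_le_add le_rfl ((abs_add_le _ _).trans ?_))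
          rw [abs_mul, abs_mul, abs_of_nonneg c1, abs_of_nonneg c2]
        refine h6.trans ?_
        have h7 := mul_le_mul_of_nonneg_left h1 c1
        have h8 := mul_le_mul_of_nonneg_left h2 c2
        simp only [ContinuousMap.smul_apply, ContinuousMap.sub_apply, smul_eq_mul]
        have h9 : g x + (P.N k + s k) * χ x ≤ (P.l + P.N k) * χ x - Lχ x := by linarith
        have h10 := mul_le_mul_of_nonneg_left h9 hE.le
        refine le_trans ?_ h10
        have : Real.exp (κ * t) * (g x + (P.N k + s k) * χ x) = Real.exp (κ * t) * g x +
            ((e k ^ 2)⁻¹ * (Real.exp (κ * t) * Real.exp (κ * e k) * χ x) +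
            ((e k ^ 2)⁻¹ + P.B / e k) * (Real.exp (κ * t) * Real.exp (-κ * e k) * χ x)) := by
          rw [hN]; simp only [s]; ring
        rw [this]
        linarith
      have b2 : A.J (P.l + P.N k) (lN_pos P k) (Real.exp (κ * t) • ((P.l + P.N k) • χ - Lχ)) =
          Real.exp (κ * t) • χ := by
        rw [map_smul]; congr 1
        exact (A.J_eq (lN_pos P k) (by simpa using hχ)).symm
      intro x
      rw [Jb_apply, abs_le]
      constructor
      · have := A.J_mono (lN_pos P k) (h := -(Real.exp (κ * t) • ((P.l + P.N k) • χ - Lχ)))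
          (h' := (f + Pk P k u) t) (fun x => (abs_le.1 (b1 x)).1) x
        rw [map_neg, b2] at this
        exact this
      · have := A.J_mono (lN_pos P k) (h := (f + Pk P k u) t) (h' := (Real.exp (κ * t) • ((P.l + P.N k) • χ - Lχ)))
          (fun x => (abs_le.1 (b1 x)).2) x
        rw [b2] at this
        exact this
  exact this

end Gen
end ConeHet

namespace ConeHet
open scoped Topology BoundedContinuousFunction

section quotient
variable {X : Type*} [NormedAddCommGroup X] [NormedSpace ℝ X]

theorem second_quotient_bound {q q' q'' : ℝ → X} (h1 : ∀ t, HasDerivAt q (q' t) t)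
    (h2 : ∀ t, HasDerivAt q' (q'' t) t) {t δ ε : ℝ} (hδ : 0 < δ)
    (H : ∀ s ∈ Set.Icc t (t + 2 * δ), ‖q'' s - q'' t‖ ≤ ε) :
    ‖(δ ^ 2)⁻¹ • (q (t + δ + δ) - q (t + δ) - (q (t + δ) - q t)) - q'' t‖ ≤ ε := by
  have b1 : ∀ s ∈ Set.Icc t (t + δ), ‖q' (s + δ) - q' s - δ • q'' t‖ ≤ ε * δ := by
    intro s hs
    have := (convex_Icc t (t + 2 * δ)).norm_image_sub_le_of_norm_hasDerivWithin_le
      (f := fun r => q' r - r • q'' t) (f' := fun r => q'' r - q'' t) (C := ε) (x := s) (y := s + δ)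
      (fun r hr => by
        have := ((h2 r).sub ((hasDerivAt_id r).smul_const (q'' t))).hasDerivWithinAt (s := Set.Icc t (t + 2 * δ))
        refine this.congr_deriv ?_
        simp)
      H ⟨hs.1, by linarith [hs.2]⟩ ⟨by linarith [hs.1], by linarith [hs.2]⟩
    rw [add_sub_cancel_left, Real.norm_of_nonneg hδ.le] at this
    convert this using 2
    rw [add_smul]; abel
  have b2 := (convex_Icc t (t + δ)).norm_image_sub_le_of_norm_hasDerivWithin_le
      (f := fun r => q (r + δ) - q r - r • (δ • q'' t)) (f' := fun r => q' (r + δ) - q' r - δ • q'' t)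
      (C := ε * δ) (x := t) (y := t + δ)
      (fun r hr => by
        have := ((((h1 (r + δ)).comp_add_const r δ).sub (h1 r)).sub
          ((hasDerivAt_id r).smul_const (δ • q'' t))).hasDerivWithinAt (s := Set.Icc t (t + δ))
        refine this.congr_deriv ?_
        simp)
      b1 ⟨le_rfl, by linarith⟩ ⟨by linarith, le_rfl⟩
  rw [add_sub_cancel_left, Real.norm_of_nonneg hδ.le] at b2
  have e1 : (δ ^ 2)⁻¹ • (q (t + δ + δ) - q (t + δ) - (q (t + δ) - q t)) - q'' t =
      (δ ^ 2)⁻¹ • ((q (t + δ + δ) - q (t + δ) - (t + δ) • (δ • q'' t)) -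
        (q (t + δ) - q t - t • (δ • q'' t))) := by
    have : q'' t = (δ ^ 2)⁻¹ • (δ • (δ • q'' t)) := by
      rw [smul_smul, smul_smul, show (δ ^ 2)⁻¹ * δ * δ = 1 by field_simp, one_smul]
    nth_rewrite 1 [this]
    rw [← smul_sub]; congr 1
    rw [add_smul]; abel
  rw [e1, norm_smul, Real.norm_of_nonneg (by positivity), inv_mul_le_iff₀ (by positivity)]
  linarith [b2]

theorem second_quotient_tendsto {q q' q'' : ℝ → X} (h1 : ∀ t, HasDerivAt q (q' t) t)
    (h2 : ∀ t, HasDerivAt q' (q'' t) t) (hc : Continuous q'') (t₀ : ℝ) {ε : ℝ} (hε : 0 < ε) :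
    ∃ δ₀ > 0, ∀ δ ∈ Set.Ioo 0 δ₀, ∀ t, |t - t₀| ≤ 2 →
      ‖(δ ^ 2)⁻¹ • (q (t + δ + δ) - q (t + δ) - (q (t + δ) - q t)) - q'' t‖ ≤ ε := by
  have huc := isCompact_Icc.uniformContinuousOn_of_continuous
    (hc.continuousOn (s := Set.Icc (t₀ - 3) (t₀ + 3)))
  obtain ⟨δ₁, h0, H⟩ := Metric.uniformContinuousOn_iff.1 huc ε hε
  refine ⟨min (δ₁ / 2) (1 / 2), by positivity, fun δ hδ t ht => ?_⟩
  have ha := abs_le.1 ht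
  have hd1 := lt_of_lt_of_le hδ.2 (min_le_left _ _)
  have hd2 := lt_of_lt_of_le hδ.2 (min_le_right _ _)
  refine second_quotient_bound h1 h2 hδ.1 fun s hs => ?_
  rw [← dist_eq_norm]
  refine (H s ⟨by linarith [hs.1], by linarith [hs.2]⟩ t ⟨by linarith, by linarith⟩ ?_).le
  rw [Real.dist_eq, abs_lt]; constructor <;> linarith [hs.1, hs.2]

theorem mem_of_hasDerivAt {L : Submodule ℝ X} (hL : IsClosed (L : Set X)) {q : ℝ → X} {c : X} {t : ℝ}
    (h : HasDerivAt q c t) (hq : ∀ t, q t ∈ L) : c ∈ L := by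
  refine hL.mem_of_tendsto (hasDerivAt_iff_tendsto_slope_zero.1 h) (Eventually.of_forall fun s => ?_)
  exact L.smul_mem _ (L.sub_mem (hq _) (hq _))

end quotient

namespace Gen
variable {S : Type} [MetricSpace S] [CompactSpace S] [Nonempty S] [MeasurableSpace S]
  [BorelSpace S] {μ : Measure S} [IsProbabilityMeasure μ] {A : Gen S μ} {P : Par}

theorem Cl.deriv_smooth {h h' h'' f f' f'' : ℝ → C(S, ℝ)} (H : A.Cl P h h' h'' f) (hc : Continuous h'')
    (hf : ∀ t, HasDerivAt f (f' t) t) (hf' : ∀ t, HasDerivAt f' (f'' t) t) (hfc : Continuous f'') :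
    ∃ h''' : ℝ → C(S, ℝ), Continuous h''' ∧ A.Cl P h' h'' h''' f' := by
  have hC := P.C_pos
  let w : ℕ → (ℝ → C(S, ℝ)) → ℝ → C(S, ℝ) := fun n q t => ((1 / ((n:ℝ) + 1)) ^ 2)⁻¹ •
    (q (t + 1 / ((n:ℝ) + 1) + 1 / ((n:ℝ) + 1)) - q (t + 1 / ((n:ℝ) + 1)) -
      (q (t + 1 / ((n:ℝ) + 1)) - q t))
  have hw : ∀ n, A.Cl P (w n h) (w n h') (w n h'') (w n f) := fun n =>
    ((((H.shift (1 / ((n:ℝ) + 1))).shift (1 / ((n:ℝ) + 1))).sub (H.shift (1 / ((n:ℝ) + 1)))).sub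
      ((H.shift (1 / ((n:ℝ) + 1))).sub H)).smul _
  have hwc : ∀ {q q' q'' : ℝ → C(S, ℝ)}, (∀ t, HasDerivAt q (q' t) t) →
      (∀ t, HasDerivAt q' (q'' t) t) → Continuous q'' → ∀ t₀ : ℝ, ∀ ε > (0:ℝ), ∃ N, ∀ n ≥ N,
      ∀ t, |t - t₀| ≤ 2 → ‖w n q t - q'' t‖ ≤ ε := by
    intro q q' q'' h1 h2 h3 t₀ ε hε
    obtain ⟨δ₀, h0, h4⟩ := second_quotient_tendsto h1 h2 h3 t₀ hε
    have := eps_tendsto.eventually (Ioo_mem_nhdsGT h0)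
    obtain ⟨N, hN⟩ := eventually_atTop.1 this
    exact ⟨N, fun n hn t ht => h4 _ (hN n hn) t ht⟩
  have hcau : ∀ t₀ : ℝ, ∀ ε > (0:ℝ), ∃ N, ∀ m ≥ N, ∀ n ≥ N, ∀ t, |t - t₀| ≤ 1 →
      ‖w m h' t - w n h' t‖ ≤ ε := by
    intro t₀ ε hε
    obtain ⟨N1, h1⟩ := hwc H.d1 H.d2 hc t₀ (ε / (4 * P.C)) (by positivity)
    obtain ⟨N2, h2⟩ := hwc hf hf' hfc t₀ (ε / (4 * P.C)) (by positivity)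
    have two : ∀ a b c : C(S, ℝ), ‖a - c‖ ≤ ε / (4 * P.C) → ‖b - c‖ ≤ ε / (4 * P.C) →
        ‖a - b‖ ≤ ε / (2 * P.C) := by
      intro a b c ha hb
      have : a - b = (a - c) - (b - c) := by abel
      rw [this]
      refine (norm_sub_le _ _).trans ((add_le_add ha hb).trans (le_of_eq ?_))
      field_simp; norm_num
    refine ⟨Max.max N1 N2, fun m hm n hn t ht => ?_⟩
    have hb : ∀ s, |s - t| ≤ 1 → |s - t₀| ≤ 2 := fun s hs => by
      have := abs_sub_le s t t₀; linarith
    refine (((hw m).sub (hw n)).gradient (t₀ := t) (M := ε / (2 * P.C)) (M' := ε / (2 * P.C))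
      (fun s hs => two _ _ _ (h1 m (le_trans (le_max_left _ _) hm) s (hb s hs))
        (h1 n (le_trans (le_max_left _ _) hn) s (hb s hs)))
      (fun s hs => two _ _ _ (h2 m (le_trans (le_max_right _ _) hm) s (hb s hs))
        (h2 n (le_trans (le_max_right _ _) hn) s (hb s hs)))).trans (le_of_eq ?_)
    field_simp; norm_num
  have hcs : ∀ t, CauchySeq fun n => w n h' t := by
    intro t
    rw [Metric.cauchySeq_iff]
    intro ε hε
    obtain ⟨N, hN⟩ := hcau t (ε / 2) (by positivity)
    refine ⟨N, fun m hm n hn => ?_⟩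
    rw [dist_eq_norm]
    exact (hN m hm n hn t (by simp)).trans_lt (by linarith)
  let k : ℝ → C(S, ℝ) := fun t => limUnder atTop fun n => w n h' t
  have hk : ∀ t, Tendsto (fun n => w n h' t) atTop (𝓝 (k t)) := fun t => (hcs t).tendsto_limUnder
  have hlu : TendstoLocallyUniformlyOn (fun n => w n h') k atTop Set.univ := by
    rw [Metric.tendstoLocallyUniformlyOn_iff]
    intro ε hε t₀ _
    refine ⟨Metric.closedBall t₀ 1, mem_nhdsWithin_of_mem_nhds (Metric.closedBall_mem_nhds _ one_pos), ?_⟩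
    obtain ⟨N, hN⟩ := hcau t₀ (ε / 2) (by positivity)
    filter_upwards [eventually_ge_atTop N] with n hn t ht
    rw [dist_eq_norm]
    refine (le_of_tendsto ((hk t).sub_const (w n h' t)).norm ?_).trans_lt (half_lt_self hε)
    filter_upwards [eventually_ge_atTop N] with m hm
    exact hN m hm n hn t (by simpa [Real.dist_eq] using ht)
  have hkc : Continuous k := by
    rw [← continuousOn_univ]
    refine hlu.continuousOn (Frequently.of_forall fun n => ?_)
    have : Continuous h' := continuous_iff_continuousAt.2 fun t => (H.d2 t).continuousAt
    simp only [w]; fun_prop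
  have hd : ∀ t, HasDerivAt h'' (k t) t := fun t =>
    hasDerivAt_of_tendstoLocallyUniformlyOn isOpen_univ hlu
      (Eventually.of_forall fun n t _ => (hw n).d1 t)
      (fun t _ => by
        rw [Metric.tendsto_atTop]
        intro ε hε
        obtain ⟨N, hN⟩ := hwc H.d1 H.d2 hc t (ε / 2) (by positivity)
        exact ⟨N, fun n hn => by
          rw [dist_eq_norm]; exact (hN n hn t (by simp)).trans_lt (half_lt_self hε)⟩)
      (Set.mem_univ t)
  refine ⟨k, hkc, H.d2, hd, fun t => ?_⟩
  exact mem_of_hasDerivAt A.isClosed_L ((H.d1 t).prodMk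
    (((((H.d1 t).const_smul P.l).sub (hd t)).add ((H.d2 t).const_smul P.B)).sub (hf t))) H.eqn

end Gen
end ConeHet

namespace ConeHet
open scoped Topology BoundedContinuousFunction

theorem rpow_sub_le {p M a b : ℝ} (hp : 1 ≤ p) (ha : a ∈ Set.Icc 0 M) (hb : b ∈ Set.Icc 0 M) :
    |a ^ p - b ^ p| ≤ p * M ^ (p - 1) * |a - b| := by
  have := (convex_Icc 0 M).norm_image_sub_le_of_norm_hasDerivWithin_le
    (f := fun x : ℝ => x ^ p) (f' := fun x => p * x ^ (p - 1)) (C := p * M ^ (p - 1))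
    (fun x _ => (Real.hasDerivAt_rpow_const (Or.inr hp)).hasDerivWithinAt)
    (fun x hx => by
      have : 0 ≤ x ^ (p - 1) := Real.rpow_nonneg hx.1 _
      rw [Real.norm_of_nonneg (by positivity)]
      exact mul_le_mul_of_nonneg_left (Real.rpow_le_rpow hx.1 hx.2 (by linarith)) (by linarith))
    hb ha
  simpa [Real.norm_eq_abs] using this

section rp
variable {S : Type} [TopologicalSpace S]

open Classical in
/-- The pointwise power of a continuous function (zero where this is not continuous a priori). -/
noncomputable def rp (p : ℝ) (f : C(S, ℝ)) : C(S, ℝ) :=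
  if h : 0 ≤ p ∨ ∀ x, 0 < f x then
    ⟨fun x => f x ^ p, by
      rcases h with h | h
      · exact (Real.continuous_rpow_const h).comp f.continuous
      · exact f.continuous.rpow_const fun x => Or.inl (h x).ne'⟩ else 0

theorem rp_apply {p : ℝ} (hp : 0 ≤ p) (f : C(S, ℝ)) (x : S) : rp p f x = f x ^ p := by
  rw [rp, dif_pos (Or.inl hp)]; rfl

theorem rp_apply' (p : ℝ) {f : C(S, ℝ)} (hf : ∀ x, 0 < f x) (x : S) : rp p f x = f x ^ p := by
  rw [rp, dif_pos (Or.inr hf)]; rfl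
end rp

namespace Gen
variable {S : Type} [MetricSpace S] [CompactSpace S] [Nonempty S] [MeasurableSpace S]
  [BorelSpace S] {μ : Measure S} [IsProbabilityMeasure μ] (A : Gen S μ)

theorem exists_fixed_ball {X : Type*} [NormedAddCommGroup X] [CompleteSpace X] (T : X → X) {r : ℝ}
    (hr : 0 ≤ r) (h1 : ∀ u, ‖u‖ ≤ r → ‖T u‖ ≤ r)
    (h2 : ∀ u v, ‖u‖ ≤ r → ‖v‖ ≤ r → ‖T u - T v‖ ≤ 1 / 2 * ‖u - v‖) :
    ∃ u, ‖u‖ ≤ r ∧ T u = u := by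
  have hm : Set.MapsTo T (Metric.closedBall (0:X) r) (Metric.closedBall 0 r) := fun u hu => by
    simpa using h1 u (by simpa using hu)
  have hc : ContractingWith (1 / 2 : NNReal) (hm.restrict T _ _) := by
    refine ⟨by rw [← NNReal.coe_lt_coe]; norm_num, LipschitzWith.of_dist_le_mul fun u v => ?_⟩
    have := h2 u v (mem_closedBall_zero_iff.1 u.2) (mem_closedBall_zero_iff.1 v.2)
    rw [Subtype.dist_eq, Subtype.dist_eq, dist_eq_norm, dist_eq_norm]
    simpa using this
  obtain ⟨u, hu, hf, _⟩ := hc.exists_fixedPoint' Metric.isClosed_closedBall.isComplete hm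
    (x := 0) (by simpa using hr) (edist_ne_top _ _)
  exact ⟨u, by simpa using hu, hf⟩

theorem abs_integral_le (f : C(S, ℝ)) : |∫ x, f x ∂μ| ≤ ‖f‖ := by
  have := norm_integral_le_of_norm_le_const (μ := μ) (f := fun x => f x)
    (Eventually.of_forall fun x => f.norm_coe_le_norm x)
  simpa using this

theorem integral_mono' {f g : C(S, ℝ)} (h : ∀ x, f x ≤ g x) : ∫ x, f x ∂μ ≤ ∫ x, g x ∂μ :=
  integral_mono (integrable f) (integrable g) h

theorem exists_V {K : C(S, ℝ)} (hK0 : ∀ x, 0 ≤ K x) (hK1 : ∀ x, K x ≤ 1) {k₀ : ℝ} (hk : 0 < k₀)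
    (hK : k₀ ≤ ∫ x, K x ∂μ) {p P ν : ℝ} (hp : 1 < p) (hpP : p ≤ P) (hν : 0 < ν)
    (hs : ν * ‖A.R‖ * (2 + 2 * P * 9 ^ P / k₀ ^ 2) ≤ 1 / 2) (hk1 : k₀ ≤ 1) :
    ∃ V : C(S, ℝ), (∀ x, 0 < V x) ∧ (V, ν • V - K * rp p V) ∈ A.L ∧
      ∀ x, p * K x * V x ^ (p - 1) ≤ P * 3 ^ P / k₀ * ν := by
  have hp0 : 0 ≤ p := by linarith
  have hP : 1 < P := by linarith
  let N : C(S, ℝ) → C(S, ℝ) := fun h => K * rp p (1 + h)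
  let D : C(S, ℝ) → ℝ := fun h => ∫ x, N h x ∂μ
  have hN : ∀ h x, N h x = K x * (1 + h x) ^ p := fun h x => by
    simp [N, rp_apply hp0]
  have hb : ∀ h : C(S, ℝ), ‖h‖ ≤ 1 / 2 → ∀ x, 1 / 2 ≤ 1 + h x ∧ 1 + h x ≤ 3 / 2 := by
    intro h hh x
    have := abs_le.1 ((h.norm_coe_le_norm x).trans hh)
    constructor <;> linarith [this.1, this.2]
  have hup : ∀ a : ℝ, 0 ≤ a → a ≤ 3 / 2 → a ^ p ≤ (3 / 2) ^ P := fun a h0 h1 =>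
    (Real.rpow_le_rpow h0 h1 hp0).trans (Real.rpow_le_rpow_of_exponent_le (by norm_num) hpP)
  have hup' : ∀ a : ℝ, 0 ≤ a → a ≤ 3 / 2 → a ^ (p - 1) ≤ (3 / 2) ^ P := fun a h0 h1 =>
    (Real.rpow_le_rpow h0 h1 (by linarith)).trans
      (Real.rpow_le_rpow_of_exponent_le (by norm_num) (by linarith))
  set b : ℝ := (3 / 2) ^ P with hbdef
  have hb0 : 0 < b := by positivity
  have hN1 : ∀ h : C(S, ℝ), ‖h‖ ≤ 1 / 2 → ‖N h‖ ≤ b := by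
    intro h hh
    rw [ContinuousMap.norm_le _ hb0.le]
    intro x
    have := hb h hh x
    have h3 : 0 ≤ (1 + h x) ^ p := Real.rpow_nonneg (by linarith) _
    rw [hN, Real.norm_of_nonneg (mul_nonneg (hK0 x) h3)]
    calc K x * (1 + h x) ^ p ≤ 1 * (1 + h x) ^ p := mul_le_mul_of_nonneg_right (hK1 x) h3
      _ ≤ b := by rw [one_mul]; exact hup _ (by linarith) this.2
  set e : ℝ := k₀ * (1 / 2) ^ P with he
  have he0 : 0 < e := by positivity
  have hD : ∀ h : C(S, ℝ), ‖h‖ ≤ 1 / 2 → e ≤ D h := by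
    intro h hh
    have h1 : ∫ x, (((1 / 2 : ℝ) ^ P) • K) x ∂μ ≤ D h := by
      refine integral_mono' fun x => ?_
      rw [hN]
      have := hb h hh x
      have h4 : (1 / 2 : ℝ) ^ P ≤ (1 + h x) ^ p :=
        (Real.rpow_le_rpow_of_exponent_ge (by norm_num) (by norm_num) hpP).trans
          (Real.rpow_le_rpow (by norm_num) this.1 hp0)
      simp only [ContinuousMap.smul_apply, smul_eq_mul]
      rw [mul_comm]
      exact mul_le_mul_of_nonneg_left h4 (hK0 x)
    have h2 : ∫ x, (((1 / 2 : ℝ) ^ P) • K) x ∂μ = (1 / 2 : ℝ) ^ P * ∫ x, K x ∂μ := by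
      simp only [ContinuousMap.smul_apply, smul_eq_mul]
      exact integral_const_mul _ _
    rw [h2] at h1
    refine le_trans ?_ h1
    rw [he, mul_comm]
    gcongr
  have hNl : ∀ h h' : C(S, ℝ), ‖h‖ ≤ 1 / 2 → ‖h'‖ ≤ 1 / 2 → ‖N h - N h'‖ ≤ P * b * ‖h - h'‖ := by
    intro h h' hh hh'
    rw [ContinuousMap.norm_le _ (by positivity)]
    intro x
    have h1 := hb h hh x
    have h2 := hb h' hh' x
    have h3 := rpow_sub_le (M := 3 / 2) hp.le (a := 1 + h x) (b := 1 + h' x) ⟨by linarith, h1.2⟩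
      ⟨by linarith, h2.2⟩
    have h4 : |h x - h' x| ≤ ‖h - h'‖ := (h - h').norm_coe_le_norm x
    rw [add_sub_add_left_eq_sub] at h3
    have h5 : ‖(N h - N h') x‖ = K x * |(1 + h x) ^ p - (1 + h' x) ^ p| := by
      rw [ContinuousMap.sub_apply, hN, hN, ← mul_sub, norm_mul, Real.norm_of_nonneg (hK0 x),
        Real.norm_eq_abs]
    rw [h5]
    calc K x * |(1 + h x) ^ p - (1 + h' x) ^ p| ≤ 1 * |(1 + h x) ^ p - (1 + h' x) ^ p| :=
          mul_le_mul_of_nonneg_right (hK1 x) (abs_nonneg _)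
      _ ≤ p * (3 / 2) ^ (p - 1) * |h x - h' x| := by rw [one_mul]; exact h3
      _ ≤ P * b * ‖h - h'‖ := by
        have := hup' (3 / 2) (by norm_num) le_rfl
        gcongr
  have hbe : b / e ≤ P * 9 ^ P / k₀ ^ 2 ∧ P * b / e + P * b * b / (e * e) ≤ 2 * P * 9 ^ P / k₀ ^ 2 ∧
      b / e = 3 ^ P / k₀ := by
    have h2 : b / e = 3 ^ P / k₀ := by
      rw [hbdef, he, Real.div_rpow (by norm_num) (by norm_num), Real.div_rpow (by norm_num) (by norm_num),
        Real.one_rpow]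
      field_simp
    have h3 : (9:ℝ) ^ P = 3 ^ P * 3 ^ P := by
      rw [← Real.mul_rpow (by norm_num) (by norm_num)]; norm_num
    have h4 : (1:ℝ) ≤ 3 ^ P := Real.one_le_rpow (by norm_num) (by linarith)
    have h5 : b / e ≤ (b / e) * (b / e) := by
      have : 1 ≤ b / e := by
        rw [h2, le_div_iff₀ hk]; linarith
      nlinarith
    have h6 : (b / e) * (b / e) = 9 ^ P / k₀ ^ 2 := by rw [h2, h3]; field_simp
    rw [h6] at h5
    have h7 : 0 < (9:ℝ) ^ P / k₀ ^ 2 := by positivity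
    have e1 : P * 9 ^ P / k₀ ^ 2 = P * (9 ^ P / k₀ ^ 2) := by ring
    have e2 : 2 * P * 9 ^ P / k₀ ^ 2 = 2 * P * (9 ^ P / k₀ ^ 2) := by ring
    have e3 : P * b / e + P * b * b / (e * e) = P * (b / e) + P * ((b / e) * (b / e)) := by
      field_simp
    rw [e1, e2, e3, h6]
    exact ⟨by nlinarith, by nlinarith, h2⟩
  let T : C(S, ℝ) → C(S, ℝ) := fun h => ν • A.R (h - (D h)⁻¹ • N h)
  have hR : 0 ≤ ‖A.R‖ := A.R.opNorm_nonneg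
  obtain ⟨h, hh, hfix⟩ := exists_fixed_ball T (r := 1 / 2) (by norm_num) (fun h hh => by
      have hd := hD h hh
      simp only [T]
      rw [norm_smul, Real.norm_of_nonneg hν.le]
      have h1 : ‖h - (D h)⁻¹ • N h‖ ≤ 1 / 2 + b / e := by
        refine (norm_sub_le _ _).trans (add_le_add hh ?_)
        rw [norm_smul, Real.norm_of_nonneg (inv_nonneg.2 (he0.le.trans hd)), inv_mul_eq_div]
        exact div_le_div₀ hb0.le (hN1 h hh) he0 hd
      have h2 := (A.R.le_opNorm (h - (D h)⁻¹ • N h)).trans (mul_le_mul_of_nonneg_left h1 hR)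
      have h3 : ‖A.R‖ * (1 / 2 + b / e) ≤ ‖A.R‖ * (2 + 2 * P * 9 ^ P / k₀ ^ 2) := by
        have : P * 9 ^ P / k₀ ^ 2 ≤ 2 * P * 9 ^ P / k₀ ^ 2 := by
          have : 0 < P * 9 ^ P / k₀ ^ 2 := by positivity
          have e2 : 2 * P * 9 ^ P / k₀ ^ 2 = 2 * (P * 9 ^ P / k₀ ^ 2) := by ring
          linarith
        exact mul_le_mul_of_nonneg_left (by linarith [hbe.1]) hR
      calc ν * ‖A.R (h - (D h)⁻¹ • N h)‖ ≤ ν * (‖A.R‖ * (2 + 2 * P * 9 ^ P / k₀ ^ 2)) :=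
            mul_le_mul_of_nonneg_left (h2.trans h3) hν.le
        _ ≤ 1 / 2 := by rw [← mul_assoc]; exact hs)
    (fun h h' hh hh' => by
      have hd := hD h hh
      have hd' := hD h' hh'
      have hd0 : 0 < D h := he0.trans_le hd
      have hd0' : 0 < D h' := he0.trans_le hd'
      have hDD : |D h' - D h| ≤ P * b * ‖h - h'‖ := by
        have h1 : D h' - D h = ∫ x, (N h' - N h) x ∂μ := by
          rw [← integral_sub (integrable _) (integrable _)]; rfl
        rw [h1]
        refine (abs_integral_le _).trans ?_
        rw [norm_sub_rev]; exact hNl h h' hh hh'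
      have h1 : ‖(h - (D h)⁻¹ • N h) - (h' - (D h')⁻¹ • N h')‖ ≤
          (1 + 2 * P * 9 ^ P / k₀ ^ 2) * ‖h - h'‖ := by
        have e1 : (h - (D h)⁻¹ • N h) - (h' - (D h')⁻¹ • N h') =
            (h - h') - ((D h)⁻¹ • (N h - N h') + ((D h)⁻¹ - (D h')⁻¹) • N h') := by
          rw [smul_sub, sub_smul]; abel
        have b1 : ‖(D h)⁻¹ • (N h - N h')‖ ≤ P * b / e * ‖h - h'‖ := by
          rw [norm_smul, Real.norm_of_nonneg (by positivity), inv_mul_eq_div, div_mul_eq_mul_div]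
          exact div_le_div₀ (by positivity) (hNl h h' hh hh') he0 hd
        have b2 : ‖((D h)⁻¹ - (D h')⁻¹) • N h'‖ ≤ P * b * b / (e * e) * ‖h - h'‖ := by
          rw [norm_smul, Real.norm_eq_abs, inv_sub_inv hd0.ne' hd0'.ne', abs_div,
            abs_of_pos (mul_pos hd0 hd0'), div_mul_eq_mul_div, div_mul_eq_mul_div]
          refine div_le_div₀ (by positivity) ?_ (by positivity) (by gcongr)
          calc |D h' - D h| * ‖N h'‖ ≤ (P * b * ‖h - h'‖) * b := by
                gcongr; exact hN1 h' hh'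
            _ = P * b * b * ‖h - h'‖ := by ring
        rw [e1]
        refine (norm_sub_le _ _).trans ?_
        have := norm_add_le ((D h)⁻¹ • (N h - N h')) (((D h)⁻¹ - (D h')⁻¹) • N h')
        have h5 := mul_le_mul_of_nonneg_right hbe.2.1 (norm_nonneg (h - h'))
        rw [add_mul] at h5
        rw [add_mul, one_mul]
        linarith
      have e2 : T h - T h' = ν • A.R ((h - (D h)⁻¹ • N h) - (h' - (D h')⁻¹ • N h')) := by
        simp only [T]; rw [← smul_sub, ← map_sub]
      rw [e2, norm_smul, Real.norm_of_nonneg hν.le]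
      have h2 := (A.R.le_opNorm _).trans (mul_le_mul_of_nonneg_left h1 hR)
      have h0 : 0 < 2 * P * 9 ^ P / k₀ ^ 2 := by positivity
      calc ν * ‖A.R ((h - (D h)⁻¹ • N h) - (h' - (D h')⁻¹ • N h'))‖
          ≤ ν * (‖A.R‖ * ((1 + 2 * P * 9 ^ P / k₀ ^ 2) * ‖h - h'‖)) :=
            mul_le_mul_of_nonneg_left h2 hν.le
        _ ≤ ν * (‖A.R‖ * ((2 + 2 * P * 9 ^ P / k₀ ^ 2) * ‖h - h'‖)) := by gcongr; norm_num
        _ = (ν * ‖A.R‖ * (2 + 2 * P * 9 ^ P / k₀ ^ 2)) * ‖h - h'‖ := by ring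
        _ ≤ 1 / 2 * ‖h - h'‖ := by gcongr)
  have hd := hD h hh
  have hd0 : 0 < D h := he0.trans_le hd
  have hL1 : (1 + h, ν • (1 + h) - (ν / D h) • N h) ∈ A.L := by
    have h1 := A.L.smul_mem ν (A.R_spec (h - (D h)⁻¹ • N h))
    have h2 := A.L.add_mem A.one h1
    have hm : ∫ x, h x ∂μ = 0 := by
      have e1 : (fun x => h x) = fun x => ν * A.R (h - (D h)⁻¹ • N h) x := by
        ext x
        conv_lhs => rw [← hfix]
        rfl
      rw [e1, integral_const_mul, A.R_mean, mul_zero]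
    have hm2 : ∫ x, (h - (D h)⁻¹ • N h) x ∂μ = -1 := by
      have e1 : ∀ x, (h - (D h)⁻¹ • N h) x = h x - (D h)⁻¹ * N h x := fun x => rfl
      simp only [e1]
      rw [integral_sub (integrable h) ((integrable (N h)).const_mul _), hm, integral_const_mul]
      change 0 - (D h)⁻¹ * D h = -1
      rw [inv_mul_cancel₀ hd0.ne']; ring
    rw [hm2] at h2
    convert h2 using 1
    ext1
    · change 1 + h = 1 + T h
      rw [hfix]
    · ext x
      simp
      ring
  set c : ℝ := ν / D h with hc
  have hc0 : 0 < c := by positivity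
  set a : ℝ := c ^ (1 / (p - 1)) with ha
  have ha0 : 0 < a := by positivity
  have hap : a ^ (p - 1) = c := by
    rw [ha, ← Real.rpow_mul hc0.le, one_div_mul_cancel (by linarith), Real.rpow_one]
  refine ⟨a • (1 + h), fun x => ?_, ?_, fun x => ?_⟩
  · have := hb h hh x
    simp only [ContinuousMap.smul_apply, ContinuousMap.add_apply, ContinuousMap.one_apply, smul_eq_mul]
    exact mul_pos ha0 (by linarith)
  · convert A.L.smul_mem a hL1 using 1
    ext1
    · rfl
    · ext x
      have h1 := hb h hh x
      simp only [Prod.smul_mk, ContinuousMap.sub_apply, ContinuousMap.smul_apply, ContinuousMap.mul_apply,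
        rp_apply hp0, ContinuousMap.add_apply, ContinuousMap.one_apply, smul_eq_mul, hN]
      rw [Real.mul_rpow ha0.le (by linarith)]
      have : a ^ p = a * c := by
        rw [← hap, ← Real.rpow_one_add' ha0.le (by linarith)]; congr 1; ring
      rw [this]; ring
  · have h1 := hb h hh x
    simp only [ContinuousMap.smul_apply, ContinuousMap.add_apply, ContinuousMap.one_apply, smul_eq_mul]
    rw [Real.mul_rpow ha0.le (by linarith), hap]
    have h2 := hup' (1 + h x) (by linarith) h1.2
    have h3 : c ≤ ν / e := div_le_div_of_nonneg_left hν.le he0 hd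
    have h4 : 0 ≤ (1 + h x) ^ (p - 1) := Real.rpow_nonneg (by linarith) _
    calc p * K x * (c * (1 + h x) ^ (p - 1)) ≤ P * 1 * (ν / e * b) := by
          have := hK1 x; have := hK0 x
          gcongr
      _ = P * (b / e) * ν := by ring
      _ = P * 3 ^ P / k₀ * ν := by rw [hbe.2.2]; ring

theorem exists_chi {Q : C(S, ℝ)} (hQ : 8 * ‖A.R‖ * ‖Q‖ ≤ 1) :
    ∃ (χ : C(S, ℝ)) (m : ℝ), (∀ x, 1 / 2 ≤ χ x ∧ χ x ≤ 3 / 2) ∧ (χ, m • χ - Q * χ) ∈ A.L ∧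
      m ≤ 3 / 2 * ‖Q‖ := by
  let D : C(S, ℝ) → ℝ := fun g => ∫ x, (Q * (1 + g)) x ∂μ
  let T : C(S, ℝ) → C(S, ℝ) := fun g => A.R (D g • (1 + g) - Q * (1 + g))
  have hR : 0 ≤ ‖A.R‖ := A.R.opNorm_nonneg
  have hq : 0 ≤ ‖Q‖ := norm_nonneg _
  have h1 : ∀ g : C(S, ℝ), ‖g‖ ≤ 1 / 2 → ‖1 + g‖ ≤ 3 / 2 := fun g hg => by
    refine (norm_add_le _ _).trans ?_
    rw [norm_one]; linarith
  have h2 : ∀ g : C(S, ℝ), ‖g‖ ≤ 1 / 2 → |D g| ≤ 3 / 2 * ‖Q‖ := fun g hg => by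
    refine (abs_integral_le _).trans ((norm_mul_le _ _).trans ?_)
    nlinarith [h1 g hg]
  obtain ⟨g, hg, hfix⟩ := exists_fixed_ball T (r := 1 / 2) (by norm_num) (fun g hg => by
      have b1 : ‖D g • (1 + g) - Q * (1 + g)‖ ≤ 4 * ‖Q‖ := by
        refine (norm_sub_le _ _).trans ?_
        rw [norm_smul, Real.norm_eq_abs]
        have := norm_mul_le Q (1 + g)
        have := mul_le_mul (h2 g hg) (h1 g hg) (norm_nonneg _) (by positivity)
        nlinarith [h1 g hg]
      refine (A.R.le_opNorm _).trans ((mul_le_mul_of_nonneg_left b1 hR).trans ?_)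
      nlinarith)
    (fun g g' hg hg' => by
      have e1 : T g - T g' = A.R (D g • (g - g') + (D g - D g') • (1 + g') - Q * (g - g')) := by
        simp only [T]
        rw [← map_sub]
        congr 1
        ext x
        simp; ring
      have hDD : |D g - D g'| ≤ ‖Q‖ * ‖g - g'‖ := by
        have e2 : D g - D g' = ∫ x, (Q * (g - g')) x ∂μ := by
          simp only [D]
          rw [← integral_sub (integrable _) (integrable _)]
          congr 1; ext x; simp; ring
        rw [e2]
        exact (abs_integral_le _).trans (norm_mul_le _ _)
      have b1 : ‖D g • (g - g') + (D g - D g') • (1 + g') - Q * (g - g')‖ ≤ 4 * ‖Q‖ * ‖g - g'‖ := by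
        refine (norm_sub_le _ _).trans ?_
        refine (add_le_add (norm_add_le _ _) (norm_mul_le _ _)).trans ?_
        rw [norm_smul, norm_smul, Real.norm_eq_abs, Real.norm_eq_abs]
        have c1 := mul_le_mul_of_nonneg_right (h2 g hg) (norm_nonneg (g - g'))
        have c2 := mul_le_mul hDD (h1 g' hg') (norm_nonneg _) (by positivity)
        nlinarith
      rw [e1]
      refine (A.R.le_opNorm _).trans ((mul_le_mul_of_nonneg_left b1 hR).trans ?_)
      have := mul_le_mul_of_nonneg_right hQ (norm_nonneg (g - g'))
      nlinarith)
  refine ⟨1 + g, D g, fun x => ?_, ?_, (le_abs_self _).trans (h2 g hg)⟩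
  · have := abs_le.1 ((g.norm_coe_le_norm x).trans hg)
    simp only [ContinuousMap.add_apply, ContinuousMap.one_apply]
    constructor <;> linarith [this.1, this.2]
  · have hm : ∫ x, g x ∂μ = 0 := by
      conv_lhs => rw [← hfix]
      exact A.R_mean _
    have hm2 : ∫ x, (D g • (1 + g) - Q * (1 + g)) x ∂μ = 0 := by
      have e1 : ∀ x, (D g • (1 + g) - Q * (1 + g)) x = (D g • (1 + g)) x - (Q * (1 + g)) x := fun x => rfl
      simp only [e1]
      rw [integral_sub (integrable _) (integrable _)]
      have e2 : ∫ x, (D g • (1 + g)) x ∂μ = D g := by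
        simp only [ContinuousMap.smul_apply, ContinuousMap.add_apply, ContinuousMap.one_apply, smul_eq_mul]
        rw [integral_const_mul, integral_add (integrable_const _) (integrable g), hm]
        simp
      rw [e2]; exact sub_self _
    have h3 := A.L.add_mem A.one (A.R_spec (D g • (1 + g) - Q * (1 + g)))
    rw [hm2] at h3
    convert h3 using 1
    ext1
    · change 1 + g = 1 + T g
      rw [hfix]
    · ext x; simp

end Gen
end ConeHet

namespace ConeHet
open scoped Topology BoundedContinuousFunction

section calculus
variable {S : Type} [TopologicalSpace S] [CompactSpace S]

theorem abs_sub_sub_le_of_deriv {φ φ' : ℝ → ℝ} {U : Set ℝ} (hU : Convex ℝ U)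
    (h1 : ∀ x ∈ U, HasDerivAt φ (φ' x) x) {a b ε : ℝ} (ha : a ∈ U) (hb : b ∈ U)
    (h : ∀ z ∈ Set.uIcc a b, |φ' z - φ' a| ≤ ε) :
    |φ b - φ a - φ' a * (b - a)| ≤ ε * |b - a| := by
  have hsub : Set.uIcc a b ⊆ U := by
    rw [← segment_eq_uIcc]; exact hU.segment_subset ha hb
  have := (convex_uIcc a b).norm_image_sub_le_of_norm_hasDerivWithin_le
    (f := fun x => φ x - φ' a * x) (f' := fun x => φ' x - φ' a) (C := ε)
    (fun x hx => by
      have := ((h1 x (hsub hx)).sub ((hasDerivAt_id x).const_mul (φ' a))).hasDerivWithinAt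
        (s := Set.uIcc a b)
      refine this.congr_deriv ?_
      simp)
    (fun x hx => h x hx) Set.left_mem_uIcc Set.right_mem_uIcc
  rw [Real.norm_eq_abs, Real.norm_eq_abs] at this
  convert this using 2
  ring

theorem hasDerivAt_comp_curve {φ φ' : ℝ → ℝ} {U : Set ℝ} (hU : Convex ℝ U) (hUo : IsOpen U)
    (h1 : ∀ x ∈ U, HasDerivAt φ (φ' x) x) (h2 : ContinuousOn φ' U) {h k : ℝ → C(S, ℝ)}
    {h' d : C(S, ℝ)} {t₀ : ℝ} (hh : HasDerivAt h h' t₀) (hin : ∀ t x, h t x ∈ U)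
    (hk : ∀ t x, k t x = φ (h t x)) (hd : ∀ x, d x = φ' (h t₀ x) * h' x) :
    HasDerivAt k d t₀ := by
  have hcpt : IsCompact (Set.range (h t₀)) := isCompact_range (h t₀).continuous
  have hφa : ∀ a ∈ Set.range (h t₀), ContinuousAt φ' a := by
    rintro _ ⟨x, rfl⟩
    exact h2.continuousAt (hUo.mem_nhds (hin t₀ x))
  obtain ⟨M, hM⟩ : ∃ M, ∀ x, |φ' (h t₀ x)| ≤ M := by
    obtain ⟨M, hM⟩ := hcpt.exists_bound_of_continuousOn
      (f := φ') (fun a ha => (hφa a ha).continuousWithinAt)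
    exact ⟨M, fun x => hM _ ⟨x, rfl⟩⟩
  have hM' : ∀ x, |φ' (h t₀ x)| ≤ |M| + 1 := fun x => (hM x).trans (by linarith [le_abs_self M])
  rw [hasDerivAt_iff_isLittleO] at hh ⊢
  have hbig : (fun t => h t - h t₀) =O[𝓝 t₀] fun t => t - t₀ := by
    have e : (fun t => h t - h t₀) = fun t => (h t - h t₀ - (t - t₀) • h') + (t - t₀) • h' := by
      ext1 t; abel
    rw [e]
    exact hh.isBigO.add (Asymptotics.isBigO_of_le' (c := ‖h'‖) _ fun t => by
      rw [norm_smul, mul_comm])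
  obtain ⟨C, hC0, hC⟩ := hbig.exists_pos
  rw [Asymptotics.isLittleO_iff]
  intro ε hε
  have huc := hcpt.uniformContinuousAt_of_continuousAt φ' hφa
    (Metric.dist_mem_uniformity (show 0 < ε / (2 * C) by positivity))
  obtain ⟨δ, hδ, hδ'⟩ := Metric.mem_uniformity_dist.1 huc
  have hcont : Tendsto (fun t => h t - h t₀) (𝓝 t₀) (𝓝 0) := by
    refine hbig.trans_tendsto ?_
    have : Tendsto (fun t : ℝ => t - t₀) (𝓝 t₀) (𝓝 (t₀ - t₀)) := (continuous_id.sub continuous_const).tendsto _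
    simpa using this
  have hev := (Metric.tendsto_nhds.1 hcont) δ hδ
  filter_upwards [hev, hC.bound, (Asymptotics.isLittleO_iff.1 hh)
    (show 0 < ε / (2 * (|M| + 1)) by positivity)] with t e1 e2 e3
  rw [dist_zero_right] at e1
  rw [ContinuousMap.norm_le _ (by positivity)]
  intro x
  have hx : |h t x - h t₀ x| ≤ ‖h t - h t₀‖ := (h t - h t₀).norm_coe_le_norm x
  have b1 : |φ (h t x) - φ (h t₀ x) - φ' (h t₀ x) * (h t x - h t₀ x)| ≤
      ε / (2 * C) * |h t x - h t₀ x| := by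
    refine abs_sub_sub_le_of_deriv hU h1 (hin t₀ x) (hin t x) fun z hz => ?_
    have hz1 : |z - h t₀ x| ≤ |h t x - h t₀ x| := by
      have := Set.abs_sub_left_of_mem_uIcc hz
      exact this
    have := hδ' (a := h t₀ x) (b := z) (by
      rw [dist_comm, Real.dist_eq]; linarith) ⟨x, rfl⟩
    change dist (φ' (h t₀ x)) (φ' z) < _ at this
    rw [dist_comm, Real.dist_eq] at this
    exact this.le
  have b2 : |h t x - h t₀ x - (t - t₀) * h' x| ≤ ε / (2 * (|M| + 1)) * ‖t - t₀‖ :=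
    ((h t - h t₀ - (t - t₀) • h').norm_coe_le_norm x).trans e3
  have e : (k t - k t₀ - (t - t₀) • d) x =
      (φ (h t x) - φ (h t₀ x) - φ' (h t₀ x) * (h t x - h t₀ x)) +
        φ' (h t₀ x) * (h t x - h t₀ x - (t - t₀) * h' x) := by
    simp only [ContinuousMap.sub_apply, ContinuousMap.smul_apply, smul_eq_mul, hk, hd]
    ring
  rw [e]
  refine (norm_add_le _ _).trans ?_
  rw [Real.norm_eq_abs, Real.norm_eq_abs, abs_mul]
  have b3 : ε / (2 * C) * |h t x - h t₀ x| ≤ ε / 2 * ‖t - t₀‖ := by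
    calc ε / (2 * C) * |h t x - h t₀ x| ≤ ε / (2 * C) * (C * ‖t - t₀‖) := by
          gcongr; exact hx.trans e2
      _ = ε / 2 * ‖t - t₀‖ := by field_simp
  have b4 : |φ' (h t₀ x)| * |h t x - h t₀ x - (t - t₀) * h' x| ≤ ε / 2 * ‖t - t₀‖ := by
    calc |φ' (h t₀ x)| * |h t x - h t₀ x - (t - t₀) * h' x|
        ≤ (|M| + 1) * (ε / (2 * (|M| + 1)) * ‖t - t₀‖) :=
          mul_le_mul (hM' x) b2 (abs_nonneg _) (by positivity)
      _ = ε / 2 * ‖t - t₀‖ := by field_simp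
  linarith

theorem hasDerivAt_rp {p : ℝ} (hp : 1 < p) {h : ℝ → C(S, ℝ)} {h' : C(S, ℝ)} {t : ℝ}
    (hh : HasDerivAt h h' t) : HasDerivAt (fun t => rp p (h t)) (p • (rp (p - 1) (h t) * h')) t := by
  refine hasDerivAt_comp_curve (φ := fun x => x ^ p) (φ' := fun x => p * x ^ (p - 1))
    convex_univ isOpen_univ (fun x _ => Real.hasDerivAt_rpow_const (Or.inr hp.le))
    ((Real.continuous_rpow_const (by linarith)).const_mul p).continuousOn hh (fun _ _ => trivial)
    (fun t x => rp_apply (by linarith) _ x) fun x => ?_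
  simp only [ContinuousMap.smul_apply, ContinuousMap.mul_apply, smul_eq_mul,
    rp_apply (by linarith : 0 ≤ p - 1)]
  ring

theorem hasDerivAt_rp' (q : ℝ) {h : ℝ → C(S, ℝ)} {h' : C(S, ℝ)} {t : ℝ} (h0 : ∀ t x, 0 < h t x)
    (hh : HasDerivAt h h' t) : HasDerivAt (fun t => rp q (h t)) (q • (rp (q - 1) (h t) * h')) t := by
  refine hasDerivAt_comp_curve (φ := fun x => x ^ q) (φ' := fun x => q * x ^ (q - 1))
    (convex_Ioi 0) isOpen_Ioi (fun x hx => Real.hasDerivAt_rpow_const (Or.inl (ne_of_gt hx)))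
    (fun x hx => ((Real.continuousAt_rpow_const x _ (Or.inl (ne_of_gt hx))).const_mul q).continuousWithinAt)
    hh h0 (fun t x => rp_apply' q (h0 t) x) fun x => ?_
  simp only [ContinuousMap.smul_apply, ContinuousMap.mul_apply, smul_eq_mul, rp_apply' _ (h0 t)]
  ring

theorem contDiff_rp (n : ℕ) (q : ℝ) {h : ℝ → C(S, ℝ)} (h0 : ∀ t x, 0 < h t x)
    (hh : ContDiff ℝ n h) (hd : Differentiable ℝ h) : ContDiff ℝ n fun t => rp q (h t) := by
  induction n generalizing q with
  | zero =>
    rw [Nat.cast_zero, contDiff_zero, continuous_iff_continuousAt]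
    exact fun t => (hasDerivAt_rp' q h0 (hd t).hasDerivAt).continuousAt
  | succ n ih =>
    rw [Nat.cast_succ] at hh ⊢
    rw [contDiff_succ_iff_deriv] at hh ⊢
    refine ⟨fun t => (hasDerivAt_rp' q h0 (hd t).hasDerivAt).differentiableAt, by simp, ?_⟩
    have e : deriv (fun t => rp q (h t)) = fun t => q • (rp (q - 1) (h t) * deriv h t) :=
      funext fun t => (hasDerivAt_rp' q h0 (hd t).hasDerivAt).deriv
    rw [e]
    have h3 : ContDiff ℝ n h := by
      have : ContDiff ℝ ((n:ℕ) + 1) h := by rw [contDiff_succ_iff_deriv]; exact hh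
      exact this.of_le (by exact_mod_cast Nat.le_succ n)
    exact ((ih (q - 1) h3).mul hh.2.2).const_smul q

end calculus

section nem
variable {S : Type} [TopologicalSpace S] [CompactSpace S]

theorem continuous_rp {p : ℝ} (hp : 0 ≤ p) : Continuous (rp p : C(S, ℝ) → C(S, ℝ)) := by
  have : (rp p : C(S, ℝ) → C(S, ℝ)) =
      fun f => (⟨fun x => x ^ p, Real.continuous_rpow_const hp⟩ : C(ℝ, ℝ)).comp f := by
    ext f x; rw [rp_apply hp]; rfl
  rw [this]
  exact ContinuousMap.continuous_postcomp _

theorem rp_norm {p : ℝ} (hp : 0 ≤ p) (f : C(S, ℝ)) : ‖rp p f‖ ≤ ‖f‖ ^ p := by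
  rw [ContinuousMap.norm_le _ (by positivity)]
  intro x
  rw [rp_apply hp, Real.norm_eq_abs]
  exact (Real.abs_rpow_le_abs_rpow _ _).trans
    (Real.rpow_le_rpow (abs_nonneg _) (f.norm_coe_le_norm x) hp)

/-- The curve `t ↦ K f(t) ^ p`. -/
noncomputable def nem (K : C(S, ℝ)) {p : ℝ} (hp : 0 ≤ p) (f : Crv C(S, ℝ)) : Crv C(S, ℝ) :=
  BoundedContinuousFunction.ofNormedAddCommGroup (fun t => K * rp p (f t))
    (continuous_const.mul ((continuous_rp hp).comp f.continuous)) (‖K‖ * ‖f‖ ^ p) fun t => by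
      refine (norm_mul_le _ _).trans (mul_le_mul_of_nonneg_left ?_ (norm_nonneg _))
      exact (rp_norm hp _).trans (Real.rpow_le_rpow (norm_nonneg _) (f.norm_coe_le_norm t) hp)

@[simp] theorem nem_apply (K : C(S, ℝ)) {p : ℝ} (hp : 0 ≤ p) (f : Crv C(S, ℝ)) (t : ℝ) :
    nem K hp f t = K * rp p (f t) := rfl

theorem nem_eval (K : C(S, ℝ)) {p : ℝ} (hp : 0 ≤ p) (f : Crv C(S, ℝ)) (t : ℝ) (x : S) :
    nem K hp f t x = K x * f t x ^ p := by
  rw [nem_apply, ContinuousMap.mul_apply, rp_apply hp]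

theorem nem_norm (K : C(S, ℝ)) {p : ℝ} (hp : 0 ≤ p) (f : Crv C(S, ℝ)) :
    ‖nem K hp f‖ ≤ ‖K‖ * ‖f‖ ^ p :=
  BoundedContinuousFunction.norm_ofNormedAddCommGroup_le _ (by positivity) _

theorem continuous_nem (K : C(S, ℝ)) {p : ℝ} (hp : 0 ≤ p) : Continuous (nem (S := S) K hp) := by
  rw [continuous_iff_continuousAt]
  intro f
  rw [ContinuousAt, Metric.tendsto_nhds]
  intro ε hε
  have hcpt : IsCompact (Set.Icc (-‖f‖) ‖f‖) := isCompact_Icc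
  have huc := hcpt.uniformContinuousAt_of_continuousAt (fun x : ℝ => x ^ p)
    (fun a _ => (Real.continuous_rpow_const hp).continuousAt)
    (Metric.dist_mem_uniformity (show 0 < ε / (2 * (‖K‖ + 1)) by positivity))
  obtain ⟨δ, hδ, hδ'⟩ := Metric.mem_uniformity_dist.1 huc
  filter_upwards [Metric.ball_mem_nhds f hδ] with g hg
  refine lt_of_le_of_lt ?_ (half_lt_self hε)
  rw [dist_eq_norm, BoundedContinuousFunction.norm_le (by positivity)]
  intro t
  rw [ContinuousMap.norm_le _ (by positivity)]
  intro x
  have h1 : ((nem K hp g - nem K hp f) t) x = K x * (g t x ^ p - f t x ^ p) := by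
    rw [BoundedContinuousFunction.sub_apply, ContinuousMap.sub_apply, nem_eval, nem_eval]; ring
  rw [h1, norm_mul]
  have hfx : |f t x| ≤ ‖f‖ := ((f t).norm_coe_le_norm x).trans (f.norm_coe_le_norm t)
  have hd : dist (f t x) (g t x) < δ := by
    rw [Metric.mem_ball, dist_eq_norm] at hg
    rw [dist_comm, Real.dist_eq]
    exact (((g t - f t).norm_coe_le_norm x).trans ((g - f).norm_coe_le_norm t)).trans_lt hg
  have h2 := hδ' hd (abs_le.1 hfx)
  change dist (f t x ^ p) (g t x ^ p) < _ at h2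
  rw [dist_comm, Real.dist_eq] at h2
  calc ‖K x‖ * ‖g t x ^ p - f t x ^ p‖ ≤ (‖K‖ + 1) * (ε / (2 * (‖K‖ + 1))) :=
        mul_le_mul ((K.norm_coe_le_norm x).trans (by linarith)) h2.le (norm_nonneg _) (by positivity)
    _ = ε / 2 := by field_simp

theorem nem_uc (K : C(S, ℝ)) {p : ℝ} (hp : 0 ≤ p) {f : Crv C(S, ℝ)} (hf : UC f) :
    UC (nem K hp f) := by
  have h1 : ∀ s, shift s (nem K hp f) = nem K hp (shift s f) := fun s => by
    ext t x
    rw [shift_apply, nem_eval, nem_eval, shift_apply]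
  have h2 := Tendsto.comp ((continuous_nem K hp).tendsto f) hf
  rw [UC]
  simp only [h1]
  exact h2

theorem uc_of_lipschitz {X : Type*} [NormedAddCommGroup X] [NormedSpace ℝ X] {f : Crv X} {L : ℝ}
    (h : ∀ s t, ‖f s - f t‖ ≤ L * |s - t|) : UC f := by
  rw [UC, tendsto_iff_norm_sub_tendsto_zero]
  refine squeeze_zero (fun _ => norm_nonneg _) (g := fun s => |L| * |s|) (fun s => ?_) ?_
  · rw [BoundedContinuousFunction.norm_le (by positivity)]
    intro t
    have := h (t + s) t
    simp only [add_sub_cancel_left] at this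
    exact this.trans (by gcongr; exact le_abs_self L)
  · have : Tendsto (fun s : ℝ => |L| * |s|) (𝓝 0) (𝓝 (|L| * |0|)) :=
      (continuous_const.mul continuous_abs).tendsto _
    simpa using this

theorem uc_mul {f g : Crv C(S, ℝ)} (hf : UC f) (hg : UC g) : UC (f * g) := by
  rw [UC, tendsto_iff_norm_sub_tendsto_zero] at hf hg ⊢
  refine squeeze_zero (fun _ => norm_nonneg _)
    (g := fun s => ‖shift s f - f‖ * ‖g‖ + ‖f‖ * ‖shift s g - g‖) (fun s => ?_) ?_
  · rw [BoundedContinuousFunction.norm_le (by positivity)]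
    intro t
    have e : (shift s (f * g) - f * g) t =
        (shift s f - f) t * g (t + s) + f t * (shift s g - g) t := by
      change f (t + s) * g (t + s) - f t * g t =
        (f (t + s) - f t) * g (t + s) + f t * (g (t + s) - g t)
      ring
    rw [e]
    refine (norm_add_le _ _).trans (add_le_add ?_ ?_)
    · exact (norm_mul_le _ _).trans (mul_le_mul ((shift s f - f).norm_coe_le_norm t)
        (g.norm_coe_le_norm _) (norm_nonneg _) (norm_nonneg _))
    · exact (norm_mul_le _ _).trans (mul_le_mul (f.norm_coe_le_norm t)
        ((shift s g - g).norm_coe_le_norm t) (norm_nonneg _) (norm_nonneg _))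
  · simpa using (hf.mul_const ‖g‖).add (hg.const_mul ‖f‖)

theorem nem_isD (K : C(S, ℝ)) {p : ℝ} (hp : 1 < p) {f f' : Crv C(S, ℝ)} (hf : IsD f f') :
    IsD (nem K (by linarith : 0 ≤ p) f) (p • (nem K (by linarith : 0 ≤ p - 1) f * f')) := by
  intro t
  have := (hasDerivAt_rp hp (hf t)).const_mul K
  refine this.congr_deriv ?_
  ext x
  change K x * (p * (rp (p - 1) (f t) x * f' t x)) = p * ((K x * rp (p - 1) (f t) x) * f' t x)
  ring

end nem
end ConeHet

namespace ConeHet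
open scoped Topology BoundedContinuousFunction

section sc
variable {X : Type*} [NormedAddCommGroup X] [NormedSpace ℝ X]

/-- The constant curve. -/
noncomputable def cst (g : X) : Crv X := BoundedContinuousFunction.const ℝ g

@[simp] theorem cst_apply (g : X) (t : ℝ) : cst g t = g := rfl

theorem isD_cst (g : X) : IsD (cst g) 0 := fun t => hasDerivAt_const t g

/-- The curve `t ↦ a(t) g`. -/
noncomputable def sc (a : Crv ℝ) (g : X) : Crv X :=
  BoundedContinuousFunction.ofNormedAddCommGroup (fun t => a t • g)
    (a.continuous.smul continuous_const) (‖a‖ * ‖g‖) fun t => by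
      rw [norm_smul]; exact mul_le_mul_of_nonneg_right (a.norm_coe_le_norm t) (norm_nonneg _)

@[simp] theorem sc_apply (a : Crv ℝ) (g : X) (t : ℝ) : sc a g t = a t • g := rfl

theorem isD_sc {a a' : Crv ℝ} (h : IsD a a') (g : X) : IsD (sc a g) (sc a' g) :=
  fun t => (h t).smul_const g

theorem isD_mul' {a a' b b' : Crv ℝ} (h : IsD a a') (h' : IsD b b') :
    IsD (a * b) (a' * b + a * b') := fun t => (h t).mul (h' t)

theorem isD_add {f f' g g' : Crv X} (h : IsD f f') (h' : IsD g g') : IsD (f + g) (f' + g') :=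
  fun t => (h t).add (h' t)

theorem isD_sub {f f' g g' : Crv X} (h : IsD f f') (h' : IsD g g') : IsD (f - g) (f' - g') :=
  fun t => (h t).sub (h' t)

theorem isD_smul {f f' : Crv X} (h : IsD f f') (c : ℝ) : IsD (c • f) (c • f') :=
  fun t => (h t).const_smul c

/-- The logistic curve. -/
noncomputable def lg (σ : ℝ) : Crv ℝ :=
  BoundedContinuousFunction.ofNormedAddCommGroup (fun t => Real.sigmoid (σ * t))
    (continuous_sigmoid.comp (continuous_const.mul continuous_id)) 1 fun t => by
      rw [Real.norm_of_nonneg (Real.sigmoid_nonneg _)]; exact Real.sigmoid_le_one _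

theorem lg_apply (σ t : ℝ) : lg σ t = Real.sigmoid (σ * t) := rfl

noncomputable def lg1 (σ : ℝ) : Crv ℝ := σ • (lg σ - lg σ * lg σ)
noncomputable def lg2 (σ : ℝ) : Crv ℝ := σ • (lg1 σ - (lg1 σ * lg σ + lg σ * lg1 σ))
noncomputable def lg3 (σ : ℝ) : Crv ℝ :=
  σ • (lg2 σ - ((lg2 σ * lg σ + lg1 σ * lg1 σ) + (lg1 σ * lg1 σ + lg σ * lg2 σ)))

theorem isD_lg (σ : ℝ) : IsD (lg σ) (lg1 σ) := fun t => by
  have := (Real.hasDerivAt_sigmoid (σ * t)).comp t ((hasDerivAt_id t).const_mul σ)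
  refine this.congr_deriv ?_
  change _ = σ * (Real.sigmoid (σ * t) - Real.sigmoid (σ * t) * Real.sigmoid (σ * t))
  ring

theorem isD_lg1 (σ : ℝ) : IsD (lg1 σ) (lg2 σ) :=
  isD_smul (isD_sub (isD_lg σ) (isD_mul' (isD_lg σ) (isD_lg σ))) σ

theorem isD_lg2 (σ : ℝ) : IsD (lg2 σ) (lg3 σ) :=
  isD_smul (isD_sub (isD_lg1 σ) (isD_add (isD_mul' (isD_lg1 σ) (isD_lg σ))
    (isD_mul' (isD_lg σ) (isD_lg1 σ)))) σ

theorem lg1_apply (σ t : ℝ) : lg1 σ t = σ * (lg σ t - lg σ t * lg σ t) := rfl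
theorem lg2_apply (σ t : ℝ) : lg2 σ t = σ * (lg1 σ t - (lg1 σ t * lg σ t + lg σ t * lg1 σ t)) := rfl

theorem lg_pos (σ t : ℝ) : 0 < lg σ t := Real.sigmoid_pos _
theorem lg_lt_one (σ t : ℝ) : lg σ t < 1 := Real.sigmoid_lt_one _

theorem lg_le_exp (σ t : ℝ) : lg σ t ≤ Real.exp (σ * t) := by
  rw [lg_apply, Real.sigmoid_def, show Real.exp (σ * t) = (Real.exp (-(σ * t)))⁻¹ by
    rw [Real.exp_neg, inv_inv]]
  exact inv_anti₀ (Real.exp_pos _) (by linarith)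

theorem lg_ge_exp {σ t : ℝ} (h : σ * t ≤ 0) : Real.exp (σ * t) / 2 ≤ lg σ t := by
  rw [lg_apply, Real.sigmoid_def, show Real.exp (σ * t) / 2 = (Real.exp (-(σ * t)) * 2)⁻¹ by
    rw [Real.exp_neg, mul_inv, inv_inv]; rfl]
  have : 1 ≤ Real.exp (-(σ * t)) := Real.one_le_exp (by linarith)
  exact inv_anti₀ (by linarith) (by linarith)

theorem lg_mono {σ s t : ℝ} (hσ : 0 < σ) (h : s ≤ t) : lg σ s ≤ lg σ t :=
  Real.sigmoid_le (by gcongr)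

theorem lg_sq_le {σ κ t : ℝ} (hσ : 0 < σ) (h1 : σ < κ) (h2 : κ ≤ 2 * σ) :
    lg σ t ^ 2 ≤ Real.exp (κ * t) := by
  have p := lg_pos σ t
  rcases le_total 0 t with h | h
  · calc lg σ t ^ 2 ≤ 1 := pow_le_one₀ p.le (lg_lt_one σ t).le
      _ ≤ Real.exp (κ * t) := Real.one_le_exp (by nlinarith)
  · calc lg σ t ^ 2 ≤ Real.exp (σ * t) ^ 2 := by gcongr; exact lg_le_exp σ t
      _ = Real.exp (2 * (σ * t)) := by rw [← Real.exp_nat_mul]; norm_num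
      _ ≤ Real.exp (κ * t) := Real.exp_le_exp.2 (by nlinarith)

theorem lg_dispersion {σ B m t : ℝ} (h : σ ^ 2 - B * σ + m = 0) :
    lg2 σ t - B * lg1 σ t + m * lg σ t =
      lg σ t ^ 2 * (B * σ - 3 * σ ^ 2 + 2 * σ ^ 2 * lg σ t) := by
  have : m = B * σ - σ ^ 2 := by linarith
  rw [lg2_apply, lg1_apply, this]; ring

end sc

theorem exists_taylor {p a b : ℝ} (hp : 1 < p) (ha : 0 < a) :
    ∃ C ≥ 0, ∀ x ∈ Set.Icc a b, ∀ y ∈ Set.Icc a b,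
      |y ^ p - x ^ p - p * x ^ (p - 1) * (y - x)| ≤ C * (y - x) ^ 2 := by
  obtain ⟨C, hC⟩ := (isCompact_Icc (a := a) (b := b)).exists_bound_of_continuousOn
    (f := fun x : ℝ => p * ((p - 1) * x ^ (p - 1 - 1))) (fun x hx =>
      (((Real.continuousAt_rpow_const x _ (Or.inl (ha.trans_le hx.1).ne')).const_mul _).const_mul
        _).continuousWithinAt)
  refine ⟨|C|, abs_nonneg _, fun x hx y hy => ?_⟩
  have h1 : ∀ z ∈ Set.uIcc x y, |p * z ^ (p - 1) - p * x ^ (p - 1)| ≤ |C| * |y - x| := by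
    intro z hz
    have hsub : Set.uIcc x y ⊆ Set.Icc a b := Set.uIcc_subset_Icc hx hy
    have := (convex_Icc a b).norm_image_sub_le_of_norm_hasDerivWithin_le
      (f := fun x : ℝ => p * x ^ (p - 1)) (C := |C|) (fun w hw =>
        ((Real.hasDerivAt_rpow_const (Or.inl (ha.trans_le hw.1).ne')).const_mul p).hasDerivWithinAt)
      (fun w hw => (hC w hw).trans (le_abs_self C)) hx (hsub hz)
    rw [Real.norm_eq_abs, Real.norm_eq_abs] at this
    refine this.trans (mul_le_mul_of_nonneg_left ?_ (abs_nonneg _))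
    have := Set.abs_sub_left_of_mem_uIcc hz
    exact this
  have := abs_sub_sub_le_of_deriv (φ := fun x : ℝ => x ^ p) (φ' := fun x => p * x ^ (p - 1))
    convex_univ (fun x _ => Real.hasDerivAt_rpow_const (Or.inr hp.le)) (a := x) (b := y)
    trivial trivial h1
  rwa [mul_assoc |C|, ← pow_two, sq_abs] at this

end ConeHet

namespace ConeHet
open scoped Topology BoundedContinuousFunction

namespace Gen
variable {S : Type} [MetricSpace S] [CompactSpace S] [Nonempty S] [MeasurableSpace S]
  [BorelSpace S] {μ : Measure S} [IsProbabilityMeasure μ] (A : Gen S μ) (P : Par)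

/-- A positive stationary solution `V`, the principal eigenpair `(χ, mh)` of its linearization and
the growth rates of the linearized problem. -/
structure Dat where
  K : C(S, ℝ)
  V : C(S, ℝ)
  χ : C(S, ℝ)
  p : ℝ
  mh : ℝ
  σ : ℝ
  κ : ℝ
  d : ℝ
  hp : 1 < p
  hK : ∀ x, 0 ≤ K x
  hV : ∀ x, 0 < V x
  hVL : (V, P.l • V - K * rp p V) ∈ A.L
  hχ1 : ∀ x, 1 / 2 ≤ χ x
  hχ2 : ∀ x, χ x ≤ 3 / 2
  hχL : (χ, mh • χ - (p • (K * rp (p - 1) V)) * χ) ∈ A.L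
  hσ : 0 < σ
  hσκ : σ < κ
  hκ : κ ≤ 2 * σ
  hσe : σ ^ 2 - P.B * σ + (mh - P.l) = 0
  hd : 0 < d
  hde : d = -(mh - P.l) - (κ ^ 2 - P.B * κ)

namespace Dat
variable {A P} (D : A.Dat P)

theorem hp0 : 0 ≤ D.p := by linarith [D.hp]

/-- The potential of the linearization. -/
noncomputable def Q : C(S, ℝ) := D.p • (D.K * rp (D.p - 1) D.V)

theorem Q_apply (x : S) : D.Q x = D.p * (D.K x * D.V x ^ (D.p - 1)) := by
  have h : 0 ≤ D.p - 1 := by linarith [D.hp]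
  simp only [Q, ContinuousMap.smul_apply, ContinuousMap.mul_apply, smul_eq_mul, rp_apply h]

theorem Q_nonneg (x : S) : 0 ≤ D.Q x := by
  rw [Q_apply]
  have := D.hp0; have := D.hK x; have := D.hV x
  positivity

theorem Q_le (x : S) : D.Q x ≤ ‖D.Q‖ := (le_abs_self _).trans (D.Q.norm_coe_le_norm x)

/-- The contraction factor. -/
noncomputable def θ : ℝ := (‖D.Q‖ + D.d / 2) / (‖D.Q‖ + D.d)

theorem θ_pos : 0 < D.θ := by
  have := D.hd; unfold θ; positivity

theorem θ_lt : D.θ < 1 := by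
  have := D.hd
  have := norm_nonneg D.Q
  rw [θ, div_lt_one (by positivity)]; linarith

theorem θ_spec (x : S) : D.Q x + D.d / 2 ≤ D.θ * (D.Q x + D.d) := by
  have h1 := D.hd
  have h2 := norm_nonneg D.Q
  have h3 := D.Q_le x
  have h4 := D.Q_nonneg x
  rw [θ, div_mul_eq_mul_div, le_div_iff₀ (by positivity)]
  nlinarith

theorem weight {f : Crv C(S, ℝ)} (hf : UC f) {g : C(S, ℝ)} {a η : ℝ} (ha : 0 ≤ a) (hη : 0 < η)
    (H : ∀ x, g x + η ≤ a * ((D.Q x + D.d) * D.χ x))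
    (hfg : ∀ t x, |f t x| ≤ Real.exp (D.κ * t) * g x) (t : ℝ) (x : S) :
    |A.G P f t x| ≤ Real.exp (D.κ * t) * (a * D.χ x) := by
  refine A.G_weight P hf (A.L.smul_mem a D.hχL) (χ := a • D.χ) (fun x => ?_) hη (fun x => ?_) hfg t x
  · exact mul_nonneg ha (by linarith [D.hχ1 x])
  · refine (H x).trans (le_of_eq ?_)
    change _ = P.l * (a * D.χ x) - a * (D.mh * D.χ x - D.Q x * D.χ x) - _ * (a * D.χ x)
    rw [D.hde]; ring

theorem weight_step {f : Crv C(S, ℝ)} (hf : UC f) {a : ℝ} (ha : 0 < a)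
    (hfg : ∀ t x, |f t x| ≤ D.Q x * (Real.exp (D.κ * t) * (a * D.χ x))) (t : ℝ) (x : S) :
    |A.G P f t x| ≤ Real.exp (D.κ * t) * (a * D.θ * D.χ x) := by
  have hd := D.hd
  refine D.weight hf (g := a • (D.Q * D.χ)) (a := a * D.θ) (η := a * D.d / 4)
    (mul_nonneg ha.le D.θ_pos.le) (by positivity) (fun x => ?_) (fun t x => ?_) t x
  · change a * (D.Q x * D.χ x) + a * D.d / 4 ≤ _
    have h1 := mul_le_mul_of_nonneg_right (D.θ_spec x) (by linarith [D.hχ1 x] : 0 ≤ D.χ x)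
    have h2 : D.d / 4 ≤ D.d / 2 * D.χ x := by nlinarith [D.hχ1 x]
    have h3 : D.Q x * D.χ x + D.d / 4 ≤ D.θ * (D.Q x + D.d) * D.χ x := by linarith
    nlinarith
  · refine (hfg t x).trans (le_of_eq ?_)
    change _ = _ * (a * (D.Q x * D.χ x))
    ring

theorem nem_sub_le {u w : Crv C(S, ℝ)} {t : ℝ} {x : S} (hu : 0 ≤ u t x ∧ u t x ≤ D.V x)
    (hw : 0 ≤ w t x ∧ w t x ≤ D.V x) :
    |(nem D.K D.hp0 u - nem D.K D.hp0 w) t x| ≤ D.Q x * |u t x - w t x| := by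
  rw [BoundedContinuousFunction.sub_apply, ContinuousMap.sub_apply, nem_eval, nem_eval, ← mul_sub,
    abs_mul, abs_of_nonneg (D.hK x), D.Q_apply]
  have := mul_le_mul_of_nonneg_left (rpow_sub_le D.hp.le hu hw) (D.hK x)
  linarith

/-- Order interval and monotonicity used in the iteration. -/
structure Good (f : Crv C(S, ℝ)) : Prop where
  uc : UC f
  nonneg : ∀ t x, 0 ≤ f t x
  le : ∀ t x, f t x ≤ D.V x
  anti : ∀ s ≥ 0, ∀ t x, f (t + s) x ≤ f t x

theorem G_V : cst D.V = A.G P (nem D.K D.hp0 (cst D.V)) := by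
  have h0 : IsD (cst D.V) 0 := isD_cst _
  refine A.eq_G_of_mem P h0 (h'' := 0) (fun t => hasDerivAt_const t 0) (isD_cst (0 : C(S, ℝ))).uc
    (nem_uc _ _ h0.uc) fun t => ?_
  convert D.hVL using 1
  ext1
  · rfl
  · change P.l • D.V - (0 - P.B • 0) - D.K * rp D.p D.V = P.l • D.V - D.K * rp D.p D.V
    simp

variable {D}

theorem Good.G {f : Crv C(S, ℝ)} (h : D.Good f) : D.Good (A.G P (nem D.K D.hp0 f)) where
  uc := A.G_uc P (nem_uc _ _ h.uc)
  nonneg t x := A.G_nonneg P (nem_uc _ _ h.uc) (fun t x => by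
    change 0 ≤ nem D.K D.hp0 f t x
    rw [nem_eval]; exact mul_nonneg (D.hK x) (Real.rpow_nonneg (h.nonneg t x) _)) t x
  le t x := by
    have := A.G_mono P (nem_uc D.K D.hp0 h.uc) (nem_uc D.K D.hp0 (isD_cst D.V).uc) (fun t x => by
      change nem D.K D.hp0 f t x ≤ nem D.K D.hp0 (cst D.V) t x
      rw [nem_eval, nem_eval]
      exact mul_le_mul_of_nonneg_left (Real.rpow_le_rpow (h.nonneg t x) (h.le t x) D.hp0) (D.hK x)) t x
    rwa [← D.G_V] at this
  anti s hs t x := by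
    have hu := nem_uc D.K D.hp0 h.uc
    have := A.G_mono P (hu.shift s) hu (fun t x => by
      change nem D.K D.hp0 f (t + s) x ≤ nem D.K D.hp0 f t x
      rw [nem_eval, nem_eval]
      exact mul_le_mul_of_nonneg_left
        (Real.rpow_le_rpow (h.nonneg _ x) (h.anti s hs t x) D.hp0) (D.hK x)) t x
    rwa [A.G_shift P hu] at this

variable (D)

/-- The starting curve `V - c m(t) χ`. -/
noncomputable def Z0 (c : ℝ) : Crv C(S, ℝ) := cst D.V - sc (c • lg D.σ) D.χ

theorem Z0_apply (c t : ℝ) (x : S) : D.Z0 c t x = D.V x - c * lg D.σ t * D.χ x := rfl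

/-- The source of the starting curve. -/
noncomputable def f0 (c : ℝ) : Crv C(S, ℝ) := cst (D.K * rp D.p D.V) - sc (c • lg D.σ) (D.Q * D.χ) +
  sc (c • (lg2 D.σ - P.B • lg1 D.σ + (D.mh - P.l) • lg D.σ)) D.χ

theorem f0_apply (c t : ℝ) (x : S) : D.f0 c t x = D.K x * D.V x ^ D.p -
    c * lg D.σ t * (D.Q x * D.χ x) +
    c * (lg2 D.σ t - P.B * lg1 D.σ t + (D.mh - P.l) * lg D.σ t) * D.χ x := by
  rw [← rp_apply D.hp0]; rfl

theorem f0_uc (c : ℝ) : UC (D.f0 c) :=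
  ((isD_cst _).uc.sub (isD_sc (isD_smul (isD_lg _) c) _).uc).add
    (isD_sc (isD_smul (isD_add (isD_sub (isD_lg2 _) (isD_smul (isD_lg1 _) _))
      (isD_smul (isD_lg _) _)) c) _).uc

theorem Z0_eq (c : ℝ) : D.Z0 c = A.G P (D.f0 c) := by
  refine A.eq_G_of_mem P (isD_sub (isD_cst _) (isD_sc (isD_smul (isD_lg _) c) _))
    (isD_sub (isD_cst 0) (isD_sc (isD_smul (isD_lg1 _) c) _))
    (isD_sub (isD_cst 0) (isD_sc (isD_smul (isD_lg2 _) c) _)).uc (D.f0_uc c) fun t => ?_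
  have h := A.L.sub_mem D.hVL (A.L.smul_mem (c * lg D.σ t) D.hχL)
  convert h using 1
  ext1
  · rfl
  · ext x
    change P.l * (D.V x - c * lg D.σ t * D.χ x) - ((0 - c * lg2 D.σ t * D.χ x) -
      P.B * (0 - c * lg1 D.σ t * D.χ x)) - D.f0 c t x =
      (P.l * D.V x - D.K x * rp D.p D.V x) - c * lg D.σ t * (D.mh * D.χ x - D.Q x * D.χ x)
    rw [f0_apply, rp_apply D.hp0]
    ring

theorem Z0_good {c : ℝ} (hc : 0 < c) (h : ∀ x, c * D.χ x ≤ D.V x / 2) : D.Good (D.Z0 c) where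
  uc := ((isD_cst _).uc.sub (isD_sc (isD_smul (isD_lg _) c) _).uc)
  nonneg t x := by
    rw [Z0_apply]
    have h1 := lg_pos D.σ t; have h2 := lg_lt_one D.σ t; have h3 := D.hχ1 x; have h4 := D.hV x
    have : c * lg D.σ t * D.χ x ≤ c * D.χ x := by
      have : 0 < c * D.χ x := mul_pos hc (by linarith)
      nlinarith
    linarith [h x]
  le t x := by
    rw [Z0_apply]
    have h1 := lg_pos D.σ t; have h3 := D.hχ1 x
    have : 0 < c * lg D.σ t * D.χ x := by positivity
    linarith
  anti s hs t x := by
    rw [Z0_apply, Z0_apply]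
    have h3 := D.hχ1 x
    have := lg_mono D.hσ (by linarith : t ≤ t + s)
    gcongr

theorem exists_start : ∃ c > 0, D.Good (D.Z0 c) ∧ ∃ C > 0, ∀ t x,
    |(nem D.K D.hp0 (D.Z0 c) - D.f0 c) t x| ≤ Real.exp (D.κ * t) * C := by
  obtain ⟨x₀, hx₀⟩ := exists_min D.V
  set a : ℝ := D.V x₀ / 2 with ha
  have ha0 : 0 < a := by have := D.hV x₀; positivity
  obtain ⟨c, hc⟩ : ∃ c, c = a * (2 / 3) := ⟨_, rfl⟩
  have hc0 : 0 < c := by rw [hc]; positivity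
  have hcχ : ∀ x, c * D.χ x ≤ D.V x / 2 := fun x => by
    have := D.hχ2 x; have := hx₀ x; nlinarith
  obtain ⟨C, hC0, hC⟩ := exists_taylor (b := ‖D.V‖) D.hp ha0
  have hg := D.Z0_good hc0 hcχ
  obtain ⟨w, hw⟩ : ∃ w : ℝ, w = |P.B * D.σ| + 3 * D.σ ^ 2 + 2 * D.σ ^ 2 := ⟨_, rfl⟩
  have hw0 : 0 ≤ w := by rw [hw]; positivity
  refine ⟨c, hc0, hg, ‖D.K‖ * C * (c * (3 / 2)) ^ 2 + c * w * (3 / 2) + 1, by positivity, fun t x => ?_⟩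
  have hm := lg_pos D.σ t
  have hm1 := lg_lt_one D.σ t
  have hχ1 := D.hχ1 x
  have hχ2 := D.hχ2 x
  have hZ : D.V x - c * lg D.σ t * D.χ x = D.Z0 c t x := rfl
  have hZa : a ≤ D.Z0 c t x := by
    rw [← hZ]
    have : c * lg D.σ t * D.χ x ≤ c * D.χ x := by
      have : 0 < c * D.χ x := mul_pos hc0 (by linarith)
      nlinarith
    linarith [hcχ x, hx₀ x]
  have hVb : D.V x ≤ ‖D.V‖ := (le_abs_self _).trans (D.V.norm_coe_le_norm x)
  have hT := hC (D.V x) ⟨by linarith [hx₀ x], hVb⟩ (D.Z0 c t x)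
    ⟨hZa, (hg.le t x).trans hVb⟩
  rw [show D.Z0 c t x - D.V x = -(c * lg D.σ t * D.χ x) by rw [← hZ]; ring] at hT
  rw [BoundedContinuousFunction.sub_apply, ContinuousMap.sub_apply, nem_eval, f0_apply,
    lg_dispersion D.hσe, D.Q_apply]
  have e : D.K x * D.Z0 c t x ^ D.p - (D.K x * D.V x ^ D.p -
      c * lg D.σ t * (D.p * (D.K x * D.V x ^ (D.p - 1)) * D.χ x) +
      c * (lg D.σ t ^ 2 * (P.B * D.σ - 3 * D.σ ^ 2 + 2 * D.σ ^ 2 * lg D.σ t)) * D.χ x) =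
      D.K x * (D.Z0 c t x ^ D.p - D.V x ^ D.p - D.p * D.V x ^ (D.p - 1) * -(c * lg D.σ t * D.χ x)) -
      c * (lg D.σ t ^ 2 * (P.B * D.σ - 3 * D.σ ^ 2 + 2 * D.σ ^ 2 * lg D.σ t)) * D.χ x := by ring
  rw [e]
  refine (abs_sub _ _).trans ?_
  have b1 : |D.K x * (D.Z0 c t x ^ D.p - D.V x ^ D.p -
      D.p * D.V x ^ (D.p - 1) * -(c * lg D.σ t * D.χ x))| ≤
      ‖D.K‖ * C * (c * (3 / 2)) ^ 2 * lg D.σ t ^ 2 := by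
    rw [abs_mul]
    calc _ ≤ ‖D.K‖ * (C * (-(c * lg D.σ t * D.χ x)) ^ 2) :=
          mul_le_mul (D.K.norm_coe_le_norm x) hT (abs_nonneg _) (norm_nonneg _)
      _ = ‖D.K‖ * C * (c * D.χ x) ^ 2 * lg D.σ t ^ 2 := by ring
      _ ≤ _ := by gcongr
  have b2 : |c * (lg D.σ t ^ 2 * (P.B * D.σ - 3 * D.σ ^ 2 + 2 * D.σ ^ 2 * lg D.σ t)) * D.χ x| ≤
      c * w * (3 / 2) * lg D.σ t ^ 2 := by
    rw [abs_mul, abs_mul, abs_mul, abs_of_pos hc0, abs_of_nonneg (sq_nonneg (lg D.σ t)),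
      abs_of_nonneg (by linarith : 0 ≤ D.χ x)]
    have : |P.B * D.σ - 3 * D.σ ^ 2 + 2 * D.σ ^ 2 * lg D.σ t| ≤ w := by
      rw [hw, abs_le]
      have h1 := neg_abs_le (P.B * D.σ); have h2 := le_abs_self (P.B * D.σ)
      constructor <;> nlinarith [sq_nonneg D.σ]
    calc _ ≤ c * (lg D.σ t ^ 2 * w) * (3 / 2) := by gcongr
      _ = _ := by ring
  have b3 := lg_sq_le (t := t) D.hσ D.hσκ D.hκ
  have b4 := mul_le_mul_of_nonneg_left b3
    (show 0 ≤ ‖D.K‖ * C * (c * (3 / 2)) ^ 2 + c * w * (3 / 2) by positivity)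
  have b5 := Real.exp_pos (D.κ * t)
  linarith

end Dat
end Gen
end ConeHet

namespace ConeHet
open scoped Topology BoundedContinuousFunction

theorem IsD.lipschitz {X : Type*} [NormedAddCommGroup X] [NormedSpace ℝ X] {f g : Crv X}
    (h : IsD f g) (s t : ℝ) : ‖f s - f t‖ ≤ ‖g‖ * |s - t| := by
  have := Convex.norm_image_sub_le_of_norm_hasDerivWithin_le (f := f) (f' := g) (C := ‖g‖)
    (s := Set.univ) (fun x _ => (h x).hasDerivWithinAt) (fun x _ => g.norm_coe_le_norm x) convex_univ
    (Set.mem_univ t) (Set.mem_univ s)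
  simpa using this

namespace Gen
variable {S : Type} [MetricSpace S] [CompactSpace S] [Nonempty S] [MeasurableSpace S]
  [BorelSpace S] {μ : Measure S} [IsProbabilityMeasure μ] {A : Gen S μ} {P : Par}

namespace Dat
variable (D : A.Dat P)

/-- Picard iterates. -/
noncomputable def it (z : Crv C(S, ℝ)) : ℕ → Crv C(S, ℝ)
  | 0 => z
  | k + 1 => A.G P (nem D.K D.hp0 (it z k))

theorem it_good {z : Crv C(S, ℝ)} (h : D.Good z) : ∀ k, D.Good (D.it z k)
  | 0 => h
  | k + 1 => (it_good h k).G

theorem it_step {c C : ℝ} (hg : D.Good (D.Z0 c)) (hC : 0 < C)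
    (H : ∀ t x, |(nem D.K D.hp0 (D.Z0 c) - D.f0 c) t x| ≤ Real.exp (D.κ * t) * C) (k : ℕ) :
    ∀ t x, |D.it (D.Z0 c) (k + 1) t x - D.it (D.Z0 c) k t x| ≤
      Real.exp (D.κ * t) * (2 * (C + 1) / D.d * D.θ ^ k * D.χ x) := by
  have hd := D.hd
  have hθ := D.θ_pos
  have hg' := D.it_good hg
  induction k with
  | zero =>
    intro t x
    have h0 : D.it (D.Z0 c) 1 - D.it (D.Z0 c) 0 = A.G P (nem D.K D.hp0 (D.Z0 c) - D.f0 c) := by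
      rw [A.G_sub P (nem_uc _ _ hg.uc) (D.f0_uc c), ← D.Z0_eq]; rfl
    rw [pow_zero, mul_one, zero_add, ← ContinuousMap.sub_apply,
      ← BoundedContinuousFunction.sub_apply, h0]
    refine D.weight ((nem_uc _ _ hg.uc).sub (D.f0_uc c)) (g := ContinuousMap.const S C)
      (by positivity) one_pos (fun x => ?_) H t x
    change C + 1 ≤ _
    have h1 := D.hχ1 x
    have h2 := D.Q_nonneg x
    calc C + 1 = 2 * (C + 1) / D.d * (D.d * (1 / 2)) := by field_simp
      _ ≤ _ := by
        gcongr
        linarith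
  | succ k ih =>
    intro t x
    have h0 : D.it (D.Z0 c) (k + 1 + 1) - D.it (D.Z0 c) (k + 1) =
        A.G P (nem D.K D.hp0 (D.it (D.Z0 c) (k + 1)) - nem D.K D.hp0 (D.it (D.Z0 c) k)) := by
      rw [A.G_sub P (nem_uc _ _ (hg' _).uc) (nem_uc _ _ (hg' _).uc)]; rfl
    rw [← ContinuousMap.sub_apply, ← BoundedContinuousFunction.sub_apply, h0]
    have := D.weight_step ((nem_uc D.K D.hp0 (hg' (k + 1)).uc).sub (nem_uc D.K D.hp0 (hg' k).uc))
      (a := 2 * (C + 1) / D.d * D.θ ^ k) (by positivity) (fun t x => ?_) t x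
    · rwa [mul_assoc (2 * (C + 1) / D.d), ← pow_succ] at this
    · exact (D.nem_sub_le ⟨(hg' _).nonneg t x, (hg' _).le t x⟩
        ⟨(hg' _).nonneg t x, (hg' _).le t x⟩).trans
        (mul_le_mul_of_nonneg_left (ih t x) (D.Q_nonneg x))

theorem exists_fixed_curve : ∃ Z : Crv C(S, ℝ), D.Good Z ∧ Z = A.G P (nem D.K D.hp0 Z) ∧
    ∃ c > 0, ∃ C > 0, ∀ t x, |Z t x - D.Z0 c t x| ≤ Real.exp (D.κ * t) * C := by
  obtain ⟨c, hc, hg, C, hC, H⟩ := D.exists_start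
  have hstep := D.it_step hg hC H
  have hg' := D.it_good hg
  have hd := D.hd
  have hθ := D.θ_pos
  have hθ1 := D.θ_lt
  obtain ⟨W, hW⟩ : ∃ W : ℕ → Crv C(S, ℝ), W = D.it (D.Z0 c) := ⟨_, rfl⟩
  have hWs : ∀ k, W (k + 1) = A.G P (nem D.K D.hp0 (W k)) := fun k => by rw [hW]; rfl
  have hW0 : W 0 = D.Z0 c := by rw [hW]; rfl
  rw [← hW] at hstep hg'
  obtain ⟨E, hE⟩ : ∃ E, E = 2 * (C + 1) / D.d * (3 / 2) := ⟨_, rfl⟩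
  have hE0 : 0 < E := by rw [hE]; positivity
  have hdist : ∀ t k, dist (W k t) (W (k + 1) t) ≤ Real.exp (D.κ * t) * E * D.θ ^ k := fun t k => by
    rw [dist_comm, dist_eq_norm, ContinuousMap.norm_le _ (by positivity)]
    intro x
    refine (hstep k t x).trans ?_
    have h2 := D.hχ2 x
    rw [hE]
    calc _ ≤ Real.exp (D.κ * t) * (2 * (C + 1) / D.d * D.θ ^ k * (3 / 2)) := by gcongr
      _ = _ := by ring
  have hlim : ∀ t, ∃ z, Tendsto (fun k => W k t) atTop (𝓝 z) := fun t =>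
    cauchySeq_tendsto_of_complete (cauchySeq_of_le_geometric _ _ hθ1 (hdist t))
  choose z hz using hlim
  have hzd : ∀ t k, dist (W k t) (z t) ≤ Real.exp (D.κ * t) * E * D.θ ^ k / (1 - D.θ) := fun t k =>
    dist_le_of_le_geometric_of_tendsto _ _ hθ1 (hdist t) (hz t) k
  have hzx : ∀ t x, Tendsto (fun k => W k t x) atTop (𝓝 (z t x)) := fun t x =>
    ((continuous_eval_const (F := C(S, ℝ)) x).tendsto _).comp (hz t)
  have hV0 : ∀ t k, ‖W k t‖ ≤ ‖D.V‖ := fun t k => by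
    rw [ContinuousMap.norm_le _ (norm_nonneg _)]
    intro x
    rw [Real.norm_eq_abs, abs_of_nonneg ((hg' k).nonneg t x)]
    exact ((hg' k).le t x).trans ((le_abs_self _).trans (D.V.norm_coe_le_norm x))
  have hV1 : ∀ k, ‖W k‖ ≤ ‖D.V‖ := fun k =>
    (BoundedContinuousFunction.norm_le (norm_nonneg _)).2 fun t => hV0 t k
  obtain ⟨L, hL⟩ : ∃ L, L = P.C1 * (‖D.K‖ * ‖D.V‖ ^ D.p) := ⟨_, rfl⟩
  have hlip : ∀ s t k, ‖W (k + 1) s - W (k + 1) t‖ ≤ L * |s - t| := fun s t k => by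
    obtain ⟨g, hg1, -, hg2⟩ := A.G_smooth P (nem_uc D.K D.hp0 (hg' k).uc)
    rw [← hWs] at hg1
    refine (hg1.lipschitz s t).trans ?_
    gcongr
    rw [hL]
    refine hg2.trans ?_
    have := P.C1_pos
    gcongr
    refine (nem_norm _ _ _).trans ?_
    gcongr
    · exact D.hp0
    · exact hV1 k
  have hzlip : ∀ s t, ‖z s - z t‖ ≤ L * |s - t| := fun s t =>
    le_of_tendsto (((hz s).sub (hz t)).norm.comp (tendsto_add_atTop_nat 1))
      (Eventually.of_forall fun k => hlip s t k)
  have hL0 : 0 ≤ L := by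
    have := P.C1_pos
    rw [hL]; positivity
  have hzc : Continuous z := by
    refine (LipschitzWith.of_dist_le_mul (K := ⟨L, hL0⟩) fun s t => ?_).continuous
    rw [dist_eq_norm, Real.dist_eq]
    exact hzlip s t
  obtain ⟨Z, hZ⟩ : ∃ Z : Crv C(S, ℝ), ∀ t, Z t = z t :=
    ⟨BoundedContinuousFunction.ofNormedAddCommGroup z hzc ‖D.V‖ fun t =>
      le_of_tendsto (hz t).norm (Eventually.of_forall fun k => hV0 t k), fun t => rfl⟩
  simp only [← hZ] at hzx hzd hzlip
  have hZg : D.Good Z :=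
    { uc := uc_of_lipschitz hzlip
      nonneg := fun t x => ge_of_tendsto (hzx t x) (Eventually.of_forall fun k => (hg' k).nonneg t x)
      le := fun t x => le_of_tendsto (hzx t x) (Eventually.of_forall fun k => (hg' k).le t x)
      anti := fun s hs t x => le_of_tendsto_of_tendsto (hzx _ x) (hzx t x)
        (Eventually.of_forall fun k => (hg' k).anti s hs t x) }
  have hpt : ∀ k t x, |W k t x - Z t x| ≤ Real.exp (D.κ * t) * E * D.θ ^ k / (1 - D.θ) := fun k t x =>
    (ContinuousMap.norm_coe_le_norm (W k t - Z t) x).trans (by rw [← dist_eq_norm]; exact hzd t k)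
  refine ⟨Z, hZg, ?_, c, hc, E / (1 - D.θ), div_pos hE0 (by linarith), fun t x => ?_⟩
  · ext t x
    have hu := nem_uc D.K D.hp0 hZg.uc
    refine tendsto_nhds_unique ((hzx t x).comp (tendsto_add_atTop_nat 1)) ?_
    rw [tendsto_iff_norm_sub_tendsto_zero]
    have hb : ∀ k, ‖W (k + 1) t x - A.G P (nem D.K D.hp0 Z) t x‖ ≤
        Real.exp (D.κ * t) * (2 * E / (1 - D.θ) * D.θ ^ k * D.θ * D.χ x) := fun k => by
      have hk := nem_uc D.K D.hp0 (hg' k).uc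
      rw [← ContinuousMap.sub_apply, ← BoundedContinuousFunction.sub_apply, hWs, ← A.G_sub P hk hu]
      have h1θ : 0 < 1 - D.θ := by linarith
      refine D.weight_step (hk.sub hu) (a := 2 * E / (1 - D.θ) * D.θ ^ k) (by positivity)
        (fun t x => ?_) t x
      refine (D.nem_sub_le ⟨(hg' k).nonneg t x, (hg' k).le t x⟩
        ⟨hZg.nonneg t x, hZg.le t x⟩).trans (mul_le_mul_of_nonneg_left ?_ (D.Q_nonneg x))
      refine (hpt k t x).trans ?_
      have := D.hχ1 x
      calc _ = Real.exp (D.κ * t) * (2 * E / (1 - D.θ) * D.θ ^ k * (1 / 2)) := by ring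
        _ ≤ _ := by gcongr
    refine squeeze_zero (fun _ => norm_nonneg _) hb ?_
    have := (((tendsto_pow_atTop_nhds_zero_of_lt_one hθ.le hθ1).const_mul
      (2 * E / (1 - D.θ))).mul_const D.θ).mul_const (D.χ x)
    simpa using this.const_mul (Real.exp (D.κ * t))
  · have := hpt 0 t x
    rw [hW0, abs_sub_comm] at this
    refine this.trans (le_of_eq ?_)
    rw [pow_zero]; ring

/-- The heteroclinic curve. -/
theorem exists_curve : ∃ Z Z' Z'' : Crv C(S, ℝ), D.Good Z ∧
    A.Cl P Z Z' Z'' (nem D.K D.hp0 Z) ∧ Tendsto Z atBot (𝓝 D.V) ∧ ∃ t, ∀ x, Z t x < D.V x := by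
  obtain ⟨Z, hZ, hZe, c, hc, C, hC, H⟩ := D.exists_fixed_curve
  have hu := nem_uc D.K D.hp0 hZ.uc
  obtain ⟨Z1, hd1, hu1, -⟩ := A.G_smooth P hu
  rw [← hZe] at hd1
  have hpu : UC (D.p • (nem D.K (by linarith [D.hp] : 0 ≤ D.p - 1) Z * Z1)) :=
    (uc_mul (nem_uc _ _ hZ.uc) hu1).smul _
  obtain ⟨Z'', -, hCl⟩ := A.G_classical P (nem_isD D.K D.hp hd1) hpu
  rw [← hZe] at hCl
  have hκ : 0 < D.κ := D.hσ.trans D.hσκ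
  refine ⟨Z, _, Z'', hZ, hCl, ?_, ?_⟩
  · rw [tendsto_iff_norm_sub_tendsto_zero]
    have hb : ∀ t, ‖Z t - D.V‖ ≤ Real.exp (D.κ * t) * C + c * Real.exp (D.σ * t) * (3 / 2) := fun t => by
      rw [ContinuousMap.norm_le _ (by positivity)]
      intro x
      have h1 := abs_le.1 (H t x)
      rw [D.Z0_apply] at h1
      have h2 := lg_le_exp D.σ t
      have h3 := lg_pos D.σ t
      have h4 := D.hχ1 x
      have h5 : c * lg D.σ t * D.χ x ≤ c * Real.exp (D.σ * t) * (3 / 2) := by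
        gcongr
        · exact D.hχ2 x
      have h6 : 0 ≤ c * lg D.σ t * D.χ x := by positivity
      rw [ContinuousMap.sub_apply, Real.norm_eq_abs, abs_le]
      constructor <;> linarith
    refine squeeze_zero (fun _ => norm_nonneg _) hb ?_
    have e1 : ∀ a : ℝ, 0 < a → Tendsto (fun t => Real.exp (a * t)) atBot (𝓝 0) := fun a ha =>
      Real.tendsto_exp_atBot.comp (tendsto_id.const_mul_atBot ha)
    simpa using ((e1 _ hκ).mul_const C).add (((e1 _ D.hσ).const_mul c).mul_const (3 / 2))
  · have e1 : Tendsto (fun t => Real.exp ((D.κ - D.σ) * t)) atBot (𝓝 0) :=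
      Real.tendsto_exp_atBot.comp (tendsto_id.const_mul_atBot (sub_pos.2 D.hσκ))
    obtain ⟨t, ht, ht0⟩ := ((e1.eventually_lt_const (show 0 < c / (4 * C) / 1 by positivity)).and
      (eventually_le_atBot 0)).exists
    refine ⟨t, fun x => ?_⟩
    have h1 := abs_le.1 (H t x)
    rw [D.Z0_apply] at h1
    have h2 := lg_ge_exp (mul_nonpos_of_nonneg_of_nonpos D.hσ.le ht0)
    have h3 := D.hχ1 x
    have e2 : Real.exp (D.κ * t) = Real.exp ((D.κ - D.σ) * t) * Real.exp (D.σ * t) := by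
      rw [← Real.exp_add]; ring_nf
    have h4 : Real.exp (D.κ * t) * C < c * (Real.exp (D.σ * t) / 2) * (1 / 2) := by
      rw [e2]
      have hh := Real.exp_pos (D.σ * t)
      calc _ < c / (4 * C) / 1 * Real.exp (D.σ * t) * C := by gcongr
        _ = _ := by field_simp; ring
    have h6 := lg_pos D.σ t
    have h5 : c * (Real.exp (D.σ * t) / 2) * (1 / 2) ≤ c * lg D.σ t * D.χ x := by gcongr
    linarith

end Dat
end Gen
end ConeHet

namespace ConeHet
open scoped Topology BoundedContinuousFunction

namespace Gen
variable {S : Type} [MetricSpace S] [CompactSpace S] [Nonempty S] [MeasurableSpace S]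
  [BorelSpace S] {μ : Measure S} [IsProbabilityMeasure μ] (A : Gen S μ) (P : Par)

theorem exists_dat {K : C(S, ℝ)} (hK0 : ∀ x, 0 ≤ K x) (hK1 : ∀ x, K x ≤ 1) {k₀ : ℝ} (hk : 0 < k₀)
    (hK : k₀ ≤ ∫ x, K x ∂μ) (hk1 : k₀ ≤ 1) {p N : ℝ} (hp : 1 < p) (hpN : p ≤ N)
    (hs : P.l * ‖A.R‖ * (2 + 2 * N * 9 ^ N / k₀ ^ 2) ≤ 1 / 2)
    (hs' : 8 * ‖A.R‖ * (N * 3 ^ N / k₀ * P.l) ≤ 1)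
    (hB : 6 * (N * 3 ^ N / k₀ * P.l) < P.B ^ 2) :
    ∃ D : A.Dat P, D.K = K ∧ D.p = p := by
  have hl := P.hl
  have hBp := P.hB
  obtain ⟨V, hV, hVL, hVQ⟩ := A.exists_V hK0 hK1 hk hK hp hpN hl hs hk1
  obtain ⟨q, hq⟩ : ∃ q, q = N * 3 ^ N / k₀ * P.l := ⟨_, rfl⟩
  rw [← hq] at hs' hB hVQ
  have hp1 : 0 ≤ p - 1 := by linarith
  have hp0 : 0 ≤ p := by linarith
  have hq0 : 0 < q := by
    have : 0 < N := by linarith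
    rw [hq]; positivity
  set Q : C(S, ℝ) := p • (K * rp (p - 1) V) with hQ
  have hQx : ∀ x, Q x = p * (K x * V x ^ (p - 1)) := fun x => by
    simp only [Q, ContinuousMap.smul_apply, ContinuousMap.mul_apply, smul_eq_mul, rp_apply hp1]
  have hR : 0 ≤ ‖A.R‖ := A.R.opNorm_nonneg
  have hQn : ‖Q‖ ≤ q := by
    rw [ContinuousMap.norm_le _ hq0.le]
    intro x
    have h1 := hK0 x
    have h2 := (hV x).le
    rw [hQx, Real.norm_eq_abs, abs_of_nonneg (by positivity), ← mul_assoc]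
    exact hVQ x
  obtain ⟨χ, mh, hχ, hχL, hm⟩ := A.exists_chi (Q := Q) (le_trans (by gcongr) hs')
  have hVp : ∀ x, V x ^ (p - 1) * V x = V x ^ p := fun x => by
    rw [← Real.rpow_add_one (hV x).ne']; ring_nf
  have hμ : 0 < mh - P.l := by
    have hsym := A.sym _ _ _ _ hχL hVL
    have e1 : ∀ x, χ x * (P.l • V - K * rp p V) x = P.l * (χ * V) x - (χ * (K * rp p V)) x :=
      fun x => by
        change χ x * (P.l * V x - K x * rp p V x) = P.l * (χ x * V x) - χ x * (K x * rp p V x)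
        ring
    have e2 : ∀ x, V x * (mh • χ - Q * χ) x = mh * (χ * V) x - p * (χ * (K * rp p V)) x :=
      fun x => by
        change V x * (mh * χ x - Q x * χ x) = mh * (χ x * V x) - p * (χ x * (K x * rp p V x))
        rw [hQx, rp_apply hp0, ← hVp]; ring
    simp only [e1, e2] at hsym
    rw [integral_sub ((integrable _).const_mul _) (integrable _),
      integral_sub ((integrable _).const_mul _) ((integrable _).const_mul _),
      integral_const_mul, integral_const_mul, integral_const_mul] at hsym
    obtain ⟨x₀, hx₀⟩ := exists_min V
    have hv0 := hV x₀
    have hI1 : 0 < ∫ x, (χ * (K * rp p V)) x ∂μ := by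
      have h1 : (1 / 2 * V x₀ ^ p) * ∫ x, K x ∂μ ≤ ∫ x, (χ * (K * rp p V)) x ∂μ := by
        rw [← integral_const_mul]
        refine integral_mono ((integrable _).const_mul _) (integrable _) fun x => ?_
        change 1 / 2 * V x₀ ^ p * K x ≤ χ x * (K x * rp p V x)
        rw [rp_apply hp0]
        have h2 := hK0 x
        have h3 : V x₀ ^ p ≤ V x ^ p := Real.rpow_le_rpow hv0.le (hx₀ x) hp0
        have h4 := (hχ x).1
        calc _ = 1 / 2 * (K x * V x₀ ^ p) := by ring
          _ ≤ _ := by gcongr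
      have : 0 < (1 / 2 * V x₀ ^ p) * ∫ x, K x ∂μ := by
        have : 0 < ∫ x, K x ∂μ := hk.trans_le hK
        positivity
      linarith
    have hI2 : 0 ≤ ∫ x, (χ * V) x ∂μ := integral_nonneg fun x =>
      mul_nonneg (by linarith [(hχ x).1]) (hV x).le
    by_contra hneg
    nlinarith
  obtain ⟨m, hmdef⟩ : ∃ m, m = mh - P.l := ⟨_, rfl⟩
  have hmB : 4 * m < P.B ^ 2 := by nlinarith
  obtain ⟨s, hsdef⟩ : ∃ s, s = √(P.B ^ 2 - 4 * m) := ⟨_, rfl⟩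
  have hs2 : s ^ 2 = P.B ^ 2 - 4 * m := by rw [hsdef, Real.sq_sqrt (by linarith)]
  have hs0 : 0 < s := by rw [hsdef]; exact Real.sqrt_pos.2 (by linarith)
  have hsB : s < P.B := by
    rw [← hmdef] at hμ
    nlinarith
  have hσ : 0 < (P.B - s) / 2 := by linarith
  have hσκ : (P.B - s) / 2 < Min.min (2 * ((P.B - s) / 2)) (P.B / 2) :=
    lt_min (by linarith) (by linarith)
  have hκB : Min.min (2 * ((P.B - s) / 2)) (P.B / 2) ≤ P.B / 2 := min_le_right _ _
  obtain ⟨κ, hκ⟩ : ∃ κ, κ = Min.min (2 * ((P.B - s) / 2)) (P.B / 2) := ⟨_, rfl⟩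
  rw [← hκ] at hσκ hκB
  have hσe : ((P.B - s) / 2) ^ 2 - P.B * ((P.B - s) / 2) + (mh - P.l) = 0 := by
    rw [← hmdef]; nlinarith
  have hd : 0 < -(mh - P.l) - (κ ^ 2 - P.B * κ) := by
    rw [← hmdef]
    have : 0 < (κ - (P.B - s) / 2) * ((P.B + s) / 2 - κ) := mul_pos (by linarith) (by linarith)
    nlinarith
  exact ⟨⟨K, V, χ, p, mh, (P.B - s) / 2, κ, -(mh - P.l) - (κ ^ 2 - P.B * κ), hp, hK0, hV, hVL,
    fun x => (hχ x).1, fun x => (hχ x).2, hχL, hσ, hσκ, by rw [hκ]; exact min_le_left _ _, hσe, hd,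
    rfl⟩, rfl, rfl⟩

end Gen
end ConeHet

namespace ConeHet
open scoped Topology BoundedContinuousFunction

namespace Gen
variable {S : Type} [MetricSpace S] [CompactSpace S] [Nonempty S] [MeasurableSpace S]
  [BorelSpace S] {μ : Measure S} [IsProbabilityMeasure μ] (A : Gen S μ) (P : Par)

/-- A bounded nonincreasing curve leaving the stationary solution `V`. -/
structure Het where
  K : C(S, ℝ)
  V : C(S, ℝ)
  p : ℝ
  σ : ℝ
  Z : Crv C(S, ℝ)
  Z' : Crv C(S, ℝ)
  Z'' : Crv C(S, ℝ)
  hp : 1 < p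
  hK0 : ∀ x, 0 ≤ K x
  hK1 : ∀ x, K x ≤ 1
  hKf : ∀ f : C(S, ℝ), (∀ x, 0 ≤ f x) → ∫ x, K x * f x ∂μ = 0 → ∀ x, f x = 0
  hV : ∀ x, 0 < V x
  hVL : (V, P.l • V - K * rp p V) ∈ A.L
  hσ : 0 < σ
  hl : P.l = σ ^ 2 + P.B * σ
  nonneg : ∀ t x, 0 ≤ Z t x
  le : ∀ t x, Z t x ≤ V x
  anti : ∀ s ≥ 0, ∀ t x, Z (t + s) x ≤ Z t x
  cl : A.Cl P Z Z' Z'' (fun t => K * rp p (Z t))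
  lim : Tendsto Z atBot (𝓝 V)
  lt : ∃ t, ∀ x, Z t x < V x

namespace Het
variable {A P} (H : A.Het P)

theorem hp0 : 0 ≤ H.p := by linarith [H.hp]

theorem antitone (x : S) : Antitone fun t => H.Z t x := fun s t h => by
  have := H.anti (t - s) (by linarith) s x
  rwa [add_sub_cancel] at this

theorem hasDerivAt_const {φ : ℝ → ℝ} {φ' t : ℝ} (h : HasDerivAt φ φ' t) :
    HasDerivAt (fun t => ContinuousMap.const S (φ t)) (ContinuousMap.const S φ') t := by
  have e : ∀ c : ℝ, ContinuousMap.const S c = c • (1 : C(S, ℝ)) := fun c => by ext x; simp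
  simp only [e]
  exact h.smul_const (1 : C(S, ℝ))

theorem ge_of_sub {φ φ' φ'' : ℝ → ℝ} (h1 : ∀ t, HasDerivAt φ (φ' t) t)
    (h2 : ∀ t, HasDerivAt φ' (φ'' t) t) {a b : ℝ} (ha : ∀ x, φ a ≤ H.Z a x) (hb : ∀ x, φ b ≤ H.Z b x)
    (hneg : ∀ t ∈ Set.Ioo a b, ∀ x, H.Z t x < φ t →
      P.B * φ' t - φ'' t + P.l * H.Z t x - H.K x * H.Z t x ^ H.p < 0) :
    ∀ t ∈ Set.Icc a b, ∀ x, φ t ≤ H.Z t x := by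
  have key := A.max_principle (a := a) (b := b)
    (h := fun t => H.Z t - ContinuousMap.const S (φ t))
    (h' := fun t => H.Z' t - ContinuousMap.const S (φ' t))
    (h'' := fun t => H.Z'' t - ContinuousMap.const S (φ'' t))
    (g := fun t => P.l • H.Z t - H.Z'' t + P.B • H.Z' t - H.K * rp H.p (H.Z t))
    (fun t _ => ((H.cl.d1 t).sub (hasDerivAt_const (h1 t))).continuousAt.continuousWithinAt)
    (fun t _ => (H.cl.d1 t).sub (hasDerivAt_const (h1 t)))
    (fun t _ => (H.cl.d2 t).sub (hasDerivAt_const (h2 t)))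
    (fun t _ => by
      convert A.L.sub_mem (H.cl.eqn t) (A.const_mem (φ t)) using 1
      ext1
      · rfl
      · simp)
    (fun x => sub_nonneg.2 (ha x)) (fun x => sub_nonneg.2 (hb x)) (fun t ht x hx hx' => by
      change H.Z t x - φ t < 0 at hx
      change H.Z' t x - φ' t = 0 at hx'
      change H.Z'' t x - φ'' t + (P.l * H.Z t x - H.Z'' t x + P.B * H.Z' t x -
        H.K x * rp H.p (H.Z t) x) < 0
      have := hneg t ht x (by linarith)
      rw [rp_apply H.hp0, show H.Z' t x = φ' t by linarith]
      linarith)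
  exact fun t ht x => sub_nonneg.1 (key t ht x)

theorem le_of_super {φ φ' φ'' : ℝ → ℝ} (h1 : ∀ t, HasDerivAt φ (φ' t) t)
    (h2 : ∀ t, HasDerivAt φ' (φ'' t) t) {a b : ℝ} (ha : ∀ x, H.Z a x ≤ φ a) (hb : ∀ x, H.Z b x ≤ φ b)
    (hpos : ∀ t ∈ Set.Ioo a b, ∀ x, φ t < H.Z t x →
      0 < P.B * φ' t - φ'' t + P.l * H.Z t x - H.K x * H.Z t x ^ H.p) :
    ∀ t ∈ Set.Icc a b, ∀ x, H.Z t x ≤ φ t := by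
  have key := A.max_principle (a := a) (b := b)
    (h := fun t => ContinuousMap.const S (φ t) - H.Z t)
    (h' := fun t => ContinuousMap.const S (φ' t) - H.Z' t)
    (h'' := fun t => ContinuousMap.const S (φ'' t) - H.Z'' t)
    (g := fun t => -(P.l • H.Z t - H.Z'' t + P.B • H.Z' t - H.K * rp H.p (H.Z t)))
    (fun t _ => ((hasDerivAt_const (h1 t)).sub (H.cl.d1 t)).continuousAt.continuousWithinAt)
    (fun t _ => (hasDerivAt_const (h1 t)).sub (H.cl.d1 t))
    (fun t _ => (hasDerivAt_const (h2 t)).sub (H.cl.d2 t))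
    (fun t _ => by
      convert A.L.sub_mem (A.const_mem (φ t)) (H.cl.eqn t) using 1
      ext1
      · rfl
      · simp)
    (fun x => sub_nonneg.2 (ha x)) (fun x => sub_nonneg.2 (hb x)) (fun t ht x hx hx' => by
      change φ t - H.Z t x < 0 at hx
      change φ' t - H.Z' t x = 0 at hx'
      change φ'' t - H.Z'' t x + -(P.l * H.Z t x - H.Z'' t x + P.B * H.Z' t x -
        H.K x * rp H.p (H.Z t) x) < 0
      have := hpos t ht x (by linarith)
      rw [rp_apply H.hp0, show H.Z' t x = φ' t by linarith]
      linarith)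
  exact fun t ht x => sub_nonneg.1 (key t ht x)

theorem hasDerivAt_exp (c a t : ℝ) : HasDerivAt (fun t => c * Real.exp (-(a * t)))
    (-a * c * Real.exp (-(a * t))) t := by
  have := (((hasDerivAt_id t).const_mul a).neg.exp).const_mul c
  refine this.congr_deriv ?_
  simp; ring

theorem tendsto_exp {a : ℝ} (ha : 0 < a) : Tendsto (fun t => Real.exp (-(a * t))) atTop (𝓝 0) :=
  Real.tendsto_exp_neg_atTop_nhds_zero.comp (tendsto_id.const_mul_atTop ha)

theorem lower {T m : ℝ} (hm : 0 ≤ m) (h : ∀ x, m * Real.exp (-(H.σ * T)) ≤ H.Z T x) :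
    ∀ t ≥ T, ∀ x, m * Real.exp (-(H.σ * t)) ≤ H.Z t x := by
  intro t ht x
  refine le_of_forall_pos_le_add fun ε hε => ?_
  have hσ := H.hσ
  have hl := P.hl
  obtain ⟨b, hb1, hb2⟩ := (((((tendsto_exp hσ).const_mul m)).eventually_lt_const
    (show m * 0 < ε by simpa)).and (eventually_ge_atTop t)).exists
  have := H.ge_of_sub (φ := fun t => m * Real.exp (-(H.σ * t)) - ε) (a := T) (b := b)
    (fun t => (hasDerivAt_exp m H.σ t).sub_const ε) (fun t => hasDerivAt_exp _ _ t)
    (fun x => by linarith [h x]) (fun x => by linarith [H.nonneg b x]) (fun t ht x hx => by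
      have h0 := mul_nonneg (H.hK0 x) (Real.rpow_nonneg (H.nonneg t x) H.p)
      have h1 := mul_lt_mul_of_pos_left hx hl
      have h2 : P.l * (m * Real.exp (-(H.σ * t)) - ε) =
        H.σ ^ 2 * m * Real.exp (-(H.σ * t)) + P.B * H.σ * m * Real.exp (-(H.σ * t)) - P.l * ε := by
        rw [mul_sub]; nth_rw 1 [H.hl]; ring
      nlinarith) t ⟨ht, hb2⟩ x
  linarith

theorem pos (t : ℝ) (x : S) : 0 < H.Z t x := by
  obtain ⟨x₀, hx₀⟩ := exists_min H.V
  have hv := H.hV x₀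
  obtain ⟨T, hT, hTt⟩ := (((Metric.tendsto_nhds.1 H.lim _ hv)).and (eventually_le_atBot t)).exists
  rw [dist_comm, dist_eq_norm] at hT
  obtain ⟨y, hy⟩ := exists_min (H.Z T)
  have hy0 : 0 < H.Z T y := by
    have h1 := (le_abs_self _).trans ((H.V - H.Z T).norm_coe_le_norm y)
    rw [ContinuousMap.sub_apply] at h1
    linarith [hx₀ y]
  have := H.lower (T := T) (m := H.Z T y * Real.exp (H.σ * T)) (by positivity) (fun x => by
    rw [mul_assoc, ← Real.exp_add, add_neg_cancel, Real.exp_zero, mul_one]; exact hy x) t hTt x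
  exact lt_of_lt_of_le (by positivity) this

end Het
end Gen
end ConeHet

namespace ConeHet
open scoped Topology BoundedContinuousFunction

/-- A bounded function with bounded derivative cannot satisfy `u'' - B u' ≥ ε` near infinity. -/
theorem exists_lt_of_bounded {u u' u'' : ℝ → ℝ} {B M ε T : ℝ} (hB : 0 ≤ B) (hε : 0 < ε)
    (h1 : ∀ t, HasDerivAt u (u' t) t) (h2 : ∀ t, HasDerivAt u' (u'' t) t)
    (hu : ∀ t ≥ T, |u t| ≤ M) (hu' : ∀ t ≥ T, |u' t| ≤ M) : ∃ t ≥ T, u'' t - B * u' t < ε := by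
  by_contra hcon
  push Not at hcon
  have hM : 0 ≤ M := (abs_nonneg _).trans (hu T le_rfl)
  have hd : ∀ t, HasDerivAt (fun t => u' t - B * u t - ε * t) (u'' t - B * u' t - ε) t := fun t => by
    have := ((h2 t).sub ((h1 t).const_mul B)).sub ((hasDerivAt_id t).const_mul ε)
    refine this.congr_deriv (by simp)
  have hmono : MonotoneOn (fun t => u' t - B * u t - ε * t) (Set.Ici T) := by
    refine monotoneOn_of_deriv_nonneg (convex_Ici T)
      (fun t _ => (hd t).continuousAt.continuousWithinAt)
      (fun t _ => (hd t).differentiableAt.differentiableWithinAt) fun t ht => ?_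
    rw [(hd t).deriv]
    rw [interior_Ici] at ht
    linarith [hcon t (le_of_lt ht)]
  obtain ⟨t, ht⟩ : ∃ t, t = T + (2 * (M + B * M) + 1) / ε := ⟨_, rfl⟩
  have htT : T ≤ t := by
    rw [ht]
    have : 0 ≤ (2 * (M + B * M) + 1) / ε := by positivity
    linarith
  have h := hmono (Set.mem_Ici.2 le_rfl) (Set.mem_Ici.2 htT) htT
  have e : ε * t = ε * T + (2 * (M + B * M) + 1) := by rw [ht]; field_simp
  simp only at h
  rw [e] at h
  have b1 := abs_le.1 (hu T le_rfl); have b2 := abs_le.1 (hu t htT)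
  have b3 := abs_le.1 (hu' T le_rfl); have b4 := abs_le.1 (hu' t htT)
  nlinarith

namespace Gen
variable {S : Type} [MetricSpace S] [CompactSpace S] [Nonempty S] [MeasurableSpace S]
  [BorelSpace S] {μ : Measure S} [IsProbabilityMeasure μ] {A : Gen S μ} {P : Par}

/-- Integration as a continuous linear functional. -/
noncomputable def intL (μ : Measure S) [IsProbabilityMeasure μ] : C(S, ℝ) →L[ℝ] ℝ :=
  LinearMap.mkContinuous
    { toFun := fun f => ∫ x, f x ∂μ
      map_add' := fun f g => integral_add (integrable f) (integrable g)
      map_smul' := fun c f => integral_const_mul c _ } 1 fun f => by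
    rw [one_mul]; exact abs_integral_le f

namespace Het
variable (H : A.Het P)

theorem tendsto_zero : Tendsto H.Z atTop (𝓝 0) := by
  have hp0 := H.hp0
  obtain ⟨C, hC⟩ := A.lip
  have hpt : ∀ x, ∃ z, Tendsto (fun t => H.Z t x) atTop (𝓝 z) := fun x =>
    ⟨_, tendsto_atTop_ciInf (H.antitone x) ⟨0, by rintro _ ⟨t, rfl⟩; exact H.nonneg t x⟩⟩
  choose z hz using hpt
  obtain ⟨F, hF⟩ : ∃ F, F = P.l * ‖H.Z‖ + ‖H.Z''‖ + P.B * ‖H.Z'‖ + ‖nem H.K hp0 H.Z‖ := ⟨_, rfl⟩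
  have hl := P.hl
  have hB := P.hB
  have hbd : ∀ t, ‖P.l • H.Z t - H.Z'' t + P.B • H.Z' t - H.K * rp H.p (H.Z t)‖ ≤ F := fun t => by
    have h1 := H.Z.norm_coe_le_norm t
    have h2 := H.Z'.norm_coe_le_norm t
    have h3 := H.Z''.norm_coe_le_norm t
    have h4 := (nem H.K hp0 H.Z).norm_coe_le_norm t
    refine (norm_sub_le _ _).trans ?_
    refine (add_le_add ((norm_add_le _ _).trans (add_le_add (norm_sub_le _ _) le_rfl)) h4).trans ?_
    rw [norm_smul, norm_smul, Real.norm_of_nonneg hl.le, Real.norm_of_nonneg hB.le, hF]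
    gcongr
  have hF0 : 0 ≤ F := (norm_nonneg _).trans (hbd 0)
  have hzl : ∀ x y, |z x - z y| ≤ |C| * F * dist x y := fun x y => by
    refine le_of_tendsto ((hz x).sub (hz y)).abs (Eventually.of_forall fun t => ?_)
    refine (hC _ _ (H.cl.eqn t) x y).trans ?_
    gcongr
    · exact le_abs_self C
    · exact hbd t
  have hzc : Continuous z := (LipschitzWith.of_dist_le_mul (K := ⟨|C| * F, by positivity⟩)
    fun x y => by rw [Real.dist_eq]; exact hzl x y).continuous
  obtain ⟨W, hW⟩ : ∃ W : C(S, ℝ), ∀ x, W x = z x := ⟨⟨z, hzc⟩, fun _ => rfl⟩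
  simp only [← hW] at hz
  have hlim : Tendsto H.Z atTop (𝓝 W) :=
    ContinuousMap.tendsto_of_antitone_of_pointwise (fun s t h x => H.antitone x h) hz
  have hW0 : ∀ x, 0 ≤ W x := fun x => ge_of_tendsto' (hz x) fun t => H.nonneg t x
  obtain ⟨t₀, ht₀⟩ := H.lt
  have hWV : ∀ x, W x < H.V x := fun x =>
    ((H.antitone x).le_of_tendsto (hz x) t₀).trans_lt (ht₀ x)
  -- the defect of the pairing with `V`
  let N : C(S, ℝ) → C(S, ℝ) := fun w => H.K * (w * rp H.p H.V - H.V * rp H.p w)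
  have hNc : Continuous N := by
    have := continuous_rp (S := S) hp0
    fun_prop
  have hNx : ∀ w x, N w x = H.K x * (w x * H.V x ^ H.p - H.V x * w x ^ H.p) := fun w x => by
    change H.K x * (w x * rp H.p H.V x - H.V x * rp H.p w x) = _
    rw [rp_apply hp0, rp_apply hp0]
  have hfac : ∀ w : ℝ, ∀ x, 0 ≤ w → w * H.V x ^ H.p - H.V x * w ^ H.p =
      w * H.V x * (H.V x ^ (H.p - 1) - w ^ (H.p - 1)) := fun w x hw => by
    have e1 : H.V x ^ H.p = H.V x ^ (H.p - 1) * H.V x := by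
      rw [← Real.rpow_add_one (H.hV x).ne']; ring_nf
    have e2 : w ^ H.p = w ^ (H.p - 1) * w := by
      rcases hw.eq_or_lt with rfl | hw
      · rw [Real.zero_rpow (by linarith [H.hp]), mul_zero]
      · rw [← Real.rpow_add_one hw.ne']; ring_nf
    rw [e1, e2]; ring
  have hp1 : 0 < H.p - 1 := by linarith [H.hp]
  have hnn : ∀ x, 0 ≤ (W * rp H.p H.V - H.V * rp H.p W) x := fun x => by
    change 0 ≤ W x * rp H.p H.V x - H.V x * rp H.p W x
    rw [rp_apply hp0, rp_apply hp0, hfac _ _ (hW0 x)]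
    exact mul_nonneg (mul_nonneg (hW0 x) (H.hV x).le)
      (sub_nonneg.2 (Real.rpow_le_rpow (hW0 x) (hWV x).le hp1.le))
  have hIz : ∫ x, H.K x * (W * rp H.p H.V - H.V * rp H.p W) x ∂μ = 0 := by
    by_contra hne
    have hpos : 0 < intL μ (N W) := lt_of_le_of_ne
      (integral_nonneg fun x => mul_nonneg (H.hK0 x) (hnn x)) (Ne.symm hne)
    have ht : Tendsto (fun t => intL μ (N (H.Z t))) atTop (𝓝 (intL μ (N W))) :=
      (((intL μ).continuous.comp hNc).tendsto W).comp hlim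
    obtain ⟨T, hT⟩ := (ht.eventually_const_lt (half_lt_self hpos)).exists_forall_of_atTop
    let ev : C(S, ℝ) →L[ℝ] ℝ := (intL μ).comp (ContinuousLinearMap.mul ℝ C(S, ℝ) H.V)
    have hev : ∀ w, ev w = ∫ x, H.V x * w x ∂μ := fun w => rfl
    have d1 : ∀ t, HasDerivAt (fun t => ev (H.Z t)) (ev (H.Z' t)) t := fun t =>
      ev.hasFDerivAt.comp_hasDerivAt t (H.cl.d1 t)
    have d2 : ∀ t, HasDerivAt (fun t => ev (H.Z' t)) (ev (H.Z'' t)) t := fun t =>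
      ev.hasFDerivAt.comp_hasDerivAt t (H.cl.d2 t)
    obtain ⟨M, hM⟩ : ∃ M, M = ‖ev‖ * ‖H.Z‖ + ‖ev‖ * ‖H.Z'‖ := ⟨_, rfl⟩
    have hev0 : 0 ≤ ‖ev‖ := ev.opNorm_nonneg
    obtain ⟨t, htT, hlt⟩ := exists_lt_of_bounded (M := M) (T := T) P.hB.le (half_pos hpos) d1 d2
      (fun t _ => by
        refine (ev.le_opNorm _).trans ?_
        have := mul_le_mul_of_nonneg_left (H.Z.norm_coe_le_norm t) hev0
        have : 0 ≤ ‖ev‖ * ‖H.Z'‖ := by positivity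
        linarith)
      (fun t _ => by
        refine (ev.le_opNorm _).trans ?_
        have := mul_le_mul_of_nonneg_left (H.Z'.norm_coe_le_norm t) hev0
        have : 0 ≤ ‖ev‖ * ‖H.Z‖ := by positivity
        linarith)
    have hs := A.sym _ _ _ _ (H.cl.eqn t) H.hVL
    have e1 : ∫ x, H.Z t x * (P.l • H.V - H.K * rp H.p H.V) x ∂μ =
        intL μ (H.Z t * (P.l • H.V - H.K * rp H.p H.V)) := rfl
    have e2 : ∫ x, H.V x * (P.l • H.Z t - H.Z'' t + P.B • H.Z' t - H.K * rp H.p (H.Z t)) x ∂μ =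
        intL μ (H.V * (P.l • H.Z t - H.Z'' t + P.B • H.Z' t - H.K * rp H.p (H.Z t))) := rfl
    have e3 : ev (H.Z'' t) - P.B * ev (H.Z' t) = intL μ (N (H.Z t)) := by
      rw [e1, e2, ← sub_eq_zero, ← map_sub] at hs
      have e4 : intL μ (H.V * H.Z'' t) - P.B * intL μ (H.V * H.Z' t) - intL μ (N (H.Z t)) = 0 := by
        have h5 : H.V * H.Z'' t - P.B • (H.V * H.Z' t) - N (H.Z t) =
            H.Z t * (P.l • H.V - H.K * rp H.p H.V) -
            H.V * (P.l • H.Z t - H.Z'' t + P.B • H.Z' t - H.K * rp H.p (H.Z t)) := by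
          ext x
          change H.V x * H.Z'' t x - P.B * (H.V x * H.Z' t x) -
            H.K x * (H.Z t x * rp H.p H.V x - H.V x * rp H.p (H.Z t) x) =
            H.Z t x * (P.l * H.V x - H.K x * rp H.p H.V x) - H.V x * (P.l * H.Z t x -
            H.Z'' t x + P.B * H.Z' t x - H.K x * rp H.p (H.Z t) x)
          ring
        have h6 := congrArg (intL μ) h5
        rw [hs, map_sub, map_sub, map_smul, smul_eq_mul] at h6
        exact h6
      exact sub_eq_zero.1 e4
    rw [e3] at hlt
    exact lt_asymm hlt (hT t htT)
  have hz0 := H.hKf _ hnn hIz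
  have : W = 0 := by
    ext x
    have h := hz0 x
    change W x * rp H.p H.V x - H.V x * rp H.p W x = 0 at h
    rw [rp_apply hp0, rp_apply hp0, hfac _ _ (hW0 x)] at h
    have h1 : 0 < H.V x ^ (H.p - 1) - W x ^ (H.p - 1) :=
      sub_pos.2 (Real.rpow_lt_rpow (hW0 x) (hWV x) hp1)
    have h2 := H.hV x
    simpa [h1.ne', h2.ne'] using h
  rwa [← this]

end Het
end Gen
end ConeHet

namespace ConeHet
open scoped Topology BoundedContinuousFunction

namespace Gen
variable {S : Type} [MetricSpace S] [CompactSpace S] [Nonempty S] [MeasurableSpace S]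
  [BorelSpace S] {μ : Measure S} [IsProbabilityMeasure μ] {A : Gen S μ} {P : Par}

namespace Het
variable (H : A.Het P)

theorem small {ε : ℝ} (hε : 0 < ε) : ∃ T, ∀ t ≥ T, ∀ x, H.Z t x ≤ ε := by
  obtain ⟨T, hT⟩ := eventually_atTop.1 (Metric.tendsto_nhds.1 H.tendsto_zero ε hε)
  refine ⟨T, fun t ht x => ?_⟩
  have := hT t ht
  rw [dist_zero_right] at this
  exact (le_abs_self _).trans (((H.Z t).norm_coe_le_norm x).trans this.le)

theorem decay {a : ℝ} (ha : 0 < a) (haσ : a < H.σ) :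
    ∃ C T, 0 ≤ C ∧ ∀ t ≥ T, ∀ x, H.Z t x ≤ C * Real.exp (-(a * t)) := by
  have hB := P.hB
  obtain ⟨η, hη⟩ : ∃ η, η = P.l - (a ^ 2 + P.B * a) := ⟨_, rfl⟩
  have hη0 : 0 < η := by
    have := H.hl
    nlinarith
  have hp1 : 0 < H.p - 1 := by linarith [H.hp]
  obtain ⟨e, he⟩ : ∃ e, e = η ^ (1 / (H.p - 1)) := ⟨_, rfl⟩
  have he0 : 0 < e := he ▸ Real.rpow_pos_of_pos hη0 _
  have hee : e ^ (H.p - 1) = η := by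
    rw [he, ← Real.rpow_mul hη0.le, one_div, inv_mul_cancel₀ hp1.ne', Real.rpow_one]
  obtain ⟨T, hT⟩ := H.small he0
  refine ⟨e * Real.exp (a * T), T, by positivity, fun t ht x => ?_⟩
  refine le_of_forall_pos_le_add fun ε hε => ?_
  obtain ⟨b, hb⟩ := H.small hε
  have hN : ∀ t ≥ T, ∀ x, H.K x * H.Z t x ^ H.p ≤ η * H.Z t x := fun t ht x => by
    have h0 := H.nonneg t x
    have h1 : H.Z t x ^ H.p = H.Z t x ^ (H.p - 1) * H.Z t x := by
      conv_lhs => rw [show H.p = (H.p - 1) + 1 by ring]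
      rw [Real.rpow_add_one' h0 (by linarith)]
    rw [h1, ← mul_assoc]
    refine mul_le_mul_of_nonneg_right ?_ h0
    have h2 := Real.rpow_le_rpow h0 (hT t ht x) hp1.le
    rw [hee] at h2
    exact (mul_le_of_le_one_left (Real.rpow_nonneg h0 _) (H.hK1 x)).trans h2
  have := H.le_of_super (φ := fun t => e * Real.exp (a * T) * Real.exp (-(a * t)) + ε) (a := T)
    (b := Max.max b t)
    (fun t => (hasDerivAt_exp _ a t).add_const ε) (fun t => hasDerivAt_exp _ _ t)
    (fun x => by
      have := hT T le_rfl x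
      rw [mul_assoc, ← Real.exp_add, add_neg_cancel, Real.exp_zero]
      linarith)
    (fun x => (hb _ (le_max_left _ _) x).trans (le_add_of_nonneg_left (by positivity)))
    (fun t ht x hx => by
      have h1 := hN t ht.1.le x
      obtain ⟨E, hE⟩ : ∃ E, E = e * Real.exp (a * T) * Real.exp (-(a * t)) := ⟨_, rfl⟩
      have h2 : -a * (-a * (e * Real.exp (a * T))) * Real.exp (-(a * t)) = a ^ 2 * E := by
        rw [hE]; ring
      have h3 : -a * (e * Real.exp (a * T)) * Real.exp (-(a * t)) = - a * E := by
        rw [hE]; ring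
      have h4 : E < H.Z t x := by rw [hE]; linarith
      rw [h2, h3]
      have h5 : (a ^ 2 + P.B * a) * E < (a ^ 2 + P.B * a) * H.Z t x :=
        mul_lt_mul_of_pos_left h4 (by positivity)
      have h6 : η * H.Z t x = P.l * H.Z t x - (a ^ 2 + P.B * a) * H.Z t x := by rw [hη]; ring
      linarith) t ⟨ht, le_max_right _ _⟩ x
  exact this

/-- Once `Z` lies below a slow exponential it stays below a slight enlargement of it. -/
theorem upper : ∃ C T δ, 0 ≤ C ∧ 0 < δ ∧
    (∀ t ≥ T, ∀ x, H.K x * H.Z t x ^ H.p ≤ C * Real.exp (-((H.σ + δ) * t))) ∧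
    ∀ T' ≥ T, ∀ m, (∀ x, H.Z T' x ≤ m * Real.exp (-(H.σ * T'))) → ∀ t ≥ T', ∀ x,
      H.Z t x ≤ (m + C * Real.exp (-(δ * T'))) * Real.exp (-(H.σ * t)) := by
  have hσ := H.hσ
  have hB := P.hB
  have hl := P.hl
  have hp := H.hp
  have hp0 : 0 < H.p := by linarith
  obtain ⟨a, ha⟩ : ∃ a, a = H.σ * (1 + 1 / H.p) / 2 := ⟨_, rfl⟩
  have hpi : 1 / H.p < 1 := (div_lt_one hp0).2 hp
  have hpi0 : 0 < 1 / H.p := by positivity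
  have ha0 : 0 < a := by rw [ha]; positivity
  obtain ⟨C, T, hC, hT⟩ := H.decay ha0 (by rw [ha]; nlinarith)
  obtain ⟨δ, hδ⟩ : ∃ δ, δ = H.p * a - H.σ := ⟨_, rfl⟩
  have hδ0 : 0 < δ := by
    have : H.p * a = H.σ * (H.p + 1) / 2 := by rw [ha]; field_simp
    rw [hδ, this]; nlinarith
  obtain ⟨D, hD⟩ : ∃ D, D = δ ^ 2 + 2 * H.σ * δ + P.B * δ := ⟨_, rfl⟩
  have hD0 : 0 < D := by rw [hD]; positivity
  have hCp := Real.rpow_nonneg hC H.p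
  have hsrc : ∀ t ≥ T, ∀ x, H.K x * H.Z t x ^ H.p ≤ C ^ H.p * Real.exp (-((H.σ + δ) * t)) :=
    fun t ht x => by
      refine (mul_le_of_le_one_left (Real.rpow_nonneg (H.nonneg t x) _) (H.hK1 x)).trans ?_
      refine (Real.rpow_le_rpow (H.nonneg t x) (hT t ht x) hp0.le).trans (le_of_eq ?_)
      rw [Real.mul_rpow hC (Real.exp_pos _).le, ← Real.exp_mul, hδ]
      congr 2; ring
  refine ⟨C ^ H.p + C ^ H.p / D, T, δ, by positivity, hδ0, fun t ht x =>
    (hsrc t ht x).trans (mul_le_mul_of_nonneg_right (by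
      have : 0 ≤ C ^ H.p / D := by positivity
      linarith) (Real.exp_pos _).le), fun T' hT' m hm t ht x => ?_⟩
  obtain ⟨K', hK'⟩ : ∃ K', K' = C ^ H.p / D := ⟨_, rfl⟩
  have hK0 : 0 ≤ K' := by rw [hK']; positivity
  have hK'' : D * K' = C ^ H.p := by rw [hK']; field_simp
  obtain ⟨M, hM⟩ : ∃ M, M = m + K' * Real.exp (-(δ * T')) := ⟨_, rfl⟩
  suffices h : H.Z t x ≤ M * Real.exp (-(H.σ * t)) by
    refine h.trans (mul_le_mul_of_nonneg_right ?_ (Real.exp_pos _).le)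
    rw [hM, hK']
    have := mul_nonneg hCp (Real.exp_pos (-(δ * T'))).le
    linarith [add_mul (C ^ H.p) (C ^ H.p / D) (Real.exp (-(δ * T')))]
  refine le_of_forall_pos_le_add fun ε hε => ?_
  have hlim : Tendsto (fun t => M * Real.exp (-(H.σ * t)) - K' * Real.exp (-((H.σ + δ) * t)))
      atTop (𝓝 0) := by
    simpa using ((tendsto_exp hσ).const_mul M).sub ((tendsto_exp (add_pos hσ hδ0)).const_mul K')
  obtain ⟨b, ⟨hb1, hb2⟩, hb3⟩ := ((hlim.eventually_const_lt (show -(ε / 2) < 0 by linarith)).and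
    ((eventually_atTop.2 (H.small (half_pos hε)))) |>.and (eventually_ge_atTop t)).exists
  have key := H.le_of_super (φ := fun t => M * Real.exp (-(H.σ * t)) -
      K' * Real.exp (-((H.σ + δ) * t)) + ε) (a := T') (b := b)
    (fun t => ((hasDerivAt_exp M H.σ t).sub (hasDerivAt_exp K' (H.σ + δ) t)).add_const ε)
    (fun t => (hasDerivAt_exp _ _ t).sub (hasDerivAt_exp _ _ t))
    (fun x => by
      have h1 := hm x
      have h2 : Real.exp (-((H.σ + δ) * T')) = Real.exp (-(δ * T')) * Real.exp (-(H.σ * T')) := by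
        rw [← Real.exp_add]; congr 1; ring
      rw [h2, hM]
      nlinarith) (fun x => by linarith [hb2 x])
    (fun t ht x hx => by
      obtain ⟨E, hE⟩ : ∃ E, E = Real.exp (-(H.σ * t)) := ⟨_, rfl⟩
      obtain ⟨E', hE'⟩ : ∃ E', E' = Real.exp (-((H.σ + δ) * t)) := ⟨_, rfl⟩
      have h1 := hsrc t (hT'.trans ht.1.le) x
      rw [← hE'] at h1
      rw [← hE, ← hE'] at hx ⊢
      have h2 := mul_lt_mul_of_pos_left hx hl
      have h3 : P.l * (M * E - K' * E' + ε) = H.σ ^ 2 * M * E + P.B * H.σ * M * E - P.l * K' * E' +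
        P.l * ε := by
        rw [mul_add, mul_sub]; nth_rw 1 [H.hl]; ring
      have h4 : P.l * K' * E' = H.σ ^ 2 * K' * E' + P.B * H.σ * K' * E' := by
        rw [H.hl]; ring
      rw [← hK'', hD] at h1
      have h5 := mul_pos hl hε
      nlinarith) t ⟨ht, hb3⟩ x
  have : 0 ≤ K' * Real.exp (-((H.σ + δ) * t)) := by positivity
  linarith

end Het
end Gen
end ConeHet

namespace ConeHet
open scoped Topology BoundedContinuousFunction

theorem contDiff_succ_of {E : Type*} [NormedAddCommGroup E] [NormedSpace ℝ E] {n : ℕ} {h h' : ℝ → E}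
    (hh : ∀ t, HasDerivAt h (h' t) t) (hc : ContDiff ℝ n h') : ContDiff ℝ (n + 1 : ℕ) h := by
  have : deriv h = h' := funext fun t => (hh t).deriv
  push_cast
  refine contDiff_succ_iff_deriv.2 ⟨fun t => (hh t).differentiableAt, by simp, this ▸ hc⟩

theorem exists_derivs {E : Type*} [NormedAddCommGroup E] [NormedSpace ℝ E] {f : ℝ → E}
    (hf : ContDiff ℝ (2 : ℕ) f) : ∃ f' f'' : ℝ → E, (∀ t, HasDerivAt f (f' t) t) ∧
      (∀ t, HasDerivAt f' (f'' t) t) ∧ Continuous f'' := by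
  have h1 : ContDiff ℝ ((1 : ℕ) + 1) f := by exact_mod_cast hf
  obtain ⟨h2, -, h3⟩ := contDiff_succ_iff_deriv.1 h1
  have h4 : ContDiff ℝ ((0 : ℕ) + 1) (deriv f) := by exact_mod_cast h3
  obtain ⟨h5, -, h6⟩ := contDiff_succ_iff_deriv.1 h4
  exact ⟨deriv f, deriv (deriv f), fun t => (h2 t).hasDerivAt, fun t => (h5 t).hasDerivAt,
    h6.continuous⟩

namespace Gen
variable {S : Type} [MetricSpace S] [CompactSpace S] [Nonempty S] [MeasurableSpace S]
  [BorelSpace S] {μ : Measure S} [IsProbabilityMeasure μ] {A : Gen S μ} {P : Par}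

theorem Cl.gradient_exp {h h' h'' f : ℝ → C(S, ℝ)} (H : A.Cl P h h' h'' f) {C T σ : ℝ} (hσ : 0 < σ)
    (hC : 0 ≤ C)
    (h1 : ∀ t ≥ T, ‖h t‖ ≤ C * Real.exp (-(σ * t))) (h2 : ∀ t ≥ T, ‖f t‖ ≤ C * Real.exp (-(σ * t))) :
    ∃ C' ≥ 0, ∀ t ≥ T + 1, ‖h' t‖ ≤ C' * Real.exp (-(σ * t)) := by
  have hP := P.C_pos
  refine ⟨P.C * (C * Real.exp σ + C * Real.exp σ), by positivity, fun t ht => ?_⟩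
  have hw : ∀ s, |s - t| ≤ 1 → s ≥ T ∧ C * Real.exp (-(σ * s)) ≤
      C * Real.exp σ * Real.exp (-(σ * t)) := fun s hs => by
    rw [abs_le] at hs
    refine ⟨by linarith, ?_⟩
    rw [mul_assoc, ← Real.exp_add]
    refine mul_le_mul_of_nonneg_left (Real.exp_le_exp.2 ?_) hC
    nlinarith
  refine (H.gradient (fun s hs => (h1 s (hw s hs).1).trans (hw s hs).2)
    (fun s hs => (h2 s (hw s hs).1).trans (hw s hs).2)).trans (le_of_eq (by ring))

namespace Het
variable (H : A.Het P)

theorem hasDerivAt_source (t : ℝ) : HasDerivAt (fun t => H.K * rp H.p (H.Z t))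
    (H.K * (H.p • (rp (H.p - 1) (H.Z t) * H.Z' t))) t :=
  (hasDerivAt_rp' H.p H.pos (H.cl.d1 t)).const_mul H.K

theorem contDiff_source {n : ℕ} (hZ : ContDiff ℝ n H.Z) :
    ContDiff ℝ n fun t => H.K * rp H.p (H.Z t) :=
  contDiff_const.mul (contDiff_rp n H.p H.pos hZ fun t => (H.cl.d1 t).differentiableAt)

theorem smooth : ContDiff ℝ (4 : ℕ) H.Z ∧
    ∃ Z3 : ℝ → C(S, ℝ), A.Cl P H.Z' H.Z'' Z3 (fun t => H.K * (H.p • (rp (H.p - 1) (H.Z t) * H.Z' t))) := by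
  have c2 : ContDiff ℝ (2 : ℕ) H.Z := contDiff_succ_of (n := 1) H.cl.d1
    (contDiff_succ_of (n := 0) H.cl.d2 (contDiff_zero.2 H.Z''.continuous))
  obtain ⟨f', f'', hf', hf'', hc⟩ := exists_derivs (H.contDiff_source c2)
  have e : f' = fun t => H.K * (H.p • (rp (H.p - 1) (H.Z t) * H.Z' t)) :=
    funext fun t => (hf' t).unique (H.hasDerivAt_source t)
  obtain ⟨Z3, hZ3, cl3⟩ := Cl.deriv_smooth H.cl H.Z''.continuous hf' hf'' hc
  have c3 : ContDiff ℝ (3 : ℕ) H.Z := contDiff_succ_of (n := 2) H.cl.d1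
    (contDiff_succ_of (n := 1) H.cl.d2 (contDiff_succ_of (n := 0) cl3.d2 (contDiff_zero.2 hZ3)))
  have cf : ContDiff ℝ (2 : ℕ) f' := by
    have h1 : ContDiff ℝ ((2 : ℕ) + 1) (fun t => H.K * rp H.p (H.Z t)) := by
      exact_mod_cast H.contDiff_source c3
    have h2 := (contDiff_succ_iff_deriv.1 h1).2.2
    rwa [show deriv (fun t => H.K * rp H.p (H.Z t)) = f' from funext fun t => (hf' t).deriv] at h2
  obtain ⟨g', g'', hg', hg'', hgc⟩ := exists_derivs cf
  obtain ⟨Z4, hZ4, cl4⟩ := Cl.deriv_smooth cl3 hZ3 hg' hg'' hgc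
  refine ⟨contDiff_succ_of (n := 3) H.cl.d1 (contDiff_succ_of (n := 2) H.cl.d2
    (contDiff_succ_of (n := 1) cl3.d2 (contDiff_succ_of (n := 0) cl4.d2 (contDiff_zero.2 hZ4)))),
    Z3, ?_⟩
  rw [← e]; exact cl3

theorem decay_all : ∃ C T, 0 ≤ C ∧ ∀ t ≥ T, ‖H.Z t‖ ≤ C * Real.exp (-(H.σ * t)) ∧
    ‖H.K * rp H.p (H.Z t)‖ ≤ C * Real.exp (-(H.σ * t)) ∧ ‖H.Z' t‖ ≤ C * Real.exp (-(H.σ * t)) ∧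
    ‖H.Z'' t‖ ≤ C * Real.exp (-(H.σ * t)) := by
  obtain ⟨C, T, δ, hC, hδ, hsrc, hup⟩ := H.upper
  have hσ := H.hσ
  have hp := H.hp
  obtain ⟨T0, hT0⟩ : ∃ T0, T0 = Max.max T 0 := ⟨_, rfl⟩
  have hTT : T ≤ T0 := hT0 ▸ le_max_left _ _
  have hT00 : 0 ≤ T0 := hT0 ▸ le_max_right _ _
  obtain ⟨C1, hC1⟩ : ∃ C1, C1 = Max.max (‖H.Z T0‖ * Real.exp (H.σ * T0) +
    C * Real.exp (-(δ * T0))) C := ⟨_, rfl⟩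
  have hCC : C ≤ C1 := hC1 ▸ le_max_right _ _
  have hC10 := hC.trans hCC
  have hZ : ∀ t ≥ T0, ‖H.Z t‖ ≤ C1 * Real.exp (-(H.σ * t)) := fun t ht => by
    rw [ContinuousMap.norm_le _ (by positivity)]
    intro x
    rw [Real.norm_of_nonneg (H.nonneg t x)]
    refine (hup T0 hTT (‖H.Z T0‖ * Real.exp (H.σ * T0)) (fun x => ?_) t ht x).trans
      (mul_le_mul_of_nonneg_right (hC1 ▸ le_max_left _ _) (Real.exp_pos _).le)
    rw [mul_assoc, ← Real.exp_add, add_neg_cancel, Real.exp_zero, mul_one]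
    exact (le_abs_self _).trans ((H.Z T0).norm_coe_le_norm x)
  have hf : ∀ t ≥ T0, ‖H.K * rp H.p (H.Z t)‖ ≤ C1 * Real.exp (-(H.σ * t)) := fun t ht => by
    rw [ContinuousMap.norm_le _ (by positivity)]
    intro x
    rw [ContinuousMap.mul_apply, rp_apply H.hp0,
      Real.norm_of_nonneg (mul_nonneg (H.hK0 x) (Real.rpow_nonneg (H.nonneg t x) _))]
    refine (hsrc t (hTT.trans ht) x).trans (mul_le_mul hCC (Real.exp_le_exp.2 ?_)
      (Real.exp_pos _).le hC10)
    nlinarith [mul_nonneg hδ.le (hT00.trans ht)]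
  obtain ⟨C2, hC2, hZ'⟩ := H.cl.gradient_exp hσ hC10 hZ hf
  obtain ⟨-, Z3, cl3⟩ := H.smooth
  obtain ⟨N, hN⟩ : ∃ N, N = H.p * ‖H.V‖ ^ (H.p - 1) := ⟨_, rfl⟩
  have hN0 : 0 ≤ N := by rw [hN]; exact mul_nonneg H.hp0 (Real.rpow_nonneg (norm_nonneg _) _)
  have hf' : ∀ t ≥ T0 + 1, ‖H.K * (H.p • (rp (H.p - 1) (H.Z t) * H.Z' t))‖ ≤
      (C2 + N * C2) * Real.exp (-(H.σ * t)) := fun t ht => by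
    have hE := Real.exp_pos (-(H.σ * t))
    rw [ContinuousMap.norm_le _ (by positivity)]
    intro x
    have h1 := ((H.Z' t).norm_coe_le_norm x).trans (hZ' t ht)
    have h2 : |H.K x| ≤ 1 := by rw [abs_of_nonneg (H.hK0 x)]; exact H.hK1 x
    have h3 : H.Z t x ^ (H.p - 1) ≤ ‖H.V‖ ^ (H.p - 1) := Real.rpow_le_rpow (H.nonneg t x)
      ((H.le t x).trans ((le_abs_self _).trans (H.V.norm_coe_le_norm x))) (by linarith)
    have h4 := Real.rpow_nonneg (H.nonneg t x) (H.p - 1)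
    change |H.K x * (H.p * (rp (H.p - 1) (H.Z t) x * H.Z' t x))| ≤ _
    rw [rp_apply (by linarith), abs_mul, abs_mul, abs_mul, abs_of_nonneg h4, abs_of_nonneg H.hp0]
    rw [Real.norm_eq_abs] at h1
    have h5 : H.p * (H.Z t x ^ (H.p - 1) * |H.Z' t x|) ≤ N * (C2 * Real.exp (-(H.σ * t))) := by
      rw [← mul_assoc, hN]
      exact mul_le_mul (mul_le_mul_of_nonneg_left h3 H.hp0) h1 (abs_nonneg _) (hN ▸ hN0)
    have h6 : 0 ≤ H.p * (H.Z t x ^ (H.p - 1) * |H.Z' t x|) :=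
      mul_nonneg H.hp0 (mul_nonneg h4 (abs_nonneg _))
    have h7 := mul_le_mul_of_nonneg_right h2 h6
    have h8 : 0 ≤ C2 * Real.exp (-(H.σ * t)) := by positivity
    nlinarith
  obtain ⟨C3, hC3, hZ''⟩ := cl3.gradient_exp hσ (C := C2 + N * C2) (by positivity)
    (fun t ht => (hZ' t ht).trans (mul_le_mul_of_nonneg_right
      (le_add_of_nonneg_right (by positivity)) (Real.exp_pos _).le)) hf'
  refine ⟨C1 + C2 + C3, T0 + 1 + 1, by positivity, fun t ht => ?_⟩
  have hE := (Real.exp_pos (-(H.σ * t))).le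
  have a1 := mul_nonneg hC10 hE
  have a2 := mul_nonneg hC2 hE
  have a3 := mul_nonneg hC3 hE
  have b1 := hZ t (by linarith)
  have b2 := hf t (by linarith)
  have b3 := hZ' t (by linarith)
  have b4 := hZ'' t (by linarith)
  refine ⟨?_, ?_, ?_, ?_⟩ <;> linarith [add_mul (C1 + C2) C3 (Real.exp (-(H.σ * t))),
    add_mul C1 C2 (Real.exp (-(H.σ * t)))]

end Het
end Gen
end ConeHet

namespace ConeHet
open scoped Topology BoundedContinuousFunction

namespace Gen
variable {S : Type} [MetricSpace S] [CompactSpace S] [Nonempty S] [MeasurableSpace S]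
  [BorelSpace S] {μ : Measure S} [IsProbabilityMeasure μ] {A : Gen S μ} {P : Par}

theorem abs_intL_le (f : C(S, ℝ)) : |intL μ f| ≤ ‖f‖ := abs_integral_le f

namespace Het
variable (H : A.Het P)

theorem exists_small_osc {ε : ℝ} (hε : 0 < ε) (T : ℝ) :
    ∃ t ≥ T, ∀ x y, |H.Z t x * Real.exp (H.σ * t) - H.Z t y * Real.exp (H.σ * t)| ≤ ε := by
  obtain ⟨C, T1, hC, hT1⟩ := H.decay_all
  obtain ⟨C0, T2, δ, hC0, hδ, hsrc, -⟩ := H.upper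
  have hσ := H.hσ
  have hB := P.hB
  have hl := P.hl
  let e : ℝ → ℝ := fun t => Real.exp (H.σ * t)
  have he : ∀ t, HasDerivAt e (H.σ * e t) t := fun t => by
    refine (((hasDerivAt_id t).const_mul H.σ).exp).congr_deriv ?_
    simp [e]; ring
  have hep : ∀ t, 0 < e t := fun t => Real.exp_pos _
  have hee : ∀ t, e t * Real.exp (-(H.σ * t)) = 1 := fun t => by
    rw [← Real.exp_add, add_neg_cancel, Real.exp_zero]
  let z : ℝ → C(S, ℝ) := fun t => e t • H.Z t
  let z' : ℝ → C(S, ℝ) := fun t => e t • (H.σ • H.Z t + H.Z' t)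
  let z'' : ℝ → C(S, ℝ) := fun t => e t • (H.σ ^ 2 • H.Z t + (2 * H.σ) • H.Z' t + H.Z'' t)
  have d1 : ∀ t, HasDerivAt z (z' t) t := fun t => by
    refine ((he t).smul (H.cl.d1 t)).congr_deriv ?_
    ext x
    change e t * H.Z' t x + H.σ * e t * H.Z t x = e t * (H.σ * H.Z t x + H.Z' t x)
    ring
  have d2 : ∀ t, HasDerivAt z' (z'' t) t := fun t => by
    refine ((he t).smul (((H.cl.d1 t).const_smul H.σ).add (H.cl.d2 t))).congr_deriv ?_
    ext x
    change e t * (H.σ * H.Z' t x + H.Z'' t x) + H.σ * e t * (H.σ * H.Z t x + H.Z' t x) =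
      e t * (H.σ ^ 2 * H.Z t x + 2 * H.σ * H.Z' t x + H.Z'' t x)
    ring
  let f : ℝ → C(S, ℝ) := fun t =>
    P.l • H.Z t - H.Z'' t + P.B • H.Z' t - H.K * rp H.p (H.Z t)
  let E : ℝ → ℝ := fun t => intL μ (z t * z t)
  let E' : ℝ → ℝ := fun t => intL μ (z' t * z t + z t * z' t)
  let E'' : ℝ → ℝ := fun t => intL μ (z'' t * z t + z' t * z' t + (z' t * z' t + z t * z'' t))
  have hE : ∀ t, HasDerivAt E (E' t) t := fun t =>
    (intL μ).hasFDerivAt.comp_hasDerivAt t ((d1 t).mul (d1 t))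
  have hE' : ∀ t, HasDerivAt E' (E'' t) t := fun t =>
    (intL μ).hasFDerivAt.comp_hasDerivAt t (((d2 t).mul (d1 t)).add ((d1 t).mul (d2 t)))
  have hsm : ∀ t ≥ T1, ∀ w : C(S, ℝ), ‖w‖ ≤ C * Real.exp (-(H.σ * t)) → ‖e t • w‖ ≤ C :=
    fun t ht w hw => by
      rw [norm_smul, Real.norm_of_nonneg (hep t).le]
      refine (mul_le_mul_of_nonneg_left hw (hep t).le).trans (le_of_eq ?_)
      rw [mul_left_comm, hee, mul_one]
  have hz : ∀ t ≥ T1, ‖z t‖ ≤ C := fun t ht => hsm t ht _ (hT1 t ht).1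
  have hz' : ∀ t ≥ T1, ‖z' t‖ ≤ H.σ * C + C := fun t ht => by
    have : z' t = H.σ • (e t • H.Z t) + e t • H.Z' t := by
      simp only [z', smul_add, smul_comm (e t) H.σ]
    rw [this]
    refine (norm_add_le _ _).trans (add_le_add ?_ (hsm t ht _ (hT1 t ht).2.2.1))
    rw [norm_smul, Real.norm_of_nonneg hσ.le]
    exact mul_le_mul_of_nonneg_left (hz t ht) hσ.le
  obtain ⟨F, hF⟩ : ∃ F, F = P.l * C + C + P.B * C + C + 1 := ⟨_, rfl⟩
  have hF1 : 0 < F := by rw [hF]; positivity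
  have hf : ∀ t ≥ T1, ‖e t • f t‖ ≤ F := fun t ht => by
    have : e t • f t = P.l • (e t • H.Z t) - e t • H.Z'' t + P.B • (e t • H.Z' t) -
        e t • (H.K * rp H.p (H.Z t)) := by
      simp only [f, smul_add, smul_sub, smul_comm (e t)]
    rw [this, hF]
    have b1 := hsm t ht _ (hT1 t ht).1
    have b2 := hsm t ht _ (hT1 t ht).2.1
    have b3 := hsm t ht _ (hT1 t ht).2.2.1
    have b4 := hsm t ht _ (hT1 t ht).2.2.2
    have b5 : ‖P.l • (e t • H.Z t)‖ ≤ P.l * C := by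
      rw [norm_smul, Real.norm_of_nonneg hl.le]; exact mul_le_mul_of_nonneg_left b1 hl.le
    have b6 : ‖P.B • (e t • H.Z' t)‖ ≤ P.B * C := by
      rw [norm_smul, Real.norm_of_nonneg hB.le]; exact mul_le_mul_of_nonneg_left b3 hB.le
    refine (norm_sub_le _ _).trans ?_
    have h2 := norm_add_le (P.l • (e t • H.Z t) - e t • H.Z'' t) (P.B • (e t • H.Z' t))
    have h3 := norm_sub_le (P.l • (e t • H.Z t)) (e t • H.Z'' t)
    linarith
  obtain ⟨δ', hδ', hosc⟩ := A.osc (ε / F) (by positivity)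
  obtain ⟨η, hη⟩ : ∃ η, η = F ^ 2 * δ' := ⟨_, rfl⟩
  have hη0 : 0 < η := by rw [hη]; positivity
  obtain ⟨T3, hT3⟩ := eventually_atTop.1 (((tendsto_exp hδ).const_mul (C * C0)).eventually_lt_const
    (show C * C0 * 0 < η / 2 by rw [mul_zero]; positivity))
  obtain ⟨t, ht, hlt⟩ := exists_lt_of_bounded (B := P.B + 2 * H.σ) (ε := η)
    (T := Max.max (Max.max T T1) (Max.max T2 T3))
    (M := C * C + 2 * (C * (H.σ * C + C))) (by positivity) hη0 hE hE'
    (fun t ht => by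
      have ht1 : T1 ≤ t := ((le_max_right _ _).trans (le_max_left _ _)).trans ht
      refine (abs_intL_le _).trans ((norm_mul_le _ _).trans ?_)
      have := mul_le_mul (hz t ht1) (hz t ht1) (norm_nonneg _) hC
      have : 0 ≤ 2 * (C * (H.σ * C + C)) := by positivity
      linarith)
    (fun t ht => by
      have ht1 : T1 ≤ t := ((le_max_right _ _).trans (le_max_left _ _)).trans ht
      refine (abs_intL_le _).trans ((norm_add_le _ _).trans ?_)
      have h1 := mul_le_mul (hz t ht1) (hz' t ht1) (norm_nonneg _) hC
      have h2 := norm_mul_le (z t) (z' t)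
      have h3 := norm_mul_le (z' t) (z t)
      have : 0 ≤ C * C := by positivity
      linarith [mul_comm ‖z' t‖ ‖z t‖])
  have htT : T ≤ t := ((le_max_left _ _).trans (le_max_left _ _)).trans ht
  have ht1 : T1 ≤ t := ((le_max_right _ _).trans (le_max_left _ _)).trans ht
  have ht2 : T2 ≤ t := ((le_max_left _ _).trans (le_max_right _ _)).trans ht
  have ht3 : T3 ≤ t := ((le_max_right _ _).trans (le_max_right _ _)).trans ht
  refine ⟨t, htT, ?_⟩
  have hmem : (F⁻¹ • z t, F⁻¹ • (e t • f t)) ∈ A.L :=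
    A.L.smul_mem F⁻¹ (A.L.smul_mem (e t) (H.cl.eqn t))
  have hn : ‖F⁻¹ • (e t • f t)‖ ≤ 1 := by
    rw [norm_smul, norm_inv, Real.norm_of_nonneg hF1.le, inv_mul_le_iff₀ hF1, mul_one]
    exact hf t ht1
  have hid : E'' t - (P.B + 2 * H.σ) * E' t = 2 * intL μ (z' t * z' t) -
      2 * intL μ (z t * (e t • f t)) - 2 * intL μ (z t * (e t • (H.K * rp H.p (H.Z t)))) := by
    have h5 : (z'' t * z t + z' t * z' t + (z' t * z' t + z t * z'' t)) -
        (P.B + 2 * H.σ) • (z' t * z t + z t * z' t) = (2:ℝ) • (z' t * z' t) -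
        (2:ℝ) • (z t * (e t • f t)) - (2:ℝ) • (z t * (e t • (H.K * rp H.p (H.Z t)))) := by
      ext x
      change (e t * (H.σ ^ 2 * H.Z t x + 2 * H.σ * H.Z' t x + H.Z'' t x)) * (e t * H.Z t x) +
        (e t * (H.σ * H.Z t x + H.Z' t x)) * (e t * (H.σ * H.Z t x + H.Z' t x)) +
        ((e t * (H.σ * H.Z t x + H.Z' t x)) * (e t * (H.σ * H.Z t x + H.Z' t x)) +
        (e t * H.Z t x) * (e t * (H.σ ^ 2 * H.Z t x + 2 * H.σ * H.Z' t x + H.Z'' t x))) -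
        (P.B + 2 * H.σ) * ((e t * (H.σ * H.Z t x + H.Z' t x)) * (e t * H.Z t x) +
        (e t * H.Z t x) * (e t * (H.σ * H.Z t x + H.Z' t x))) =
        2 * ((e t * (H.σ * H.Z t x + H.Z' t x)) * (e t * (H.σ * H.Z t x + H.Z' t x))) -
        2 * ((e t * H.Z t x) * (e t * (P.l * H.Z t x - H.Z'' t x + P.B * H.Z' t x -
          H.K x * rp H.p (H.Z t) x))) - 2 * ((e t * H.Z t x) * (e t * (H.K x * rp H.p (H.Z t) x)))
      rw [H.hl]; ring
    have h6 := congrArg (intL μ) h5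
    simp only [map_sub, map_smul, smul_eq_mul] at h6
    exact h6
  have hsq : 0 ≤ intL μ (z' t * z' t) := integral_nonneg fun x => mul_self_nonneg (z' t x)
  have hzg : intL μ (z t * (e t • (H.K * rp H.p (H.Z t)))) ≤ C * C0 * Real.exp (-(δ * t)) := by
    refine (le_abs_self _).trans ((abs_intL_le _).trans ((norm_mul_le _ _).trans ?_))
    rw [mul_assoc]
    refine mul_le_mul (hz t ht1) ?_ (norm_nonneg _) hC
    rw [norm_smul, Real.norm_of_nonneg (hep t).le]
    have : ‖H.K * rp H.p (H.Z t)‖ ≤ C0 * Real.exp (-((H.σ + δ) * t)) := by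
      rw [ContinuousMap.norm_le _ (by positivity)]
      intro x
      rw [ContinuousMap.mul_apply, rp_apply H.hp0,
        Real.norm_of_nonneg (mul_nonneg (H.hK0 x) (Real.rpow_nonneg (H.nonneg t x) _))]
      exact hsrc t ht2 x
    refine (mul_le_mul_of_nonneg_left this (hep t).le).trans (le_of_eq ?_)
    rw [mul_left_comm]
    change _ * (Real.exp (H.σ * t) * _) = _
    rw [← Real.exp_add]; congr 2; ring
  have hdiss : -intL μ (z t * (e t • f t)) ≤ η := by
    have := hT3 t ht3
    linarith
  have hd : -∫ x, (F⁻¹ • z t) x * (F⁻¹ • (e t • f t)) x ∂μ ≤ δ' := by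
    have h7 : ∫ x, (F⁻¹ • z t) x * (F⁻¹ • (e t • f t)) x ∂μ =
        intL μ ((F⁻¹ * F⁻¹) • (z t * (e t • f t))) := by
      refine integral_congr_ae (ae_of_all _ fun x => ?_)
      change F⁻¹ * z t x * (F⁻¹ * (e t * f t x)) = F⁻¹ * F⁻¹ * (z t x * (e t * f t x))
      ring
    rw [h7, map_smul, smul_eq_mul, ← mul_neg]
    have := mul_le_mul_of_nonneg_left hdiss (show 0 ≤ F⁻¹ * F⁻¹ by positivity)
    refine this.trans (le_of_eq ?_)
    rw [hη]; field_simp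
  intro x y
  have := hosc _ _ hmem hn hd x y
  change |F⁻¹ * (e t * H.Z t x) - F⁻¹ * (e t * H.Z t y)| ≤ ε / F at this
  rw [← mul_sub, abs_mul, abs_of_pos (inv_pos.2 hF1), inv_mul_le_iff₀ hF1,
    mul_div_cancel₀ _ hF1.ne'] at this
  rwa [mul_comm (H.Z t x), mul_comm (H.Z t y)]

theorem asymptotics : ∃ c > 0, ∀ ε > 0, ∃ T, ∀ t ≥ T, ∀ x,
    |H.Z t x * Real.exp (H.σ * t) - c| ≤ ε := by
  have hexp : ∀ t, Real.exp (H.σ * t) * Real.exp (-(H.σ * t)) = 1 := fun t => by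
    rw [← Real.exp_add, add_neg_cancel, Real.exp_zero]
  have hep : ∀ t, 0 < Real.exp (H.σ * t) := fun t => Real.exp_pos _
  have hlow : ∀ T m, 0 ≤ m → (∀ x, m ≤ H.Z T x * Real.exp (H.σ * T)) → ∀ t ≥ T, ∀ x,
      m ≤ H.Z t x * Real.exp (H.σ * t) := fun T m hm h t ht x => by
    have := H.lower (T := T) hm (fun x => by
      have := mul_le_mul_of_nonneg_right (h x) (Real.exp_pos (-(H.σ * T))).le
      rwa [mul_assoc _ (Real.exp _) (Real.exp _), hexp, mul_one] at this) t ht x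
    have := mul_le_mul_of_nonneg_right this (hep t).le
    rwa [mul_assoc, mul_comm (Real.exp (-_)), hexp, mul_one] at this
  obtain ⟨C, T0, δ, hC, hδ, -, hup⟩ := H.upper
  have hcl : ∀ ε > 0, ∃ T, ∃ a, ∀ t ≥ T, ∀ x, |H.Z t x * Real.exp (H.σ * t) - a| ≤ ε := by
    intro ε hε
    obtain ⟨T1, hT1⟩ := eventually_atTop.1 (((tendsto_exp hδ).const_mul C).eventually_lt_const
      (show C * 0 < ε / 2 by rw [mul_zero]; positivity))
    obtain ⟨T, hT, hosc⟩ := H.exists_small_osc (half_pos hε) (Max.max T0 T1)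
    obtain ⟨y, hy⟩ := exists_min (H.Z T)
    refine ⟨T, H.Z T y * Real.exp (H.σ * T), fun t ht x => ?_⟩
    have h1 := hlow T _ (mul_nonneg (H.nonneg T y) (hep T).le)
      (fun x => mul_le_mul_of_nonneg_right (hy x) (hep T).le) t ht x
    have h2 := hup T ((le_max_left _ _).trans hT) (H.Z T y * Real.exp (H.σ * T) + ε / 2)
      (fun x => by
        have h3 := (abs_le.1 (hosc x y)).2
        have h4 := mul_le_mul_of_nonneg_right (show H.Z T x * Real.exp (H.σ * T) ≤
          H.Z T y * Real.exp (H.σ * T) + ε / 2 by linarith) (Real.exp_pos (-(H.σ * T))).le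
        rwa [mul_assoc _ (Real.exp _) (Real.exp _), hexp, mul_one] at h4) t ht x
    have h5 := hT1 T ((le_max_right _ _).trans hT)
    have h6 := mul_le_mul_of_nonneg_right h2 (hep t).le
    rw [mul_assoc, mul_comm (Real.exp (-(H.σ * t))), hexp, mul_one] at h6
    rw [abs_le]; constructor <;> linarith
  obtain ⟨x₀⟩ := (inferInstance : Nonempty S)
  have hcs : CauchySeq fun t => H.Z t x₀ * Real.exp (H.σ * t) := by
    refine Metric.cauchySeq_iff'.2 fun ε hε => ?_
    obtain ⟨T, a, h⟩ := hcl (ε / 3) (by positivity)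
    refine ⟨T, fun t ht => ?_⟩
    have h1 := abs_le.1 (h t ht x₀)
    have h2 := abs_le.1 (h T le_rfl x₀)
    rw [Real.dist_eq, abs_lt]; constructor <;> linarith
  obtain ⟨c, hc⟩ := cauchySeq_tendsto_of_complete hcs
  obtain ⟨y, hy⟩ := exists_min (H.Z 0)
  have hcy : H.Z 0 y ≤ c := ge_of_tendsto hc (eventually_atTop.2 ⟨0, fun t ht =>
    hlow 0 _ (H.nonneg 0 y) (fun x => by simpa using hy x) t ht x₀⟩)
  refine ⟨c, (H.pos 0 y).trans_le hcy, fun ε hε => ?_⟩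
  obtain ⟨T, a, h⟩ := hcl (ε / 2) (by positivity)
  refine ⟨T, fun t ht x => ?_⟩
  have hca : |c - a| ≤ ε / 2 := le_of_tendsto ((hc.sub_const a).abs)
    (eventually_atTop.2 ⟨T, fun t ht => h t ht x₀⟩)
  have h1 := abs_le.1 (h t ht x)
  have h2 := abs_le.1 hca
  rw [abs_le]; constructor <;> linarith

end Het
end Gen
end ConeHet

namespace ConeHet
open scoped Topology BoundedContinuousFunction

namespace Gen
variable {S : Type} [MetricSpace S] [CompactSpace S] [Nonempty S] [MeasurableSpace S]
  [BorelSpace S] {μ : Measure S} [IsProbabilityMeasure μ] (A : Gen S μ)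

theorem exists_het {k₀ N B₀ : ℝ} (hk : 0 < k₀) (hk1 : k₀ ≤ 1) (hN : 1 ≤ N) (hB₀ : 0 < B₀) :
    ∃ l₀ > 0, ∀ P : Par, P.l < l₀ → B₀ ≤ P.B → ∀ σ p : ℝ, 0 < σ → P.l = σ ^ 2 + P.B * σ →
      1 < p → p ≤ N → ∀ K : C(S, ℝ), (∀ x, 0 ≤ K x) → (∀ x, K x ≤ 1) → k₀ ≤ ∫ x, K x ∂μ →
      (∀ f : C(S, ℝ), (∀ x, 0 ≤ f x) → ∫ x, K x * f x ∂μ = 0 → ∀ x, f x = 0) →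
      ∃ H : A.Het P, H.K = K ∧ H.p = p ∧ H.σ = σ := by
  have hR : 0 ≤ ‖A.R‖ := A.R.opNorm_nonneg
  obtain ⟨c1, hc1⟩ : ∃ c1, c1 = ‖A.R‖ * (2 + 2 * N * 9 ^ N / k₀ ^ 2) := ⟨_, rfl⟩
  obtain ⟨c2, hc2⟩ : ∃ c2, c2 = 8 * ‖A.R‖ * (N * 3 ^ N / k₀) := ⟨_, rfl⟩
  obtain ⟨c3, hc3⟩ : ∃ c3, c3 = 6 * (N * 3 ^ N / k₀) := ⟨_, rfl⟩
  have h1 : 0 ≤ c1 := by rw [hc1]; positivity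
  have h2 : 0 ≤ c2 := by rw [hc2]; positivity
  have h3 : 0 ≤ c3 := by rw [hc3]; positivity
  refine ⟨Min.min 1 (B₀ ^ 2) / (2 * (c1 + c2 + c3 + 1)), by positivity, ?_⟩
  intro P hl hB σ p hσ hlσ hp hpN K hK0 hK1 hK hKf
  have hl0 := P.hl
  rw [lt_div_iff₀ (by positivity)] at hl
  have m1 := hl.trans_le (min_le_left _ _)
  have m2 := hl.trans_le (min_le_right _ _)
  have n1 := mul_nonneg hl0.le h1
  have n2 := mul_nonneg hl0.le h2
  have n3 := mul_nonneg hl0.le h3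
  have hBB : B₀ ^ 2 ≤ P.B ^ 2 := pow_le_pow_left₀ hB₀.le hB 2
  obtain ⟨D, hDK, hDp⟩ := A.exists_dat P hK0 hK1 hk hK hk1 hp hpN
    (by rw [mul_assoc, ← hc1]; nlinarith)
    (by rw [← mul_assoc, ← hc2]; nlinarith)
    (by rw [← mul_assoc, ← hc3]; nlinarith)
  obtain ⟨Z, Z', Z'', hZ, cl, lim, lt⟩ := D.exists_curve
  subst hDK hDp
  exact ⟨⟨D.K, D.V, D.p, σ, Z, Z', Z'', hp, hK0, hK1, hKf, D.hV, D.hVL, hσ, hlσ, hZ.nonneg, hZ.le,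
    hZ.anti, cl, lim, lt⟩, rfl, rfl, rfl⟩

end Gen
end ConeHet

namespace ConeHet
open scoped Topology BoundedContinuousFunction

theorem eq_of_hasDerivAt {F G φ : ℝ → ℝ} {a b : ℝ} (hF : ContinuousOn F (Set.Icc a b))
    (hG : ContinuousOn G (Set.Icc a b)) (hF' : ∀ x ∈ Set.Ioo a b, HasDerivAt F (φ x) x)
    (hG' : ∀ x ∈ Set.Ioo a b, HasDerivAt G (φ x) x) (h0 : F a = G a) :
    ∀ x ∈ Set.Icc a b, F x = G x := by
  intro x hx
  have hs : Set.Icc a x ⊆ Set.Icc a b := Set.Icc_subset_Icc_right hx.2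
  have := intervalIntegral.integral_eq_sub_of_hasDerivAt_of_le hx.1 ((hF.sub hG).mono hs)
    (f' := fun _ => 0) (fun y hy => ((hF' y ⟨hy.1, hy.2.trans_le hx.2⟩).sub
      (hG' y ⟨hy.1, hy.2.trans_le hx.2⟩)).congr_deriv (sub_self _)) (by simp)
  simp only [intervalIntegral.integral_zero, Pi.sub_apply, h0, sub_self, sub_zero] at this
  linarith

variable {ℓ : ℝ} [hℓ : Fact (0 < ℓ)]

instance : Nonempty (Set.Icc (0:ℝ) ℓ) := ⟨⟨0, le_rfl, hℓ.out.le⟩⟩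

/-- The projection of the line to the segment. -/
noncomputable def pr (ℓ : ℝ) [hℓ : Fact (0 < ℓ)] : ℝ → Set.Icc (0:ℝ) ℓ := Set.projIcc 0 ℓ hℓ.out.le

theorem continuous_pr : Continuous (pr ℓ) := continuous_projIcc

theorem pr_of_mem {x : ℝ} (hx : x ∈ Set.Icc 0 ℓ) : pr ℓ x = ⟨x, hx⟩ := Set.projIcc_of_mem _ hx

theorem pr_val (x : Set.Icc (0:ℝ) ℓ) : pr ℓ x = x := Set.projIcc_val _ x

/-- Extension of a function on the segment to the line. -/
noncomputable def ex (g : C(Set.Icc (0:ℝ) ℓ, ℝ)) (x : ℝ) : ℝ := g (pr ℓ x)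

theorem continuous_ex (g : C(Set.Icc (0:ℝ) ℓ, ℝ)) : Continuous (ex g) :=
  g.continuous.comp continuous_pr

theorem ex_val (g : C(Set.Icc (0:ℝ) ℓ, ℝ)) (x : Set.Icc (0:ℝ) ℓ) : ex g x = g x := by
  rw [ex, pr_val]

theorem ex_of_mem (g : C(Set.Icc (0:ℝ) ℓ, ℝ)) {x : ℝ} (hx : x ∈ Set.Icc 0 ℓ) : ex g x = g ⟨x, hx⟩ := by
  rw [ex, pr_of_mem hx]

theorem abs_ex_le (g : C(Set.Icc (0:ℝ) ℓ, ℝ)) (x : ℝ) : |ex g x| ≤ ‖g‖ := g.norm_coe_le_norm _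

/-- Restriction of a continuous function on the line to the segment. -/
noncomputable def rs (ℓ : ℝ) [hℓ : Fact (0 < ℓ)] (f : ℝ → ℝ) (hf : ContinuousOn f (Set.Icc 0 ℓ)) :
    C(Set.Icc (0:ℝ) ℓ, ℝ) := ⟨fun x => f x, hf.restrict⟩

theorem ex_rs {f : ℝ → ℝ} (hf : ContinuousOn f (Set.Icc 0 ℓ)) {x : ℝ} (hx : x ∈ Set.Icc 0 ℓ) :
    ex (rs ℓ f hf) x = f x := by rw [ex_of_mem _ hx]; rfl

theorem eq_of_ex {g f : C(Set.Icc (0:ℝ) ℓ, ℝ)} (h : ∀ x ∈ Set.Ioo 0 ℓ, ex g x = ex f x) : g = f := by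
  have hd : Set.EqOn (ex g) (ex f) (closure (Set.Ioo 0 ℓ)) :=
    Set.EqOn.closure h (continuous_ex g) (continuous_ex f)
  rw [closure_Ioo hℓ.out.ne] at hd
  ext x
  have := hd x.2
  rwa [ex_val, ex_val] at this

/-- `g` has the continuous derivative `g'`. -/
def Dv (g g' : C(Set.Icc (0:ℝ) ℓ, ℝ)) : Prop := ∀ x ∈ Set.Ioo 0 ℓ, HasDerivAt (ex g) (ex g' x) x

namespace Dv
variable {g g' f f' : C(Set.Icc (0:ℝ) ℓ, ℝ)}

theorem add (hg : Dv g g') (hf : Dv f f') : Dv (g + f) (g' + f') := fun x hx => (hg x hx).add (hf x hx)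
theorem sub (hg : Dv g g') (hf : Dv f f') : Dv (g - f) (g' - f') := fun x hx => (hg x hx).sub (hf x hx)
theorem smul (c : ℝ) (hg : Dv g g') : Dv (c • g) (c • g') := fun x hx => (hg x hx).const_mul c
theorem const (c : ℝ) : Dv (ContinuousMap.const _ c) (0 : C(Set.Icc (0:ℝ) ℓ, ℝ)) :=
  fun x hx => hasDerivAt_const x c
theorem mul (hg : Dv g g') (hf : Dv f f') : Dv (g * f) (g' * f + g * f') :=
  fun x hx => (hg x hx).mul (hf x hx)

theorem eq_integral (hg : Dv g g') {x : ℝ} (hx : x ∈ Set.Icc 0 ℓ) :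
    ex g x = ex g 0 + ∫ y in (0:ℝ)..x, ex g' y := by
  have := intervalIntegral.integral_eq_sub_of_hasDerivAt_of_le hx.1 (continuous_ex g).continuousOn
    (fun y hy => hg y ⟨hy.1, hy.2.trans_le hx.2⟩) ((continuous_ex g').intervalIntegrable _ _)
  linarith

/-- The `C¹` extension to the line. -/
theorem hasDerivAt_integral (g' : C(Set.Icc (0:ℝ) ℓ, ℝ)) (c x : ℝ) :
    HasDerivAt (fun x => c + ∫ y in (0:ℝ)..x, ex g' y) (ex g' x) x :=
  (((continuous_ex g').integral_hasStrictDerivAt 0 x).hasDerivAt).const_add c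

theorem within (hg : Dv g g') {x : ℝ} (hx : x ∈ Set.Icc 0 ℓ) :
    HasDerivWithinAt (ex g) (ex g' x) (Set.Icc 0 ℓ) x :=
  (hasDerivAt_integral g' (ex g 0) x).hasDerivWithinAt.congr (fun y hy => hg.eq_integral hy)
    (hg.eq_integral hx)

theorem of_integral (h : ∀ x ∈ Set.Ioo 0 ℓ, ex g x = ex g 0 + ∫ y in (0:ℝ)..x, ex g' y) : Dv g g' :=
  fun x hx => (hasDerivAt_integral g' (ex g 0) x).congr_of_eventuallyEq (by
    filter_upwards [isOpen_Ioo.mem_nhds hx] with y hy using h y hy)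

end Dv

/-- The primitive vanishing at `0`. -/
noncomputable def In : C(Set.Icc (0:ℝ) ℓ, ℝ) →L[ℝ] C(Set.Icc (0:ℝ) ℓ, ℝ) :=
  LinearMap.mkContinuous
    { toFun := fun g => rs ℓ (fun x => ∫ y in (0:ℝ)..x, ex g y) (fun x _ =>
        (((continuous_ex g).integral_hasStrictDerivAt 0 x).hasDerivAt).continuousAt.continuousWithinAt)
      map_add' := fun g f => by
        ext x
        exact intervalIntegral.integral_add ((continuous_ex g).intervalIntegrable _ _)
          ((continuous_ex f).intervalIntegrable _ _)
      map_smul' := fun c g => by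
        ext x
        exact intervalIntegral.integral_const_mul c _ } ℓ fun g => by
    rw [ContinuousMap.norm_le _ (mul_nonneg hℓ.out.le (norm_nonneg _))]
    intro x
    have := intervalIntegral.norm_integral_le_of_norm_le_const (a := 0) (b := x) (f := ex g)
      (C := ‖g‖) fun y _ => abs_ex_le g y
    refine this.trans ?_
    rw [sub_zero, abs_of_nonneg x.2.1, mul_comm]
    exact mul_le_mul_of_nonneg_right x.2.2 (norm_nonneg _)

theorem ex_In (g : C(Set.Icc (0:ℝ) ℓ, ℝ)) {x : ℝ} (hx : x ∈ Set.Icc 0 ℓ) :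
    ex (In g) x = ∫ y in (0:ℝ)..x, ex g y := by
  rw [ex_of_mem _ hx]; rfl

theorem ex_In_zero (g : C(Set.Icc (0:ℝ) ℓ, ℝ)) : ex (In g) 0 = 0 := by
  rw [ex_In g ⟨le_rfl, hℓ.out.le⟩, intervalIntegral.integral_same]

theorem Dv_In (g : C(Set.Icc (0:ℝ) ℓ, ℝ)) : Dv (In g) g := Dv.of_integral fun x hx => by
  rw [ex_In_zero, zero_add, ex_In g (Set.Ioo_subset_Icc_self hx)]

theorem Dv.eq_In {g g' : C(Set.Icc (0:ℝ) ℓ, ℝ)} (h : Dv g g') :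
    g = ContinuousMap.const _ (ex g 0) + In g' := eq_of_ex fun x hx => by
  have hx' := Set.Ioo_subset_Icc_self hx
  rw [h.eq_integral hx', ← ex_In g' hx']; rfl

/-- `J d h (x) = ∫₀¹ τ^(d-1) h(xτ) dτ`, in the variable `τ^d`. -/
noncomputable def J (d : ℝ) (hd : 0 < d) : C(Set.Icc (0:ℝ) ℓ, ℝ) →L[ℝ] C(Set.Icc (0:ℝ) ℓ, ℝ) :=
  have hc : ∀ (h : C(Set.Icc (0:ℝ) ℓ, ℝ)), Continuous (Function.uncurry fun (x s : ℝ) =>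
      ex h (x * s ^ (1 / d))) := fun h => (continuous_ex h).comp
        (continuous_fst.mul (continuous_snd.rpow_const fun _ => Or.inr (by positivity)))
  have hc1 : ∀ (h : C(Set.Icc (0:ℝ) ℓ, ℝ)) (x : ℝ), Continuous fun s : ℝ => ex h (x * s ^ (1 / d)) :=
    fun h x => (hc h).comp (Continuous.prodMk_right x)
  LinearMap.mkContinuous
    { toFun := fun h => rs ℓ (fun x => (1 / d) * ∫ s in (0:ℝ)..1, ex h (x * s ^ (1 / d)))
        (continuous_const.mul (intervalIntegral.continuous_parametric_intervalIntegral_of_continuous'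
          (hc h) 0 1)).continuousOn
      map_add' := fun g f => by
        ext x
        change (1 / d) * (∫ s in (0:ℝ)..1, (ex g (x * s ^ (1 / d)) + ex f (x * s ^ (1 / d)))) =
          (1 / d) * _ + (1 / d) * _
        rw [intervalIntegral.integral_add ((hc1 g x).intervalIntegrable _ _)
          ((hc1 f x).intervalIntegrable _ _), mul_add]
      map_smul' := fun c g => by
        ext x
        change (1 / d) * (∫ s in (0:ℝ)..1, c * ex g (x * s ^ (1 / d))) = c * ((1 / d) * _)
        rw [intervalIntegral.integral_const_mul]; ring } (1 / d) fun g => by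
    rw [ContinuousMap.norm_le _ (by positivity)]
    intro x
    have := intervalIntegral.norm_integral_le_of_norm_le_const (a := 0) (b := 1)
      (f := fun s : ℝ => ex g (x * s ^ (1 / d))) (C := ‖g‖) fun y _ => abs_ex_le g _
    rw [sub_zero, abs_one, mul_one] at this
    change ‖(1 / d) * ∫ s in (0:ℝ)..1, ex g (x * s ^ (1 / d))‖ ≤ _
    rw [norm_mul, Real.norm_of_nonneg (by positivity)]
    exact mul_le_mul_of_nonneg_left this (by positivity)

theorem ex_J (d : ℝ) (hd : 0 < d) (h : C(Set.Icc (0:ℝ) ℓ, ℝ)) {x : ℝ} (hx : x ∈ Set.Icc 0 ℓ) :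
    ex (J d hd h) x = (1 / d) * ∫ s in (0:ℝ)..1, ex h (x * s ^ (1 / d)) := by
  rw [ex_of_mem _ hx]; rfl

theorem rpow_mul_J (d : ℝ) (hd : 0 < d) (h : C(Set.Icc (0:ℝ) ℓ, ℝ)) {x : ℝ} (hx : x ∈ Set.Icc 0 ℓ) :
    x ^ d * ex (J d hd h) x = (1 / d) * ∫ z in (0:ℝ)..x ^ d, ex h (z ^ (1 / d)) := by
  rw [ex_J d hd h hx]
  have h1 := intervalIntegral.smul_integral_comp_mul_left (a := 0) (b := 1)
    (fun z => ex h (z ^ (1 / d))) (x ^ d)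
  rw [mul_zero, mul_one, smul_eq_mul] at h1
  rw [← h1, mul_left_comm]
  congr 2
  refine intervalIntegral.integral_congr fun s hs => ?_
  rw [Set.uIcc_of_le zero_le_one] at hs
  rw [Real.mul_rpow (Real.rpow_nonneg hx.1 _) hs.1, ← Real.rpow_mul hx.1, mul_one_div_cancel hd.ne',
    Real.rpow_one]

theorem hasDerivAt_rpow_mul_J (d : ℝ) (hd : 0 < d) (h : C(Set.Icc (0:ℝ) ℓ, ℝ)) {x : ℝ}
    (hx : x ∈ Set.Ioo 0 ℓ) :
    HasDerivAt (fun x => x ^ d * ex (J d hd h) x) (x ^ (d - 1) * ex h x) x := by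
  have hc : Continuous fun z : ℝ => ex h (z ^ (1 / d)) :=
    (continuous_ex h).comp (continuous_id.rpow_const fun _ => Or.inr (by positivity))
  have h1 := (((hc.integral_hasStrictDerivAt 0 (x ^ d)).hasDerivAt.comp x
    (Real.hasDerivAt_rpow_const (p := d) (Or.inl hx.1.ne'))).const_mul (1 / d))
  refine (h1.congr_deriv ?_).congr_of_eventuallyEq ?_
  · rw [← Real.rpow_mul hx.1.le, mul_one_div_cancel hd.ne', Real.rpow_one]
    field_simp
  · filter_upwards [isOpen_Ioo.mem_nhds hx] with y hy
    exact rpow_mul_J d hd h (Set.Ioo_subset_Icc_self hy)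

theorem continuous_rpow_mul_J (d : ℝ) (hd : 0 < d) (h : C(Set.Icc (0:ℝ) ℓ, ℝ)) :
    Continuous fun x => x ^ d * ex (J d hd h) x :=
  (continuous_id.rpow_const fun _ => Or.inr hd.le).mul (continuous_ex _)

theorem J_nonneg (d : ℝ) (hd : 0 < d) {h : C(Set.Icc (0:ℝ) ℓ, ℝ)} (h0 : ∀ x, 0 ≤ h x)
    (x : Set.Icc (0:ℝ) ℓ) : 0 ≤ J d hd h x :=
  mul_nonneg (by positivity) (intervalIntegral.integral_nonneg zero_le_one fun s _ => h0 _)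

theorem Dv_J (d : ℝ) (hd : 0 < d) {h h' : C(Set.Icc (0:ℝ) ℓ, ℝ)} (hh : Dv h h') :
    Dv (J d hd h) (J (d + 1) (add_pos hd one_pos) h') := by
  have hd1 : 0 < d + 1 := by linarith
  have key := eq_of_hasDerivAt (a := 0) (b := ℓ)
    (F := fun x => x ^ (d + 1) * ex (J (d + 1) hd1 h') x)
    (G := fun x => x ^ d * ex h x - d * (x ^ d * ex (J d hd h) x)) (φ := fun x => x ^ d * ex h' x)
    (continuous_rpow_mul_J _ hd1 _).continuousOn
    (((continuous_id.rpow_const fun _ => Or.inr hd.le).mul (continuous_ex _)).sub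
      (continuous_const.mul (continuous_rpow_mul_J _ _ _))).continuousOn
    (fun x hx => by
      have := hasDerivAt_rpow_mul_J (d + 1) hd1 h' hx
      rwa [add_sub_cancel_right] at this)
    (fun x hx => by
      have h1 := ((Real.hasDerivAt_rpow_const (p := d) (Or.inl hx.1.ne')).mul (hh x hx)).sub
        ((hasDerivAt_rpow_mul_J d hd h hx).const_mul d)
      refine h1.congr_deriv ?_
      ring) (by simp [Real.zero_rpow hd.ne', Real.zero_rpow hd1.ne'])
  intro x hx
  have hk := key x (Set.Ioo_subset_Icc_self hx)
  have hxd := Real.rpow_pos_of_pos hx.1 d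
  have h2 := (hasDerivAt_rpow_mul_J d hd h hx).div (Real.hasDerivAt_rpow_const (p := d)
    (Or.inl hx.1.ne')) hxd.ne'
  refine (h2.congr_deriv ?_).congr_of_eventuallyEq ?_
  · have e1 : x ^ (d + 1) = x ^ d * x := Real.rpow_add_one hx.1.ne' d
    have e2 : x ^ (d - 1) = x ^ d / x := Real.rpow_sub_one hx.1.ne' d
    simp only [e1] at hk
    rw [e2, div_eq_iff (by positivity)]
    have hx0 := hx.1.ne'
    field_simp
    have h3 : x ^ d * (x * ex (J (d + 1) hd1 h') x - (ex h x - d * ex (J d hd h) x)) = 0 := by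
      linarith
    have h4 := (mul_eq_zero.1 h3).resolve_left hxd.ne'
    linarith
  · filter_upwards [isOpen_Ioo.mem_nhds hx] with y hy
    simp only [Pi.div_apply]
    rw [mul_div_cancel_left₀ _ (Real.rpow_pos_of_pos hy.1 d).ne']

end ConeHet

namespace ConeHet
open scoped Topology BoundedContinuousFunction

variable {ℓ : ℝ} [hℓ : Fact (0 < ℓ)]

theorem Dv.exists_ext {g w w' : C(Set.Icc (0:ℝ) ℓ, ℝ)} (hg : Dv g w) (hw : Dv w w') :
    ∃ φ φ' φ'' : ℝ → ℝ, (∀ x, HasDerivAt φ (φ' x) x) ∧ (∀ x, HasDerivAt φ' (φ'' x) x) ∧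
      Continuous φ'' ∧ ∀ x ∈ Set.Icc 0 ℓ, φ x = ex g x ∧ φ' x = ex w x ∧ φ'' x = ex w' x := by
  have h1 : ∀ x, HasDerivAt (fun x => ex w 0 + ∫ y in (0:ℝ)..x, ex w' y) (ex w' x) x :=
    Dv.hasDerivAt_integral w' (ex w 0)
  have hc : Continuous fun x => ex w 0 + ∫ y in (0:ℝ)..x, ex w' y :=
    continuous_iff_continuousAt.2 fun x => (h1 x).continuousAt
  refine ⟨fun x => ex g 0 + ∫ y in (0:ℝ)..x, (ex w 0 + ∫ z in (0:ℝ)..y, ex w' z),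
    fun x => ex w 0 + ∫ y in (0:ℝ)..x, ex w' y, ex w', fun x =>
      ((hc.integral_hasStrictDerivAt 0 x).hasDerivAt).const_add _, h1, continuous_ex w',
      fun x hx => ⟨?_, (hw.eq_integral hx).symm, rfl⟩⟩
  simp only
  rw [hg.eq_integral hx]
  congr 1
  refine intervalIntegral.integral_congr fun y hy => ?_
  rw [Set.uIcc_of_le hx.1] at hy
  exact (hw.eq_integral ⟨hy.1, hy.2.trans hx.2⟩).symm

variable [hℓ2 : Fact (ℓ < 2)]

theorem two_sub_pos {x : ℝ} (hx : x ∈ Set.Icc 0 ℓ) : 0 < 2 - x := by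
  have := hℓ2.out
  linarith [hx.2]

theorem continuousOn_wt (a : ℝ) : ContinuousOn (fun x : ℝ => (2 - x) ^ a) (Set.Icc 0 ℓ) :=
  fun x hx => (((continuous_const.sub continuous_id).continuousAt).rpow_const
    (Or.inl (two_sub_pos hx).ne')).continuousWithinAt

/-- The power weight `(2 - x)^a`. -/
noncomputable def wt (ℓ a : ℝ) [hℓ : Fact (0 < ℓ)] [hℓ2 : Fact (ℓ < 2)] : C(Set.Icc (0:ℝ) ℓ, ℝ) :=
  rs ℓ (fun x => (2 - x) ^ a) (continuousOn_wt a)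

theorem ex_wt (a : ℝ) {x : ℝ} (hx : x ∈ Set.Icc 0 ℓ) : ex (wt ℓ a) x = (2 - x) ^ a :=
  ex_rs (continuousOn_wt a) hx

theorem hasDerivAt_wt (a : ℝ) {x : ℝ} (hx : x ∈ Set.Icc 0 ℓ) :
    HasDerivAt (fun x : ℝ => (2 - x) ^ a) (-a * (2 - x) ^ (a - 1)) x := by
  have := (((hasDerivAt_id x).const_sub 2).rpow_const (p := a) (Or.inl (two_sub_pos hx).ne'))
  refine this.congr_deriv ?_
  simp

theorem Dv_wt (a : ℝ) : Dv (wt ℓ a) ((-a) • wt ℓ (a - 1)) := fun x hx => by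
  have hx' := Set.Ioo_subset_Icc_self hx
  change HasDerivAt _ (-a * ex (wt ℓ (a - 1)) x) x
  rw [ex_wt _ hx']
  refine (hasDerivAt_wt a hx').congr_of_eventuallyEq ?_
  filter_upwards [isOpen_Ioo.mem_nhds hx] with y hy
  exact ex_wt a (Set.Ioo_subset_Icc_self hy)

/-- The derivative of the solution of the radial problem with right-hand side `q`. -/
noncomputable def B0 (d : ℝ) (hd : 0 < d) : C(Set.Icc (0:ℝ) ℓ, ℝ) →L[ℝ] C(Set.Icc (0:ℝ) ℓ, ℝ) :=
  (ContinuousLinearMap.mul ℝ _ (wt ℓ (-d))).comp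
    ((J d hd).comp (ContinuousLinearMap.mul ℝ _ (wt ℓ (d - 1))))

/-- The derivative of `B0 d hd q`. -/
noncomputable def B1 (d : ℝ) (hd : 0 < d) (q q' : C(Set.Icc (0:ℝ) ℓ, ℝ)) : C(Set.Icc (0:ℝ) ℓ, ℝ) :=
  (d • wt ℓ (-d - 1)) * J d hd (wt ℓ (d - 1) * q) +
    wt ℓ (-d) * J (d + 1) (add_pos hd one_pos) ((-(d - 1)) • wt ℓ (d - 1 - 1) * q + wt ℓ (d - 1) * q')

variable {d : ℝ} (hd : 0 < d)

theorem B0_apply (q : C(Set.Icc (0:ℝ) ℓ, ℝ)) : B0 d hd q = wt ℓ (-d) * J d hd (wt ℓ (d - 1) * q) := rfl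

theorem Dv_B0 {q q' : C(Set.Icc (0:ℝ) ℓ, ℝ)} (h : Dv q q') : Dv (B0 d hd q) (B1 d hd q q') := by
  have := (Dv_wt (ℓ := ℓ) (-d)).mul (Dv_J d hd ((Dv_wt (d - 1)).mul h))
  rw [neg_neg] at this
  exact this

theorem flux_eq (q : C(Set.Icc (0:ℝ) ℓ, ℝ)) {x : ℝ} (hx : x ∈ Set.Icc 0 ℓ) :
    x ^ d * (2 - x) ^ d * ex (B0 d hd q) x = x ^ d * ex (J d hd (wt ℓ (d - 1) * q)) x := by
  change x ^ d * (2 - x) ^ d * (ex (wt ℓ (-d)) x * ex (J d hd (wt ℓ (d - 1) * q)) x) = _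
  rw [ex_wt _ hx, Real.rpow_neg (two_sub_pos hx).le]
  have := (Real.rpow_pos_of_pos (two_sub_pos hx) d).ne'
  field_simp

theorem hasDerivAt_flux (q : C(Set.Icc (0:ℝ) ℓ, ℝ)) {x : ℝ} (hx : x ∈ Set.Ioo 0 ℓ) :
    HasDerivAt (fun x => x ^ d * (2 - x) ^ d * ex (B0 d hd q) x)
      (x ^ (d - 1) * (2 - x) ^ (d - 1) * ex q x) x := by
  have h := hasDerivAt_rpow_mul_J d hd (wt ℓ (d - 1) * q) hx
  have e : ex (wt ℓ (d - 1) * q) x = (2 - x) ^ (d - 1) * ex q x := by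
    rw [← ex_wt (d - 1) (Set.Ioo_subset_Icc_self hx)]; rfl
  rw [e, ← mul_assoc] at h
  refine h.congr_of_eventuallyEq ?_
  filter_upwards [isOpen_Ioo.mem_nhds hx] with y hy
  exact flux_eq hd q (Set.Ioo_subset_Icc_self hy)

/-- The radial differential equation. -/
theorem ode {q w' : C(Set.Icc (0:ℝ) ℓ, ℝ)} (h : Dv (B0 d hd q) w') {x : ℝ} (hx : x ∈ Set.Icc 0 ℓ) :
    x * (2 - x) * ex w' x + 2 * d * (1 - x) * ex (B0 d hd q) x = ex q x := by
  have key : ∀ x ∈ Set.Ioo 0 ℓ,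
      x * (2 - x) * ex w' x + 2 * d * (1 - x) * ex (B0 d hd q) x = ex q x := fun x hx => by
    have hx' := Set.Ioo_subset_Icc_self hx
    have h2 := two_sub_pos hx'
    have h3 := (((Real.hasDerivAt_rpow_const (p := d) (Or.inl hx.1.ne')).mul
      (hasDerivAt_wt d hx')).mul (h x hx)).unique (hasDerivAt_flux hd q hx)
    simp only [Pi.mul_apply] at h3
    rw [Real.rpow_sub_one hx.1.ne', Real.rpow_sub_one h2.ne'] at h3
    have a1 := Real.rpow_pos_of_pos hx.1 d
    have a2 := Real.rpow_pos_of_pos h2 d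
    have h1 := hx.1
    field_simp at h3
    linarith
  have hd : Set.EqOn (fun x => x * (2 - x) * ex w' x + 2 * d * (1 - x) * ex (B0 d hd q) x) (ex q)
      (closure (Set.Ioo 0 ℓ)) := by
    refine Set.EqOn.closure key ?_ (continuous_ex q)
    have h1 := continuous_ex w'
    have h2 := continuous_ex (B0 d hd q)
    fun_prop
  rw [closure_Ioo hℓ.out.ne] at hd
  exact hd hx

theorem B0_bound : ∃ C ≥ 0, ∀ (q : C(Set.Icc (0:ℝ) ℓ, ℝ)) (a : ℝ) (k : ℕ),
    (∀ x ∈ Set.Icc 0 ℓ, |ex q x| ≤ a * x ^ k) → ∀ x ∈ Set.Icc 0 ℓ, |ex (B0 d hd q) x| ≤ C * a * x ^ k := by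
  refine ⟨‖wt ℓ (-d)‖ * ((1 / d) * ‖wt ℓ (d - 1)‖), by positivity, fun q a k hq x hx => ?_⟩
  change |ex (wt ℓ (-d)) x * ex (J d hd (wt ℓ (d - 1) * q)) x| ≤ _
  rw [abs_mul, mul_assoc, mul_assoc]
  refine mul_le_mul (abs_ex_le _ _) ?_ (abs_nonneg _) (norm_nonneg _)
  rw [ex_J d hd _ hx, abs_mul, abs_of_nonneg (by positivity : 0 ≤ 1 / d), mul_assoc]
  refine mul_le_mul_of_nonneg_left ?_ (by positivity)
  have := intervalIntegral.norm_integral_le_of_norm_le_const (a := 0) (b := 1)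
    (f := fun s : ℝ => ex (wt ℓ (d - 1) * q) (x * s ^ (1 / d))) (C := ‖wt ℓ (d - 1)‖ * (a * x ^ k))
    fun s hs => by
      rw [Set.uIoc_of_le zero_le_one] at hs
      change |ex (wt ℓ (d - 1)) (x * s ^ (1 / d)) * ex q (x * s ^ (1 / d))| ≤ _
      rw [abs_mul]
      have h1 : s ^ (1 / d) ≤ 1 := Real.rpow_le_one hs.1.le hs.2 (by positivity)
      have h0 : 0 ≤ s ^ (1 / d) := Real.rpow_nonneg hs.1.le _
      have h2 : x * s ^ (1 / d) ≤ x := mul_le_of_le_one_right hx.1 h1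
      have h3 : 0 ≤ x * s ^ (1 / d) := mul_nonneg hx.1 h0
      refine mul_le_mul (abs_ex_le _ _) ((hq _ ⟨h3, h2.trans hx.2⟩).trans ?_) (abs_nonneg _)
        (norm_nonneg _)
      have ha : 0 ≤ a := by
        have := (abs_nonneg _).trans (hq ℓ ⟨hℓ.out.le, le_rfl⟩)
        exact nonneg_of_mul_nonneg_left this (pow_pos hℓ.out k)
      exact mul_le_mul_of_nonneg_left (pow_le_pow_left₀ h3 h2 k) ha
  rwa [sub_zero, abs_one, mul_one] at this

theorem exists_psi (Λ : ℝ) : ∃ ψ : C(Set.Icc (0:ℝ) ℓ, ℝ), ex ψ 0 = 1 ∧ Dv ψ (B0 d hd ((-Λ) • ψ)) := by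
  obtain ⟨C, hC, hb⟩ := B0_bound (ℓ := ℓ) hd
  let T : C(Set.Icc (0:ℝ) ℓ, ℝ) →L[ℝ] C(Set.Icc (0:ℝ) ℓ, ℝ) := (-Λ) • In.comp (B0 d hd)
  have hT : ∀ (q : C(Set.Icc (0:ℝ) ℓ, ℝ)) (a : ℝ) (k : ℕ), (∀ x ∈ Set.Icc 0 ℓ, |ex q x| ≤ a * x ^ k) →
      ∀ x ∈ Set.Icc 0 ℓ, |ex (T q) x| ≤ |Λ| * C * a / (k + 1) * x ^ (k + 1) := by
    intro q a k hq x hx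
    change |-Λ * ex (In (B0 d hd q)) x| ≤ _
    rw [abs_mul, abs_neg, ex_In _ hx]
    have h1 : |∫ y in (0:ℝ)..x, ex (B0 d hd q) y| ≤ ∫ y in (0:ℝ)..x, C * a * y ^ k := by
      rw [← Real.norm_eq_abs]
      refine intervalIntegral.norm_integral_le_of_norm_le hx.1 (ae_of_all _ fun y hy => ?_)
        ((continuous_const.mul (continuous_pow k)).intervalIntegrable _ _)
      exact hb q a k hq y ⟨hy.1.le, hy.2.trans hx.2⟩
    rw [intervalIntegral.integral_const_mul, integral_pow] at h1
    refine (mul_le_mul_of_nonneg_left h1 (abs_nonneg Λ)).trans (le_of_eq ?_)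
    rw [zero_pow (Nat.succ_ne_zero k)]
    ring
  have hk : ∀ k : ℕ, ∀ x ∈ Set.Icc 0 ℓ, |ex ((T ^ k) 1) x| ≤ (|Λ| * C) ^ k / k.factorial * x ^ k := by
    intro k
    induction k with
    | zero => intro x hx; simp [ex]
    | succ k ih =>
      intro x hx
      have := hT _ _ k ih x hx
      rw [pow_succ', ContinuousLinearMap.mul_apply]
      refine this.trans (le_of_eq ?_)
      rw [Nat.factorial_succ]
      push_cast
      field_simp
      ring
  have hsum : Summable fun k : ℕ => (T ^ k) (1 : C(Set.Icc (0:ℝ) ℓ, ℝ)) := by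
    refine Summable.of_norm_bounded (Real.summable_pow_div_factorial (|Λ| * C * ℓ)) fun k => ?_
    rw [ContinuousMap.norm_le _ (by have := hℓ.out; positivity)]
    intro x
    have := hk k x x.2
    rw [ex_val] at this
    refine this.trans ?_
    rw [mul_pow _ ℓ, mul_div_right_comm]
    exact mul_le_mul_of_nonneg_left (pow_le_pow_left₀ x.2.1 x.2.2 k) (by positivity)
  obtain ⟨ψ, hψ⟩ : ∃ ψ, ψ = ∑' k : ℕ, (T ^ k) (1 : C(Set.Icc (0:ℝ) ℓ, ℝ)) := ⟨_, rfl⟩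
  have hfix : ψ = 1 + In (B0 d hd ((-Λ) • ψ)) := by
    have h1 : T ψ = ∑' k : ℕ, (T ^ (k + 1)) 1 := by
      rw [hψ, T.map_tsum hsum]
      exact tsum_congr fun k => by rw [pow_succ']; rfl
    have h2 : In (B0 d hd ((-Λ) • ψ)) = T ψ := by
      rw [map_smul, map_smul]; rfl
    rw [h2, h1, hψ, hsum.tsum_eq_zero_add]
    rfl
  refine ⟨ψ, ?_, ?_⟩
  · rw [hfix]
    change 1 + ex (In (B0 d hd ((-Λ) • ψ))) 0 = 1
    rw [ex_In_zero, add_zero]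
  · have h := (Dv.const (ℓ := ℓ) 1).add (Dv_In (B0 d hd ((-Λ) • ψ)))
    rw [zero_add] at h
    nth_rw 1 [hfix]
    exact h

end ConeHet

namespace ConeHet
open scoped Topology BoundedContinuousFunction

/-- A positive radial eigenfunction on the cap vanishing exactly on the boundary. -/
structure Prof (ℓ d : ℝ) [hℓ : Fact (0 < ℓ)] [hℓ2 : Fact (ℓ < 2)] where
  hd : 0 < d
  Λ : ℝ
  hΛ : 0 < Λ
  ψ : C(Set.Icc (0:ℝ) ℓ, ℝ)
  at_zero : ex ψ 0 = 1
  dv : Dv ψ (B0 d hd ((-Λ) • ψ))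
  pos : ∀ x ∈ Set.Ico 0 ℓ, 0 < ex ψ x
  zero : ex ψ ℓ = 0

theorem B0_nonneg {ℓ : ℝ} [hℓ : Fact (0 < ℓ)] [hℓ2 : Fact (ℓ < 2)] {d : ℝ} (hd : 0 < d)
    {q : C(Set.Icc (0:ℝ) ℓ, ℝ)} (hq : ∀ x, 0 ≤ q x) (x : Set.Icc (0:ℝ) ℓ) : 0 ≤ B0 d hd q x := by
  have hw : ∀ a (x : Set.Icc (0:ℝ) ℓ), 0 ≤ wt ℓ a x := fun a x =>
    (Real.rpow_pos_of_pos (two_sub_pos x.2) a).le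
  exact mul_nonneg (hw _ x) (J_nonneg d hd (fun y => mul_nonneg (hw _ y) (hq y)) x)

namespace Prof
variable {ℓ d : ℝ} [hℓ : Fact (0 < ℓ)] [hℓ2 : Fact (ℓ < 2)] (Q : Prof ℓ d)

theorem nonneg {x : ℝ} (hx : x ∈ Set.Icc 0 ℓ) : 0 ≤ ex Q.ψ x := by
  rcases hx.2.eq_or_lt with h | h
  · rw [h, Q.zero]
  · exact (Q.pos x ⟨hx.1, h⟩).le

theorem nonneg' (x : Set.Icc (0:ℝ) ℓ) : 0 ≤ Q.ψ x := by
  rw [← ex_val]; exact Q.nonneg x.2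

theorem deriv_nonpos (x : ℝ) : ex (B0 d Q.hd ((-Q.Λ) • Q.ψ)) x ≤ 0 := by
  rw [neg_smul, map_neg]
  have := B0_nonneg Q.hd (q := Q.Λ • Q.ψ) (fun y => mul_nonneg Q.hΛ.le (Q.nonneg' y)) (pr ℓ x)
  change -(B0 d Q.hd (Q.Λ • Q.ψ) (pr ℓ x)) ≤ 0
  linarith

theorem anti : AntitoneOn (ex Q.ψ) (Set.Icc 0 ℓ) := by
  refine antitoneOn_of_deriv_nonpos (convex_Icc _ _) (continuous_ex _).continuousOn ?_ ?_
  · rw [interior_Icc]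
    exact fun x hx => (Q.dv x hx).differentiableAt.differentiableWithinAt
  · rw [interior_Icc]
    intro x hx
    rw [(Q.dv x hx).deriv]
    exact Q.deriv_nonpos x

theorem le_one (x : Set.Icc (0:ℝ) ℓ) : Q.ψ x ≤ 1 := by
  have := Q.anti ⟨le_rfl, hℓ.out.le⟩ x.2 x.2.1
  rwa [Q.at_zero, ex_val] at this

/-- The weight of the source. -/
noncomputable def om : C(Set.Icc (0:ℝ) ℓ, ℝ) := wt ℓ (d - 1) * (Q.ψ * Q.ψ)
/-- The weight of the flux. -/
noncomputable def Pw : C(Set.Icc (0:ℝ) ℓ, ℝ) := wt ℓ d * (Q.ψ * Q.ψ)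

theorem ex_om {x : ℝ} (hx : x ∈ Set.Icc 0 ℓ) : ex Q.om x = (2 - x) ^ (d - 1) * (ex Q.ψ x * ex Q.ψ x) := by
  rw [← ex_wt _ hx]; rfl
theorem ex_Pw {x : ℝ} (hx : x ∈ Set.Icc 0 ℓ) : ex Q.Pw x = (2 - x) ^ d * (ex Q.ψ x * ex Q.ψ x) := by
  rw [← ex_wt _ hx]; rfl

theorem om_pos {x : ℝ} (hx : x ∈ Set.Ico 0 ℓ) : 0 < ex Q.om x := by
  rw [Q.ex_om (Set.Ico_subset_Icc_self hx)]
  have := Q.pos x hx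
  have := Real.rpow_pos_of_pos (two_sub_pos (Set.Ico_subset_Icc_self hx)) (d - 1)
  positivity
theorem Pw_pos {x : ℝ} (hx : x ∈ Set.Ico 0 ℓ) : 0 < ex Q.Pw x := by
  rw [Q.ex_Pw (Set.Ico_subset_Icc_self hx)]
  have := Q.pos x hx
  have := Real.rpow_pos_of_pos (two_sub_pos (Set.Ico_subset_Icc_self hx)) d
  positivity
theorem om_nonneg {x : ℝ} (hx : x ∈ Set.Icc 0 ℓ) : 0 ≤ ex Q.om x := by
  rw [Q.ex_om hx]
  have := Real.rpow_pos_of_pos (two_sub_pos hx) (d - 1)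
  exact mul_nonneg this.le (mul_self_nonneg _)
theorem Pw_nonneg {x : ℝ} (hx : x ∈ Set.Icc 0 ℓ) : 0 ≤ ex Q.Pw x := by
  rw [Q.ex_Pw hx]
  have := Real.rpow_pos_of_pos (two_sub_pos hx) d
  exact mul_nonneg this.le (mul_self_nonneg _)
theorem Pw_end : ex Q.Pw ℓ = 0 := by
  rw [Q.ex_Pw ⟨hℓ.out.le, le_rfl⟩, Q.zero]; simp

/-- `x^d J(ω f)(x) = ∫₀ˣ y^(d-1) ω f`. -/
noncomputable def N (f : C(Set.Icc (0:ℝ) ℓ, ℝ)) (x : ℝ) : ℝ := x ^ d * ex (J d Q.hd (Q.om * f)) x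

theorem continuous_N (f : C(Set.Icc (0:ℝ) ℓ, ℝ)) : Continuous (Q.N f) := continuous_rpow_mul_J _ _ _

theorem N_zero (f : C(Set.Icc (0:ℝ) ℓ, ℝ)) : Q.N f 0 = 0 := by
  rw [N, Real.zero_rpow Q.hd.ne', zero_mul]

theorem hasDerivAt_N (f : C(Set.Icc (0:ℝ) ℓ, ℝ)) {x : ℝ} (hx : x ∈ Set.Ioo 0 ℓ) :
    HasDerivAt (Q.N f) (x ^ (d - 1) * (ex Q.om x * ex f x)) x := hasDerivAt_rpow_mul_J d Q.hd _ hx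

/-- Total mass. -/
noncomputable def mass : ℝ := ex (J d Q.hd Q.om) ℓ

theorem eq_zero_of_J {h : C(Set.Icc (0:ℝ) ℓ, ℝ)} (h0 : ∀ x, 0 ≤ h x)
    (hJ : ex (J d Q.hd (Q.om * h)) ℓ = 0) (x : Set.Icc (0:ℝ) ℓ) : h x = 0 := by
  have hmono : MonotoneOn (Q.N h) (Set.Icc 0 ℓ) := by
    refine monotoneOn_of_deriv_nonneg (convex_Icc _ _) (Q.continuous_N h).continuousOn ?_ ?_
    · rw [interior_Icc]
      exact fun x hx => (Q.hasDerivAt_N h hx).differentiableAt.differentiableWithinAt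
    · rw [interior_Icc]
      intro x hx
      rw [(Q.hasDerivAt_N h hx).deriv]
      exact mul_nonneg (Real.rpow_nonneg hx.1.le _)
        (mul_nonneg (Q.om_nonneg (Set.Ioo_subset_Icc_self hx)) (h0 _))
  have hz : ∀ x ∈ Set.Icc 0 ℓ, Q.N h x = 0 := by
    intro x hx
    have h1 := hmono ⟨le_rfl, hℓ.out.le⟩ hx hx.1
    have h2 := hmono hx ⟨hℓ.out.le, le_rfl⟩ hx.2
    rw [Q.N_zero] at h1
    rw [show Q.N h ℓ = 0 by rw [N, hJ, mul_zero]] at h2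
    exact le_antisymm h2 h1
  suffices h = 0 by rw [this]; rfl
  refine eq_of_ex fun x hx => ?_
  have h1 : HasDerivAt (Q.N h) 0 x := (hasDerivAt_const x (0:ℝ)).congr_of_eventuallyEq (by
    filter_upwards [isOpen_Ioo.mem_nhds hx] with y hy using hz y (Set.Ioo_subset_Icc_self hy))
  have h2 := (Q.hasDerivAt_N h hx).unique h1
  have h3 := Q.om_pos (x := x) ⟨hx.1.le, hx.2⟩
  have h4 := Real.rpow_pos_of_pos hx.1 (d - 1)
  rcases mul_eq_zero.1 h2 with h | h
  · exact absurd h h4.ne'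
  · exact (mul_eq_zero.1 h).resolve_left h3.ne'

theorem mass_pos : 0 < Q.mass := by
  have h0 : ∀ x, 0 ≤ Q.om x := fun x => by rw [← ex_val]; exact Q.om_nonneg x.2
  refine lt_of_le_of_ne (J_nonneg d Q.hd h0 _) fun h => ?_
  have := Q.eq_zero_of_J (h := 1) (fun _ => zero_le_one) (by rw [mul_one]; exact h.symm) (pr ℓ 0)
  exact one_ne_zero this

/-- The mean. -/
noncomputable def mn : C(Set.Icc (0:ℝ) ℓ, ℝ) →L[ℝ] ℝ :=
  (1 / Q.mass) • (ContinuousMap.evalCLM ℝ (pr ℓ ℓ)).comp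
    ((J d Q.hd).comp (ContinuousLinearMap.mul ℝ _ Q.om))

theorem mn_apply (f : C(Set.Icc (0:ℝ) ℓ, ℝ)) : Q.mn f = 1 / Q.mass * ex (J d Q.hd (Q.om * f)) ℓ := rfl

theorem mn_eq_zero {f : C(Set.Icc (0:ℝ) ℓ, ℝ)} : Q.mn f = 0 ↔ ex (J d Q.hd (Q.om * f)) ℓ = 0 := by
  rw [mn_apply, mul_eq_zero, or_iff_right (one_div_pos.2 Q.mass_pos).ne']

theorem mn_const (c : ℝ) : Q.mn (ContinuousMap.const _ c) = c := by
  have : ContinuousMap.const (Set.Icc (0:ℝ) ℓ) c = c • 1 := by ext x; simp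
  rw [this, map_smul, mn_apply, mul_one]
  change c * (1 / Q.mass * Q.mass) = c
  rw [one_div_mul_cancel Q.mass_pos.ne', mul_one]

/-- The parametrization. -/
noncomputable def par (ℓ d : ℝ) [hℓ : Fact (0 < ℓ)] (s : ℝ) : Set.Icc (0:ℝ) ℓ := pr ℓ (ℓ * s ^ (1 / d))

theorem continuous_par (hd : 0 < d) : Continuous (par ℓ d) :=
  continuous_pr.comp (continuous_const.mul (continuous_id.rpow_const fun _ => Or.inr (by positivity)))

/-- The invariant measure. -/
noncomputable def meas : Measure (Set.Icc (0:ℝ) ℓ) :=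
  ((volume.restrict (Set.Ioc (0:ℝ) 1)).withDensity fun s =>
    ENNReal.ofReal (1 / Q.mass * (1 / d) * Q.om (par ℓ d s))).map (par ℓ d)

theorem integral_meas (f : C(Set.Icc (0:ℝ) ℓ, ℝ)) : ∫ x, f x ∂Q.meas = Q.mn f := by
  have hc := continuous_par (ℓ := ℓ) Q.hd
  have hpos : ∀ s, 0 ≤ 1 / Q.mass * (1 / d) * Q.om (par ℓ d s) := fun s => by
    have := Q.mass_pos
    have := Q.hd
    have : 0 ≤ Q.om (par ℓ d s) := by rw [← ex_val]; exact Q.om_nonneg (par ℓ d s).2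
    positivity
  rw [meas, integral_map hc.measurable.aemeasurable f.continuous.aestronglyMeasurable,
    integral_withDensity_eq_integral_toReal_smul]
  · simp only [ENNReal.toReal_ofReal (hpos _), smul_eq_mul]
    rw [mn_apply, ex_J d Q.hd _ ⟨hℓ.out.le, le_rfl⟩, intervalIntegral.integral_of_le zero_le_one,
      ← mul_assoc, ← integral_const_mul]
    refine integral_congr_ae (ae_of_all _ fun s => ?_)
    change _ * Q.om (par ℓ d s) * f (par ℓ d s) = _ * (Q.om (par ℓ d s) * f (par ℓ d s))
    ring
  · exact (continuous_const.mul (Q.om.continuous.comp hc)).measurable.ennreal_ofReal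
  · exact ae_of_all _ fun _ => ENNReal.ofReal_lt_top

instance : IsProbabilityMeasure Q.meas := by
  have h1 := Q.integral_meas (ContinuousMap.const _ 1)
  rw [mn_const] at h1
  simp only [ContinuousMap.const_apply, integral_const, smul_eq_mul, mul_one] at h1
  constructor
  have h2 : (Q.meas Set.univ).toReal = 1 := h1
  rw [← ENNReal.toReal_eq_one_iff]; exact h2

/-- The bound that makes the flux divisible by the weight. -/
theorem flux_bound : ∃ C ≥ 0, ∀ f : C(Set.Icc (0:ℝ) ℓ, ℝ), Q.mn f = 0 → ∀ x ∈ Set.Icc 0 ℓ,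
    |ex (J d Q.hd (Q.om * f)) x| ≤ C * ‖f‖ * ((ℓ - x) * ex Q.Pw x) := by
  have hl := hℓ.out
  have hl2 := hℓ2.out
  obtain ⟨b, hb⟩ : ∃ b, b = ℓ / 2 := ⟨_, rfl⟩
  have hb0 : 0 < b := by linarith
  have hbl : b < ℓ := by linarith
  obtain ⟨C1, hC1⟩ := (isCompact_Icc (a := b) (b := ℓ)).exists_bound_of_continuousOn
    (f := fun y : ℝ => y ^ (d - 1) * (2 - y) ^ (d - 1)) (fun y hy =>
      ((continuousAt_id.rpow_const (Or.inl (hb0.trans_le hy.1).ne')).mul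
        ((continuous_const.sub continuous_id).continuousAt.rpow_const
          (Or.inl (by have := hy.2; simp; linarith)))).continuousWithinAt)
  have hC1n : 0 ≤ C1 := (norm_nonneg _).trans (hC1 b ⟨le_rfl, hbl.le⟩)
  have hP2 : 0 < (2 - ℓ) ^ d := Real.rpow_pos_of_pos (by linarith) d
  have hbd : 0 < b ^ d := Real.rpow_pos_of_pos hb0 d
  have hψb := Q.pos b ⟨hb0.le, hbl⟩
  have hPlow : ∀ x ∈ Set.Icc 0 ℓ, (2 - ℓ) ^ d * (ex Q.ψ x * ex Q.ψ x) ≤ ex Q.Pw x := fun x hx => by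
    rw [Q.ex_Pw hx]
    exact mul_le_mul_of_nonneg_right (Real.rpow_le_rpow (by linarith) (by linarith [hx.2]) Q.hd.le)
      (mul_self_nonneg _)
  obtain ⟨A, hA⟩ : ∃ A, A = ‖(J d Q.hd).comp (ContinuousLinearMap.mul ℝ _ Q.om)‖ := ⟨_, rfl⟩
  have hA0 : 0 ≤ A := by rw [hA]; exact norm_nonneg _
  obtain ⟨D, hD⟩ : ∃ D, D = b * ((2 - ℓ) ^ d * (ex Q.ψ b * ex Q.ψ b)) := ⟨_, rfl⟩
  have hD0 : 0 < D := by rw [hD]; positivity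
  refine ⟨A / D + C1 / (b ^ d * (2 - ℓ) ^ d), by positivity, fun f hf x hx => ?_⟩
  have hPx := Q.Pw_nonneg hx
  have hlx : 0 ≤ ℓ - x := by linarith [hx.2]
  have hf0 := norm_nonneg f
  rcases le_total x b with hxb | hxb
  · have h1 : |ex (J d Q.hd (Q.om * f)) x| ≤ A * ‖f‖ := by
      refine (abs_ex_le _ _).trans ?_
      rw [hA]
      exact ((J d Q.hd).comp (ContinuousLinearMap.mul ℝ _ Q.om)).le_opNorm f
    have h2 : D ≤ (ℓ - x) * ex Q.Pw x := by
      rw [hD]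
      refine mul_le_mul (by linarith) (le_trans ?_ (hPlow x hx)) (by positivity) hlx
      have h3 := Q.anti hx ⟨hb0.le, hbl.le⟩ hxb
      exact mul_le_mul_of_nonneg_left (mul_self_le_mul_self hψb.le h3) hP2.le
    calc _ ≤ A * ‖f‖ := h1
      _ = A / D * ‖f‖ * D := by field_simp
      _ ≤ A / D * ‖f‖ * ((ℓ - x) * ex Q.Pw x) := mul_le_mul_of_nonneg_left h2 (by positivity)
      _ ≤ _ := by
        have : 0 ≤ C1 / (b ^ d * (2 - ℓ) ^ d) * ‖f‖ * ((ℓ - x) * ex Q.Pw x) := by positivity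
        linarith
  · have hx0 := hb0.trans_le hxb
    have h1 : |Q.N f ℓ - Q.N f x| ≤ C1 * (ex Q.ψ x * ex Q.ψ x) * ‖f‖ * |ℓ - x| := by
      rcases hx.2.eq_or_lt with h | hxl
      · rw [h]; simp
      obtain ⟨c, hc, hc'⟩ := exists_hasDerivAt_eq_slope (Q.N f) _ hxl (Q.continuous_N f).continuousOn
        (fun y hy => Q.hasDerivAt_N f ⟨hx0.trans hy.1, hy.2⟩)
      rw [eq_div_iff (by linarith)] at hc'
      rw [← hc', abs_mul]
      refine mul_le_mul_of_nonneg_right ?_ (abs_nonneg _)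
      have hcI : c ∈ Set.Icc 0 ℓ := ⟨(hx0.trans hc.1).le, hc.2.le⟩
      rw [Q.ex_om hcI, ← mul_assoc, ← mul_assoc, abs_mul, abs_mul]
      have h4 := Q.anti hx hcI hc.1.le
      have h5 := mul_self_le_mul_self (Q.nonneg hcI) h4
      refine mul_le_mul (mul_le_mul (hC1 c ⟨hxb.trans hc.1.le, hc.2.le⟩) ?_ (abs_nonneg _) hC1n)
        (abs_ex_le _ _) (abs_nonneg _) (mul_nonneg hC1n (mul_self_nonneg _))
      rwa [abs_of_nonneg (mul_self_nonneg _)]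
    have h2 : Q.N f ℓ = 0 := by rw [N, Q.mn_eq_zero.1 hf, mul_zero]
    rw [h2, zero_sub, abs_neg, N, abs_mul, abs_of_pos (Real.rpow_pos_of_pos hx0 d),
      abs_of_nonneg hlx] at h1
    have h3 : b ^ d * |ex (J d Q.hd (Q.om * f)) x| ≤ x ^ d * |ex (J d Q.hd (Q.om * f)) x| :=
      mul_le_mul_of_nonneg_right (Real.rpow_le_rpow hb0.le hxb Q.hd.le) (abs_nonneg _)
    have h4 : C1 * (ex Q.ψ x * ex Q.ψ x) * ‖f‖ * (ℓ - x) ≤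
        C1 / (2 - ℓ) ^ d * ‖f‖ * ((ℓ - x) * ex Q.Pw x) := by
      have := mul_le_mul_of_nonneg_left (hPlow x hx)
        (show 0 ≤ C1 / (2 - ℓ) ^ d * ‖f‖ * (ℓ - x) by positivity)
      refine le_trans (le_of_eq ?_) (this.trans (le_of_eq (by ring)))
      field_simp
    have h5 : |ex (J d Q.hd (Q.om * f)) x| ≤
        C1 / (b ^ d * (2 - ℓ) ^ d) * ‖f‖ * ((ℓ - x) * ex Q.Pw x) := by
      have := (h3.trans h1).trans h4
      rw [← le_div_iff₀' hbd] at this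
      refine this.trans (le_of_eq ?_)
      field_simp
    refine h5.trans ?_
    have : 0 ≤ A / D * ‖f‖ * ((ℓ - x) * ex Q.Pw x) := by positivity
    linarith

end Prof
end ConeHet

namespace ConeHet
open scoped Topology BoundedContinuousFunction
namespace Prof
variable {ℓ d : ℝ} [hℓ : Fact (0 < ℓ)] [hℓ2 : Fact (ℓ < 2)] (Q : Prof ℓ d)

/-- Projection to mean zero. -/
noncomputable def pm : C(Set.Icc (0:ℝ) ℓ, ℝ) →L[ℝ] C(Set.Icc (0:ℝ) ℓ, ℝ) :=
  ContinuousLinearMap.id ℝ _ - Q.mn.smulRight 1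

theorem mn_pm (f : C(Set.Icc (0:ℝ) ℓ, ℝ)) : Q.mn (Q.pm f) = 0 := by
  have h1 : Q.mn (1 : C(Set.Icc (0:ℝ) ℓ, ℝ)) = 1 := Q.mn_const 1
  change Q.mn (f - Q.mn f • 1) = 0
  rw [map_sub, map_smul, h1, smul_eq_mul, mul_one, sub_self]

theorem pm_of {f : C(Set.Icc (0:ℝ) ℓ, ℝ)} (h : Q.mn f = 0) : Q.pm f = f := by
  change f - Q.mn f • 1 = f
  rw [h, zero_smul, sub_zero]

theorem pm_sub_const (f : C(Set.Icc (0:ℝ) ℓ, ℝ)) (c : ℝ) :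
    Q.pm (f - ContinuousMap.const _ c) = Q.pm f := by
  change (f - ContinuousMap.const _ c) - Q.mn (f - ContinuousMap.const _ c) • 1 = f - Q.mn f • 1
  rw [map_sub, Q.mn_const]
  ext x
  change f x - c - (Q.mn f - c) * 1 = f x - Q.mn f * 1
  ring

/-- The flux divided by the weight. -/
noncomputable def bf (f : C(Set.Icc (0:ℝ) ℓ, ℝ)) (x : ℝ) : ℝ :=
  ex (J d Q.hd (Q.om * f)) x / ex Q.Pw x

theorem bf_bound : ∃ C ≥ 0, ∀ f : C(Set.Icc (0:ℝ) ℓ, ℝ), Q.mn f = 0 → ∀ x ∈ Set.Icc 0 ℓ,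
    |Q.bf f x| ≤ C * ‖f‖ * (ℓ - x) := by
  obtain ⟨C, hC, h⟩ := Q.flux_bound
  refine ⟨C, hC, fun f hf x hx => ?_⟩
  have hlx : 0 ≤ ℓ - x := by linarith [hx.2]
  rw [bf, abs_div]
  refine div_le_of_le_mul₀ (abs_nonneg _) (by positivity) ?_
  rw [abs_of_nonneg (Q.Pw_nonneg hx), mul_assoc]
  exact h f hf x hx

theorem continuousOn_bf {f : C(Set.Icc (0:ℝ) ℓ, ℝ)} (hf : Q.mn f = 0) :
    ContinuousOn (Q.bf f) (Set.Icc 0 ℓ) := by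
  intro x hx
  rcases hx.2.eq_or_lt with h | h
  · obtain ⟨C, hC, hb⟩ := Q.bf_bound
    have h0 : Q.bf f x = 0 := by rw [bf, h, Q.Pw_end, div_zero]
    rw [ContinuousWithinAt, h0]
    refine squeeze_zero_norm' (a := fun y => C * ‖f‖ * (ℓ - y)) ?_ ?_
    · filter_upwards [self_mem_nhdsWithin] with y hy using hb f hf y hy
    · have : Continuous fun y => C * ‖f‖ * (ℓ - y) := by fun_prop
      have := this.tendsto x
      rw [h, sub_self, mul_zero] at this
      rw [h]
      exact this.mono_left nhdsWithin_le_nhds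
  · exact ((continuous_ex _).continuousAt.div (continuous_ex _).continuousAt
      (Q.Pw_pos ⟨hx.1, h⟩).ne').continuousWithinAt

theorem bf_add (f g : C(Set.Icc (0:ℝ) ℓ, ℝ)) (x : ℝ) : Q.bf (f + g) x = Q.bf f x + Q.bf g x := by
  rw [bf, mul_add, map_add]
  exact add_div _ _ _

theorem bf_smul (c : ℝ) (f : C(Set.Icc (0:ℝ) ℓ, ℝ)) (x : ℝ) : Q.bf (c • f) x = c * Q.bf f x := by
  rw [bf, mul_smul_comm, map_smul]
  exact mul_div_assoc _ _ _

theorem exists_Bc : ∃ T : C(Set.Icc (0:ℝ) ℓ, ℝ) →L[ℝ] C(Set.Icc (0:ℝ) ℓ, ℝ),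
    ∀ f, ∀ x ∈ Set.Icc 0 ℓ, ex (T f) x = Q.bf (Q.pm f) x := by
  obtain ⟨C, hC, hb⟩ := Q.bf_bound
  refine ⟨LinearMap.mkContinuous
    { toFun := fun f => rs ℓ (Q.bf (Q.pm f)) (Q.continuousOn_bf (Q.mn_pm f))
      map_add' := fun f g => by
        ext x
        change Q.bf (Q.pm (f + g)) x = Q.bf (Q.pm f) x + Q.bf (Q.pm g) x
        rw [map_add, bf_add]
      map_smul' := fun c f => by
        ext x
        change Q.bf (Q.pm (c • f)) x = c * Q.bf (Q.pm f) x
        rw [map_smul, bf_smul] } (C * ‖Q.pm‖ * ℓ) fun f => ?_, fun f x hx => ?_⟩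
  · have hl := hℓ.out
    rw [ContinuousMap.norm_le _ (by positivity)]
    intro x
    refine (hb _ (Q.mn_pm f) x x.2).trans ?_
    have h1 := Q.pm.le_opNorm f
    calc C * ‖Q.pm f‖ * (ℓ - x) ≤ C * (‖Q.pm‖ * ‖f‖) * ℓ :=
          mul_le_mul (mul_le_mul_of_nonneg_left h1 hC) (by linarith [x.2.1]) (by linarith [x.2.2])
            (by positivity)
      _ = _ := by ring
  · exact ex_rs (Q.continuousOn_bf (Q.mn_pm f)) hx

/-- The derivative of the solution with given source. -/
noncomputable def Bc : C(Set.Icc (0:ℝ) ℓ, ℝ) →L[ℝ] C(Set.Icc (0:ℝ) ℓ, ℝ) := Q.exists_Bc.choose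

theorem ex_Bc {f : C(Set.Icc (0:ℝ) ℓ, ℝ)} (hf : Q.mn f = 0) {x : ℝ} (hx : x ∈ Set.Icc 0 ℓ) :
    ex (Q.Bc f) x = Q.bf f x := by
  have := Q.exists_Bc.choose_spec f x hx
  rw [Q.pm_of hf] at this
  exact this

theorem Bc_sub_const (f : C(Set.Icc (0:ℝ) ℓ, ℝ)) (c : ℝ) :
    Q.Bc (f - ContinuousMap.const _ c) = Q.Bc f := by
  refine eq_of_ex fun x hx => ?_
  rw [Bc, Q.exists_Bc.choose_spec _ x (Set.Ioo_subset_Icc_self hx),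
    Q.exists_Bc.choose_spec _ x (Set.Ioo_subset_Icc_self hx), Q.pm_sub_const]

theorem flux_Bc {f : C(Set.Icc (0:ℝ) ℓ, ℝ)} (hf : Q.mn f = 0) {x : ℝ} (hx : x ∈ Set.Icc 0 ℓ) :
    x ^ d * (ex Q.Pw x * ex (Q.Bc f) x) = Q.N f x := by
  rw [Q.ex_Bc hf hx, N, bf]
  rcases hx.2.eq_or_lt with h | h
  · rw [h, Q.mn_eq_zero.1 hf, Q.Pw_end]; simp
  · rw [mul_div_cancel₀ _ (Q.Pw_pos ⟨hx.1, h⟩).ne']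

theorem energy {g f f' : C(Set.Icc (0:ℝ) ℓ, ℝ)} (hf : Q.mn f = 0) (hg : Dv g (Q.Bc f))
    (hf' : Q.mn f' = 0) : Q.mn (g * f') =
      -(1 / Q.mass / ℓ ^ d) * ∫ x in (0:ℝ)..ℓ, x ^ d * ex Q.Pw x * (ex (Q.Bc f) x * ex (Q.Bc f') x) := by
  have hc : Continuous fun x => x ^ d * ex Q.Pw x * (ex (Q.Bc f) x * ex (Q.Bc f') x) :=
    ((continuous_id.rpow_const fun _ => Or.inr Q.hd.le).mul (continuous_ex _)).mul
      ((continuous_ex _).mul (continuous_ex _))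
  have hI : ∀ x, HasDerivAt (fun x => ∫ x in (0:ℝ)..x,
      x ^ d * ex Q.Pw x * (ex (Q.Bc f) x * ex (Q.Bc f') x)) _ x :=
    fun x => (hc.integral_hasStrictDerivAt 0 x).hasDerivAt
  have key := eq_of_hasDerivAt (a := 0) (b := ℓ) (F := Q.N (g * f'))
    (G := fun x => ex g x * Q.N f' x - ∫ x in (0:ℝ)..x,
      x ^ d * ex Q.Pw x * (ex (Q.Bc f) x * ex (Q.Bc f') x))
    (φ := fun x => x ^ (d - 1) * (ex Q.om x * ex (g * f') x)) (Q.continuous_N _).continuousOn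
    (((continuous_ex g).mul (Q.continuous_N _)).sub
      (continuous_iff_continuousAt.2 fun x => (hI x).continuousAt)).continuousOn
    (fun x hx => Q.hasDerivAt_N _ hx)
    (fun x hx => by
      have := ((hg x hx).mul (Q.hasDerivAt_N f' hx)).sub (hI x)
      refine this.congr_deriv ?_
      rw [← Q.flux_Bc hf' (Set.Ioo_subset_Icc_self hx)]
      change _ = x ^ (d - 1) * (ex Q.om x * (ex g x * ex f' x))
      ring)
    (by simp [Q.N_zero]) ℓ ⟨hℓ.out.le, le_rfl⟩
  have h0 : Q.N f' ℓ = 0 := by rw [N, Q.mn_eq_zero.1 hf', mul_zero]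
  simp only [h0, mul_zero, zero_sub] at key
  have hld := Real.rpow_pos_of_pos hℓ.out d
  rw [mn_apply, neg_mul, ← mul_neg, ← key, N]
  field_simp

theorem max_principle {g f : C(Set.Icc (0:ℝ) ℓ, ℝ)} (hf : Q.mn f = 0) (hg : Dv g (Q.Bc f))
    (x : Set.Icc (0:ℝ) ℓ) (hx : ∀ y, g y ≤ g x) : f x ≤ 0 := by
  by_contra hfx
  push Not at hfx
  have hl := hℓ.out
  obtain ⟨x, hxI⟩ := x
  rw [← ex_of_mem] at hfx
  have hmax : ∀ y, ex g y ≤ ex g x := fun y => (hx _).trans (by rw [ex_of_mem g hxI])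
  have hnear : ∀ᶠ y in 𝓝 x, 0 < ex f y := (continuous_ex f).continuousAt.eventually (lt_mem_nhds hfx)
  obtain ⟨ε, hε, hball⟩ := Metric.eventually_nhds_iff.1 hnear
  have hNpos : ∀ y ∈ Set.Ioo 0 ℓ, 0 < ex f y → 0 < y ^ (d - 1) * (ex Q.om y * ex f y) := fun y hy h => by
    have h3 := Q.om_pos (x := y) ⟨hy.1.le, hy.2⟩
    have h4 := Real.rpow_pos_of_pos hy.1 (d - 1)
    positivity
  have hBN : ∀ y ∈ Set.Ioo 0 ℓ, ex (Q.Bc f) y = Q.N f y / (y ^ d * ex Q.Pw y) := fun y hy => by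
    have h3 := Q.Pw_pos (x := y) ⟨hy.1.le, hy.2⟩
    have h4 := Real.rpow_pos_of_pos hy.1 d
    rw [← Q.flux_Bc hf (Set.Ioo_subset_Icc_self hy), ← mul_assoc, mul_div_cancel_left₀]
    positivity
  have hPp : ∀ y ∈ Set.Ioo 0 ℓ, 0 < y ^ d * ex Q.Pw y := fun y hy =>
    mul_pos (Real.rpow_pos_of_pos hy.1 d) (Q.Pw_pos ⟨hy.1.le, hy.2⟩)
  have hsm : ∀ a b, 0 ≤ a → b ≤ ℓ → (∀ y ∈ Set.Ioo a b, 0 < ex f y) →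
      StrictMonoOn (Q.N f) (Set.Icc a b) := fun a b ha hb h => by
    refine strictMonoOn_of_deriv_pos (convex_Icc _ _) (Q.continuous_N f).continuousOn fun y hy => ?_
    rw [interior_Icc] at hy
    have hy' : y ∈ Set.Ioo 0 ℓ := ⟨ha.trans_lt hy.1, hy.2.trans_le hb⟩
    rw [(Q.hasDerivAt_N f hy').deriv]
    exact hNpos y hy' (h y hy)
  rcases hxI.2.eq_or_lt with h | h
  · obtain ⟨a, ha⟩ : ∃ a, a = Max.max (ℓ - ε / 2) (ℓ / 2) := ⟨_, rfl⟩
    have ha0 : 0 < a := lt_of_lt_of_le (by linarith) (ha ▸ le_max_right _ _)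
    have hal : a < ℓ := by rw [ha]; exact max_lt (by linarith) (by linarith)
    have hae : ℓ - ε / 2 ≤ a := ha ▸ le_max_left _ _
    have hfp : ∀ y ∈ Set.Ioo a ℓ, 0 < ex f y := fun y hy => hball (by
      rw [Real.dist_eq, h, abs_lt]; constructor <;> linarith [hy.1, hy.2])
    have hN := hsm a ℓ ha0.le le_rfl hfp
    have hNl : Q.N f ℓ = 0 := by rw [N, Q.mn_eq_zero.1 hf, mul_zero]
    have hga : StrictAntiOn (ex g) (Set.Icc a ℓ) := by
      refine strictAntiOn_of_deriv_neg (convex_Icc _ _) (continuous_ex g).continuousOn fun y hy => ?_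
      rw [interior_Icc] at hy
      have hy' : y ∈ Set.Ioo 0 ℓ := ⟨ha0.trans hy.1, hy.2⟩
      rw [(hg y hy').deriv, hBN y hy']
      have := hN ⟨hy.1.le, hy.2.le⟩ ⟨hal.le, le_rfl⟩ hy.2
      rw [hNl] at this
      exact div_neg_of_neg_of_pos this (hPp y hy')
    have := hga ⟨le_rfl, hal.le⟩ ⟨hal.le, le_rfl⟩ hal
    have hm := hmax a
    rw [h] at hm
    exact absurd hm (not_le.2 this)
  · obtain ⟨b, hb⟩ : ∃ b, b = Min.min (x + ε / 2) ℓ := ⟨_, rfl⟩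
    have hxb : x < b := by rw [hb]; exact lt_min (by linarith) h
    have hbl : b ≤ ℓ := hb ▸ min_le_right _ _
    have hbe : b ≤ x + ε / 2 := hb ▸ min_le_left _ _
    have hfp : ∀ y ∈ Set.Ioo x b, 0 < ex f y := fun y hy => hball (by
      rw [Real.dist_eq, abs_lt]; constructor <;> linarith [hy.1, hy.2])
    have hN := hsm x b hxI.1 hbl hfp
    have hN0 : 0 ≤ Q.N f x := by
      rcases hxI.1.eq_or_lt with h0 | h0
      · rw [← h0, Q.N_zero]
      · have hloc : IsLocalMax (ex g) x := Eventually.of_forall hmax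
        have := hloc.hasDerivAt_eq_zero (hg x ⟨h0, h⟩)
        rw [← Q.flux_Bc hf hxI, this, mul_zero, mul_zero]
    have hga : StrictMonoOn (ex g) (Set.Icc x b) := by
      refine strictMonoOn_of_deriv_pos (convex_Icc _ _) (continuous_ex g).continuousOn fun y hy => ?_
      rw [interior_Icc] at hy
      have hy' : y ∈ Set.Ioo 0 ℓ := ⟨hxI.1.trans_lt hy.1, hy.2.trans_le hbl⟩
      rw [(hg y hy').deriv, hBN y hy']
      have := hN ⟨le_rfl, hxb.le⟩ ⟨hy.1.le, hy.2.le⟩ hy.1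
      exact div_pos (hN0.trans_lt this) (hPp y hy')
    exact absurd (hmax b) (not_le.2 (hga ⟨le_rfl, hxb.le⟩ ⟨hxb.le, le_rfl⟩ hxb))

end Prof
end ConeHet

namespace ConeHet
open scoped Topology BoundedContinuousFunction
namespace Prof
variable {ℓ d : ℝ} [hℓ : Fact (0 < ℓ)] [hℓ2 : Fact (ℓ < 2)] (Q : Prof ℓ d)

theorem lip_aux {g f : C(Set.Icc (0:ℝ) ℓ, ℝ)} (hg : Dv g (Q.Bc f)) {x y : ℝ}
    (hx : x ∈ Set.Icc 0 ℓ) (hy : y ∈ Set.Icc 0 ℓ) : |ex g x - ex g y| ≤ ‖Q.Bc‖ * ‖f‖ * |x - y| :=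
  (convex_Icc 0 ℓ).norm_image_sub_le_of_norm_hasDerivWithin_le (fun z hz => hg.within hz)
    (fun z _ => (abs_ex_le _ z).trans (Q.Bc.le_opNorm f)) hy hx

theorem osc_aux {ε : ℝ} (hε : 0 < ε) : ∃ δ > 0, ∀ g f, Q.mn f = 0 → Dv g (Q.Bc f) → ‖f‖ ≤ 1 →
    -Q.mn (g * f) ≤ δ → ∀ x y, |g x - g y| ≤ ε := by
  have hl := hℓ.out
  obtain ⟨C, hC⟩ : ∃ C, C = ‖Q.Bc‖ := ⟨_, rfl⟩
  have hC0 : 0 ≤ C := hC ▸ Q.Bc.opNorm_nonneg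
  obtain ⟨η, hη⟩ : ∃ η, η = Min.min (ℓ / 4) (ε / (4 * (C + 1))) := ⟨_, rfl⟩
  have hη0 : 0 < η := by rw [hη]; positivity
  have hη1 : η ≤ ℓ / 4 := hη ▸ min_le_left _ _
  have hη2 : C * η ≤ ε / 4 := by
    have : η ≤ ε / (4 * (C + 1)) := hη ▸ min_le_right _ _
    rw [le_div_iff₀ (by positivity)] at this
    nlinarith
  have hWc : Continuous fun x : ℝ => x ^ d * ex Q.Pw x :=
    (continuous_id.rpow_const fun _ => Or.inr Q.hd.le).mul (continuous_ex _)
  obtain ⟨z, hz, hzmin⟩ := (isCompact_Icc (a := η) (b := ℓ - η)).exists_isMinOn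
    ⟨η, le_rfl, by linarith⟩ hWc.continuousOn
  obtain ⟨c, hc⟩ : ∃ c, c = z ^ d * ex Q.Pw z := ⟨_, rfl⟩
  have hc0 : 0 < c := by
    rw [hc]
    exact mul_pos (Real.rpow_pos_of_pos (hη0.trans_le hz.1) d)
      (Q.Pw_pos ⟨(hη0.trans_le hz.1).le, by linarith [hz.2]⟩)
  obtain ⟨e, he⟩ : ∃ e, e = ε / (4 * ℓ) := ⟨_, rfl⟩
  have he0 : 0 < e := by rw [he]; positivity
  have hM := Q.mass_pos
  have hld := Real.rpow_pos_of_pos hl d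
  refine ⟨ε / 4 * (4 * e * c) / (Q.mass * ℓ ^ d), by positivity, fun g f hf hg hf1 hE => ?_⟩
  rw [Q.energy hf hg hf] at hE
  obtain ⟨E, hEd⟩ : ∃ E, E = ∫ x in (0:ℝ)..ℓ, x ^ d * ex Q.Pw x * (ex (Q.Bc f) x * ex (Q.Bc f) x) :=
    ⟨_, rfl⟩
  rw [← hEd] at hE
  have hE2 : E / (4 * e * c) ≤ ε / 4 := by
    rw [div_le_iff₀ (by positivity)]
    have h1 : -(-(1 / Q.mass / ℓ ^ d) * E) = E / (Q.mass * ℓ ^ d) := by field_simp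
    rw [h1] at hE
    exact (div_le_div_iff_of_pos_right (by positivity)).1 hE
  have hlip : ∀ x ∈ Set.Icc 0 ℓ, ∀ y ∈ Set.Icc 0 ℓ, |ex g x - ex g y| ≤ C * |x - y| := by
    intro x hx y hy
    refine (Q.lip_aux hg hx hy).trans (mul_le_mul_of_nonneg_right ?_ (abs_nonneg _))
    rw [← hC]
    exact mul_le_of_le_one_right hC0 hf1
  have hGc : Continuous fun x => x ^ d * ex Q.Pw x * (ex (Q.Bc f) x * ex (Q.Bc f) x) :=
    hWc.mul ((continuous_ex _).mul (continuous_ex _))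
  have hmid : ∀ x y, η ≤ x → x ≤ y → y ≤ ℓ - η → |ex g x - ex g y| ≤ ε / 2 := by
    intro x y hx hxy hy
    have h1 : ex g y - ex g x = ∫ s in x..y, ex (Q.Bc f) s :=
      (intervalIntegral.integral_eq_sub_of_hasDerivAt_of_le hxy (continuous_ex g).continuousOn
        (fun s hs => hg s ⟨by linarith [hs.1], by linarith [hs.2]⟩)
        ((continuous_ex _).intervalIntegrable _ _)).symm
    rw [abs_sub_comm, h1, ← Real.norm_eq_abs]
    have h2 : ‖∫ s in x..y, ex (Q.Bc f) s‖ ≤ ∫ s in x..y, (e + 1 / (4 * e * c) *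
        (s ^ d * ex Q.Pw s * (ex (Q.Bc f) s * ex (Q.Bc f) s))) := by
      refine intervalIntegral.norm_integral_le_of_norm_le hxy (ae_of_all _ fun s hs => ?_)
        ((continuous_const.add (continuous_const.mul hGc)).intervalIntegrable _ _)
      have h3 : c ≤ s ^ d * ex Q.Pw s := by
        rw [hc]; exact hzmin ⟨by linarith [hs.1], by linarith [hs.2]⟩
      have h4 : ex (Q.Bc f) s * ex (Q.Bc f) s / (4 * e) ≤ 1 / (4 * e * c) *
          (s ^ d * ex Q.Pw s * (ex (Q.Bc f) s * ex (Q.Bc f) s)) := by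
        have := mul_le_mul_of_nonneg_right h3 (mul_self_nonneg (ex (Q.Bc f) s))
        rw [one_div_mul_eq_div, div_le_div_iff₀ (by positivity) (by positivity)]
        nlinarith
      refine le_trans ?_ (add_le_add_right h4 e)
      rw [Real.norm_eq_abs, ← abs_mul_abs_self (ex (Q.Bc f) s), ← sub_nonneg]
      have : e + |ex (Q.Bc f) s| * |ex (Q.Bc f) s| / (4 * e) - |ex (Q.Bc f) s| =
          (|ex (Q.Bc f) s| - 2 * e) ^ 2 / (4 * e) := by field_simp; ring
      rw [this]; positivity
    refine h2.trans ?_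
    rw [intervalIntegral.integral_add (continuous_const.intervalIntegrable _ _)
      (show IntervalIntegrable (fun s => 1 / (4 * e * c) *
        (s ^ d * ex Q.Pw s * (ex (Q.Bc f) s * ex (Q.Bc f) s))) volume x y from
        (continuous_const.mul hGc).intervalIntegrable _ _), intervalIntegral.integral_const,
      intervalIntegral.integral_const_mul]
    have h5 : ∫ s in x..y, s ^ d * ex Q.Pw s * (ex (Q.Bc f) s * ex (Q.Bc f) s) ≤ E := by
      rw [hEd]
      refine intervalIntegral.integral_mono_interval (by linarith) hxy (by linarith) ?_
        (hGc.intervalIntegrable _ _)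
      filter_upwards [ae_restrict_mem measurableSet_Ioc] with s hs
      exact mul_nonneg (mul_nonneg (Real.rpow_nonneg hs.1.le _) (Q.Pw_nonneg ⟨hs.1.le, hs.2⟩))
        (mul_self_nonneg _)
    have h6 : 1 / (4 * e * c) * ∫ s in x..y, s ^ d * ex Q.Pw s * (ex (Q.Bc f) s * ex (Q.Bc f) s) ≤
        E / (4 * e * c) := by
      rw [div_eq_mul_one_div E, mul_comm E]
      exact mul_le_mul_of_nonneg_left h5 (by positivity)
    have h7 : (y - x) • e ≤ ε / 4 := by
      rw [smul_eq_mul]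
      calc (y - x) * e ≤ ℓ * e := mul_le_mul_of_nonneg_right (by linarith) he0.le
        _ = ε / 4 := by rw [he]; field_simp
    linarith
  have hcl : ∀ x ∈ Set.Icc 0 ℓ, ∃ x', η ≤ x' ∧ x' ≤ ℓ - η ∧ |ex g x - ex g x'| ≤ ε / 4 := by
    intro x hx
    refine ⟨Max.max η (Min.min x (ℓ - η)), le_max_left _ _, max_le (by linarith) (min_le_right _ _), ?_⟩
    have hm1 : η ≤ Max.max η (Min.min x (ℓ - η)) := le_max_left _ _
    have hm2 : Max.max η (Min.min x (ℓ - η)) ≤ ℓ - η := max_le (by linarith) (min_le_right _ _)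
    refine (hlip x hx _ ⟨by linarith, by linarith⟩).trans (le_trans ?_ hη2)
    refine mul_le_mul_of_nonneg_left ?_ hC0
    rw [abs_le]
    rcases max_cases η (Min.min x (ℓ - η)) with h | h <;> rcases min_cases x (ℓ - η) with h' | h' <;>
      constructor <;> linarith [hx.1, hx.2]
  intro x y
  rw [← ex_val, ← ex_val]
  obtain ⟨x', h1, h2, h3⟩ := hcl x x.2
  obtain ⟨y', h4, h5, h6⟩ := hcl y y.2
  have h7 : |ex g x' - ex g y'| ≤ ε / 2 := by
    rcases le_total x' y' with h | h
    · exact hmid x' y' h1 h h5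
    · rw [abs_sub_comm]; exact hmid y' x' h4 h h2
  rw [abs_le] at h3 h6 h7 ⊢
  constructor <;> linarith [h3.1, h3.2, h6.1, h6.2, h7.1, h7.2]

/-- The generator of the cap, after the ground state transform. -/
noncomputable def gen : Gen (Set.Icc (0:ℝ) ℓ) Q.meas where
  L :=
    { carrier := {q | Q.mn q.2 = 0 ∧ Dv q.1 (Q.Bc q.2)}
      add_mem' := fun {a b} ha hb => ⟨by
        change Q.mn (a.2 + b.2) = 0
        rw [map_add, ha.1, hb.1, add_zero], by
        change Dv (a.1 + b.1) (Q.Bc (a.2 + b.2))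
        rw [map_add]; exact ha.2.add hb.2⟩
      zero_mem' := ⟨map_zero _, by
        change Dv 0 (Q.Bc 0)
        rw [map_zero]; exact Dv.const 0⟩
      smul_mem' := fun c a ha => ⟨by
        change Q.mn (c • a.2) = 0
        rw [map_smul, ha.1, smul_zero], by
        change Dv (c • a.1) (Q.Bc (c • a.2))
        rw [map_smul]; exact ha.2.smul c⟩ }
  one := ⟨map_zero _, by
    change Dv 1 (Q.Bc 0)
    rw [map_zero]; exact Dv.const 1⟩
  max := fun g f h => Q.max_principle h.1 h.2
  mean := fun g f h => by rw [Q.integral_meas]; exact h.1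
  R := In.comp Q.Bc - (Q.mn.comp (In.comp Q.Bc)).smulRight 1
  R_spec := fun f => ⟨by
    change Q.mn (f - ContinuousMap.const _ _) = 0
    rw [Q.integral_meas, map_sub, Q.mn_const, sub_self], by
    change Dv (In (Q.Bc f) - Q.mn (In (Q.Bc f)) • 1) (Q.Bc (f - ContinuousMap.const _ _))
    rw [Q.Bc_sub_const]
    have h1 := (Dv_In (Q.Bc f)).sub (Dv.const (Q.mn (In (Q.Bc f))))
    rw [sub_zero] at h1
    convert h1 using 2
    ext x
    change Q.mn (In (Q.Bc f)) * 1 = Q.mn (In (Q.Bc f))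
    rw [mul_one]⟩
  R_mean := fun f => by
    rw [Q.integral_meas]
    exact Q.mn_pm (In (Q.Bc f))
  sym := fun g f g' f' h h' => by
    have h1 := Q.integral_meas (g * f')
    have h2 := Q.integral_meas (g' * f)
    rw [Q.energy h.1 h.2 h'.1] at h1
    rw [Q.energy h'.1 h'.2 h.1] at h2
    change ∫ x, (g * f') x ∂_ = ∫ x, (g' * f) x ∂_
    rw [h1, h2]
    congr 2
    ext x
    ring
  lip := ⟨‖Q.Bc‖, fun g f h x y => by
    rw [← ex_val, ← ex_val]
    exact Q.lip_aux h.2 x.2 y.2⟩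
  osc := fun ε hε => by
    obtain ⟨δ, hδ, H⟩ := Q.osc_aux hε
    refine ⟨δ, hδ, fun g f h hf hE => H g f h.1 h.2 hf ?_⟩
    rw [← Q.integral_meas]
    exact hE

theorem mem_gen {g f : C(Set.Icc (0:ℝ) ℓ, ℝ)} : (g, f) ∈ Q.gen.L ↔ Q.mn f = 0 ∧ Dv g (Q.Bc f) := Iff.rfl

theorem mean_eq_zero {K f : C(Set.Icc (0:ℝ) ℓ, ℝ)} (hK : ∀ x ∈ Set.Ico 0 ℓ, 0 < ex K x)
    (hf : ∀ x, 0 ≤ f x) (h : ∫ x, K x * f x ∂Q.meas = 0) (x : Set.Icc (0:ℝ) ℓ) : f x = 0 := by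
  have h1 := Q.integral_meas (K * f)
  change ∫ x, K x * f x ∂_ = _ at h1
  rw [h] at h1
  have hK0 : ∀ x, 0 ≤ K x := by
    have hd : Set.Icc 0 ℓ ⊆ {x | 0 ≤ ex K x} := by
      rw [← closure_Ioo hℓ.out.ne]
      exact closure_minimal (fun x hx => (hK x ⟨hx.1.le, hx.2⟩).le)
        (isClosed_le continuous_const (continuous_ex K))
    intro x
    have := hd x.2
    rwa [Set.mem_setOf, ex_val] at this
  have h2 := Q.eq_zero_of_J (h := K * f) (fun x => mul_nonneg (hK0 x) (hf x)) (Q.mn_eq_zero.1 h1.symm)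
  suffices f = 0 by rw [this]; rfl
  refine eq_of_ex fun x hx => ?_
  exact (mul_eq_zero.1 (h2 (pr ℓ x))).resolve_left (hK x ⟨hx.1.le, hx.2⟩).ne'

end Prof
end ConeHet

namespace ConeHet
open scoped Topology BoundedContinuousFunction

section
variable {ℓ : ℝ} [hℓ : Fact (0 < ℓ)]

theorem Dv.rp_comp {g g' : C(Set.Icc (0:ℝ) ℓ, ℝ)} (h : Dv g g') {p : ℝ} (hp : 1 < p) :
    Dv (rp p g) (p • (rp (p - 1) g * g')) := fun x hx => by
  have h1 := (h x hx).rpow_const (p := p) (Or.inr hp.le)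
  have e : ex (rp p g) = fun x => ex g x ^ p := funext fun y => rp_apply (by linarith) _ _
  rw [e]
  refine h1.congr_deriv ?_
  change _ = p * (rp (p - 1) g (pr ℓ x) * ex g' x)
  rw [rp_apply (by linarith)]
  change _ = p * (ex g x ^ (p - 1) * ex g' x)
  ring

theorem hasDerivAt_ex {U : ℝ → C(Set.Icc (0:ℝ) ℓ, ℝ)} {U' : C(Set.Icc (0:ℝ) ℓ, ℝ)} {t : ℝ}
    (h : HasDerivAt U U' t) (x : ℝ) : HasDerivAt (fun t => ex (U t) x) (ex U' x) t := by
  let T : C(Set.Icc (0:ℝ) ℓ, ℝ) →L[ℝ] ℝ := ContinuousMap.evalCLM ℝ (pr ℓ x)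
  exact T.hasFDerivAt.comp_hasDerivAt t h

theorem Dv.deriv {U w U' w' : ℝ → C(Set.Icc (0:ℝ) ℓ, ℝ)} (hU : ∀ t, HasDerivAt U (U' t) t)
    (hw : ∀ t, HasDerivAt w (w' t) t) (h : ∀ t, Dv (U t) (w t)) (t : ℝ) : Dv (U' t) (w' t) := by
  have h1 : HasDerivAt (fun t => ex (U t) 0 • (1 : C(Set.Icc (0:ℝ) ℓ, ℝ)) + In (w t))
      (ex (U' t) 0 • 1 + In (w' t)) t :=
    ((hasDerivAt_ex (hU t) 0).smul_const _).add (In.hasFDerivAt.comp_hasDerivAt t (hw t))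
  have h2 : U = fun t => ex (U t) 0 • (1 : C(Set.Icc (0:ℝ) ℓ, ℝ)) + In (w t) := funext fun s => by
    conv_lhs => rw [(h s).eq_In]
    congr 1
    ext x
    exact (mul_one _).symm
  have h3 : U' t = ex (U' t) 0 • (1 : C(Set.Icc (0:ℝ) ℓ, ℝ)) + In (w' t) := by
    rw [← h2] at h1
    exact (hU t).unique h1
  rw [h3]
  have h4 := ((Dv.const (ℓ := ℓ) 1).smul (ex (U' t) 0)).add (Dv_In (w' t))
  rw [smul_zero, zero_add] at h4
  exact h4
end

namespace Prof
variable {ℓ d : ℝ} [hℓ : Fact (0 < ℓ)] [hℓ2 : Fact (ℓ < 2)] (Q : Prof ℓ d)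

theorem dv_mul {g f : C(Set.Icc (0:ℝ) ℓ, ℝ)} (h : (g, f) ∈ Q.gen.L) :
    Dv (Q.ψ * g) (B0 d Q.hd (Q.ψ * f - Q.Λ • (Q.ψ * g))) := by
  obtain ⟨hf, hg⟩ := Q.mem_gen.1 h
  have h1 := Q.dv.mul hg
  suffices B0 d Q.hd ((-Q.Λ) • Q.ψ) * g + Q.ψ * Q.Bc f = B0 d Q.hd (Q.ψ * f - Q.Λ • (Q.ψ * g)) by
    rw [← this]; exact h1
  have hxc : Continuous fun x : ℝ => x ^ d := continuous_id.rpow_const fun _ => Or.inr Q.hd.le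
  have h2c : ContinuousOn (fun x : ℝ => x ^ d * (2 - x) ^ d) (Set.Icc 0 ℓ) :=
    hxc.continuousOn.mul (continuousOn_wt d)
  have key := eq_of_hasDerivAt (a := 0) (b := ℓ)
    (F := fun x => x ^ d * (2 - x) ^ d * ex (B0 d Q.hd ((-Q.Λ) • Q.ψ) * g + Q.ψ * Q.Bc f) x)
    (G := fun x => x ^ d * (2 - x) ^ d * ex (B0 d Q.hd (Q.ψ * f - Q.Λ • (Q.ψ * g))) x)
    (φ := fun x => x ^ (d - 1) * (2 - x) ^ (d - 1) * ex (Q.ψ * f - Q.Λ • (Q.ψ * g)) x)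
    (h2c.mul (continuous_ex _).continuousOn) (h2c.mul (continuous_ex _).continuousOn)
    (fun x hx => by
      have hp := Q.pos x ⟨hx.1.le, hx.2⟩
      have hI := Set.Ioo_subset_Icc_self hx
      have a1 := (hasDerivAt_flux Q.hd ((-Q.Λ) • Q.ψ) hx).mul (hg x hx)
      have a2 := (Q.hasDerivAt_N f hx).div (Q.dv x hx) hp.ne'
      have a3 := a1.add a2
      have hN : Q.N f x = x ^ d * ((2 - x) ^ d * (ex Q.ψ x * ex Q.ψ x) * ex (Q.Bc f) x) := by
        rw [← Q.flux_Bc hf hI, Q.ex_Pw hI]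
      refine (a3.congr_deriv ?_).congr_of_eventuallyEq ?_
      · rw [hN, Q.ex_om hI]
        change _ = _ * (ex Q.ψ x * ex f x - Q.Λ * (ex Q.ψ x * ex g x))
        change _ * (-Q.Λ * ex Q.ψ x) * _ + _ + _ = _
        field_simp
        ring
      · filter_upwards [isOpen_Ioo.mem_nhds hx] with y hy
        have hpy := Q.pos y ⟨hy.1.le, hy.2⟩
        have hI := Set.Ioo_subset_Icc_self hy
        simp only [Pi.add_apply, Pi.mul_apply, Pi.div_apply]
        rw [← Q.flux_Bc hf hI, Q.ex_Pw hI]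
        change _ * (ex (B0 d Q.hd ((-Q.Λ) • Q.ψ)) y * ex g y + ex Q.ψ y * ex (Q.Bc f) y) = _
        field_simp)
    (fun x hx => hasDerivAt_flux Q.hd _ hx) (by simp [Real.zero_rpow Q.hd.ne'])
  refine eq_of_ex fun x hx => ?_
  have h3 := key x (Set.Ioo_subset_Icc_self hx)
  have h4 : 0 < x ^ d * (2 - x) ^ d := mul_pos (Real.rpow_pos_of_pos hx.1 d)
    (Real.rpow_pos_of_pos (two_sub_pos (Set.Ioo_subset_Icc_self hx)) d)
  exact mul_left_cancel₀ h4.ne' h3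

theorem rp_mul {p : ℝ} (hp : 1 < p) {g : C(Set.Icc (0:ℝ) ℓ, ℝ)} (hg : ∀ x, 0 ≤ g x) :
    Q.ψ * (rp (p - 1) Q.ψ * rp p g) = rp p (Q.ψ * g) := by
  ext x
  change Q.ψ x * (rp (p - 1) Q.ψ x * rp p g x) = rp p (Q.ψ * g) x
  rw [rp_apply (by linarith), rp_apply (by linarith), rp_apply (by linarith)]
  change _ = (Q.ψ x * g x) ^ p
  have h0 := Q.nonneg' x
  rw [Real.mul_rpow h0 (hg x), ← mul_assoc]
  congr 1
  rcases h0.eq_or_lt with h | h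
  · rw [← h, zero_mul, Real.zero_rpow (by linarith)]
  · rw [Real.rpow_sub_one h.ne']
    field_simp

variable {Q} {P : Par} (H : Q.gen.Het P)

theorem dv_V (hK : H.K = rp (H.p - 1) Q.ψ) : ∃ w w', Dv (Q.ψ * H.V) w ∧ Dv w w' ∧
    ∀ x ∈ Set.Icc 0 ℓ, x * (2 - x) * ex w' x + 2 * d * (1 - x) * ex w x =
      (P.l - Q.Λ) * ex (Q.ψ * H.V) x - ex (Q.ψ * H.V) x ^ H.p := by
  have h1 := Q.dv_mul H.hVL
  have e : Q.ψ * (P.l • H.V - H.K * rp H.p H.V) - Q.Λ • (Q.ψ * H.V) =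
      (P.l - Q.Λ) • (Q.ψ * H.V) - rp H.p (Q.ψ * H.V) := by
    rw [← Q.rp_mul H.hp (fun x => (H.hV x).le), hK]
    ext x
    change Q.ψ x * (P.l * H.V x - _) - Q.Λ * (Q.ψ x * H.V x) = (P.l - Q.Λ) * (Q.ψ x * H.V x) - Q.ψ x * _
    ring
  rw [e] at h1
  have h2 := Dv_B0 Q.hd ((h1.smul (P.l - Q.Λ)).sub (h1.rp_comp H.hp))
  refine ⟨_, _, h1, h2, fun x hx => ?_⟩
  rw [ode Q.hd h2 hx]
  change _ * _ - rp H.p (Q.ψ * H.V) (pr ℓ x) = _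
  rw [rp_apply (by linarith [H.hp])]
  rfl

set_option maxHeartbeats 1000000 in
theorem dv_Z (hK : H.K = rp (H.p - 1) Q.ψ) : ∃ Z' Z'' w w' w2 : ℝ → C(Set.Icc (0:ℝ) ℓ, ℝ),
    (∀ t, HasDerivAt (fun t => Q.ψ * H.Z t) (Z' t) t) ∧ (∀ t, HasDerivAt Z' (Z'' t) t) ∧
    Continuous Z'' ∧ (∀ t, HasDerivAt w (w' t) t) ∧ Continuous w' ∧ Continuous w2 ∧
    (∀ t, Dv (Q.ψ * H.Z t) (w t)) ∧ (∀ t, Dv (Z' t) (w' t)) ∧ (∀ t, Dv (w t) (w2 t)) ∧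
    ∀ t, ∀ x ∈ Set.Icc 0 ℓ, x * (2 - x) * ex (w2 t) x + 2 * d * (1 - x) * ex (w t) x =
      (P.l - Q.Λ) * ex (Q.ψ * H.Z t) x - ex (Z'' t) x + P.B * ex (Z' t) x
        - ex (Q.ψ * H.Z t) x ^ H.p := by
  have hp := H.hp
  have c4 := H.smooth.1
  have eZ1 : deriv H.Z = H.Z' := funext fun t => (H.cl.d1 t).deriv
  have eZ2 : deriv H.Z' = H.Z'' := funext fun t => (H.cl.d2 t).deriv
  have c3 : ContDiff ℝ (3 : ℕ) H.Z' := by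
    have : ContDiff ℝ ((3 : ℕ) + 1) H.Z := by exact_mod_cast c4
    rw [← eZ1]; exact (contDiff_succ_iff_deriv.1 this).2.2
  have c2 : ContDiff ℝ (2 : ℕ) H.Z'' := by
    have : ContDiff ℝ ((2 : ℕ) + 1) H.Z' := by exact_mod_cast c3
    rw [← eZ2]; exact (contDiff_succ_iff_deriv.1 this).2.2
  have cs : ContDiff ℝ (2 : ℕ) fun t => H.K * rp H.p (H.Z t) :=
    H.contDiff_source (c4.of_le (by norm_cast))
  obtain ⟨q, hq⟩ : ∃ q : ℝ → C(Set.Icc (0:ℝ) ℓ, ℝ), q = fun t =>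
    Q.ψ * (P.l • H.Z t - H.Z'' t + P.B • H.Z' t - H.K * rp H.p (H.Z t)) - Q.Λ • (Q.ψ * H.Z t) := ⟨_, rfl⟩
  have cq : ContDiff ℝ (2 : ℕ) q := by
    rw [hq]
    have c4' : ContDiff ℝ (2 : ℕ) H.Z := c4.of_le (by norm_cast)
    have c3' : ContDiff ℝ (2 : ℕ) H.Z' := c3.of_le (by norm_cast)
    have a1 : ContDiff ℝ (2 : ℕ) fun t => P.l • H.Z t := c4'.const_smul P.l
    have a2 : ContDiff ℝ (2 : ℕ) fun t => P.B • H.Z' t := c3'.const_smul P.B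
    have a3 : ContDiff ℝ (2 : ℕ) fun t => P.l • H.Z t - H.Z'' t := a1.sub c2
    have a4 : ContDiff ℝ (2 : ℕ) fun t => P.l • H.Z t - H.Z'' t + P.B • H.Z' t := a3.add a2
    have a5 : ContDiff ℝ (2 : ℕ) fun t =>
      P.l • H.Z t - H.Z'' t + P.B • H.Z' t - H.K * rp H.p (H.Z t) := a4.sub cs
    have a6 : ContDiff ℝ (2 : ℕ) fun t => Q.ψ *
      (P.l • H.Z t - H.Z'' t + P.B • H.Z' t - H.K * rp H.p (H.Z t)) := contDiff_const.mul a5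
    have a7 : ContDiff ℝ (2 : ℕ) fun t => Q.ψ * H.Z t := contDiff_const.mul c4'
    have a8 : ContDiff ℝ (2 : ℕ) fun t => Q.Λ • (Q.ψ * H.Z t) := a7.const_smul Q.Λ
    exact a6.sub a8
  obtain ⟨q', q'', hq', hq'', hqc⟩ := exists_derivs cq
  obtain ⟨w, hw⟩ : ∃ w : ℝ → C(Set.Icc (0:ℝ) ℓ, ℝ), w = fun t => B0 d Q.hd (q t) := ⟨_, rfl⟩
  obtain ⟨w', hw'⟩ : ∃ w : ℝ → C(Set.Icc (0:ℝ) ℓ, ℝ), w = fun t => B0 d Q.hd (q' t) := ⟨_, rfl⟩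
  obtain ⟨w'', hw''⟩ : ∃ w : ℝ → C(Set.Icc (0:ℝ) ℓ, ℝ), w = fun t => B0 d Q.hd (q'' t) := ⟨_, rfl⟩
  have dw : ∀ t, HasDerivAt w (w' t) t := fun t => by
    rw [hw, hw']; exact (B0 d Q.hd).hasFDerivAt.comp_hasDerivAt t (hq' t)
  have dw' : ∀ t, HasDerivAt w' (w'' t) t := fun t => by
    rw [hw', hw'']; exact (B0 d Q.hd).hasFDerivAt.comp_hasDerivAt t (hq'' t)
  have cw'' : Continuous w'' := by rw [hw'']; exact (B0 d Q.hd).continuous.comp hqc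
  have cw' : Continuous w' := continuous_iff_continuousAt.2 fun t => (dw' t).continuousAt
  have cw : Continuous w := continuous_iff_continuousAt.2 fun t => (dw t).continuousAt
  have cZ : Continuous H.Z := H.Z.continuous
  have dZ : ∀ t, HasDerivAt (fun t => Q.ψ * H.Z t) (Q.ψ * H.Z' t) t := fun t => (H.cl.d1 t).const_mul _
  have dZ' : ∀ t, HasDerivAt (fun t => Q.ψ * H.Z' t) (Q.ψ * H.Z'' t) t :=
    fun t => (H.cl.d2 t).const_mul _
  have v0 : ∀ t, Dv (Q.ψ * H.Z t) (w t) := fun t => by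
    rw [hw, hq]; exact Q.dv_mul (H.cl.eqn t)
  have v1 : ∀ t, Dv (Q.ψ * H.Z' t) (w' t) := Dv.deriv dZ dw v0
  have v2 : ∀ t, Dv (Q.ψ * H.Z'' t) (w'' t) := Dv.deriv dZ' dw' v1
  have eq : ∀ t, q t = (P.l - Q.Λ) • (Q.ψ * H.Z t) - Q.ψ * H.Z'' t + P.B • (Q.ψ * H.Z' t) -
      rp H.p (Q.ψ * H.Z t) := fun t => by
    rw [← Q.rp_mul H.hp (H.nonneg t), ← hK, hq]
    ext x
    change Q.ψ x * (P.l * H.Z t x - H.Z'' t x + P.B * H.Z' t x - _) - Q.Λ * (Q.ψ x * H.Z t x) =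
      (P.l - Q.Λ) * (Q.ψ x * H.Z t x) - Q.ψ x * H.Z'' t x + P.B * (Q.ψ x * H.Z' t x) - Q.ψ x * _
    ring
  obtain ⟨qx, hqx⟩ : ∃ qx : ℝ → C(Set.Icc (0:ℝ) ℓ, ℝ), qx = fun t =>
      (P.l - Q.Λ) • w t - w'' t + P.B • w' t - H.p • (rp (H.p - 1) (Q.ψ * H.Z t) * w t) := ⟨_, rfl⟩
  have vq : ∀ t, Dv (q t) (qx t) := fun t => by
    rw [eq t, hqx]
    exact ((((v0 t).smul _).sub (v2 t)).add ((v1 t).smul _)).sub ((v0 t).rp_comp hp)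
  have hrp : ∀ t, rp (H.p - 1) (Q.ψ * H.Z t) = rp (H.p - 1) Q.ψ * rp (H.p - 1) (H.Z t) := fun t => by
    ext x
    change _ = rp (H.p - 1) Q.ψ x * rp (H.p - 1) (H.Z t) x
    rw [rp_apply (by linarith), rp_apply (by linarith), rp_apply (by linarith)]
    exact Real.mul_rpow (Q.nonneg' x) (H.nonneg t x)
  have cqx : Continuous qx := by
    rw [hqx]
    have h1 : Continuous fun t => rp (H.p - 1) (H.Z t) := continuous_iff_continuousAt.2 fun t =>
      (hasDerivAt_rp' (H.p - 1) H.pos (H.cl.d1 t)).continuousAt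
    simp only [hrp]
    have h2 : Continuous fun t => rp (H.p - 1) Q.ψ * rp (H.p - 1) (H.Z t) := continuous_const.mul h1
    have h3 : Continuous fun t => rp (H.p - 1) Q.ψ * rp (H.p - 1) (H.Z t) * w t := h2.mul cw
    have h4 : Continuous fun t => H.p • (rp (H.p - 1) Q.ψ * rp (H.p - 1) (H.Z t) * w t) :=
      h3.const_smul H.p
    have h5 : Continuous fun t => (P.l - Q.Λ) • w t := cw.const_smul (P.l - Q.Λ)
    have h6 : Continuous fun t => P.B • w' t := cw'.const_smul P.B
    have h7 : Continuous fun t => (P.l - Q.Λ) • w t - w'' t := h5.sub cw''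
    have h8 : Continuous fun t => (P.l - Q.Λ) • w t - w'' t + P.B • w' t := h7.add h6
    exact h8.sub h4
  have cq0 : Continuous q := cq.continuous
  refine ⟨_, _, w, w', fun t => B1 d Q.hd (q t) (qx t), dZ, dZ', continuous_const.mul H.Z''.continuous,
    dw, cw', ?_, v0, v1, fun t => ?_, fun t x hx => ?_⟩
  · exact (continuous_const.mul ((J d Q.hd).continuous.comp (continuous_const.mul cq0))).add
      (continuous_const.mul ((J (d + 1) _).continuous.comp
        ((continuous_const.mul cq0).add (continuous_const.mul cqx))))
  · rw [hw]; exact Dv_B0 Q.hd (vq t)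
  · have h2 := ode Q.hd (Dv_B0 Q.hd (vq t)) hx
    rw [hw, h2, eq t]
    change _ * ex (Q.ψ * H.Z t) x - ex (Q.ψ * H.Z'' t) x + P.B * ex (Q.ψ * H.Z' t) x -
      rp H.p (Q.ψ * H.Z t) (pr ℓ x) = _
    rw [rp_apply (by linarith)]
    rfl

end Prof
end ConeHet

namespace ConeHet
open scoped Topology BoundedContinuousFunction

section
variable {ℓ : ℝ} [hℓ : Fact (0 < ℓ)]

/-- The closed strip. -/
def strip (ℓ : ℝ) : Set (ℝ × ℝ) := Set.univ ×ˢ Set.Icc 0 ℓ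

/-- The linear form with the given partial derivatives. -/
noncomputable def lin (a b : ℝ) : ℝ × ℝ →L[ℝ] ℝ :=
  a • ContinuousLinearMap.fst ℝ ℝ ℝ + b • ContinuousLinearMap.snd ℝ ℝ ℝ

theorem lin_apply (a b : ℝ) (z : ℝ × ℝ) : lin a b z = a * z.1 + b * z.2 := rfl

theorem continuous_curve {f : ℝ → C(Set.Icc (0:ℝ) ℓ, ℝ)} (hf : Continuous f) :
    Continuous fun z : ℝ × ℝ => ex (f z.1) z.2 :=
  continuous_eval.comp ((hf.comp continuous_fst).prodMk (continuous_pr.comp continuous_snd))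

theorem hasFDerivWithinAt_curve {U : ℝ → C(Set.Icc (0:ℝ) ℓ, ℝ)} {U' w : C(Set.Icc (0:ℝ) ℓ, ℝ)} {z : ℝ × ℝ}
    (hU : HasDerivAt U U' z.1) (hw : Dv (U z.1) w) (hz : z ∈ strip ℓ) :
    HasFDerivWithinAt (fun z : ℝ × ℝ => ex (U z.1) z.2) (lin (ex U' z.2) (ex w z.2)) (strip ℓ) z := by
  rw [hasFDerivWithinAt_iff_isLittleO]
  have hl : 𝓝[strip ℓ] z ≤ 𝓝 z := nhdsWithin_le_nhds
  have t1 : Tendsto (fun y : ℝ × ℝ => y.1) (𝓝[strip ℓ] z) (𝓝 z.1) :=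
    (continuous_fst.tendsto z).mono_left hl
  have t2 : Tendsto (fun y : ℝ × ℝ => y.2) (𝓝[strip ℓ] z) (𝓝 z.2) :=
    (continuous_snd.tendsto z).mono_left hl
  have t3 : Tendsto (fun y : ℝ × ℝ => y.2) (𝓝[strip ℓ] z) (𝓝[Set.Icc 0 ℓ] z.2) :=
    tendsto_nhdsWithin_iff.2 ⟨t2, eventually_mem_nhdsWithin.mono fun y hy => hy.2⟩
  have o1 : (fun y : ℝ × ℝ => y.1 - z.1) =O[𝓝[strip ℓ] z] fun y => y - z :=
    Asymptotics.isBigO_of_le _ fun y => by rw [Prod.norm_def (y - z)]; exact le_max_left _ _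
  have o2 : (fun y : ℝ × ℝ => y.2 - z.2) =O[𝓝[strip ℓ] z] fun y => y - z :=
    Asymptotics.isBigO_of_le _ fun y => by rw [Prod.norm_def (y - z)]; exact le_max_right _ _
  have a1 := ((hasDerivAt_iff_isLittleO.1 hU).comp_tendsto t1).trans_isBigO o1
  have a1' : (fun y : ℝ × ℝ => ex (U y.1) y.2 - ex (U z.1) y.2 - (y.1 - z.1) * ex U' y.2)
      =o[𝓝[strip ℓ] z] fun y => y - z :=
    (Asymptotics.isBigO_of_le _ fun y : ℝ × ℝ =>
      (abs_ex_le (U y.1 - U z.1 - (y.1 - z.1) • U') y.2)).trans_isLittleO a1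
  have a3 := ((hasDerivWithinAt_iff_isLittleO.1 (hw.within hz.2)).comp_tendsto t3).trans_isBigO o2
  have a2 : (fun y : ℝ × ℝ => (ex U' y.2 - ex U' z.2) * (y.1 - z.1)) =o[𝓝[strip ℓ] z] fun y => y - z := by
    have : (fun y : ℝ × ℝ => ex U' y.2 - ex U' z.2) =o[𝓝[strip ℓ] z] fun _ => (1:ℝ) := by
      rw [Asymptotics.isLittleO_one_iff]
      have := (((continuous_ex U').tendsto z.2).comp t2).sub_const (ex U' z.2)
      rwa [sub_self] at this
    have h := this.mul_isBigO o1.norm_right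
    simp only [one_mul] at h
    exact h.of_norm_right
  refine ((a1'.add a2).add a3).congr_left fun y => ?_
  rw [lin_apply]
  simp only [Function.comp, Prod.fst_sub, Prod.snd_sub, smul_eq_mul]
  ring

theorem uniqueDiffOn_strip : UniqueDiffOn ℝ (strip ℓ) :=
  uniqueDiffOn_univ.prod (uniqueDiffOn_Icc hℓ.out)

theorem contDiffOn_strip {n : ℕ} {F a b : ℝ × ℝ → ℝ} (ha : ContDiffOn ℝ n a (strip ℓ))
    (hb : ContDiffOn ℝ n b (strip ℓ))
    (h : ∀ z ∈ strip ℓ, HasFDerivWithinAt F (lin (a z) (b z)) (strip ℓ) z) :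
    ContDiffOn ℝ (n + 1) F (strip ℓ) := by
  rw [contDiffOn_succ_iff_hasFDerivWithinAt_of_uniqueDiffOn uniqueDiffOn_strip]
  refine ⟨by simp, fun z => lin (a z) (b z), ?_, h⟩
  exact (ha.smul contDiffOn_const).add (hb.smul contDiffOn_const)

theorem contDiffOn_curve {U U' U'' w w' w2 : ℝ → C(Set.Icc (0:ℝ) ℓ, ℝ)}
    (h1 : ∀ t, HasDerivAt U (U' t) t) (h2 : ∀ t, HasDerivAt U' (U'' t) t) (c1 : Continuous U'')
    (h3 : ∀ t, HasDerivAt w (w' t) t) (c2 : Continuous w') (c3 : Continuous w2)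
    (v0 : ∀ t, Dv (U t) (w t)) (v1 : ∀ t, Dv (U' t) (w' t)) (v2 : ∀ t, Dv (w t) (w2 t)) :
    ContDiffOn ℝ 2 (fun z : ℝ × ℝ => ex (U z.1) z.2) (strip ℓ) := by
  have e0 : ∀ {f : ℝ → C(Set.Icc (0:ℝ) ℓ, ℝ)}, Continuous f →
      ContDiffOn ℝ (0:ℕ) (fun z : ℝ × ℝ => ex (f z.1) z.2) (strip ℓ) := fun hf => by
    rw [Nat.cast_zero, contDiffOn_zero]; exact (continuous_curve hf).continuousOn
  have b1 := contDiffOn_strip (e0 c1) (e0 c2) fun z hz => hasFDerivWithinAt_curve (h2 z.1) (v1 z.1) hz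
  have b2 := contDiffOn_strip (e0 c2) (e0 c3) fun z hz => hasFDerivWithinAt_curve (h3 z.1) (v2 z.1) hz
  have b3 := contDiffOn_strip (n := 1) (by simpa using b1) (by simpa using b2)
    fun z hz => hasFDerivWithinAt_curve (h1 z.1) (v0 z.1) hz
  exact b3.of_le (by norm_num)

theorem strip_mem_nhds {z : ℝ × ℝ} (hz : z.2 ∈ Set.Ioo 0 ℓ) : strip ℓ ∈ 𝓝 z := by
  refine prod_mem_nhds univ_mem (Icc_mem_nhds hz.1 hz.2)
end
end ConeHet

namespace ConeHet
open scoped Topology BoundedContinuousFunction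

section
variable {n : ℕ} (i₀ : Fin n)

local notation "E" => EuclideanSpace ℝ (Fin n)

/-- Logarithmic radius and height of a point. -/
noncomputable def gc (y : E) : ℝ × ℝ := (Real.log ‖y‖, 1 - y i₀ / ‖y‖)

theorem hasFDerivAt_norm' {y : E} (hy : y ≠ 0) :
    HasFDerivAt (fun z : E => ‖z‖) (‖y‖⁻¹ • innerSL ℝ y) y := by
  have hp : 0 < ‖y‖ := norm_pos_iff.2 hy
  have h := (hasStrictFDerivAt_norm_sq y).hasFDerivAt.sqrt (by positivity)
  simp only [Real.sqrt_sq (norm_nonneg _)] at h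
  refine h.congr_fderiv ?_
  rw [two_smul, ← two_smul ℝ, smul_smul]
  congr 1
  field_simp

theorem hasFDerivAt_coord (y : E) (i : Fin n) :
    HasFDerivAt (fun z : E => z i) (EuclideanSpace.proj i : E →L[ℝ] ℝ) y :=
  (EuclideanSpace.proj i : E →L[ℝ] ℝ).hasFDerivAt

/-- The coordinate vectors. -/
noncomputable def bv (i : Fin n) : E := EuclideanSpace.single i 1

theorem bv_apply (i j : Fin n) : (bv i : E) j = if i = j then 1 else 0 := by
  simp [bv, EuclideanSpace.single_apply, eq_comm]

theorem proj_bv (i j : Fin n) : (EuclideanSpace.proj j : E →L[ℝ] ℝ) (bv i) = (bv i : E) j := rfl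

theorem inner_bv (y : E) (i : Fin n) : innerSL ℝ y (bv i) = y i := by
  simp [bv, EuclideanSpace.inner_single_right]

/-- Partial derivatives of the two coordinates. -/
noncomputable def pt (i : Fin n) (y : E) : ℝ := y i * (‖y‖⁻¹) ^ 2

noncomputable def px (i : Fin n) (y : E) : ℝ :=
  y i₀ * y i * (‖y‖⁻¹) ^ 3 - (bv i : E) i₀ * ‖y‖⁻¹

theorem hasFDerivAt_norm_inv {y : E} (hy : y ≠ 0) :
    HasFDerivAt (fun z : E => ‖z‖⁻¹) (-((‖y‖⁻¹) ^ 3 • innerSL ℝ y)) y := by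
  have hp : 0 < ‖y‖ := norm_pos_iff.2 hy
  have h := (hasDerivAt_inv hp.ne').comp_hasFDerivAt y (hasFDerivAt_norm' hy)
  refine h.congr_fderiv ?_
  ext z
  simp
  field_simp

theorem hasFDerivAt_gc {y : E} (hy : y ≠ 0) : ∃ T : E →L[ℝ] ℝ × ℝ, HasFDerivAt (gc i₀) T y ∧
    ∀ i, T (bv i) = (pt i y, px i₀ i y) := by
  have hp : 0 < ‖y‖ := norm_pos_iff.2 hy
  have h1 := (hasFDerivAt_norm' hy).log hp.ne'
  have h2 := ((hasFDerivAt_coord y i₀).mul (hasFDerivAt_norm_inv hy)).const_sub 1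
  refine ⟨_, h1.prodMk h2, fun i => ?_⟩
  simp only [ContinuousLinearMap.prod_apply, ContinuousLinearMap.smul_apply, inner_bv,
    ContinuousLinearMap.neg_apply, ContinuousLinearMap.add_apply, smul_eq_mul, pt, px,
    proj_bv]
  refine Prod.ext ?_ ?_ <;> simp only <;> field_simp <;> ring

theorem hasFDerivAt_pt {y : E} (hy : y ≠ 0) (i : Fin n) : ∃ T : E →L[ℝ] ℝ, HasFDerivAt (pt i) T y ∧
    T (bv i) = (‖y‖⁻¹) ^ 2 - 2 * y i ^ 2 * (‖y‖⁻¹) ^ 4 := by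
  have h1 := (hasFDerivAt_coord y i).mul ((hasFDerivAt_norm_inv hy).pow 2)
  refine ⟨_, h1, ?_⟩
  simp only [ContinuousLinearMap.smul_apply, inner_bv,
    ContinuousLinearMap.neg_apply, ContinuousLinearMap.add_apply, smul_eq_mul,
    proj_bv, bv_apply, if_true]
  simp
  ring

theorem hasFDerivAt_px {y : E} (hy : y ≠ 0) (i : Fin n) : ∃ T : E →L[ℝ] ℝ, HasFDerivAt (px i₀ i) T y ∧
    T (bv i) = (2 * (bv i : E) i₀ * y i + y i₀) * (‖y‖⁻¹) ^ 3 - 3 * y i₀ * y i ^ 2 * (‖y‖⁻¹) ^ 5 := by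
  have h1 := (((hasFDerivAt_coord y i₀).mul (hasFDerivAt_coord y i)).mul
    ((hasFDerivAt_norm_inv hy).pow 3)).sub ((hasFDerivAt_norm_inv hy).const_mul ((bv i : E) i₀))
  refine ⟨_, h1, ?_⟩
  simp only [ContinuousLinearMap.smul_apply, inner_bv, ContinuousLinearMap.sub_apply,
    ContinuousLinearMap.neg_apply, ContinuousLinearMap.add_apply, smul_eq_mul,
    proj_bv]
  have h2 : (bv i : E) i = 1 := by simp [bv_apply]
  have h3 : y i₀ = y i ∨ (bv i : E) i₀ = 0 := by
    rw [bv_apply]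
    by_cases h : i = i₀ <;> simp [h]
  rw [h2]
  simp
  rcases h3 with h3 | h3
  · rw [h3]; ring
  · rw [h3]; ring

theorem lap_comp {F Ft Fx : ℝ × ℝ → ℝ} {a b b' c : ℝ} {y : E} (hy : y ≠ 0)
    (hF : ∀ᶠ z in 𝓝 (gc i₀ y), HasFDerivAt F (lin (Ft z) (Fx z)) z)
    (hFt : HasFDerivAt Ft (lin a b) (gc i₀ y)) (hFx : HasFDerivAt Fx (lin b' c) (gc i₀ y)) :
    lap (fun z => F (gc i₀ z)) y = (‖y‖⁻¹) ^ 2 * (a + (n - 2) * Ft (gc i₀ y) +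
      (gc i₀ y).2 * (2 - (gc i₀ y).2) * c + (n - 1) * (1 - (gc i₀ y).2) * Fx (gc i₀ y)) := by
  have hp : 0 < ‖y‖ := norm_pos_iff.2 hy
  obtain ⟨T, hT, hT'⟩ := hasFDerivAt_gc i₀ hy
  have key : ∀ i, fderiv ℝ (fun z => fderiv ℝ (fun z => F (gc i₀ z)) z (bv i)) y (bv i) =
      a * pt i y ^ 2 + (b + b') * (pt i y * px i₀ i y) + c * px i₀ i y ^ 2 +
      Ft (gc i₀ y) * ((‖y‖⁻¹) ^ 2 - 2 * y i ^ 2 * (‖y‖⁻¹) ^ 4) +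
      Fx (gc i₀ y) * ((2 * (bv i : E) i₀ * y i + y i₀) * (‖y‖⁻¹) ^ 3
        - 3 * y i₀ * y i ^ 2 * (‖y‖⁻¹) ^ 5) := fun i => by
    have e1 : (fun z => fderiv ℝ (fun z => F (gc i₀ z)) z (bv i)) =ᶠ[𝓝 y]
        fun z => Ft (gc i₀ z) * pt i z + Fx (gc i₀ z) * px i₀ i z := by
      filter_upwards [hT.continuousAt.eventually hF, isOpen_ne.mem_nhds hy] with z hz hz0
      obtain ⟨T', h1, h2⟩ := hasFDerivAt_gc i₀ hz0
      have h5 : HasFDerivAt (fun z => F (gc i₀ z)) _ z := hz.comp z h1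
      rw [h5.fderiv, ContinuousLinearMap.comp_apply, h2, lin_apply]
    obtain ⟨P, hP, hP'⟩ := hasFDerivAt_pt hy i
    obtain ⟨X, hX, hX'⟩ := hasFDerivAt_px i₀ hy i
    have h3 := ((hFt.comp y hT).mul hP).add ((hFx.comp y hT).mul hX)
    rw [e1.fderiv_eq]
    have h4 := h3.fderiv
    simp only [Function.comp_def] at h4
    erw [h4]
    simp only [ContinuousLinearMap.smul_apply, ContinuousLinearMap.add_apply, smul_eq_mul,
      ContinuousLinearMap.comp_apply, hP', hX', hT', lin_apply]
    ring
  refine (Finset.sum_congr rfl fun i _ => key i).trans ?_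
  have s1 : ∑ i, y i ^ 2 = ‖y‖ ^ 2 := by rw [EuclideanSpace.real_norm_sq_eq]
  have s2 : ∑ i, (bv i : E) i₀ * y i = y i₀ := by simp [bv_apply]
  have s3 : ∑ i, (bv i : E) i₀ ^ 2 = 1 := by simp [bv_apply]
  have S1 : ∑ i, pt i y ^ 2 = (‖y‖⁻¹) ^ 2 := by
    simp only [pt, mul_pow]
    rw [← Finset.sum_mul, s1]
    field_simp
  have S2 : ∑ i, pt i y * px i₀ i y = 0 := by
    have : ∀ i, pt i y * px i₀ i y = y i₀ * (‖y‖⁻¹) ^ 5 * y i ^ 2 - (‖y‖⁻¹) ^ 3 * ((bv i : E) i₀ * y i) :=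
      fun i => by rw [pt, px]; ring
    rw [Finset.sum_congr rfl fun i _ => this i, Finset.sum_sub_distrib, ← Finset.mul_sum,
      ← Finset.mul_sum, s1, s2]
    field_simp
    ring
  have S3 : ∑ i, px i₀ i y ^ 2 = (‖y‖⁻¹) ^ 2 * ((gc i₀ y).2 * (2 - (gc i₀ y).2)) := by
    have : ∀ i, px i₀ i y ^ 2 = y i₀ ^ 2 * (‖y‖⁻¹) ^ 6 * y i ^ 2
        - 2 * y i₀ * (‖y‖⁻¹) ^ 4 * ((bv i : E) i₀ * y i) + (‖y‖⁻¹) ^ 2 * (bv i : E) i₀ ^ 2 :=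
      fun i => by rw [px]; ring
    rw [Finset.sum_congr rfl fun i _ => this i, Finset.sum_add_distrib, Finset.sum_sub_distrib,
      ← Finset.mul_sum, ← Finset.mul_sum, ← Finset.mul_sum, s1, s2, s3]
    simp only [gc]
    field_simp
    ring
  have S4 : ∑ i, ((‖y‖⁻¹) ^ 2 - 2 * y i ^ 2 * (‖y‖⁻¹) ^ 4) = (n - 2) * (‖y‖⁻¹) ^ 2 := by
    have : ∀ i, (‖y‖⁻¹) ^ 2 - 2 * y i ^ 2 * (‖y‖⁻¹) ^ 4 = (‖y‖⁻¹) ^ 2 - 2 * (‖y‖⁻¹) ^ 4 * y i ^ 2 :=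
      fun i => by ring
    rw [Finset.sum_congr rfl fun i _ => this i, Finset.sum_sub_distrib, ← Finset.mul_sum, s1]
    simp
    field_simp
  have S5 : ∑ i, ((2 * (bv i : E) i₀ * y i + y i₀) * (‖y‖⁻¹) ^ 3
        - 3 * y i₀ * y i ^ 2 * (‖y‖⁻¹) ^ 5) = (‖y‖⁻¹) ^ 2 * ((n - 1) * (1 - (gc i₀ y).2)) := by
    have : ∀ i, (2 * (bv i : E) i₀ * y i + y i₀) * (‖y‖⁻¹) ^ 3 - 3 * y i₀ * y i ^ 2 * (‖y‖⁻¹) ^ 5 =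
        2 * (‖y‖⁻¹) ^ 3 * ((bv i : E) i₀ * y i) + y i₀ * (‖y‖⁻¹) ^ 3
          - 3 * y i₀ * (‖y‖⁻¹) ^ 5 * y i ^ 2 := fun i => by ring
    rw [Finset.sum_congr rfl fun i _ => this i, Finset.sum_sub_distrib, Finset.sum_add_distrib,
      ← Finset.mul_sum, s2, ← Finset.mul_sum (f := fun i => y i ^ 2), s1]
    simp [gc]
    field_simp
    ring
  rw [Finset.sum_add_distrib, Finset.sum_add_distrib, Finset.sum_add_distrib, Finset.sum_add_distrib,
    ← Finset.mul_sum, ← Finset.mul_sum, ← Finset.mul_sum, ← Finset.mul_sum, ← Finset.mul_sum,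
    S1, S2, S3, S4, S5]
  ring
end
end ConeHet

namespace ConeHet
open scoped Topology BoundedContinuousFunction

section
variable {n : ℕ}

local notation "E" => EuclideanSpace ℝ (Fin n)

theorem lap_congr {f g : E → ℝ} {y : E} (h : f =ᶠ[𝓝 y] g) : lap f y = lap g y := by
  refine Finset.sum_congr rfl fun i _ => ?_
  have : (fun z => fderiv ℝ f z (EuclideanSpace.single i 1)) =ᶠ[𝓝 y]
      fun z => fderiv ℝ g z (EuclideanSpace.single i 1) := by
    filter_upwards [h.eventuallyEq_nhds] with z hz
    rw [hz.fderiv_eq]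
  rw [this.fderiv_eq]

theorem contDiffAt_fderiv_apply {f : E → ℝ} {y : E} (hf : ContDiffAt ℝ 2 f y) (v : E) :
    ContDiffAt ℝ 1 (fun z => fderiv ℝ f z v) y :=
  (hf.fderiv_right (m := 1) (by norm_num)).clm_apply contDiffAt_const

theorem differentiable_near {f : E → ℝ} {y : E} (hf : ContDiffAt ℝ 2 f y) :
    ∀ᶠ z in 𝓝 y, DifferentiableAt ℝ f z :=
  (hf.eventually (by norm_num)).mono fun z hz => hz.differentiableAt (by norm_num)

theorem lap_comb {f g : E → ℝ} {y : E} (hf : ContDiffAt ℝ 2 f y) (hg : ContDiffAt ℝ 2 g y) (c d : ℝ) :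
    lap (fun z => c * f z - d * g z) y = c * lap f y - d * lap g y := by
  rw [lap, lap, lap, Finset.mul_sum, Finset.mul_sum, ← Finset.sum_sub_distrib]
  refine Finset.sum_congr rfl fun i _ => ?_
  have h1 := (contDiffAt_fderiv_apply hf (EuclideanSpace.single i 1)).differentiableAt one_ne_zero
  have h2 := (contDiffAt_fderiv_apply hg (EuclideanSpace.single i 1)).differentiableAt one_ne_zero
  have : (fun z => fderiv ℝ (fun z => c * f z - d * g z) z (EuclideanSpace.single i 1)) =ᶠ[𝓝 y]
      fun z => c * fderiv ℝ f z (EuclideanSpace.single i 1)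
        - d * fderiv ℝ g z (EuclideanSpace.single i 1) := by
    filter_upwards [differentiable_near hf, differentiable_near hg] with z a1 a2
    rw [((a1.hasFDerivAt.const_mul c).fun_sub (a2.hasFDerivAt.const_mul d)).fderiv]
    rfl
  rw [this.fderiv_eq, ((h1.hasFDerivAt.const_mul c).fun_sub (h2.hasFDerivAt.const_mul d)).fderiv]
  rfl

theorem lap_nonneg_of_isLocalMin {f : E → ℝ} {y : E} (hf : ContDiffAt ℝ 2 f y) (hm : IsLocalMin f y) :
    0 ≤ lap f y := by
  refine Finset.sum_nonneg fun i _ => ?_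
  obtain ⟨v, hv⟩ : ∃ v : E, v = EuclideanSpace.single i 1 := ⟨_, rfl⟩
  rw [← hv]
  have hl : ∀ s : ℝ, HasDerivAt (fun s : ℝ => y + s • v) v s := fun s => by
    simpa using ((hasDerivAt_id s).smul_const v).const_add y
  have hc : Tendsto (fun s : ℝ => y + s • v) (𝓝 0) (𝓝 y) := by
    have := (hl 0).continuousAt.tendsto
    simpa using this
  have e1 : deriv (fun s : ℝ => f (y + s • v)) =ᶠ[𝓝 0] fun s => fderiv ℝ f (y + s • v) v := by
    filter_upwards [hc.eventually (differentiable_near hf)] with s hs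
    exact (hs.hasFDerivAt.comp_hasDerivAt s (hl s)).deriv
  have h2 : deriv (deriv fun s : ℝ => f (y + s • v)) 0 = fderiv ℝ (fun z => fderiv ℝ f z v) y v := by
    rw [e1.deriv_eq]
    have h := (contDiffAt_fderiv_apply hf v).differentiableAt one_ne_zero
    have h' : HasFDerivAt (fun z => fderiv ℝ f z v) (fderiv ℝ (fun z => fderiv ℝ f z v) y)
        (y + (0:ℝ) • v) := by
      rw [zero_smul, add_zero]; exact h.hasFDerivAt
    exact (h'.comp_hasDerivAt (0:ℝ) (hl 0)).deriv
  by_contra! hneg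
  rw [← h2] at hneg
  have hmin : IsLocalMin (fun s : ℝ => f (y + s • v)) 0 := by
    filter_upwards [hc.eventually hm] with s hs
    simpa using hs
  have hmax := isLocalMax_of_deriv_deriv_neg hneg hmin.deriv_eq_zero (by
    refine ContinuousAt.comp (g := f) ?_ (hl 0).continuousAt
    rw [zero_smul, add_zero]; exact hf.continuousAt)
  have hcst : (fun s : ℝ => f (y + s • v)) =ᶠ[𝓝 0] fun _ => f (y + (0:ℝ) • v) := by
    filter_upwards [hmin, hmax] with s h1 h2
    exact le_antisymm h2 h1
  have h3 : deriv (fun s : ℝ => f (y + s • v)) =ᶠ[𝓝 0] fun _ => 0 := by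
    refine hcst.deriv.trans ?_
    simp
  rw [h3.deriv_eq] at hneg
  simp at hneg

/-- The Gaussian barrier. -/
theorem lap_gauss (a k : ℝ) (y z : E) : lap (fun z : E => Real.exp (-a * ‖z - y‖ ^ 2) - k) z =
    Real.exp (-a * ‖z - y‖ ^ 2) * (4 * a ^ 2 * ‖z - y‖ ^ 2 - 2 * a * n) := by
  have h0 : ∀ z : E, HasFDerivAt (fun z : E => Real.exp (-a * ‖z - y‖ ^ 2))
      ((-2 * a * Real.exp (-a * ‖z - y‖ ^ 2)) • innerSL ℝ (z - y)) z := fun z => by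
    have h1 : HasFDerivAt (fun z : E => z - y) (ContinuousLinearMap.id ℝ E) z :=
      (hasFDerivAt_id z).sub_const y
    have h2 : HasFDerivAt (fun z : E => ‖z - y‖ ^ 2) _ z := h1.norm_sq
    refine ((h2.const_mul (-a)).exp).congr_fderiv ?_
    ext v
    simp
    ring
  have e : ∀ i, (fun z : E => fderiv ℝ (fun z : E => Real.exp (-a * ‖z - y‖ ^ 2) - k) z
      (EuclideanSpace.single i 1)) =
      fun z => -2 * a * Real.exp (-a * ‖z - y‖ ^ 2) * (z i - y i) := fun i => funext fun z => by
    rw [((h0 z).sub_const k).fderiv]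
    simp [EuclideanSpace.inner_single_right]
  have key : ∀ i, fderiv ℝ (fun z : E => fderiv ℝ (fun z : E => Real.exp (-a * ‖z - y‖ ^ 2) - k) z
      (EuclideanSpace.single i 1)) z (EuclideanSpace.single i 1) =
      Real.exp (-a * ‖z - y‖ ^ 2) * (4 * a ^ 2 * (z i - y i) ^ 2 - 2 * a) := fun i => by
    rw [e i]
    have h3 : HasFDerivAt (fun z : E => -2 * a * Real.exp (-a * ‖z - y‖ ^ 2) * (z i - y i)) _ z :=
      ((h0 z).const_mul (-2 * a)).mul ((hasFDerivAt_coord z i).sub_const (y i))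
    rw [h3.fderiv]
    simp [EuclideanSpace.inner_single_right]
    ring
  refine (Finset.sum_congr rfl fun i _ => key i).trans ?_
  rw [← Finset.mul_sum, Finset.sum_sub_distrib, ← Finset.mul_sum]
  have s1 : ∑ i, (z i - y i) ^ 2 = ‖z - y‖ ^ 2 := by rw [EuclideanSpace.real_norm_sq_eq]; rfl
  rw [s1]
  simp
  ring

theorem pos_on_ball {U : Set E} (hU : IsOpen U) {w : E → ℝ} (hw : ContDiffOn ℝ 2 w U)
    (hl : ∀ x ∈ U, lap w x = 0) (h0 : ∀ x ∈ U, 0 ≤ w x) {y : E} {ρ : ℝ} (hρ : 0 < ρ)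
    (hb : Metric.closedBall y ρ ⊆ U) (hy : 0 < w y) : ∀ z ∈ Metric.ball y ρ, 0 < w z := by
  have hyU : y ∈ U := hb (Metric.mem_closedBall_self hρ.le)
  have hC : ∀ x ∈ U, ContDiffAt ℝ 2 w x := fun x hx => hw.contDiffAt (hU.mem_nhds hx)
  obtain ⟨r, hr, hrw⟩ := Metric.eventually_nhds_iff.1
    ((hC y hyU).continuousAt.eventually (lt_mem_nhds (half_lt_self hy)))
  obtain ⟨s, hs0, hsr, hsρ⟩ : ∃ s, 0 < s ∧ s < r ∧ s < ρ :=
    ⟨Min.min r ρ / 2, by positivity, by linarith [min_le_left r ρ, lt_min hr hρ],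
      by linarith [min_le_right r ρ, lt_min hr hρ]⟩
  obtain ⟨a, ha0, ha⟩ : ∃ a : ℝ, 0 < a ∧ 2 * a * n < 4 * a ^ 2 * s ^ 2 := by
    refine ⟨(n + 1) / s ^ 2, by positivity, ?_⟩
    have : (0:ℝ) ≤ n := n.cast_nonneg
    have e : 4 * ((n + 1) / s ^ 2) ^ 2 * s ^ 2 = 2 * ((n + 1) / s ^ 2) * (2 * ((n:ℝ) + 1)) := by
      field_simp; ring
    rw [e]
    have : (0:ℝ) < 2 * ((n + 1) / s ^ 2) := by positivity
    refine mul_lt_mul_of_pos_left (by linarith) this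
  obtain ⟨m, hm⟩ : ∃ m, m = w y / 2 := ⟨_, rfl⟩
  have hm0 : 0 < m := by rw [hm]; linarith
  obtain ⟨k, hk⟩ : ∃ k, k = Real.exp (-a * ρ ^ 2) := ⟨_, rfl⟩
  have hk0 : 0 < k := hk ▸ Real.exp_pos _
  have hg : ∀ x : E, ContDiffAt ℝ 2 (fun z : E => Real.exp (-a * ‖z - y‖ ^ 2) - k) x := fun x =>
    (((contDiffAt_const.mul ((contDiffAt_id.sub contDiffAt_const).norm_sq ℝ)).exp).sub contDiffAt_const)
  obtain ⟨q, hq⟩ : ∃ q : E → ℝ, q = fun z =>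
    1 * w z - m * (Real.exp (-a * ‖z - y‖ ^ 2) - k) := ⟨_, rfl⟩
  have hqC : ∀ x ∈ U, ContDiffAt ℝ 2 q x := fun x hx => by
    rw [hq]
    exact (contDiffAt_const.mul (hC x hx)).sub (contDiffAt_const.mul (hg x))
  have key : ∀ z ∈ Metric.closedBall y ρ, 0 ≤ q z := by
    obtain ⟨z₀, hz₀, hmin⟩ := (isCompact_closedBall y ρ).exists_isMinOn
      ⟨y, Metric.mem_closedBall_self hρ.le⟩
      (fun x hx => (hqC x (hb hx)).continuousAt.continuousWithinAt)
    suffices 0 ≤ q z₀ from fun z hz => this.trans (hmin hz)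
    by_contra! hneg
    have hd : ‖z₀ - y‖ ≤ ρ := by rwa [← dist_eq_norm]
    have hdρ : ‖z₀ - y‖ < ρ := by
      refine lt_of_le_of_ne hd fun h => ?_
      have : q z₀ = w z₀ := by rw [hq]; simp only; rw [h, ← hk]; ring
      linarith [h0 z₀ (hb hz₀)]
    have hds : s < ‖z₀ - y‖ := by
      by_contra! h
      have h1 : w y / 2 < w z₀ := hrw (by rw [dist_eq_norm]; linarith)
      have h2 : Real.exp (-a * ‖z₀ - y‖ ^ 2) ≤ 1 := Real.exp_le_one_iff.2 (by nlinarith [sq_nonneg ‖z₀ - y‖])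
      have h3 : q z₀ = w z₀ - m * (Real.exp (-a * ‖z₀ - y‖ ^ 2) - k) := by rw [hq]; ring
      nlinarith
    have hloc : IsLocalMin q z₀ := hmin.isLocalMin
      (mem_of_superset (Metric.isOpen_ball.mem_nhds (show z₀ ∈ Metric.ball y ρ by
        rwa [Metric.mem_ball, dist_eq_norm])) Metric.ball_subset_closedBall)
    have h1 := lap_nonneg_of_isLocalMin (hqC z₀ (hb hz₀)) hloc
    rw [hq, lap_comb (hC z₀ (hb hz₀)) (hg z₀), hl z₀ (hb hz₀), lap_gauss] at h1
    have h2 : 0 < 4 * a ^ 2 * ‖z₀ - y‖ ^ 2 - 2 * a * n := by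
      have : s ^ 2 < ‖z₀ - y‖ ^ 2 := by gcongr
      have : 4 * a ^ 2 * s ^ 2 < 4 * a ^ 2 * ‖z₀ - y‖ ^ 2 := mul_lt_mul_of_pos_left this (by positivity)
      linarith
    have h3 := mul_pos hm0 (mul_pos (Real.exp_pos (-a * ‖z₀ - y‖ ^ 2)) h2)
    linarith
  intro z hz
  have h1 := key z (Metric.ball_subset_closedBall hz)
  rw [hq] at h1
  have h2 : k < Real.exp (-a * ‖z - y‖ ^ 2) := by
    rw [hk, Real.exp_lt_exp]
    have : ‖z - y‖ < ρ := by rwa [Metric.mem_ball, dist_eq_norm] at hz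
    have : ‖z - y‖ ^ 2 < ρ ^ 2 := by gcongr
    nlinarith
  have := mul_pos hm0 (sub_pos.2 h2)
  linarith

theorem pos_of_harmonic {U : Set E} (hU : IsOpen U) (hc : IsPreconnected U) {w : E → ℝ}
    (hw : ContDiffOn ℝ 2 w U) (hl : ∀ x ∈ U, lap w x = 0) (h0 : ∀ x ∈ U, 0 ≤ w x)
    (hy : ∃ y ∈ U, 0 < w y) : ∀ x ∈ U, 0 < w x := by
  have ho : IsOpen {x | x ∈ U ∧ 0 < w x} := hw.continuousOn.isOpen_inter_preimage hU isOpen_Ioi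
  obtain ⟨y, hyU, hy⟩ := hy
  have := hc.subset_of_closure_inter_subset ho ⟨y, hyU, hyU, hy⟩ fun x hx => by
    obtain ⟨ρ, hρ, hb⟩ := Metric.isOpen_iff.1 hU x hx.2
    obtain ⟨z, hz, hd⟩ := Metric.mem_closure_iff.1 hx.1 (ρ / 2) (by positivity)
    refine ⟨hx.2, pos_on_ball hU hw hl h0 (half_pos hρ) (fun v hv => hb ?_) hz.2 x hd⟩
    rw [Metric.mem_closedBall] at hv
    rw [Metric.mem_ball]
    linarith [dist_triangle v z x, dist_comm x z]
  exact fun x hx => (this hx).2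
end
end ConeHet

namespace ConeHet
open scoped Topology BoundedContinuousFunction

section
variable {n : ℕ} (i₀ : Fin n)

local notation "E" => EuclideanSpace ℝ (Fin n)

/-- The height of a point. -/
noncomputable def xc (y : E) : ℝ := (gc i₀ y).2

theorem xc_nonneg (y : E) : 0 ≤ xc i₀ y := by
  rw [xc, gc]
  simp only
  rcases eq_or_ne y 0 with h | h
  · simp [h]
  · have hp : 0 < ‖y‖ := norm_pos_iff.2 h
    rw [sub_nonneg, div_le_one hp]
    exact (le_abs_self _).trans (PiLp.norm_apply_le y i₀)

theorem gc_smul {r : ℝ} (hr : 0 < r) {y : E} (hy : y ≠ 0) :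
    gc i₀ (r • y) = (Real.log r + Real.log ‖y‖, xc i₀ y) := by
  have hp : 0 < ‖y‖ := norm_pos_iff.2 hy
  rw [xc, gc, gc, norm_smul, Real.norm_of_nonneg hr.le, Real.log_mul hr.ne' hp.ne']
  refine Prod.ext rfl ?_
  change 1 - r * y i₀ / (r * ‖y‖) = 1 - y i₀ / ‖y‖
  field_simp

theorem xc_smul {r : ℝ} (hr : 0 < r) {y : E} (hy : y ≠ 0) : xc i₀ (r • y) = xc i₀ y := by
  rw [xc, gc_smul i₀ hr hy]

theorem contDiffAt_gc {y : E} (hy : y ≠ 0) : ContDiffAt ℝ 2 (gc i₀) y := by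
  have hp : ‖y‖ ≠ 0 := norm_ne_zero_iff.2 hy
  have h1 : ContDiffAt ℝ 2 (fun z : E => ‖z‖) y := contDiffAt_norm ℝ hy
  have h2 : ContDiffAt ℝ 2 (fun z : E => z i₀) y :=
    (EuclideanSpace.proj i₀ : E →L[ℝ] ℝ).contDiff.contDiffAt
  exact (h1.log hp).prodMk (contDiffAt_const.sub (h2.div h1 hp))

theorem continuousAt_gc {y : E} (hy : y ≠ 0) : ContinuousAt (gc i₀) y := (contDiffAt_gc i₀ hy).continuousAt

theorem continuousAt_xc {y : E} (hy : y ≠ 0) : ContinuousAt (xc i₀) y :=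
  continuousAt_snd.comp (continuousAt_gc i₀ hy)

/-- The open cone of height less than `s`. -/
def Cs (s : ℝ) : Set E := {y | y ≠ 0 ∧ xc i₀ y < s}

theorem isOpen_Cs (s : ℝ) : IsOpen (Cs i₀ s) := by
  refine isOpen_iff_mem_nhds.2 fun y hy => ?_
  filter_upwards [isOpen_ne.mem_nhds hy.1, (continuousAt_xc i₀ hy.1).eventually (gt_mem_nhds hy.2)]
    with z h1 h2 using ⟨h1, h2⟩

theorem mem_Cs {s : ℝ} {y : E} : y ∈ Cs i₀ s ↔ ‖y‖ * (1 - s) < y i₀ := by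
  constructor
  · rintro ⟨h1, h2⟩
    have hp : 0 < ‖y‖ := norm_pos_iff.2 h1
    change 1 - y i₀ / ‖y‖ < s at h2
    have : 1 - s < y i₀ / ‖y‖ := by linarith
    rw [lt_div_iff₀ hp] at this
    linarith
  · intro h
    have h1 : y ≠ 0 := by rintro rfl; simp at h
    have hp : 0 < ‖y‖ := norm_pos_iff.2 h1
    refine ⟨h1, ?_⟩
    change 1 - y i₀ / ‖y‖ < s
    have : 1 - s < y i₀ / ‖y‖ := by rw [lt_div_iff₀ hp]; linarith
    linarith

theorem norm_bv (i : Fin n) : ‖(bv i : E)‖ = 1 := by simp [bv]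

theorem isPreconnected_Cs {s : ℝ} (h0 : 0 < s) (h2 : s < 2) : IsPreconnected (Cs i₀ s) := by
  have hb : (bv i₀ : E) i₀ = 1 := by simp [bv_apply]
  have hstar : StarConvex ℝ (bv i₀ : E) (Cs i₀ s) := by
    intro y hy a b ha hb' hab
    rw [mem_Cs] at hy ⊢
    have e1 : (a • (bv i₀ : E) + b • y) i₀ = a + b * y i₀ := by simp [hb]
    rw [e1]
    rcases hb'.eq_or_lt with h | h
    · rw [← h, zero_smul, zero_mul, add_zero, add_zero, norm_smul, norm_bv, Real.norm_of_nonneg ha]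
      have : a = 1 := by linarith
      rw [this]; linarith
    have n1 : ‖a • (bv i₀ : E)‖ = a := by rw [norm_smul, norm_bv, Real.norm_of_nonneg ha, mul_one]
    have n2 : ‖b • y‖ = b * ‖y‖ := by rw [norm_smul, Real.norm_of_nonneg hb']
    have t1 := norm_add_le (a • (bv i₀ : E)) (b • y)
    have t2 := norm_sub_le (a • (bv i₀ : E) + b • y) (a • (bv i₀ : E))
    rw [add_sub_cancel_left] at t2
    rw [n1, n2] at t1 t2
    have h3 := mul_lt_mul_of_pos_left hy h
    rcases le_total 0 (1 - s) with h4 | h4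
    · nlinarith
    · nlinarith
  have hm : (bv i₀ : E) ∈ Cs i₀ s := (mem_Cs i₀).2 (by rw [hb, norm_bv]; linarith)
  exact (hstar.isPathConnected hm).isConnected.isPreconnected

theorem cone_eq (hn : 2 ≤ n) (β : ℝ) : cone n hn β = Cs ⟨0, by omega⟩ (1 - Real.cos β) := by
  ext y
  rw [mem_Cs]
  constructor
  · rintro ⟨h1, h2⟩
    simpa using h2
  · intro h
    have h1 : y ≠ 0 := by rintro rfl; simp at h
    exact ⟨h1, by simpa using h⟩

/-- A curve of unit vectors parametrised by height. -/
theorem exists_pnt (hn : 2 ≤ n) : ∃ f : ℝ → E, Continuous f ∧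
    ∀ s ∈ Set.Icc (0:ℝ) 2, ‖f s‖ = 1 ∧ xc i₀ (f s) = s := by
  obtain ⟨i₁, hi⟩ : ∃ i₁ : Fin n, i₁ ≠ i₀ := by
    haveI : Nontrivial (Fin n) := Fin.nontrivial_iff_two_le.2 hn
    exact exists_ne i₀
  refine ⟨fun s => (1 - s) • bv i₀ + Real.sqrt (1 - (1 - s) ^ 2) • bv i₁, by fun_prop, fun s hs => ?_⟩
  have h0 : 0 ≤ 1 - (1 - s) ^ 2 := by nlinarith [hs.1, hs.2]
  have hin : inner ℝ (bv i₀ : E) (bv i₁) = 0 := by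
    have := inner_bv (bv i₀ : E) i₁
    rw [innerSL_apply_apply] at this
    rw [this, bv_apply, if_neg hi.symm]
  have hN : ‖(1 - s) • (bv i₀ : E) + Real.sqrt (1 - (1 - s) ^ 2) • bv i₁‖ = 1 := by
    rw [← sq_eq_sq₀ (norm_nonneg _) zero_le_one, norm_add_sq_real, norm_smul, norm_smul, norm_bv, norm_bv,
      inner_smul_left, inner_smul_right, hin, mul_one, mul_one, Real.norm_eq_abs, Real.norm_eq_abs, sq_abs,
      sq_abs, Real.sq_sqrt h0]
    ring
  refine ⟨hN, ?_⟩
  rw [xc, gc]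
  simp only
  rw [hN]
  simp [bv_apply, hi]

/-- Functions of separated variables. -/
noncomputable def sep (a : ℝ) (φ : ℝ → ℝ) (y : E) : ℝ := Real.exp (a * (gc i₀ y).1) * φ (gc i₀ y).2

theorem sep_eq (a : ℝ) (φ : ℝ → ℝ) {y : E} (hy : y ≠ 0) : sep i₀ a φ y = ‖y‖ ^ a * φ (xc i₀ y) := by
  rw [Real.rpow_def_of_pos (norm_pos_iff.2 hy), mul_comm (Real.log _)]; rfl

theorem sep_smul (a : ℝ) (φ : ℝ → ℝ) {y : E} (hy : y ≠ 0) {r : ℝ} (hr : 0 < r) :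
    sep i₀ a φ (r • y) = r ^ a * sep i₀ a φ y := by
  rw [sep_eq i₀ a φ hy, sep_eq i₀ a φ (smul_ne_zero hr.ne' hy), xc_smul i₀ hr hy, norm_smul,
    Real.norm_of_nonneg hr.le, Real.mul_rpow hr.le (norm_nonneg _), mul_assoc]

theorem hasFDerivAt_expmul (k a : ℝ) {φ : ℝ → ℝ} {φ' : ℝ} {z : ℝ × ℝ} (h : HasDerivAt φ φ' z.2) :
    HasFDerivAt (fun z : ℝ × ℝ => k * (Real.exp (a * z.1) * φ z.2))
      (lin (k * (a * (Real.exp (a * z.1) * φ z.2))) (k * (Real.exp (a * z.1) * φ'))) z := by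
  have h1 := ((hasFDerivAt_fst (𝕜 := ℝ) (p := z)).const_mul a).exp
  have h2 := h.hasFDerivAt.comp z (hasFDerivAt_snd (𝕜 := ℝ) (p := z))
  refine ((h1.mul h2).const_mul k).congr_fderiv ?_
  ext
  · simp [lin, mul_left_comm, mul_comm]
  · simp [lin]

variable {φ φ' φ'' : ℝ → ℝ} (h1 : ∀ x, HasDerivAt φ (φ' x) x) (h2 : ∀ x, HasDerivAt φ' (φ'' x) x)

include h1 h2

theorem lap_sep (a : ℝ) {y : E} (hy : y ≠ 0) : lap (sep i₀ a φ) y = (‖y‖⁻¹) ^ 2 * ‖y‖ ^ a *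
    ((a ^ 2 + (n - 2) * a) * φ (xc i₀ y) + xc i₀ y * (2 - xc i₀ y) * φ'' (xc i₀ y) +
      (n - 1) * (1 - xc i₀ y) * φ' (xc i₀ y)) := by
  have := lap_comp i₀ (F := fun z => 1 * (Real.exp (a * z.1) * φ z.2))
    (Ft := fun z => a * (Real.exp (a * z.1) * φ z.2)) (Fx := fun z => 1 * (Real.exp (a * z.1) * φ' z.2))
    hy (Eventually.of_forall fun z => by simpa using hasFDerivAt_expmul 1 a (h1 z.2))
    (hasFDerivAt_expmul a a (h1 _)) (hasFDerivAt_expmul 1 a (h2 _))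
  simp only [one_mul] at this
  refine Eq.trans this ?_
  have e : Real.exp (a * (gc i₀ y).1) = ‖y‖ ^ a := by
    rw [Real.rpow_def_of_pos (norm_pos_iff.2 hy), mul_comm (Real.log _)]; rfl
  rw [e]
  change (‖y‖⁻¹) ^ 2 * (a * (a * (_ * φ (xc i₀ y))) + (n - 2) * (a * (_ * φ (xc i₀ y)))
    + xc i₀ y * (2 - xc i₀ y) * (_ * φ'' (xc i₀ y)) + (n - 1) * (1 - xc i₀ y) * (_ * φ' (xc i₀ y))) = _
  ring

theorem contDiffAt_sep (hc : Continuous φ'') (a : ℝ) {y : E} (hy : y ≠ 0) : ContDiffAt ℝ 2 (sep i₀ a φ) y := by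
  have e1 : deriv φ = φ' := funext fun x => (h1 x).deriv
  have e2 : deriv φ' = φ'' := funext fun x => (h2 x).deriv
  have c1 : ContDiff ℝ 1 φ' := by
    rw [contDiff_one_iff_deriv]; exact ⟨fun x => (h2 x).differentiableAt, by rw [e2]; exact hc⟩
  have c2 : ContDiff ℝ 2 φ := by
    have : ContDiff ℝ (1 + 1) φ := by
      rw [contDiff_succ_iff_deriv]
      exact ⟨fun x => (h1 x).differentiableAt, by simp, by rw [e1]; exact c1⟩
    exact this.of_le (by norm_num)
  have g := contDiffAt_gc i₀ hy
  exact ((contDiffAt_const.mul (contDiffAt_fst.comp y g)).exp).mul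
    (c2.contDiffAt.comp y (contDiffAt_snd.comp y g))
end
end ConeHet

namespace ConeHet
open scoped Topology BoundedContinuousFunction

section
variable {n : ℕ} (i₀ : Fin n)

local notation "E" => EuclideanSpace ℝ (Fin n)

/-- Positively homogeneous of degree `γ` away from the origin. -/
def Hom (γ : ℝ) (f : E → ℝ) : Prop := ∀ r : ℝ, 0 < r → ∀ y, y ≠ 0 → f (r • y) = r ^ γ * f y

theorem hom_sep (γ : ℝ) (φ : ℝ → ℝ) : Hom γ (sep i₀ γ φ) := fun _ hr _ hy => sep_smul i₀ γ φ hy hr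

theorem Hom.comb {γ : ℝ} {f g : E → ℝ} (hf : Hom γ f) (hg : Hom γ g) (a b : ℝ) :
    Hom γ fun y => a * f y - b * g y := fun r hr y hy => by
  simp only [hf r hr y hy, hg r hr y hy]; ring

theorem exists_ratio {γ : ℝ} {f g : E → ℝ} (hf : Hom γ f) (hg : Hom γ g) {I : Set ℝ} (hI : IsClosed I)
    (hne : ∃ y : E, ‖y‖ = 1 ∧ xc i₀ y ∈ I) (cf : ∀ y, y ≠ 0 → xc i₀ y ∈ I → ContinuousAt f y)
    (cg : ∀ y, y ≠ 0 → xc i₀ y ∈ I → ContinuousAt g y) (gpos : ∀ y, y ≠ 0 → xc i₀ y ∈ I → 0 < g y) :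
    ∃ y₀, ‖y₀‖ = 1 ∧ xc i₀ y₀ ∈ I ∧ ∀ y, y ≠ 0 → xc i₀ y ∈ I → f y * g y₀ ≤ f y₀ * g y := by
  have h0 : ∀ y : E, ‖y‖ = 1 → y ≠ 0 := fun y hy => norm_ne_zero_iff.1 (by rw [hy]; exact one_ne_zero)
  have hcl : IsClosed (Metric.sphere (0:E) 1 ∩ xc i₀ ⁻¹' I) :=
    ContinuousOn.preimage_isClosed_of_isClosed (fun y hy =>
      (continuousAt_xc i₀ (h0 y (mem_sphere_zero_iff_norm.1 hy))).continuousWithinAt) Metric.isClosed_sphere hI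
  have hcpt : IsCompact (Metric.sphere (0:E) 1 ∩ xc i₀ ⁻¹' I) :=
    (isCompact_sphere (0:E) 1).of_isClosed_subset hcl Set.inter_subset_left
  obtain ⟨z, hz1, hz2⟩ := hne
  obtain ⟨y₀, ⟨hy1, hy2⟩, hm⟩ := hcpt.exists_isMaxOn ⟨z, mem_sphere_zero_iff_norm.2 hz1, hz2⟩
    (f := fun y => f y / g y) fun y hy => by
      have := h0 y (mem_sphere_zero_iff_norm.1 hy.1)
      exact ((cf y this hy.2).div (cg y this hy.2) (gpos y this hy.2).ne').continuousWithinAt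
  have hy1' := mem_sphere_zero_iff_norm.1 hy1
  refine ⟨y₀, hy1', hy2, fun y hy hyI => ?_⟩
  have hp : 0 < ‖y‖ := norm_pos_iff.2 hy
  have hx := xc_smul i₀ (inv_pos.2 hp) hy
  have hn1 : ‖‖y‖⁻¹ • y‖ = 1 := by
    rw [norm_smul, norm_inv, norm_norm, inv_mul_cancel₀ hp.ne']
  have := hm (a := ‖y‖⁻¹ • y) ⟨mem_sphere_zero_iff_norm.2 hn1, by rw [Set.mem_preimage, hx]; exact hyI⟩
  change f (‖y‖⁻¹ • y) / g (‖y‖⁻¹ • y) ≤ f y₀ / g y₀ at this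
  rw [hf _ (inv_pos.2 hp) y hy, hg _ (inv_pos.2 hp) y hy,
    mul_div_mul_left _ _ (Real.rpow_pos_of_pos (inv_pos.2 hp) γ).ne',
    div_le_div_iff₀ (gpos y hy hyI) (gpos y₀ (h0 _ hy1') hy2)] at this
  exact this

theorem eq_of_touch {s : ℝ} (h0 : 0 < s) (h2 : s < 2) {f g : E → ℝ} (cf : ∀ y ∈ Cs i₀ s, ContDiffAt ℝ 2 f y)
    (cg : ∀ y ∈ Cs i₀ s, ContDiffAt ℝ 2 g y) (lf : ∀ y ∈ Cs i₀ s, lap f y = 0)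
    (lg : ∀ y ∈ Cs i₀ s, lap g y = 0) {y₀ : E} (hy : y₀ ∈ Cs i₀ s)
    (h : ∀ y ∈ Cs i₀ s, f y * g y₀ ≤ f y₀ * g y) : ∀ y ∈ Cs i₀ s, f y * g y₀ = f y₀ * g y := by
  by_contra! hne
  obtain ⟨y, hyC, hne⟩ := hne
  have := pos_of_harmonic (isOpen_Cs i₀ s) (isPreconnected_Cs i₀ h0 h2)
    (w := fun y => f y₀ * g y - g y₀ * f y)
    (fun y hy => ((contDiffAt_const.mul (cg y hy)).sub (contDiffAt_const.mul (cf y hy))).contDiffWithinAt)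
    (fun y hy => by rw [lap_comb (cg y hy) (cf y hy), lf y hy, lg y hy]; ring)
    (fun y hy => by have := h y hy; linarith)
    ⟨y, hyC, by have := lt_of_le_of_ne (h y hyC) hne; linarith⟩ y₀ hy
  linarith

theorem eq_at_end {f : ℝ → E} (hf : Continuous f) {s : ℝ} (hs : 0 < s) {w₁ w₂ : E → ℝ}
    (c₁ : ContinuousAt w₁ (f s)) (c₂ : ContinuousAt w₂ (f s)) (h : ∀ t ∈ Set.Ioo 0 s, w₁ (f t) = w₂ (f t)) :
    w₁ (f s) = w₂ (f s) := by
  have t1 : Tendsto (fun t => w₁ (f t)) (𝓝[<] s) (𝓝 (w₁ (f s))) :=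
    (c₁.tendsto.comp hf.continuousAt).mono_left nhdsWithin_le_nhds
  have t2 : Tendsto (fun t => w₂ (f t)) (𝓝[<] s) (𝓝 (w₂ (f s))) :=
    (c₂.tendsto.comp hf.continuousAt).mono_left nhdsWithin_le_nhds
  refine tendsto_nhds_unique t1 (t2.congr' ?_)
  filter_upwards [Ioo_mem_nhdsLT hs] with t ht using (h t ht).symm

/-- A positive homogeneous harmonic function on a cone, extended by zero. -/
structure Adm (ℓ γ : ℝ) (G : E → ℝ) : Prop where
  hom : Hom γ G
  cont : ∀ y, y ≠ 0 → ContinuousAt G y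
  pos : ∀ y ∈ Cs i₀ ℓ, 0 < G y
  zero : ∀ y, y ∉ Cs i₀ ℓ → G y = 0
  smooth : ∀ y ∈ Cs i₀ ℓ, ContDiffAt ℝ 2 G y
  harm : ∀ y ∈ Cs i₀ ℓ, lap G y = 0

theorem exists_adm {ℓ γ : ℝ} {Φ : E → ℝ} (hC2 : ContDiffOn ℝ 2 Φ (Cs i₀ ℓ)) (hpos : ∀ x ∈ Cs i₀ ℓ, 0 < Φ x)
    (hharm : ∀ x ∈ Cs i₀ ℓ, lap Φ x = 0) (hbd : VanishesOnBoundary (Cs i₀ ℓ) Φ)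
    (hhom : ∀ r > (0:ℝ), ∀ x ∈ Cs i₀ ℓ, Φ (r • x) = r ^ γ * Φ x) :
    ∃ G, Adm i₀ ℓ γ G ∧ ∀ y ∈ Cs i₀ ℓ, G y = Φ y := by
  classical
  have ho := isOpen_Cs i₀ ℓ
  have hin : ∀ y ∈ Cs i₀ ℓ, (Cs i₀ ℓ).indicator Φ y = Φ y := fun y hy => Set.indicator_of_mem hy _
  have hout : ∀ y, y ∉ Cs i₀ ℓ → (Cs i₀ ℓ).indicator Φ y = 0 := fun y hy => Set.indicator_of_notMem hy _
  have hev : ∀ y ∈ Cs i₀ ℓ, (Cs i₀ ℓ).indicator Φ =ᶠ[𝓝 y] Φ := fun y hy => by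
    filter_upwards [ho.mem_nhds hy] with z hz using hin z hz
  have hsm : ∀ y ∈ Cs i₀ ℓ, ContDiffAt ℝ 2 ((Cs i₀ ℓ).indicator Φ) y := fun y hy =>
    (hC2.contDiffAt (ho.mem_nhds hy)).congr_of_eventuallyEq (hev y hy)
  refine ⟨(Cs i₀ ℓ).indicator Φ, ⟨fun r hr y hy => ?_, fun y hy => ?_, fun y hy => ?_, hout, hsm,
    fun y hy => ?_⟩, hin⟩
  · by_cases h : y ∈ Cs i₀ ℓ
    · have h' : r • y ∈ Cs i₀ ℓ := ⟨smul_ne_zero hr.ne' hy, by rw [xc_smul i₀ hr hy]; exact h.2⟩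
      rw [hin _ h, hin _ h', hhom r hr y h]
    · have h' : r • y ∉ Cs i₀ ℓ := fun h' => h ⟨hy, by rw [← xc_smul i₀ hr hy]; exact h'.2⟩
      rw [hout _ h, hout _ h', mul_zero]
  · by_cases h : y ∈ Cs i₀ ℓ
    · exact (hsm y h).continuousAt
    · have ht : Tendsto Φ (𝓝[Cs i₀ ℓ] y) (𝓝 0) := by
        by_cases hc : y ∈ closure (Cs i₀ ℓ)
        · exact hbd y ⟨hc, h⟩ hy
        · rw [mem_closure_iff_nhdsWithin_neBot, not_neBot] at hc
          rw [hc]; exact tendsto_bot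
      rw [ContinuousAt, hout y h, Metric.tendsto_nhds]
      intro ε hε
      filter_upwards [eventually_nhdsWithin_iff.1 (Metric.tendsto_nhds.1 ht ε hε)] with z hz
      by_cases h' : z ∈ Cs i₀ ℓ
      · rw [hin z h']; exact hz h'
      · rw [hout z h', dist_self]; exact hε
  · rw [hin y hy]; exact hpos y hy
  · rw [lap_congr (hev y hy)]; exact hharm y hy

section
variable {ℓ γ : ℝ} {G : EuclideanSpace ℝ (Fin n) → ℝ} (hn : 2 ≤ n) (hG : Adm i₀ ℓ γ G) (hℓ : 0 < ℓ) (hℓ2 : ℓ < 2)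
  {φ φ' φ'' : ℝ → ℝ} (h1 : ∀ x, HasDerivAt φ (φ' x) x) (h2 : ∀ x, HasDerivAt φ' (φ'' x) x)
  (hc : Continuous φ'') (hφ0 : φ 0 = 1)
  (hode : ∀ x ∈ Set.Icc 0 ℓ, (γ ^ 2 + (n - 2) * γ) * φ x + x * (2 - x) * φ'' x + (n - 1) * (1 - x) * φ' x = 0)

include hn hG hℓ hℓ2 h1 h2 hc hφ0 hode

theorem no_early_zero {x₁ : ℝ} (hx0 : 0 < x₁) (hx : x₁ < ℓ) (hpos : ∀ x ∈ Set.Ico 0 x₁, 0 < φ x) : φ x₁ ≠ 0 := by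
  intro hz
  obtain ⟨f, hf, hfn⟩ := exists_pnt i₀ hn
  have f0 : ∀ s ∈ Set.Icc (0:ℝ) 2, f s ≠ 0 := fun s hs =>
    norm_ne_zero_iff.1 (by rw [(hfn s hs).1]; exact one_ne_zero)
  have m0 : (0:ℝ) ∈ Set.Icc (0:ℝ) 2 := ⟨le_rfl, zero_le_two⟩
  have m1 : x₁ ∈ Set.Icc (0:ℝ) 2 := ⟨hx0.le, by linarith⟩
  have inC : ∀ y, y ≠ 0 → xc i₀ y ≤ x₁ → y ∈ Cs i₀ ℓ := fun y hy h => ⟨hy, by linarith⟩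
  have cs : ∀ y, y ≠ 0 → ContDiffAt ℝ 2 (sep i₀ γ φ) y := fun y hy => contDiffAt_sep i₀ h1 h2 hc γ hy
  have sval : ∀ s ∈ Set.Icc (0:ℝ) 2, sep i₀ γ φ (f s) = φ s := fun s hs => by
    rw [sep_eq i₀ γ φ (f0 s hs), (hfn s hs).1, (hfn s hs).2, Real.one_rpow, one_mul]
  obtain ⟨y₀, hy1, hy2, hm⟩ := exists_ratio i₀ (hom_sep i₀ γ φ) hG.hom (isClosed_Iic (a := x₁))
    ⟨f 0, (hfn 0 m0).1, by rw [(hfn 0 m0).2]; exact hx0.le⟩ (fun y hy _ => (cs y hy).continuousAt)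
    (fun y hy _ => hG.cont y hy) (fun y hy h => hG.pos y (inC y hy h))
  have y0 : y₀ ≠ 0 := norm_ne_zero_iff.1 (by rw [hy1]; exact one_ne_zero)
  have g0 := hG.pos y₀ (inC y₀ y0 hy2)
  have hH : 0 < sep i₀ γ φ y₀ := by
    have t := hm (f 0) (f0 0 m0) (by rw [(hfn 0 m0).2]; exact hx0.le)
    rw [sval 0 m0, hφ0, one_mul] at t
    exact pos_of_mul_pos_left (g0.trans_le t)
      (hG.pos _ (inC _ (f0 0 m0) (by rw [(hfn 0 m0).2]; exact hx0.le))).le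
  have hlt : xc i₀ y₀ < x₁ := by
    refine lt_of_le_of_ne hy2 fun h => ?_
    rw [sep_eq i₀ γ φ y0, h, hz, mul_zero] at hH
    exact lt_irrefl _ hH
  have heq := eq_of_touch i₀ hx0 (by linarith) (fun y hy => cs y hy.1)
    (fun y hy => hG.smooth y (inC y hy.1 hy.2.le))
    (fun y hy => by
      rw [lap_sep i₀ h1 h2 γ hy.1, hode _ ⟨xc_nonneg i₀ y, by linarith [hy.2]⟩, mul_zero])
    (fun y hy => hG.harm y (inC y hy.1 hy.2.le)) (y₀ := y₀) ⟨y0, hlt⟩ (fun y hy => hm y hy.1 hy.2.le)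
  have := eq_at_end hf hx0 (w₁ := fun y => sep i₀ γ φ y * G y₀) (w₂ := fun y => sep i₀ γ φ y₀ * G y)
    ((cs _ (f0 _ m1)).continuousAt.mul continuousAt_const)
    (continuousAt_const.mul (hG.cont _ (f0 _ m1)))
    (fun t ht => by
      have mt : t ∈ Set.Icc (0:ℝ) 2 := ⟨ht.1.le, by linarith [ht.2]⟩
      exact heq _ ⟨f0 t mt, by rw [(hfn t mt).2]; exact ht.2⟩)
  simp only [sval x₁ m1, hz, zero_mul] at this
  exact (mul_pos hH (hG.pos _ (inC _ (f0 _ m1) (by rw [(hfn _ m1).2])))).ne this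

theorem exists_zero : ∃ x ∈ Set.Icc 0 ℓ, φ x ≤ 0 := by
  by_contra! hpos
  obtain ⟨f, hf, hfn⟩ := exists_pnt i₀ hn
  have f0 : ∀ s ∈ Set.Icc (0:ℝ) 2, f s ≠ 0 := fun s hs =>
    norm_ne_zero_iff.1 (by rw [(hfn s hs).1]; exact one_ne_zero)
  have m0 : (0:ℝ) ∈ Set.Icc (0:ℝ) 2 := ⟨le_rfl, zero_le_two⟩
  have m1 : ℓ ∈ Set.Icc (0:ℝ) 2 := ⟨hℓ.le, by linarith⟩
  have cs : ∀ y, y ≠ 0 → ContDiffAt ℝ 2 (sep i₀ γ φ) y := fun y hy => contDiffAt_sep i₀ h1 h2 hc γ hy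
  have spos : ∀ y, y ≠ 0 → xc i₀ y ≤ ℓ → 0 < sep i₀ γ φ y := fun y hy h => by
    rw [sep_eq i₀ γ φ hy]
    exact mul_pos (Real.rpow_pos_of_pos (norm_pos_iff.2 hy) γ) (hpos _ ⟨xc_nonneg i₀ y, h⟩)
  obtain ⟨y₀, hy1, hy2, hm⟩ := exists_ratio i₀ hG.hom (hom_sep i₀ γ φ) (isClosed_Iic (a := ℓ))
    ⟨f 0, (hfn 0 m0).1, by rw [(hfn 0 m0).2]; exact hℓ.le⟩
    (fun y hy _ => hG.cont y hy) (fun y hy _ => (cs y hy).continuousAt) (fun y hy h => spos y hy h)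
  have y0 : y₀ ≠ 0 := norm_ne_zero_iff.1 (by rw [hy1]; exact one_ne_zero)
  have s0 := spos y₀ y0 hy2
  have hg : 0 < G y₀ := by
    have h' : xc i₀ (f 0) ≤ ℓ := by rw [(hfn 0 m0).2]; exact hℓ.le
    have t := hm (f 0) (f0 0 m0) h'
    exact pos_of_mul_pos_left ((mul_pos (hG.pos _ ⟨f0 0 m0, by rw [(hfn 0 m0).2]; exact hℓ⟩) s0).trans_le t)
      (spos _ (f0 0 m0) h').le
  have hC : y₀ ∈ Cs i₀ ℓ := by
    by_contra h
    rw [hG.zero _ h] at hg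
    exact lt_irrefl _ hg
  have heq := eq_of_touch i₀ hℓ hℓ2 hG.smooth (fun y hy => cs y hy.1) hG.harm
    (fun y hy => by
      rw [lap_sep i₀ h1 h2 γ hy.1, hode _ ⟨xc_nonneg i₀ y, hy.2.le⟩, mul_zero])
    hC (fun y hy => hm y hy.1 hy.2.le)
  have := eq_at_end hf hℓ (w₁ := fun y => G y * sep i₀ γ φ y₀) (w₂ := fun y => G y₀ * sep i₀ γ φ y)
    ((hG.cont _ (f0 _ m1)).mul continuousAt_const)
    (continuousAt_const.mul (cs _ (f0 _ m1)).continuousAt)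
    (fun t ht => by
      have mt : t ∈ Set.Icc (0:ℝ) 2 := ⟨ht.1.le, by linarith [ht.2]⟩
      exact heq _ ⟨f0 t mt, by rw [(hfn t mt).2]; exact ht.2⟩)
  have hz : G (f ℓ) = 0 := hG.zero _ fun h => by
    have := h.2; rw [(hfn ℓ m1).2] at this; exact lt_irrefl _ this
  simp only [hz, zero_mul] at this
  exact (mul_pos hg (spos _ (f0 _ m1) (by rw [(hfn _ m1).2]))).ne this

end
end
end ConeHet

namespace ConeHet
open scoped Topology BoundedContinuousFunction

section
variable {n : ℕ} (i₀ : Fin n)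

local notation "E" => EuclideanSpace ℝ (Fin n)

/-- A positive strict supersolution near the boundary of the cap. -/
theorem exists_barrier (n : ℕ) (hn : 2 ≤ n) {ℓ Λ : ℝ} (hℓ : 0 < ℓ) (hℓ2 : ℓ < 2) (hΛ : 0 < Λ) :
    ∃ x₂ : ℝ, 0 < x₂ ∧ x₂ < ℓ ∧ ∃ η η' η'' : ℝ → ℝ, (∀ x, HasDerivAt η (η' x) x) ∧
      (∀ x, HasDerivAt η' (η'' x) x) ∧ Continuous η'' ∧ ∀ x ∈ Set.Icc x₂ ℓ, 0 < η x ∧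
        Λ * η x + x * (2 - x) * η'' x + (n - 1) * (1 - x) * η' x < 0 := by
  have hn' : (2:ℝ) ≤ n := by exact_mod_cast hn
  obtain ⟨δ, hδ⟩ : ∃ δ, δ = ℓ * (2 - ℓ) / 4 := ⟨_, rfl⟩
  have hδ0 : 0 < δ := by rw [hδ]; have : 0 < 2 - ℓ := by linarith
                         positivity
  obtain ⟨N, hN⟩ : ∃ N, N = Λ / δ := ⟨_, rfl⟩
  have hN0 : 0 < N := by rw [hN]; positivity
  have hNδ : N * δ = Λ := by rw [hN]; field_simp
  obtain ⟨e, he⟩ : ∃ e, e = Min.min (Min.min (ℓ / 2) (δ / n)) (Min.min 1 (1 / (2 * N))) := ⟨_, rfl⟩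
  have hn0 : (0:ℝ) < n := by linarith
  have he0 : 0 < e := by
    rw [he]; exact lt_min (lt_min (by positivity) (by positivity)) (lt_min one_pos (by positivity))
  have e1 : e ≤ ℓ / 2 := by rw [he]; exact (min_le_left _ _).trans (min_le_left _ _)
  have e2 : e ≤ δ / n := by rw [he]; exact (min_le_left _ _).trans (min_le_right _ _)
  have e3 : e ≤ 1 := by rw [he]; exact (min_le_right _ _).trans (min_le_left _ _)
  have e4 : e ≤ 1 / (2 * N) := by rw [he]; exact (min_le_right _ _).trans (min_le_right _ _)
  rw [le_div_iff₀ hn0] at e2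
  rw [le_div_iff₀ (by positivity)] at e4
  refine ⟨ℓ - e, by linarith, by linarith, fun x => 1 - N * (ℓ - x) ^ 2, fun x => 2 * N * (ℓ - x),
    fun _ => -(2 * N), fun x => ?_, fun x => ?_, continuous_const, fun x hx => ?_⟩
  · have := ((((hasDerivAt_id x).const_sub ℓ).pow 2).const_mul N).const_sub 1
    refine this.congr_deriv ?_
    simp; ring
  · have := ((hasDerivAt_id x).const_sub ℓ).const_mul (2 * N)
    refine this.congr_deriv ?_
    ring
  · obtain ⟨hx1, hx2⟩ := hx
    have a0 : 0 ≤ ℓ - x := by linarith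
    have a1 : ℓ - x ≤ e := by linarith
    have b : (ℓ - x) ^ 2 ≤ e := by nlinarith
    have c : 2 * δ ≤ x * (2 - x) := by rw [hδ]; nlinarith
    have hk : (ℓ - x) * (n - 1) * (1 - x) ≤ δ := by
      have k1 : (ℓ - x) * (n - 1) * (1 - x) ≤ (ℓ - x) * (n - 1) * 1 :=
        mul_le_mul_of_nonneg_left (by linarith) (mul_nonneg a0 (by linarith))
      nlinarith
    refine ⟨by nlinarith, ?_⟩
    have d1 : Λ * (1 - N * (ℓ - x) ^ 2) ≤ Λ := by
      have : 0 ≤ Λ * (N * (ℓ - x) ^ 2) := by positivity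
      linarith
    have d2 : x * (2 - x) * (-(2 * N)) ≤ -(4 * Λ) := by rw [← hNδ]; nlinarith
    have d3 : (n - 1) * (1 - x) * (2 * N * (ℓ - x)) ≤ 2 * Λ := by rw [← hNδ]; nlinarith
    linarith

section
variable {ℓ γ : ℝ} {G : EuclideanSpace ℝ (Fin n) → ℝ} (hn : 2 ≤ n) (hG : Adm i₀ ℓ γ G) (hℓ : 0 < ℓ) (hℓ2 : ℓ < 2)
  {φ φ' φ'' : ℝ → ℝ} (h1 : ∀ x, HasDerivAt φ (φ' x) x) (h2 : ∀ x, HasDerivAt φ' (φ'' x) x)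
  (hc : Continuous φ'') (hφ0 : φ 0 = 1)
  (hode : ∀ x ∈ Set.Icc 0 ℓ, (γ ^ 2 + (n - 2) * γ) * φ x + x * (2 - x) * φ'' x + (n - 1) * (1 - x) * φ' x = 0)

include hn hG hℓ hℓ2 h1 h2 hc hφ0 hode

theorem eq_mul_sep (hΛ : 0 < γ ^ 2 + (n - 2) * γ) (hpos : ∀ x ∈ Set.Ico 0 ℓ, 0 < φ x) (hz : φ ℓ = 0) :
    ∃ c > 0, ∀ y ∈ Cs i₀ ℓ, G y = c * sep i₀ γ φ y := by
  obtain ⟨x₂, hx0, hxℓ, η, η', η'', k1, k2, kc, hη⟩ := exists_barrier n hn hℓ hℓ2 hΛ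
  obtain ⟨f, hf, hfn⟩ := exists_pnt i₀ hn
  have f0 : ∀ s ∈ Set.Icc (0:ℝ) 2, f s ≠ 0 := fun s hs =>
    norm_ne_zero_iff.1 (by rw [(hfn s hs).1]; exact one_ne_zero)
  have m0 : (0:ℝ) ∈ Set.Icc (0:ℝ) 2 := ⟨le_rfl, zero_le_two⟩
  have m1 : ℓ ∈ Set.Icc (0:ℝ) 2 := ⟨hℓ.le, by linarith⟩
  have cs : ∀ y, y ≠ 0 → ContDiffAt ℝ 2 (sep i₀ γ φ) y := fun y hy => contDiffAt_sep i₀ h1 h2 hc γ hy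
  have cη : ∀ y, y ≠ 0 → ContDiffAt ℝ 2 (sep i₀ γ η) y := fun y hy => contDiffAt_sep i₀ k1 k2 kc γ hy
  have ls : ∀ y ∈ Cs i₀ ℓ, lap (sep i₀ γ φ) y = 0 := fun y hy => by
    rw [lap_sep i₀ h1 h2 γ hy.1, hode _ ⟨xc_nonneg i₀ y, hy.2.le⟩, mul_zero]
  have spos : ∀ y, y ≠ 0 → xc i₀ y < ℓ → 0 < sep i₀ γ φ y := fun y hy h => by
    rw [sep_eq i₀ γ φ hy]
    exact mul_pos (Real.rpow_pos_of_pos (norm_pos_iff.2 hy) γ) (hpos _ ⟨xc_nonneg i₀ y, h⟩)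
  have ηpos : ∀ y, y ≠ 0 → xc i₀ y ∈ Set.Icc x₂ ℓ → 0 < sep i₀ γ η y := fun y hy h => by
    rw [sep_eq i₀ γ η hy]
    exact mul_pos (Real.rpow_pos_of_pos (norm_pos_iff.2 hy) γ) (hη _ h).1
  obtain ⟨y₀, hy1, hy2, hm⟩ := exists_ratio i₀ hG.hom (hom_sep i₀ γ φ) (isClosed_Iic (a := x₂))
    ⟨f 0, (hfn 0 m0).1, by rw [(hfn 0 m0).2]; exact hx0.le⟩
    (fun y hy _ => hG.cont y hy) (fun y hy _ => (cs y hy).continuousAt)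
    (fun y hy h => spos y hy (lt_of_le_of_lt h hxℓ))
  have y0 : y₀ ≠ 0 := norm_ne_zero_iff.1 (by rw [hy1]; exact one_ne_zero)
  have hC : y₀ ∈ Cs i₀ ℓ := ⟨y0, lt_of_le_of_lt hy2 hxℓ⟩
  have s0 := spos y₀ y0 hC.2
  have g0 := hG.pos y₀ hC
  have hstrip : ∀ y ∈ Cs i₀ ℓ, x₂ ≤ xc i₀ y → G y * sep i₀ γ φ y₀ ≤ G y₀ * sep i₀ γ φ y := by
    obtain ⟨y₁, hz1, hz2, hM⟩ := exists_ratio i₀ (hG.hom.comb (hom_sep i₀ γ φ) (sep i₀ γ φ y₀) (G y₀))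
      (hom_sep i₀ γ η) (isClosed_Icc (a := x₂) (b := ℓ))
      ⟨f ℓ, (hfn ℓ m1).1, by rw [(hfn ℓ m1).2]; exact ⟨hxℓ.le, le_rfl⟩⟩
      (fun y hy _ => (continuousAt_const.mul (hG.cont y hy)).sub (continuousAt_const.mul (cs y hy).continuousAt))
      (fun y hy _ => (cη y hy).continuousAt) ηpos
    have y10 : y₁ ≠ 0 := norm_ne_zero_iff.1 (by rw [hz1]; exact one_ne_zero)
    have e1 := ηpos y₁ y10 hz2
    rcases le_or_gt (sep i₀ γ φ y₀ * G y₁ - G y₀ * sep i₀ γ φ y₁) 0 with h | h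
    · intro y hy hx
      have t := hM y hy.1 ⟨hx, hy.2.le⟩
      have t2 := mul_nonpos_of_nonpos_of_nonneg h (ηpos y hy.1 ⟨hx, hy.2.le⟩).le
      have := nonpos_of_mul_nonpos_left (t.trans t2) e1
      linarith
    · exfalso
      rcases hz2.1.eq_or_lt with ha | ha
      · have := hm y₁ y10 ha.symm.le
        linarith
      rcases hz2.2.eq_or_lt with hb | hb
      · rw [hG.zero y₁ (fun h => by have := h.2; linarith), sep_eq i₀ γ φ y10, hb, hz] at h
        simp at h
      have hC1 : y₁ ∈ Cs i₀ ℓ := ⟨y10, hb⟩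
      obtain ⟨a, hae⟩ : ∃ a, a = sep i₀ γ φ y₀ * G y₁ - G y₀ * sep i₀ γ φ y₁ := ⟨_, rfl⟩
      obtain ⟨b, hbe⟩ : ∃ b, b = sep i₀ γ η y₁ := ⟨_, rfl⟩
      have cf : ContDiffAt ℝ 2 (fun y => sep i₀ γ φ y₀ * G y - G y₀ * sep i₀ γ φ y) y₁ :=
        (contDiffAt_const.mul (hG.smooth y₁ hC1)).sub (contDiffAt_const.mul (cs y₁ y10))
      have := lap_nonneg_of_isLocalMin (f := fun y => a * sep i₀ γ η y -
          b * (sep i₀ γ φ y₀ * G y - G y₀ * sep i₀ γ φ y)) (y := y₁)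
        ((contDiffAt_const.mul (cη y₁ y10)).sub (contDiffAt_const.mul cf)) (by
          have ev : ∀ᶠ y in 𝓝 y₁, y ≠ 0 ∧ xc i₀ y ∈ Set.Icc x₂ ℓ :=
            (isOpen_ne.eventually_mem y10).and ((continuousAt_xc i₀ y10).eventually (Icc_mem_nhds ha hb))
          filter_upwards [ev] with y hy
          have t := hM y hy.1 hy.2
          rw [← hae, ← hbe] at t
          rw [hae, hbe, mul_comm (sep i₀ γ η y₁), sub_self, ← hae, ← hbe]
          linarith)
      rw [lap_comb (cη y₁ y10) cf, lap_comb (hG.smooth y₁ hC1) (cs y₁ y10), hG.harm y₁ hC1, ls y₁ hC1,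
        lap_sep i₀ k1 k2 γ y10] at this
      have neg := mul_neg_of_pos_of_neg
        (mul_pos (pow_pos (inv_pos.2 (norm_pos_iff.2 y10)) 2) (Real.rpow_pos_of_pos (norm_pos_iff.2 y10) γ))
        (hη _ ⟨ha.le, hb.le⟩).2
      have neg2 := mul_neg_of_pos_of_neg (hae ▸ h) neg
      linarith
  have heq := eq_of_touch i₀ hℓ hℓ2 hG.smooth (fun y hy => cs y hy.1) hG.harm ls hC (fun y hy => by
    rcases le_total (xc i₀ y) x₂ with h | h
    · exact hm y hy.1 h
    · exact hstrip y hy h)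
  refine ⟨G y₀ / sep i₀ γ φ y₀, div_pos g0 s0, fun y hy => ?_⟩
  have := heq y hy
  field_simp
  linarith

end

theorem exists_prof (hn : 2 ≤ n) {ℓ γ : ℝ} [hℓ : Fact (0 < ℓ)] [hℓ2 : Fact (ℓ < 2)] (hγ : 0 < γ) {G : E → ℝ}
    (hG : Adm i₀ ℓ γ G) : ∃ Q : Prof ℓ ((n - 1) / 2 : ℝ), Q.Λ = γ ^ 2 + (n - 2) * γ ∧
      ∃ c > 0, ∀ y ∈ Cs i₀ ℓ, G y = c * (‖y‖ ^ γ * ex Q.ψ (xc i₀ y)) := by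
  have hn' : (2:ℝ) ≤ n := by exact_mod_cast hn
  have hd : 0 < ((n:ℝ) - 1) / 2 := by linarith
  have hΛ : 0 < γ ^ 2 + ((n:ℝ) - 2) * γ :=
    add_pos_of_pos_of_nonneg (by positivity) (mul_nonneg (by linarith) hγ.le)
  obtain ⟨ψ, ψ0, hψ⟩ := exists_psi (ℓ := ℓ) hd (γ ^ 2 + (n - 2) * γ)
  have hB := Dv_B0 hd (hψ.smul (-(γ ^ 2 + (n - 2) * γ)))
  obtain ⟨φ, φ', φ'', h1, h2, hc, he⟩ := hψ.exists_ext hB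
  have z0 : (0:ℝ) ∈ Set.Icc 0 ℓ := ⟨le_rfl, hℓ.out.le⟩
  have hφ0 : φ 0 = 1 := by rw [(he 0 z0).1, ψ0]
  have hode : ∀ x ∈ Set.Icc 0 ℓ,
      (γ ^ 2 + (n - 2) * γ) * φ x + x * (2 - x) * φ'' x + (n - 1) * (1 - x) * φ' x = 0 := fun x hx => by
    obtain ⟨a, b, c⟩ := he x hx
    have := ode hd hB hx
    rw [a, b, c]
    have e : ex ((-(γ ^ 2 + (n - 2) * γ)) • ψ) x = -(γ ^ 2 + (n - 2) * γ) * ex ψ x := rfl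
    rw [e] at this
    linarith
  have hφc : Continuous φ := continuous_iff_continuousAt.2 fun x => (h1 x).continuousAt
  obtain ⟨xz, hxz1, hxz2⟩ := exists_zero i₀ hn hG hℓ.out hℓ2.out h1 h2 hc hφ0 hode
  have hK : IsCompact (Set.Icc 0 ℓ ∩ φ ⁻¹' Set.Iic 0) := isCompact_Icc.inter_right (isClosed_Iic.preimage hφc)
  obtain ⟨x₁, ⟨hx1, hx2⟩, hmin⟩ := hK.exists_isLeast ⟨xz, hxz1, hxz2⟩
  have hx2' : φ x₁ ≤ 0 := hx2
  have hpos : ∀ x ∈ Set.Ico 0 x₁, 0 < φ x := fun x hx => by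
    by_contra h
    exact absurd (hmin ⟨⟨hx.1, hx.2.le.trans hx1.2⟩, not_lt.1 h⟩) (not_le.2 hx.2)
  have hx0 : 0 < x₁ := by
    refine lt_of_le_of_ne hx1.1 fun h => ?_
    rw [← h, hφ0] at hx2'
    linarith
  have hz : φ x₁ = 0 := by
    refine le_antisymm hx2' (ge_of_tendsto (hφc.continuousAt.tendsto.mono_left nhdsWithin_le_nhds :
      Tendsto φ (𝓝[<] x₁) (𝓝 (φ x₁))) ?_)
    filter_upwards [Ioo_mem_nhdsLT hx0] with x hx using (hpos x ⟨hx.1.le, hx.2⟩).le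
  rcases hx1.2.eq_or_lt with h | h
  · subst h
    obtain ⟨c, hc0, hcG⟩ := eq_mul_sep i₀ hn hG hℓ.out hℓ2.out h1 h2 hc hφ0 hode hΛ hpos hz
    refine ⟨⟨hd, _, hΛ, ψ, ψ0, hψ, fun x hx => ?_, ?_⟩, rfl, c, hc0, fun y hy => ?_⟩
    · rw [← (he x ⟨hx.1, hx.2.le⟩).1]; exact hpos x hx
    · rw [← (he _ ⟨hℓ.out.le, le_rfl⟩).1]; exact hz
    · rw [hcG y hy, sep_eq i₀ γ φ hy.1, (he _ ⟨xc_nonneg i₀ y, hy.2.le⟩).1]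
  · exact absurd hz (no_early_zero i₀ hn hG hℓ.out hℓ2.out h1 h2 hc hφ0 hode hx0 h hpos)
end
end ConeHet

namespace ConeHet
open scoped Topology BoundedContinuousFunction

section
variable {n : ℕ} (i₀ : Fin n)

local notation "E" => EuclideanSpace ℝ (Fin n)

theorem hasFDerivAt_expcurve (m : ℝ) {g : ℝ × ℝ → ℝ} {a b : ℝ} {z : ℝ × ℝ} (h : HasFDerivAt g (lin a b) z) :
    HasFDerivAt (fun z : ℝ × ℝ => Real.exp (-m * z.1) * g z)
      (lin (Real.exp (-m * z.1) * (-m * g z + a)) (Real.exp (-m * z.1) * b)) z := by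
  have h1 := ((hasFDerivAt_fst (𝕜 := ℝ) (p := z)).const_mul (-m)).exp
  refine (h1.mul h).congr_fderiv ?_
  ext
  · simp [lin]; ring
  · simp [lin]

/-- The function with radial exponent `-m` and angular profile `U`. -/
noncomputable def cv {ℓ : ℝ} [hℓ : Fact (0 < ℓ)] (m : ℝ) (U : ℝ → C(Set.Icc (0:ℝ) ℓ, ℝ)) (y : E) : ℝ :=
  Real.exp (-m * (gc i₀ y).1) * ex (U (gc i₀ y).1) (gc i₀ y).2

theorem exp_log_eq (a : ℝ) {y : E} (hy : y ≠ 0) : Real.exp (a * (gc i₀ y).1) = ‖y‖ ^ a := by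
  rw [Real.rpow_def_of_pos (norm_pos_iff.2 hy), mul_comm (Real.log _)]; rfl

theorem cv_eq {ℓ : ℝ} [hℓ : Fact (0 < ℓ)] (m : ℝ) (U : ℝ → C(Set.Icc (0:ℝ) ℓ, ℝ)) {y : E} (hy : y ≠ 0) :
    cv i₀ m U y = ‖y‖ ^ (-m) * ex (U (Real.log ‖y‖)) (xc i₀ y) := by
  rw [cv, exp_log_eq i₀ _ hy]; rfl

theorem vanishes_cv {ℓ : ℝ} [hℓ : Fact (0 < ℓ)] (m : ℝ) {U : ℝ → C(Set.Icc (0:ℝ) ℓ, ℝ)} (hU : Continuous U)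
    (h0 : ∀ t, ex (U t) ℓ = 0) : VanishesOnBoundary (Cs i₀ ℓ) (cv i₀ m U) := by
  intro y hy hy0
  have hc : ContinuousAt (cv i₀ m U) y :=
    (continuousAt_const.mul (continuousAt_fst.comp (continuousAt_gc i₀ hy0))).rexp.mul
      ((continuous_curve hU).continuousAt.comp (continuousAt_gc i₀ hy0))
  have hx : ℓ ≤ xc i₀ y := not_lt.1 fun h => hy.2 ⟨hy0, h⟩
  have e : cv i₀ m U y = 0 := by
    rw [cv_eq i₀ m U hy0]
    have := h0 (Real.log ‖y‖)
    rw [ex, pr, Set.projIcc_of_right_le _ le_rfl] at this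
    rw [ex, pr, Set.projIcc_of_right_le _ hx, this, mul_zero]
  have := hc.tendsto
  rw [e] at this
  exact this.mono_left nhdsWithin_le_nhds

theorem continuousAt_lap {u : E → ℝ} {y : E} (hu : ContDiffAt ℝ 2 u y) : ContinuousAt (lap u) y := by
  refine tendsto_finsetSum _ fun i _ => ?_
  have := (contDiffAt_fderiv_apply hu (EuclideanSpace.single i 1)).fderiv_right (m := 0) (by norm_num)
  exact this.continuousAt.clm_apply continuousAt_const

theorem eq_zero_of_xc {i₁ : Fin n} (hi : i₁ ≠ i₀) {y : E} (hy : y ≠ 0) (h : xc i₀ y = 0) : y i₁ = 0 := by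
  have hp : 0 < ‖y‖ := norm_pos_iff.2 hy
  change 1 - y i₀ / ‖y‖ = 0 at h
  have h1 : y i₀ = ‖y‖ := by
    have : y i₀ / ‖y‖ = 1 := by linarith
    rwa [div_eq_one_iff_eq hp.ne'] at this
  have h2 := EuclideanSpace.norm_sq_eq y
  rw [← Finset.add_sum_erase _ _ (Finset.mem_univ i₀), h1, norm_norm] at h2
  have h3 := (Finset.sum_eq_zero_iff_of_nonneg (fun i _ => sq_nonneg _)).1 (by linarith : ∑ i ∈ Finset.univ.erase i₀, ‖y i‖ ^ 2 = 0)
    i₁ (Finset.mem_erase.2 ⟨hi, Finset.mem_univ _⟩)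
  simpa using h3

section
variable {ℓ : ℝ} [hℓ : Fact (0 < ℓ)] {m p B κ : ℝ} {U U' U'' w w' w2 : ℝ → C(Set.Icc (0:ℝ) ℓ, ℝ)}
  (h1 : ∀ t, HasDerivAt U (U' t) t) (h2 : ∀ t, HasDerivAt U' (U'' t) t) (c1 : Continuous U'')
  (h3 : ∀ t, HasDerivAt w (w' t) t) (c2 : Continuous w') (c3 : Continuous w2)
  (v0 : ∀ t, Dv (U t) (w t)) (v1 : ∀ t, Dv (U' t) (w' t)) (v2 : ∀ t, Dv (w t) (w2 t))

include h1 h2 c1 h3 c2 c3 v0 v1 v2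

theorem contDiffOn_cv : ContDiffOn ℝ 2 (cv i₀ m U) (Cs i₀ ℓ) := by
  have g : ContDiffOn ℝ 2 (gc i₀) (Cs i₀ ℓ) := fun y hy => (contDiffAt_gc i₀ hy.1).contDiffWithinAt
  exact ((contDiffOn_const.mul (contDiff_fst.comp_contDiffOn g)).exp).mul
    ((contDiffOn_curve h1 h2 c1 h3 c2 c3 v0 v1 v2).comp g fun y hy =>
      ⟨trivial, xc_nonneg i₀ y, (hy.2 : xc i₀ y < ℓ).le⟩)

theorem lap_cv_of_pos (hB : B = 2 * m - (n - 2)) (hκ : κ = m ^ 2 - (n - 2) * m) (hpm : m * p = m + 2)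
    (U0 : ∀ t x, 0 ≤ U t x)
    (hode : ∀ t, ∀ x ∈ Set.Icc 0 ℓ, x * (2 - x) * ex (w2 t) x + (n - 1) * (1 - x) * ex (w t) x =
      -κ * ex (U t) x - ex (U'' t) x + B * ex (U' t) x - ex (U t) x ^ p)
    {y : E} (hy : y ∈ Cs i₀ ℓ) (hx : 0 < xc i₀ y) : lap (cv i₀ m U) y + cv i₀ m U y ^ p = 0 := by
  have hp : 0 < ‖y‖ := norm_pos_iff.2 hy.1
  have hz : (gc i₀ y).2 ∈ Set.Ioo 0 ℓ := ⟨hx, hy.2⟩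
  have D : ∀ {X X' ω : ℝ → C(Set.Icc (0:ℝ) ℓ, ℝ)}, (∀ t, HasDerivAt X (X' t) t) → (∀ t, Dv (X t) (ω t)) →
      ∀ z : ℝ × ℝ, z.2 ∈ Set.Ioo 0 ℓ →
      HasFDerivAt (fun z : ℝ × ℝ => ex (X z.1) z.2) (lin (ex (X' z.1) z.2) (ex (ω z.1) z.2)) z :=
    fun hX hω z hz => (hasFDerivWithinAt_curve (hX z.1) (hω z.1) ⟨trivial, Set.Ioo_subset_Icc_self hz⟩).hasFDerivAt
      (strip_mem_nhds hz)
  have ev : ∀ᶠ z : ℝ × ℝ in 𝓝 (gc i₀ y), z.2 ∈ Set.Ioo 0 ℓ :=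
    continuousAt_snd.eventually (isOpen_Ioo.mem_nhds hz)
  have hFt : HasFDerivAt (fun z : ℝ × ℝ => -m * ex (U z.1) z.2 + ex (U' z.1) z.2)
      (lin (-m * ex (U' (gc i₀ y).1) (gc i₀ y).2 + ex (U'' (gc i₀ y).1) (gc i₀ y).2)
        (-m * ex (w (gc i₀ y).1) (gc i₀ y).2 + ex (w' (gc i₀ y).1) (gc i₀ y).2)) (gc i₀ y) := by
    refine (((D h1 v0 _ hz).const_mul (-m)).fun_add (D h2 v1 _ hz)).congr_fderiv ?_
    ext
    · simp [lin]
    · simp [lin]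
  have := lap_comp i₀ hy.1 (ev.mono fun z hz => hasFDerivAt_expcurve m (D h1 v0 z hz))
    (hasFDerivAt_expcurve m hFt) (hasFDerivAt_expcurve m (D h3 v2 _ hz))
  have e := hode (gc i₀ y).1 (gc i₀ y).2 (Set.Ioo_subset_Icc_self hz)
  have hl : lap (cv i₀ m U) y = _ := this
  have hU0 : 0 ≤ ex (U (gc i₀ y).1) (gc i₀ y).2 := U0 _ _
  rw [hl, cv, Real.mul_rpow (Real.exp_pos _).le hU0, exp_log_eq i₀ _ hy.1, ← Real.rpow_mul hp.le]
  have e2 : ‖y‖ ^ (-m * p) = (‖y‖⁻¹) ^ 2 * ‖y‖ ^ (-m) := by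
    rw [show -m * p = -2 + -m by linarith, Real.rpow_add hp, Real.rpow_neg hp.le, Real.rpow_two, inv_pow]
  rw [e2]
  have e' : ex (U (gc i₀ y).1) (gc i₀ y).2 ^ p = -κ * ex (U (gc i₀ y).1) (gc i₀ y).2
      - ex (U'' (gc i₀ y).1) (gc i₀ y).2 + B * ex (U' (gc i₀ y).1) (gc i₀ y).2
      - ((gc i₀ y).2 * (2 - (gc i₀ y).2) * ex (w2 (gc i₀ y).1) (gc i₀ y).2 +
        (n - 1) * (1 - (gc i₀ y).2) * ex (w (gc i₀ y).1) (gc i₀ y).2) := by linarith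
  rw [e', hB, hκ]
  ring

theorem lap_cv (hn : 2 ≤ n) (hB : B = 2 * m - (n - 2)) (hκ : κ = m ^ 2 - (n - 2) * m) (hpm : m * p = m + 2)
    (hp0 : 0 ≤ p) (U0 : ∀ t x, 0 ≤ U t x)
    (hode : ∀ t, ∀ x ∈ Set.Icc 0 ℓ, x * (2 - x) * ex (w2 t) x + (n - 1) * (1 - x) * ex (w t) x =
      -κ * ex (U t) x - ex (U'' t) x + B * ex (U' t) x - ex (U t) x ^ p)
    {y : E} (hy : y ∈ Cs i₀ ℓ) : lap (cv i₀ m U) y + cv i₀ m U y ^ p = 0 := by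
  have off := fun {y : E} => lap_cv_of_pos i₀ h1 h2 c1 h3 c2 c3 v0 v1 v2 hB hκ hpm U0 hode (y := y)
  rcases (xc_nonneg i₀ y).eq_or_lt with h | h
  · obtain ⟨i₁, hi⟩ : ∃ i₁ : Fin n, i₁ ≠ i₀ := by
      haveI : Nontrivial (Fin n) := Fin.nontrivial_iff_two_le.2 hn
      exact exists_ne i₀
    have hy1 := eq_zero_of_xc i₀ hi hy.1 h.symm
    have hC := (isOpen_Cs i₀ ℓ).mem_nhds hy
    have hsm := (contDiffOn_cv i₀ (m := m) h1 h2 c1 h3 c2 c3 v0 v1 v2).contDiffAt hC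
    have hcont : ContinuousAt (fun z => lap (cv i₀ m U) z + cv i₀ m U z ^ p) y :=
      (continuousAt_lap hsm).add (hsm.continuousAt.rpow_const (Or.inr hp0))
    have hline : Tendsto (fun s : ℝ => y + s • bv i₁) (𝓝[>] 0) (𝓝 y) := by
      have : Continuous fun s : ℝ => y + s • bv i₁ := by fun_prop
      have := this.tendsto 0
      rw [zero_smul, add_zero] at this
      exact this.mono_left nhdsWithin_le_nhds
    refine tendsto_nhds_unique (hcont.tendsto.comp hline) (tendsto_const_nhds.congr' ?_)
    filter_upwards [hline.eventually hC, self_mem_nhdsWithin] with s hs hs0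
    refine (off hs (lt_of_le_of_ne (xc_nonneg i₀ _) fun h => ?_)).symm
    have := eq_zero_of_xc i₀ hi hs.1 h.symm
    simp [hy1, bv_apply] at this
    exact (hs0 : (0:ℝ) < s).ne' this
  · exact off hy h
end
end
end ConeHet

namespace ConeHet
open scoped Topology BoundedContinuousFunction

section
variable {n : ℕ} (i₀ : Fin n)

local notation "E" => EuclideanSpace ℝ (Fin n)

theorem le_sSup_profile {ℓ m : ℝ} {v : E → ℝ} (hv : ∀ y, y ≠ 0 → ContDiffAt ℝ 2 v y)
    (hh : ∀ r : ℝ, 0 < r → ∀ y, y ≠ 0 → v (r • y) = r ^ (-m) * v y) {x : E} (hx : x ∈ Cs i₀ ℓ) :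
    v x ≤ sSup {m : ℝ | ∃ y ∈ Cs i₀ ℓ, ‖y‖ = 1 ∧
      m = v y + ‖gradient v y‖ + ‖iteratedFDeriv ℝ 2 v y‖} * ‖x‖ ^ (-m) := by
  have hp : 0 < ‖x‖ := norm_pos_iff.2 hx.1
  have h0 : ∀ y ∈ Metric.sphere (0:E) 1, y ≠ 0 := fun y hy =>
    norm_ne_zero_iff.1 (by rw [mem_sphere_zero_iff_norm.1 hy]; exact one_ne_zero)
  have hc : ContinuousOn (fun y => v y + ‖gradient v y‖ + ‖iteratedFDeriv ℝ 2 v y‖) (Metric.sphere (0:E) 1) := by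
    intro y hy
    have h := hv y (h0 y hy)
    have a1 : ContinuousAt (fderiv ℝ v) y := (h.fderiv_right (m := 1) (by norm_num)).continuousAt
    have a2 : ContinuousAt (iteratedFDeriv ℝ 2 v) y :=
      (h.iteratedFDeriv_right (m := 0) (i := 2) (by norm_num)).continuousAt
    have a3 : ContinuousAt (gradient v) y :=
      (InnerProductSpace.toDual ℝ E).symm.continuous.continuousAt.comp a1
    exact ((h.continuousAt.add a3.norm).add a2.norm).continuousWithinAt
  obtain ⟨M, hM⟩ := (isCompact_sphere (0:E) 1).bddAbove_image hc
  have hb : BddAbove {m : ℝ | ∃ y ∈ Cs i₀ ℓ, ‖y‖ = 1 ∧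
      m = v y + ‖gradient v y‖ + ‖iteratedFDeriv ℝ 2 v y‖} := by
    refine ⟨M, ?_⟩
    rintro _ ⟨y, -, hy, rfl⟩
    exact hM ⟨y, mem_sphere_zero_iff_norm.2 hy, rfl⟩
  have hn1 : ‖‖x‖⁻¹ • x‖ = 1 := by
    rw [norm_smul, norm_inv, norm_norm, inv_mul_cancel₀ hp.ne']
  have hy0 : ‖x‖⁻¹ • x ≠ 0 := smul_ne_zero (inv_pos.2 hp).ne' hx.1
  have hC : ‖x‖⁻¹ • x ∈ Cs i₀ ℓ := ⟨hy0, by rw [xc_smul i₀ (inv_pos.2 hp) hx.1]; exact hx.2⟩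
  have hle := le_csSup hb ⟨_, hC, hn1, rfl⟩
  have e : x = ‖x‖ • (‖x‖⁻¹ • x) := by rw [smul_smul, mul_inv_cancel₀ hp.ne', one_smul]
  have e2 := hh ‖x‖ hp _ hy0
  rw [← e] at e2
  rw [e2, mul_comm]
  refine mul_le_mul_of_nonneg_right ?_ (Real.rpow_pos_of_pos hp _).le
  have b1 := norm_nonneg (gradient v (‖x‖⁻¹ • x))
  have b2 := norm_nonneg (iteratedFDeriv ℝ 2 v (‖x‖⁻¹ • x))
  linarith

theorem exists_solutions (hn : 2 ≤ n) {ℓ : ℝ} [hℓ : Fact (0 < ℓ)] [hℓ2 : Fact (ℓ < 2)]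
    (Q : Prof ℓ ((n - 1) / 2 : ℝ)) {P : Par} (H : Q.gen.Het P) (hK : H.K = rp (H.p - 1) Q.ψ) {m : ℝ}
    (hm : m = 2 / (H.p - 1)) (hB : P.B = 2 * m - (n - 2)) (hκ : Q.Λ - P.l = m ^ 2 - (n - 2) * m) :
    ∃ u v : E → ℝ, ContDiffOn ℝ 2 u (Cs i₀ ℓ) ∧ ContDiffOn ℝ 2 v (Cs i₀ ℓ) ∧
      (∀ x ∈ Cs i₀ ℓ, 0 < u x) ∧ (∀ x ∈ Cs i₀ ℓ, 0 < v x) ∧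
      VanishesOnBoundary (Cs i₀ ℓ) u ∧ VanishesOnBoundary (Cs i₀ ℓ) v ∧
      (∀ x ∈ Cs i₀ ℓ, lap u x + u x ^ H.p = 0) ∧ (∀ x ∈ Cs i₀ ℓ, lap v x + v x ^ H.p = 0) ∧
      (∀ r > (0:ℝ), ∀ x ∈ Cs i₀ ℓ, v (r • x) = r ^ (-m) * v x) ∧
      (∀ η > (0:ℝ), ∃ r₀ > (0:ℝ), ∀ x ∈ Cs i₀ ℓ, ‖x‖ < r₀ → |u x - v x| ≤ η * v x) ∧
      (∃ c > (0:ℝ), ∀ η > (0:ℝ), ∃ R₀ > (0:ℝ), ∀ x ∈ Cs i₀ ℓ, R₀ < ‖x‖ →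
        |u x - c * (‖x‖ ^ (-(m + H.σ)) * ex Q.ψ (xc i₀ x))| ≤
          η * (c * (‖x‖ ^ (-(m + H.σ)) * ex Q.ψ (xc i₀ x)))) ∧
      (∀ x ∈ Cs i₀ ℓ, u x ≤ sSup {m : ℝ | ∃ y ∈ Cs i₀ ℓ, ‖y‖ = 1 ∧
        m = v y + ‖gradient v y‖ + ‖iteratedFDeriv ℝ 2 v y‖} * ‖x‖ ^ (-m)) := by
  have hp := H.hp
  have hpm : m * H.p = m + 2 := by
    rw [hm]; field_simp [(by linarith : H.p - 1 ≠ 0)]; ring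
  have hd : 2 * (((n:ℝ) - 1) / 2) = n - 1 := by ring
  have hmem : ∀ y ∈ Cs i₀ ℓ, xc i₀ y ∈ Set.Icc 0 ℓ := fun y hy => ⟨xc_nonneg i₀ y, hy.2.le⟩
  have hψ : ∀ y ∈ Cs i₀ ℓ, 0 < ex Q.ψ (xc i₀ y) := fun y hy => Q.pos _ ⟨xc_nonneg i₀ y, hy.2⟩
  have hr : ∀ y ∈ Cs i₀ ℓ, 0 < ‖y‖ := fun y hy => norm_pos_iff.2 hy.1
  have hrm : ∀ a : ℝ, ∀ y ∈ Cs i₀ ℓ, 0 < ‖y‖ ^ a := fun a y hy => Real.rpow_pos_of_pos (hr y hy) a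
  obtain ⟨Z', Z'', w, w', w2, h1, h2, c1, h3, c2, c3, v0, v1, v2, hode⟩ := Prof.dv_Z H hK
  obtain ⟨ω, ω', g1, g2, gode⟩ := Prof.dv_V H hK
  obtain ⟨φ, φ', φ'', k1, k2, kc, hφ⟩ := g1.exists_ext g2
  have hu : ∀ y ∈ Cs i₀ ℓ, cv i₀ m (fun t => Q.ψ * H.Z t) y =
      ‖y‖ ^ (-m) * (ex Q.ψ (xc i₀ y) * H.Z (Real.log ‖y‖) (pr ℓ (xc i₀ y))) := fun y hy => cv_eq i₀ m _ hy.1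
  have hv : ∀ y ∈ Cs i₀ ℓ, sep i₀ (-m) φ y =
      ‖y‖ ^ (-m) * (ex Q.ψ (xc i₀ y) * H.V (pr ℓ (xc i₀ y))) := fun y hy => by
    rw [sep_eq i₀ _ _ hy.1, (hφ _ (hmem y hy)).1]; rfl
  have hvpos : ∀ y ∈ Cs i₀ ℓ, 0 < sep i₀ (-m) φ y := fun y hy => by
    rw [hv y hy]; exact mul_pos (hrm _ y hy) (mul_pos (hψ y hy) (H.hV _))
  have hvs : ∀ y : E, y ≠ 0 → ContDiffAt ℝ 2 (sep i₀ (-m) φ) y := fun y hy => contDiffAt_sep i₀ k1 k2 kc _ hy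
  have hvh : ∀ r : ℝ, 0 < r → ∀ y : E, y ≠ 0 → sep i₀ (-m) φ (r • y) = r ^ (-m) * sep i₀ (-m) φ y :=
    fun r hr y hy => sep_smul i₀ _ _ hy hr
  have hend : ∀ g : C(Set.Icc (0:ℝ) ℓ, ℝ), ex (Q.ψ * g) ℓ = 0 := fun g => by
    change ex Q.ψ ℓ * ex g ℓ = 0
    rw [Q.zero, zero_mul]
  refine ⟨cv i₀ m fun t => Q.ψ * H.Z t, sep i₀ (-m) φ, contDiffOn_cv i₀ h1 h2 c1 h3 c2 c3 v0 v1 v2,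
    fun y hy => (hvs y hy.1).contDiffWithinAt, fun y hy => ?_, hvpos,
    vanishes_cv i₀ m (continuous_iff_continuousAt.2 fun t => (h1 t).continuousAt) fun t => hend _, ?_,
    fun y hy => ?_, fun y hy => ?_, fun r hr y hy => hvh r hr y hy.1, fun η hη => ?_, ?_, fun y hy => ?_⟩
  · rw [hu y hy]; exact mul_pos (hrm _ y hy) (mul_pos (hψ y hy) (H.pos _ _))
  · intro y hy hy0
    refine (vanishes_cv i₀ m (U := fun _ => Q.ψ * H.V) continuous_const (fun t => hend _) y hy hy0).congr' ?_
    filter_upwards [self_mem_nhdsWithin] with z hz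
    rw [hv z hz, cv_eq i₀ m _ hz.1]; rfl
  · refine lap_cv i₀ h1 h2 c1 h3 c2 c3 v0 v1 v2 hn hB rfl hpm (by linarith)
      (fun t x => mul_nonneg (Q.nonneg' x) (H.nonneg t x)) (fun t x hx => ?_) hy
    have := hode t x hx
    rw [hd] at this
    rw [this, ← hκ]
    ring
  · have hx := hmem y hy
    have hVe : 0 ≤ ex (Q.ψ * H.V) (xc i₀ y) := mul_nonneg (hψ y hy).le (H.hV _).le
    have e := gode _ hx
    rw [hd] at e
    rw [lap_sep i₀ k1 k2 (-m) hy.1, (hφ _ hx).1, (hφ _ hx).2.1, (hφ _ hx).2.2, sep_eq i₀ _ _ hy.1, (hφ _ hx).1,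
      Real.mul_rpow (hrm _ y hy).le hVe, ← Real.rpow_mul (hr y hy).le]
    have e2 : ‖y‖ ^ (-m * H.p) = (‖y‖⁻¹) ^ 2 * ‖y‖ ^ (-m) := by
      rw [show -m * H.p = -2 + -m by linarith, Real.rpow_add (hr y hy), Real.rpow_neg (hr y hy).le,
        Real.rpow_two, inv_pow]
    have e3 : ex (Q.ψ * H.V) (xc i₀ y) ^ H.p = (P.l - Q.Λ) * ex (Q.ψ * H.V) (xc i₀ y) -
      (xc i₀ y * (2 - xc i₀ y) * ex ω' (xc i₀ y) + (n - 1) * (1 - xc i₀ y) * ex ω (xc i₀ y)) := by linarith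
    rw [e2, e3, show P.l - Q.Λ = -(m ^ 2 - (n - 2) * m) by linarith]
    ring
  · obtain ⟨x₀, -, hx₀⟩ := isCompact_univ.exists_isMinOn Set.univ_nonempty H.V.continuous.continuousOn
    have hε : 0 < η * H.V x₀ := mul_pos hη (H.hV _)
    obtain ⟨T, hT⟩ := eventually_atBot.1 (Metric.tendsto_nhds.1 H.lim _ hε)
    refine ⟨Real.exp T, Real.exp_pos T, fun y hy hlt => ?_⟩
    have hlog : Real.log ‖y‖ ≤ T := ((Real.log_lt_iff_lt_exp (hr y hy)).2 hlt).le
    have b1 : |H.Z (Real.log ‖y‖) (pr ℓ (xc i₀ y)) - H.V (pr ℓ (xc i₀ y))| ≤ η * H.V (pr ℓ (xc i₀ y)) :=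
      ((H.Z (Real.log ‖y‖) - H.V).norm_coe_le_norm _).trans
        ((dist_eq_norm (H.Z (Real.log ‖y‖)) H.V ▸ (hT _ hlog).le).trans
          (mul_le_mul_of_nonneg_left (hx₀ (Set.mem_univ _)) hη.le))
    have q := mul_pos (hrm (-m) y hy) (hψ y hy)
    rw [hu y hy, hv y hy, ← mul_assoc, ← mul_assoc, ← mul_sub, abs_mul, abs_of_pos q]
    have := mul_le_mul_of_nonneg_left b1 q.le
    linarith
  · obtain ⟨c, hc, has⟩ := H.asymptotics
    refine ⟨c, hc, fun η hη => ?_⟩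
    obtain ⟨T, hT⟩ := has (η * c) (mul_pos hη hc)
    refine ⟨Real.exp T, Real.exp_pos T, fun y hy hlt => ?_⟩
    have hlog : T ≤ Real.log ‖y‖ := ((Real.lt_log_iff_exp_lt (hr y hy)).2 hlt).le
    have b1 := hT _ hlog (pr ℓ (xc i₀ y))
    have q := mul_pos (hrm (-(m + H.σ)) y hy) (hψ y hy)
    have e1 : ‖y‖ ^ (-m) = ‖y‖ ^ (-(m + H.σ)) * Real.exp (H.σ * Real.log ‖y‖) := by
      rw [mul_comm H.σ, ← Real.rpow_def_of_pos (hr y hy), ← Real.rpow_add (hr y hy)]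
      congr 1; ring
    have e2 : cv i₀ m (fun t => Q.ψ * H.Z t) y - c * (‖y‖ ^ (-(m + H.σ)) * ex Q.ψ (xc i₀ y)) =
        ‖y‖ ^ (-(m + H.σ)) * ex Q.ψ (xc i₀ y) *
          (H.Z (Real.log ‖y‖) (pr ℓ (xc i₀ y)) * Real.exp (H.σ * Real.log ‖y‖) - c) := by
      rw [hu y hy, e1]; ring
    rw [e2, abs_mul, abs_of_pos q]
    have := mul_le_mul_of_nonneg_left b1 q.le
    linarith
  · refine le_trans ?_ (le_sSup_profile i₀ hvs hvh hy)
    rw [hu y hy, hv y hy]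
    exact mul_le_mul_of_nonneg_left (mul_le_mul_of_nonneg_left (H.le _ _) (hψ y hy).le) (hrm _ y hy).le
end
end ConeHet

namespace ConeHet
open scoped Topology BoundedContinuousFunction

namespace Prof
variable {ℓ d : ℝ} [hℓ : Fact (0 < ℓ)] [hℓ2 : Fact (ℓ < 2)] (Q : Prof ℓ d)

theorem rp_pos {q : ℝ} (hq : 0 ≤ q) (x : ℝ) (hx : x ∈ Set.Ico 0 ℓ) : 0 < ex (rp q Q.ψ) x := by
  change 0 < rp q Q.ψ _
  rw [rp_apply hq]
  exact Real.rpow_pos_of_pos (Q.pos x hx) q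

theorem rp_nonneg {q : ℝ} (hq : 0 ≤ q) (x) : 0 ≤ rp q Q.ψ x := by
  rw [rp_apply hq]; exact Real.rpow_nonneg (Q.nonneg' x) q

theorem rp_le_one {q : ℝ} (hq : 0 ≤ q) (x) : rp q Q.ψ x ≤ 1 := by
  rw [rp_apply hq]; exact Real.rpow_le_one (Q.nonneg' x) (Q.le_one x) hq

theorem integral_rp_pos {q : ℝ} (hq : 0 ≤ q) : 0 < ∫ x, rp q Q.ψ x ∂Q.meas := by
  refine lt_of_le_of_ne (integral_nonneg fun x => Q.rp_nonneg hq x) fun h => ?_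
  have h1 : ∫ x, rp q Q.ψ x * (1 : C(Set.Icc (0:ℝ) ℓ, ℝ)) x ∂Q.meas = 0 := by simpa using h.symm
  have := Q.mean_eq_zero (Q.rp_pos hq) (f := 1) (fun x => zero_le_one) h1 ⟨0, le_rfl, hℓ.out.le⟩
  exact one_ne_zero this

theorem integral_rp_le {q r : ℝ} (hq : 0 ≤ q) (hqr : q ≤ r) :
    ∫ x, rp r Q.ψ x ∂Q.meas ≤ ∫ x, rp q Q.ψ x ∂Q.meas := by
  refine integral_mono (Gen.integrable _) (Gen.integrable _) fun x => ?_
  change rp r Q.ψ x ≤ rp q Q.ψ x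
  rw [rp_apply hq, rp_apply (hq.trans hqr)]
  rcases (Q.nonneg' x).eq_or_lt with h | h
  · rw [← h]
    rcases hq.eq_or_lt with h' | h'
    · rw [← h', Real.rpow_zero]; exact Real.rpow_le_one le_rfl zero_le_one (hq.trans hqr)
    · rw [Real.zero_rpow h'.ne', Real.zero_rpow (h'.trans_le hqr).ne']
  · exact Real.rpow_le_rpow_of_exponent_ge h (Q.le_one x) hqr

theorem integral_rp_le_one {q : ℝ} (hq : 0 ≤ q) : ∫ x, rp q Q.ψ x ∂Q.meas ≤ 1 := by
  have := integral_mono (μ := Q.meas) (Gen.integrable (rp q Q.ψ)) (integrable_const (1:ℝ)) (Q.rp_le_one hq)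
  simpa using this
end Prof
end ConeHet

open ConeHet
theorem stmt0 (n : ℕ) (hn : 2 ≤ n) (β : ℝ) (hβ : β ∈ Set.Ioo 0 π)
    (γ : ℝ) (hγ : 0 < γ) (Φ : EuclideanSpace ℝ (Fin n) → ℝ)
    (hΦC2 : ContDiffOn ℝ 2 Φ (cone n hn β))
    (hΦpos : ∀ x ∈ cone n hn β, 0 < Φ x)
    (hΦharm : ∀ x ∈ cone n hn β, lap Φ x = 0)
    (hΦbd : VanishesOnBoundary (cone n hn β) Φ)
    (hΦhom : ∀ r > (0:ℝ), ∀ x ∈ cone n hn β, Φ (r • x) = r ^ γ * Φ x) :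
    ∃ p₀ > ((n:ℝ) + γ) / ((n:ℝ) + γ - 2), ∃ C₀ > (0:ℝ),
      ∀ p ∈ Set.Ioo (((n:ℝ) + γ) / ((n:ℝ) + γ - 2)) p₀,
        ∃ u₁ v : EuclideanSpace ℝ (Fin n) → ℝ,
          ContDiffOn ℝ 2 u₁ (cone n hn β) ∧ ContDiffOn ℝ 2 v (cone n hn β) ∧
          (∀ x ∈ cone n hn β, 0 < u₁ x) ∧ (∀ x ∈ cone n hn β, 0 < v x) ∧
          VanishesOnBoundary (cone n hn β) u₁ ∧ VanishesOnBoundary (cone n hn β) v ∧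
          -- (i) both solve Δu + u^p = 0 on the cone
          (∀ x ∈ cone n hn β, lap u₁ x + u₁ x ^ p = 0) ∧
          (∀ x ∈ cone n hn β, lap v x + v x ^ p = 0) ∧
          -- (ii) v is positively homogeneous of degree -2/(p-1)
          (∀ r > (0:ℝ), ∀ x ∈ cone n hn β, v (r • x) = r ^ (-(2 / (p - 1))) * v x) ∧
          -- (iii) u₁ ~ v near the vertex
          (∀ η > (0:ℝ), ∃ r₀ > (0:ℝ), ∀ x ∈ cone n hn β, ‖x‖ < r₀ →
            |u₁ x - v x| ≤ η * v x) ∧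
          -- (iv) fast decay at infinity
          (∃ c > (0:ℝ), ∀ η > (0:ℝ), ∃ R₀ > (0:ℝ), ∀ x ∈ cone n hn β, R₀ < ‖x‖ →
            |u₁ x - c * ‖x‖ ^ (2 - 2 * γ - (n:ℝ)) * Φ x| ≤
              η * (c * ‖x‖ ^ (2 - 2 * γ - (n:ℝ)) * Φ x)) ∧
          -- (v) uniform pointwise bound
          (∀ x ∈ cone n hn β,
            u₁ x ≤ C₀ *
              sSup {m : ℝ | ∃ y ∈ cone n hn β, ‖y‖ = 1 ∧
                m = v y + ‖gradient v y‖ + ‖iteratedFDeriv ℝ 2 v y‖} *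
              ‖x‖ ^ (-(2 / (p - 1)))) := by
  have hcos : Real.cos β < 1 := by
    have := Real.cos_lt_cos_of_nonneg_of_le_pi le_rfl hβ.2.le hβ.1
    rwa [Real.cos_zero] at this
  have hcos' : -1 < Real.cos β := by
    have := Real.cos_lt_cos_of_nonneg_of_le_pi hβ.1.le le_rfl hβ.2
    rwa [Real.cos_pi] at this
  have : Fact (0 < 1 - Real.cos β) := ⟨by linarith⟩
  have : Fact (1 - Real.cos β < 2) := ⟨by linarith⟩
  rw [cone_eq] at hΦC2 hΦpos hΦharm hΦbd hΦhom
  rw [cone_eq]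
  obtain ⟨G, hG, hGΦ⟩ := exists_adm _ hΦC2 hΦpos hΦharm hΦbd hΦhom
  obtain ⟨Q, hΛ, cΦ, hcΦ, hGQ⟩ := exists_prof _ hn hγ hG
  have hn' : (2:ℝ) ≤ n := by exact_mod_cast hn
  obtain ⟨s, hs⟩ : ∃ s, s = (n:ℝ) + γ - 2 := ⟨_, rfl⟩
  have hs0 : 0 < s := by linarith
  rw [← hs]
  obtain ⟨q, hq⟩ : ∃ q, q = ((n:ℝ) + γ) / s := ⟨_, rfl⟩
  rw [← hq]
  have hq1 : q - 1 = 2 / s := by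
    rw [hq]; field_simp; linarith
  have hq1' : 0 < q - 1 := by rw [hq1]; positivity
  obtain ⟨B₀, hB₀⟩ : ∃ B₀, B₀ = ((n:ℝ) - 2 + 2 * γ) / 2 := ⟨_, rfl⟩
  have hB₀p : 0 < B₀ := by linarith
  have hN : 0 ≤ q + 1 := by linarith
  obtain ⟨l₀, hl₀, hex⟩ := Q.gen.exists_het (Q.integral_rp_pos hN) (Q.integral_rp_le_one hN)
    (by linarith : 1 ≤ q + 1) hB₀p
  obtain ⟨δ, hδ0, hδ1, hδB, hδl, hδs⟩ : ∃ δ > 0, δ ≤ 1 ∧ δ ≤ B₀ / 2 ∧ δ * (1 + 2 * s) ≤ l₀ ∧ δ ≤ s / 2 := by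
    refine ⟨min (min 1 (B₀ / 2)) (min (l₀ / (1 + 2 * s)) (s / 2)), by positivity,
      (min_le_left _ _).trans (min_le_left _ _), (min_le_left _ _).trans (min_le_right _ _), ?_,
      (min_le_right _ _).trans (min_le_right _ _)⟩
    rw [← le_div_iff₀ (by positivity)]
    exact (min_le_right _ _).trans (min_le_left _ _)
  have hsd : 0 < s - δ := by linarith
  refine ⟨min (q + 1) (1 + 2 / (s - δ)), lt_min (by linarith) ?_, 1, one_pos, fun p hp => ?_⟩
  · have : 2 / s < 2 / (s - δ) := div_lt_div_of_pos_left two_pos hsd (by linarith)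
    linarith
  have hpq := hp.1
  have hpN : p ≤ q + 1 := (hp.2.trans_le (min_le_left _ _)).le
  have hpδ : p - 1 < 2 / (s - δ) := by linarith [hp.2.trans_le (min_le_right _ _)]
  have hp1 : 0 < p - 1 := by linarith
  obtain ⟨m, hm⟩ : ∃ m, m = 2 / (p - 1) := ⟨_, rfl⟩
  have hms : m < s := by
    rw [hm, div_lt_iff₀ hp1, mul_comm, ← div_lt_iff₀ hs0, ← hq1]; linarith
  have hmδ : s - δ < m := by
    rw [hm, lt_div_iff₀ hp1, mul_comm]; exact (lt_div_iff₀ hsd).1 hpδ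
  obtain ⟨σ, hσ⟩ : ∃ σ, σ = s - m := ⟨_, rfl⟩
  have hσ0 : 0 < σ := by linarith
  have hBB : B₀ ≤ 2 * m - (n - 2) := by linarith
  have hBp : 0 < 2 * m - ((n:ℝ) - 2) := by linarith
  have hlp : 0 < σ ^ 2 + (2 * m - ((n:ℝ) - 2)) * σ := by positivity
  have hll : σ ^ 2 + (2 * m - ((n:ℝ) - 2)) * σ < l₀ := by
    have h1 : σ + (2 * m - ((n:ℝ) - 2)) ≤ 1 + 2 * s := by linarith
    have h2 := mul_le_mul_of_nonneg_left h1 hσ0.le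
    have h3 : σ * (1 + 2 * s) < δ * (1 + 2 * s) := mul_lt_mul_of_pos_right (by linarith) (by linarith)
    nlinarith
  obtain ⟨H, hHK, hHp, hHσ⟩ := hex (Par.mk _ _ hBp hlp) hll hBB σ p hσ0 rfl (by linarith) hpN
    (rp (p - 1) Q.ψ) (Q.rp_nonneg hp1.le) (Q.rp_le_one hp1.le) (Q.integral_rp_le hp1.le (by linarith))
    fun f hf h => Q.mean_eq_zero (Q.rp_pos hp1.le) hf h
  subst hHp
  obtain ⟨u, v, a1, a2, a3, a4, a5, a6, a7, a8, a9, a10, ⟨c, hc, a11⟩, a12⟩ :=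
    exists_solutions ⟨0, by omega⟩ hn Q H hHK hm rfl (by
      rw [hΛ]
      change _ - (σ ^ 2 + (2 * m - ((n:ℝ) - 2)) * σ) = _
      rw [hσ, hs]; ring)
  rw [← hm]
  refine ⟨u, v, a1, a2, a3, a4, a5, a6, a7, a8, a9, a10,
    ⟨c / cΦ, div_pos hc hcΦ, fun η hη => ?_⟩, fun x hx => ?_⟩
  · obtain ⟨R, hR, h⟩ := a11 η hη
    refine ⟨R, hR, fun x hx hlt => ?_⟩
    have e : c / cΦ * ‖x‖ ^ (2 - 2 * γ - (n:ℝ)) * Φ x =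
        c * (‖x‖ ^ (-(m + H.σ)) * ex Q.ψ (xc ⟨0, by omega⟩ x)) := by
      rw [← hGΦ x hx, hGQ x hx, show -(m + H.σ) = (2 - 2 * γ - (n:ℝ)) + γ by rw [hHσ, hσ, hs]; ring,
        Real.rpow_add (norm_pos_iff.2 hx.1)]
      field_simp
    rw [e]
    exact h x hx hlt
  · rw [one_mul]; exact a12 x hx
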